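/- Let u_ε, for ε > 0, be solutions of Δu_ε = ε⁻²∇W(u_ε) in Ω with u_ε = g on ∂Ω, satisfying dist(u_ε(x),Γ) ≤ δ₁ for all x ∈ Ω; let t_ε be the signed distance of u_ε to Γ and ψ_ε := φ_ε − ζ the normalized phase deviation (vanishing on ∂Ω). Then there is a constant C independent of ε such that ‖t_ε‖_{L^∞(Ω)} ≤ Cε², ‖∇t_ε‖_{L^∞(Ω)} ≤ Cε, ‖ψ_ε‖_{L^∞(Ω)} ≤ Cε², and ‖∇ψ_ε‖_{L^∞(Ω)} ≤ Cε. -/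

import Mathlib

open Complex Metric MeasureTheory Filter Set Topology Bornology

noncomputable section

/-- The Laplacian of a map `u : ℂ → ℂ`, viewing `ℂ ≅ ℝ²`. -/
def lapC (u : ℂ → ℂ) (x : ℂ) : ℂ :=
  fderiv ℝ (fun y => fderiv ℝ u y 1) x 1 +
    fderiv ℝ (fun y => fderiv ℝ u y Complex.I) x Complex.I

/-- The Laplacian of a function `h : ℂ → ℝ`. -/
def lapR (h : ℂ → ℝ) (x : ℂ) : ℝ :=
  fderiv ℝ (fun y => fderiv ℝ h y 1) x 1 +
    fderiv ℝ (fun y => fderiv ℝ h y Complex.I) x Complex.I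

/-- `|∇u|²` for `u : ℂ → ℂ`. -/
def gradSq (u : ℂ → ℂ) (x : ℂ) : ℝ :=
  ‖fderiv ℝ u x 1‖ ^ 2 + ‖fderiv ℝ u x Complex.I‖ ^ 2

/-- The gradient `∇W` of a potential `W : ℂ → ℝ`, as a point of `ℂ ≅ ℝ²`. -/
def gradW (W : ℂ → ℝ) (x : ℂ) : ℂ :=
  (fderiv ℝ W x 1 : ℂ) + (fderiv ℝ W x Complex.I : ℂ) * Complex.I

/-- The Ginzburg–Landau type energy `E_ε(u) = ∫_Ω [½|∇u|² + W(u)/ε²]`. -/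
def energy (W : ℂ → ℝ) (Ω : Set ℂ) (ε : ℝ) (u : ℂ → ℂ) : ℝ :=
  ∫ x in Ω, ((1 / 2) * gradSq u x + W (u x) / ε ^ 2)

/-- `Γ` is a smooth simple closed curve of length `2π`, with (`2π`-periodic) arclength
parametrization `τ` (so that the point `τ(e^{is})` of the paper is `τ s` here). -/
structure ArcParam (Γ : Set ℂ) (τ : ℝ → ℂ) : Prop where
  smooth : ContDiff ℝ (⊤ : ℕ∞) τ
  periodic : Function.Periodic τ (2 * Real.pi)
  arclength : ∀ s, ‖deriv τ s‖ = 1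
  inj : ∀ s t : ℝ, τ s = τ t → ∃ k : ℤ, s - t = 2 * Real.pi * k
  srange : Set.range τ = Γ

/-- The hypotheses (h1)–(h5) on the potential `W`: smooth, nonnegative, vanishing exactly
on `Γ`, non-degenerate near `Γ`, and radially coercive outside `B_{R₀} ⊇ Γ`. -/
structure PotentialHyp (Γ : Set ℂ) (W : ℂ → ℝ) (R₀ : ℝ) : Prop where
  smooth : ContDiff ℝ (⊤ : ℕ∞) W
  nonneg : ∀ z, 0 ≤ W z
  zeros : W ⁻¹' {0} = Γ
  nondeg : ∃ μ > 0, ∃ δ > 0, ∀ z : ℂ,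
    Metric.infDist z Γ < δ → μ * Metric.infDist z Γ ^ 2 ≤ W z
  R0_large : ∀ z ∈ Γ, ‖z‖ < R₀
  coercive : ∀ z : ℂ, R₀ < ‖z‖ →
    0 ≤ (gradW W z).re * z.re + (gradW W z).im * z.im

/-- `u` is a (globally smooth) solution of `Δu = ε⁻² ∇W(u)` in `Ω`. -/
def SolvesGL (W : ℂ → ℝ) (Ω : Set ℂ) (ε : ℝ) (u : ℂ → ℂ) : Prop :=
  ContDiff ℝ (⊤ : ℕ∞) u ∧ ∀ x ∈ Ω, lapC u x = (ε ^ 2)⁻¹ • gradW W (u x)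

/-- The decomposition `u = τ(e^{iφ}) + t·n⃗(τ(e^{iφ}))` on the set `s`, where `t` is the
signed distance of `u` to `Γ` and `φ` is a (global) phase; the unit normal to `Γ` at `τ s`
is `i·τ'(s)`. -/
def PhaseDecomp (Γ : Set ℂ) (τ : ℝ → ℂ) (s : Set ℂ) (u : ℂ → ℂ) (t φ : ℂ → ℝ) : Prop :=
  ContinuousOn t s ∧ ContinuousOn φ s ∧
    ∀ x ∈ s, u x = τ (φ x) + (t x : ℂ) * (Complex.I * deriv τ (φ x)) ∧
      |t x| = Metric.infDist (u x) Γ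

/-- `γ` is an `L`-periodic arclength parametrization of the (smooth) boundary of `Ω`. -/
structure BoundaryParam (Ω : Set ℂ) (γ : ℝ → ℂ) (L : ℝ) : Prop where
  Lpos : 0 < L
  smooth : ContDiff ℝ (⊤ : ℕ∞) γ
  periodic : Function.Periodic γ L
  arclength : ∀ s, ‖deriv γ s‖ = 1
  inj : ∀ s t : ℝ, γ s = γ t → ∃ k : ℤ, s - t = L * k
  srange : Set.range γ = frontier Ω

/-- `n` is the outward unit normal field along the boundary parametrization `γ` of `Ω`. -/
structure OutwardNormal (Ω : Set ℂ) (γ : ℝ → ℂ) (n : ℝ → ℂ) : Prop where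
  unit : ∀ s, ‖n s‖ = 1
  orth : ∀ s, (n s).re * (deriv γ s).re + (n s).im * (deriv γ s).im = 0
  outward : ∀ s, ∀ᶠ r in nhdsWithin (0 : ℝ) (Set.Ioi (0 : ℝ)), γ s + Complex.ofReal r * n s ∉ closure Ω

/-- The maximum principle for the phase (Proposition 2.2) holds with constants `δ₁`, `m`:
for every critical point `u` of `E_ε` on a bounded simply connected domain `ω`, continuous on
`closure ω` and with `dist(u,Γ) ≤ δ₁` there, the functions `φ ∓ m t²/2` attain their
min/max on `∂ω`. -/
def MaxPrinciple (Γ : Set ℂ) (τ : ℝ → ℂ) (W : ℂ → ℝ) (δ₁ m : ℝ) : Prop :=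
  ∀ (ω : Set ℂ) (ε : ℝ) (u : ℂ → ℂ) (t φ : ℂ → ℝ),
    IsOpen ω → Bornology.IsBounded ω → ω.Nonempty → SimplyConnectedSpace ↥ω →
    0 < ε → ContDiffOn ℝ (⊤ : ℕ∞) u ω → ContinuousOn u (closure ω) →
    (∀ x ∈ ω, lapC u x = (ε ^ 2)⁻¹ • gradW W (u x)) →
    (∀ x ∈ closure ω, Metric.infDist (u x) Γ ≤ δ₁) →
    PhaseDecomp Γ τ (closure ω) u t φ →
    sInf ((fun x => φ x - m * t x ^ 2 / 2) '' closure ω) =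
        sInf ((fun x => φ x - m * t x ^ 2 / 2) '' frontier ω) ∧
      sSup ((fun x => φ x + m * t x ^ 2 / 2) '' closure ω) =
        sSup ((fun x => φ x + m * t x ^ 2 / 2) '' frontier ω)

namespace GLPhase

section Calculus

variable {E : Type*} [NormedAddCommGroup E] [NormedSpace ℝ E]

/-- The derivative of `f` in the direction `e`. -/
def dir (e : ℂ) (f : ℂ → E) (x : ℂ) : E := fderiv ℝ f x e

/-- The Laplacian of a vector-valued map on `ℂ ≅ ℝ²`. -/
def lap (f : ℂ → E) (x : ℂ) : E := dir 1 (dir 1 f) x + dir Complex.I (dir Complex.I f) x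

theorem lapC_eq_lap (f : ℂ → ℂ) : lapC f = lap f := rfl

theorem eventually_contDiffAt {f : ℂ → E} {x : ℂ} (hf : ContDiffAt ℝ 2 f x) :
    ∀ᶠ y in 𝓝 x, ContDiffAt ℝ 2 f y :=
  hf.eventually (by simp)

theorem differentiableAt_of_two {f : ℂ → E} {x : ℂ} (hf : ContDiffAt ℝ 2 f x) :
    DifferentiableAt ℝ f x :=
  hf.differentiableAt (by simp)

theorem eventually_differentiableAt {f : ℂ → E} {x : ℂ} (hf : ContDiffAt ℝ 2 f x) :
    ∀ᶠ y in 𝓝 x, DifferentiableAt ℝ f y :=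
  (eventually_contDiffAt hf).mono fun _ h => differentiableAt_of_two h

theorem ContDiffAt.dir {n : WithTop ℕ∞} {f : ℂ → E} {x : ℂ} (hf : ContDiffAt ℝ (n + 1) f x)
    (e : ℂ) : ContDiffAt ℝ n (dir e f) x :=
  (hf.fderiv_right le_rfl).clm_apply contDiffAt_const

theorem differentiableAt_dir {f : ℂ → E} {x : ℂ} (hf : ContDiffAt ℝ 2 f x) (e : ℂ) :
    DifferentiableAt ℝ (dir e f) x :=
  (ContDiffAt.dir (n := 1) (by simpa [one_add_one_eq_two] using hf) e).differentiableAt (by simp)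

theorem dir_congr {f g : ℂ → E} {x : ℂ} (h : f =ᶠ[𝓝 x] g) (e : ℂ) : dir e f x = dir e g x := by
  simp [dir, h.fderiv_eq]

theorem eventuallyEq_dir {f g : ℂ → E} {x : ℂ} (h : f =ᶠ[𝓝 x] g) (e : ℂ) :
    dir e f =ᶠ[𝓝 x] dir e g :=
  h.eventuallyEq_nhds.mono fun _ hy => dir_congr hy e

theorem lap_congr {f g : ℂ → E} {x : ℂ} (h : f =ᶠ[𝓝 x] g) : lap f x = lap g x := by
  simp only [lap, dir_congr (eventuallyEq_dir h _)]

theorem dir_add {f g : ℂ → E} {x : ℂ} (hf : DifferentiableAt ℝ f x) (hg : DifferentiableAt ℝ g x)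
    (e : ℂ) : dir e (fun y => f y + g y) x = dir e f x + dir e g x := by
  simp [dir, fderiv_fun_add hf hg]

theorem dir_smul {a : ℂ → ℝ} {g : ℂ → E} {x : ℂ} (ha : DifferentiableAt ℝ a x)
    (hg : DifferentiableAt ℝ g x) (e : ℂ) :
    dir e (fun y => a y • g y) x = a x • dir e g x + dir e a x • g x := by
  simp [dir, fderiv_fun_smul ha hg]

theorem dir_comp {Φ : ℝ → E} {f : ℂ → ℝ} {x : ℂ} (hΦ : DifferentiableAt ℝ Φ (f x))
    (hf : DifferentiableAt ℝ f x) (e : ℂ) :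
    dir e (fun y => Φ (f y)) x = dir e f x • deriv Φ (f x) := by
  have := (hΦ.hasDerivAt.hasFDerivAt.comp x hf.hasFDerivAt).fderiv
  simp only [dir]
  erw [this]
  simp

theorem dir_dir_add {f g : ℂ → E} {x : ℂ} (hf : ContDiffAt ℝ 2 f x) (hg : ContDiffAt ℝ 2 g x)
    (e : ℂ) : dir e (dir e (fun y => f y + g y)) x = dir e (dir e f) x + dir e (dir e g) x := by
  have h : dir e (fun y => f y + g y) =ᶠ[𝓝 x] fun y => dir e f y + dir e g y := by
    filter_upwards [eventually_differentiableAt hf, eventually_differentiableAt hg] with y h1 h2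
    exact dir_add h1 h2 e
  rw [dir_congr h, dir_add (differentiableAt_dir hf e) (differentiableAt_dir hg e)]

theorem dir_dir_smul {a : ℂ → ℝ} {g : ℂ → E} {x : ℂ} (ha : ContDiffAt ℝ 2 a x)
    (hg : ContDiffAt ℝ 2 g x) (e : ℂ) :
    dir e (dir e (fun y => a y • g y)) x =
      a x • dir e (dir e g) x + (2 : ℝ) • (dir e a x • dir e g x) + dir e (dir e a) x • g x := by
  have h : dir e (fun y => a y • g y) =ᶠ[𝓝 x] fun y => a y • dir e g y + dir e a y • g y := by
    filter_upwards [eventually_differentiableAt ha, eventually_differentiableAt hg] with y h1 h2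
    exact dir_smul h1 h2 e
  have ha1 := differentiableAt_of_two ha
  have hg1 := differentiableAt_of_two hg
  have ha2 := differentiableAt_dir ha e
  have hg2 := differentiableAt_dir hg e
  rw [dir_congr h, dir_add (f := fun y => a y • dir e g y) (g := fun y => dir e a y • g y)
    (ha1.fun_smul hg2) (ha2.fun_smul hg1), dir_smul ha1 hg2, dir_smul ha2 hg1]
  module

theorem dir_dir_comp {Φ : ℝ → E} {f : ℂ → ℝ} {x : ℂ} (hΦ : ContDiffAt ℝ 2 Φ (f x))
    (hf : ContDiffAt ℝ 2 f x) (e : ℂ) :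
    dir e (dir e (fun y => Φ (f y))) x =
      (dir e f x) ^ 2 • deriv (deriv Φ) (f x) + dir e (dir e f) x • deriv Φ (f x) := by
  have hd : ∀ᶠ s in 𝓝 (f x), DifferentiableAt ℝ Φ s :=
    (hΦ.eventually (by simp)).mono fun _ h => h.differentiableAt (by simp)
  have hd2 : DifferentiableAt ℝ (deriv Φ) (f x) := by
    have h1 : ContDiffAt ℝ 1 (fderiv ℝ Φ) (f x) :=
      hΦ.fderiv_right (m := 1) (by simp [one_add_one_eq_two])
    exact ((h1.clm_apply contDiffAt_const).differentiableAt (by simp) :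
      DifferentiableAt ℝ (fun s => fderiv ℝ Φ s 1) (f x))
  have hf1 := differentiableAt_of_two hf
  have h : dir e (fun y => Φ (f y)) =ᶠ[𝓝 x] fun y => dir e f y • deriv Φ (f y) := by
    filter_upwards [eventually_differentiableAt hf, hf1.continuousAt.eventually hd] with y h1 h2
    exact dir_comp h2 h1 e
  rw [dir_congr h, dir_smul (g := fun y => deriv Φ (f y)) (differentiableAt_dir hf e)
    (hd2.comp x hf1), dir_comp hd2 hf1 e, smul_smul, sq]

theorem dir_const (c : E) (e x : ℂ) : dir e (fun _ : ℂ => c) x = 0 := by simp [dir]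

theorem lap_const (c : E) (x : ℂ) : lap (fun _ : ℂ => c) x = 0 := by
  have : ∀ e : ℂ, dir e (fun _ : ℂ => c) = fun _ => 0 := fun e => funext fun x => dir_const c e x
  simp [lap, this, dir_const]

theorem lap_add {f g : ℂ → E} {x : ℂ} (hf : ContDiffAt ℝ 2 f x) (hg : ContDiffAt ℝ 2 g x) :
    lap (fun y => f y + g y) x = lap f x + lap g x := by
  simp only [lap, dir_dir_add hf hg]; abel

theorem lap_smul {a : ℂ → ℝ} {g : ℂ → E} {x : ℂ} (ha : ContDiffAt ℝ 2 a x)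
    (hg : ContDiffAt ℝ 2 g x) :
    lap (fun y => a y • g y) x = a x • lap g x +
      (2 : ℝ) • (dir 1 a x • dir 1 g x + dir Complex.I a x • dir Complex.I g x) +
        lap a x • g x := by
  simp only [lap, dir_dir_smul ha hg]; module

theorem lap_const_smul (c : ℝ) {g : ℂ → E} {x : ℂ} (hg : ContDiffAt ℝ 2 g x) :
    lap (fun y => c • g y) x = c • lap g x := by
  rw [lap_smul (a := fun _ => c) contDiffAt_const hg]
  simp [dir_const, lap_const]

theorem lap_neg {g : ℂ → E} {x : ℂ} (hg : ContDiffAt ℝ 2 g x) :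
    lap (fun y => - g y) x = - lap g x := by
  simpa using lap_const_smul (-1) hg

theorem lap_sub {f g : ℂ → E} {x : ℂ} (hf : ContDiffAt ℝ 2 f x) (hg : ContDiffAt ℝ 2 g x) :
    lap (fun y => f y - g y) x = lap f x - lap g x := by
  simp only [sub_eq_add_neg]
  rw [lap_add (g := fun y => - g y) hf hg.neg, lap_neg hg]

theorem lap_comp {Φ : ℝ → E} {f : ℂ → ℝ} {x : ℂ} (hΦ : ContDiffAt ℝ 2 Φ (f x))
    (hf : ContDiffAt ℝ 2 f x) :
    lap (fun y => Φ (f y)) x =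
      ((dir 1 f x) ^ 2 + (dir Complex.I f x) ^ 2) • deriv (deriv Φ) (f x) +
        lap f x • deriv Φ (f x) := by
  simp only [lap, dir_dir_comp hΦ hf]; module

theorem lap_mul {a g : ℂ → ℝ} {x : ℂ} (ha : ContDiffAt ℝ 2 a x) (hg : ContDiffAt ℝ 2 g x) :
    lap (fun y => a y * g y) x = a x * lap g x +
      2 * (dir 1 a x * dir 1 g x + dir Complex.I a x * dir Complex.I g x) + lap a x * g x := by
  simpa using lap_smul ha hg

theorem norm_fderiv_le (f : ℂ → E) (x : ℂ) :
    ‖fderiv ℝ f x‖ ≤ ‖dir 1 f x‖ + ‖dir Complex.I f x‖ := by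
  refine ContinuousLinearMap.opNorm_le_bound _ (by positivity) fun v => ?_
  have hv : v = v.re • (1 : ℂ) + v.im • Complex.I := by
    apply Complex.ext <;> simp
  have : fderiv ℝ f x v = v.re • dir 1 f x + v.im • dir Complex.I f x := by
    calc fderiv ℝ f x v = fderiv ℝ f x (v.re • (1 : ℂ) + v.im • Complex.I) := by rw [← hv]
      _ = _ := by rw [map_add, map_smul, map_smul]; rfl
  rw [this]
  refine (norm_add_le _ _).trans ?_
  rw [norm_smul, norm_smul, add_mul, mul_comm ‖dir 1 f x‖, mul_comm ‖dir Complex.I f x‖]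
  have h1 := Complex.abs_re_le_norm v
  have h2 := Complex.abs_im_le_norm v
  gcongr <;> simpa

end Calculus

section MaximumPrinciple

theorem hasDerivAt_line {E : Type*} [NormedAddCommGroup E] [NormedSpace ℝ E]
    {f : ℂ → E} {x e : ℂ} {s : ℝ} (hf : DifferentiableAt ℝ f (x + s • e)) :
    HasDerivAt (fun r : ℝ => f (x + r • e)) (dir e f (x + s • e)) s := by
  have h : HasDerivAt (fun r : ℝ => x + r • e) e s := by
    simpa using ((hasDerivAt_id s).smul_const e).const_add x
  exact hf.hasFDerivAt.comp_hasDerivAt s h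

/-- Second derivative test: at a local maximum the pure second derivatives are nonpositive. -/
theorem dir_dir_nonpos {f : ℂ → ℝ} {x : ℂ} (hf : ContDiffAt ℝ 2 f x) (hx : IsLocalMax f x)
    (e : ℂ) : dir e (dir e f) x ≤ 0 := by
  by_contra! hpos
  set c : ℝ → ℝ := fun r => f (x + r • e) with hc
  have hline : Tendsto (fun r : ℝ => x + r • e) (𝓝 0) (𝓝 x) := by
    have : Continuous fun r : ℝ => x + r • e := by fun_prop
    simpa using this.tendsto 0
  have h1 : deriv c =ᶠ[𝓝 0] fun r : ℝ => dir e f (x + r • e) := by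
    filter_upwards [hline.eventually (eventually_differentiableAt hf)] with r hr
    exact (hasDerivAt_line hr).deriv
  have h2 : deriv (deriv c) 0 = dir e (dir e f) x := by
    rw [h1.deriv_eq]
    have := hasDerivAt_line (f := dir e f) (x := x) (e := e) (s := 0)
      (by simpa using differentiableAt_dir hf e)
    simpa using this.deriv
  have hmax : IsLocalMax c 0 := by
    have := hline.eventually hx
    simpa [IsLocalMax, IsMaxFilter, hc] using this
  have hcont : ContinuousAt c 0 := by
    have : ContinuousAt f (x + (0 : ℝ) • e) := by simpa using hf.continuousAt
    exact ContinuousAt.comp (g := f) this (by fun_prop)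
  have hmin : IsLocalMin c 0 :=
    isLocalMin_of_deriv_deriv_pos (by rw [h2]; exact hpos) hmax.deriv_eq_zero hcont
  have hconst : c =ᶠ[𝓝 0] fun _ => c 0 := by
    filter_upwards [hmax, hmin] with r h h' using le_antisymm h h'
  have h3 : deriv (deriv c) 0 = 0 := by
    have : deriv c =ᶠ[𝓝 0] fun _ => 0 := by
      simpa using hconst.deriv
    rw [this.deriv_eq]; simp
  linarith

theorem dir_norm_sq (a e x : ℂ) :
    dir e (fun y => ‖y - a‖ ^ 2) x = 2 * inner ℝ (x - a) e := by
  have h : HasFDerivAt (fun y : ℂ => y - a) (ContinuousLinearMap.id ℝ ℂ) x :=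
    (hasFDerivAt_id x).sub_const a
  have := h.norm_sq.fderiv
  simp only [dir]
  rw [this]
  simp
  ring

theorem contDiff_norm_sq_sub (a : ℂ) {n : WithTop ℕ∞} : ContDiff ℝ n fun y : ℂ => ‖y - a‖ ^ 2 :=
  (contDiff_id.sub contDiff_const).norm_sq ℝ

theorem dir_dir_norm_sq (a e x : ℂ) :
    dir e (dir e (fun y => ‖y - a‖ ^ 2)) x = 2 * ‖e‖ ^ 2 := by
  have h : dir e (fun y : ℂ => ‖y - a‖ ^ 2) = fun y => 2 * inner ℝ (y - a) e :=
    funext fun y => dir_norm_sq a e y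
  have h2 : HasFDerivAt (fun y : ℂ => 2 * inner ℝ (y - a) e)
      ((2 : ℝ) • innerSL ℝ e) x := by
    have h3 : HasFDerivAt (fun y : ℂ => 2 * (innerSL ℝ e) (y - a)) ((2 : ℝ) • innerSL ℝ e) x :=
      (((innerSL ℝ e).hasFDerivAt (x := x - a)).comp x
        ((hasFDerivAt_id x).sub_const a)).const_mul 2
    simpa [real_inner_comm] using h3
  rw [h, dir, h2.fderiv]
  simp

theorem lap_norm_sq (a x : ℂ) : lap (fun y => ‖y - a‖ ^ 2) x = 4 := by
  simp only [lap, dir_dir_norm_sq]; norm_num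

/-- The weak maximum principle for functions subharmonic on their positivity set. -/
theorem max_principle {Ω : Set ℂ} (ho : IsOpen Ω) (hb : IsBounded Ω) {F : ℂ → ℝ}
    (hc : ContinuousOn F (closure Ω)) (hfr : ∀ x ∈ frontier Ω, F x ≤ 0)
    (h : ∀ x ∈ Ω, 0 < F x → ContDiffAt ℝ 2 F x ∧ 0 ≤ lap F x) {x : ℂ} (hx : x ∈ closure Ω) :
    F x ≤ 0 := by
  by_contra! hpos
  obtain ⟨R, hR⟩ := hb.closure.exists_norm_le
  have hR0 : ∀ y ∈ closure Ω, ‖y - 0‖ ^ 2 ≤ R ^ 2 := fun y hy => by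
    rw [sub_zero]; exact pow_le_pow_left₀ (norm_nonneg _) (hR y hy) 2
  set δ : ℝ := F x / (2 * (R ^ 2 + 1)) with hδ
  have hδ0 : 0 < δ := by positivity
  have hδR : δ * R ^ 2 < F x := by
    rw [hδ, div_mul_eq_mul_div, div_lt_iff₀ (by positivity)]
    nlinarith [sq_nonneg R]
  set G : ℂ → ℝ := fun y => F y + (δ * ‖y - 0‖ ^ 2 + - (δ * R ^ 2)) with hG
  have hGc : ContinuousOn G (closure Ω) := hc.add (by fun_prop)
  obtain ⟨z, hz, hzmax⟩ := hb.isCompact_closure.exists_isMaxOn ⟨x, hx⟩ hGc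
  have hGz : 0 < G z := by
    have h1 : G x ≤ G z := hzmax hx
    have h2 : 0 ≤ δ * ‖x - 0‖ ^ 2 := by positivity
    simp only [hG] at h1 ⊢
    linarith
  have hFz : 0 < F z := by
    have := mul_le_mul_of_nonneg_left (hR0 z hz) hδ0.le
    simp only [hG] at hGz
    linarith
  have hzΩ : z ∈ Ω := by
    by_contra hn
    have : z ∈ frontier Ω := by rw [ho.frontier_eq]; exact ⟨hz, hn⟩
    exact absurd (hfr z this) (not_le.2 hFz)
  obtain ⟨hF2, hlap⟩ := h z hzΩ hFz
  have hq : ContDiffAt ℝ 2 (fun y : ℂ => δ * ‖y - 0‖ ^ 2 + - (δ * R ^ 2)) z :=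
    ((contDiff_const.mul (contDiff_norm_sq_sub 0)).add contDiff_const).contDiffAt
  have hG2 : ContDiffAt ℝ 2 G z := hF2.add hq
  have hloc : IsLocalMax G z := by
    filter_upwards [ho.mem_nhds hzΩ] with y hy using hzmax (subset_closure hy)
  have hle : lap G z ≤ 0 :=
    add_nonpos (dir_dir_nonpos hG2 hloc _) (dir_dir_nonpos hG2 hloc _)
  have hGl : lap G z = lap F z + (δ * 4 + 0) := by
    rw [hG, lap_add hF2 hq, lap_add (contDiff_const.mul (contDiff_norm_sq_sub 0)).contDiffAt
      contDiffAt_const, lap_const]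
    congr 2
    have := lap_const_smul δ (g := fun y : ℂ => ‖y - 0‖ ^ 2) (x := z)
      (contDiff_norm_sq_sub 0).contDiffAt
    simpa only [smul_eq_mul, lap_norm_sq] using this
  linarith

end MaximumPrinciple

section InteriorGradient

variable {E : Type*} [NormedAddCommGroup E] [NormedSpace ℝ E]

theorem dir_comp_affine {v : ℂ → E} (L : ℂ →L[ℝ] ℂ) {x y : ℂ}
    (hv : DifferentiableAt ℝ v (x + L y)) (e : ℂ) :
    dir e (fun z => v (x + L z)) y = dir (L e) v (x + L y) := by
  have h : HasFDerivAt (fun z => x + L z) L y := L.hasFDerivAt.const_add x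
  have := (hv.hasFDerivAt.comp y h).fderiv
  simp only [dir]
  erw [this]
  rfl

theorem dir_dir_comp_affine {v : ℂ → E} (L : ℂ →L[ℝ] ℂ) {x y : ℂ}
    (hv : ContDiffAt ℝ 2 v (x + L y)) (e : ℂ) :
    dir e (dir e (fun z => v (x + L z))) y = dir (L e) (dir (L e) v) (x + L y) := by
  have hc : ContinuousAt (fun z => x + L z) y := by fun_prop
  have : dir e (fun z => v (x + L z)) =ᶠ[𝓝 y] fun z => dir (L e) v (x + L z) := by
    filter_upwards [hc.eventually (eventually_differentiableAt hv)] with z hz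
    exact dir_comp_affine L hz e
  rw [dir_congr this, dir_comp_affine L (differentiableAt_dir hv _)]

theorem dir_neg_vec (f : ℂ → E) (e x : ℂ) : dir (-e) f x = - dir e f x := by simp [dir]

theorem dir_dir_neg_vec (f : ℂ → E) (e x : ℂ) : dir (-e) (dir (-e) f) x = dir e (dir e f) x := by
  have : dir (-e) f = fun y => - dir e f y := funext fun y => dir_neg_vec f e y
  rw [this, dir_neg_vec]
  change -(fderiv ℝ (fun y => - dir e f y) x e) = _
  rw [fderiv_fun_neg]
  simp [dir]

theorem lap_comp_affine {v : ℂ → E} {L : ℂ →L[ℝ] ℂ} {x y : ℂ}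
    (hv : ContDiffAt ℝ 2 v (x + L y))
    (hL : (L 1 = 1 ∨ L 1 = -1) ∧ (L I = I ∨ L I = -I) ∨
      (L 1 = I ∨ L 1 = -I) ∧ (L I = 1 ∨ L I = -1)) :
    lap (fun z => v (x + L z)) y = lap v (x + L y) := by
  simp only [lap, dir_dir_comp_affine L hv]
  rcases hL with ⟨h1 | h1, h2 | h2⟩ | ⟨h1 | h1, h2 | h2⟩ <;>
    simp only [h1, h2, dir_dir_neg_vec] <;> abel

theorem contDiffAt_comp_affine {v : ℂ → E} {L : ℂ →L[ℝ] ℂ} {x y : ℂ} {n : WithTop ℕ∞}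
    (hv : ContDiffAt ℝ n v (x + L y)) : ContDiffAt ℝ n (fun z => v (x + L z)) y :=
  ContDiffAt.comp (g := v) y hv (contDiff_const.add L.contDiff).contDiffAt

theorem dir_quadratic (α β γ : ℝ) (e x : ℂ) :
    dir e (fun y : ℂ => α * y.im ^ 2 + β * y.re - γ * y.re ^ 2) x =
      2 * α * x.im * e.im + β * e.re - 2 * γ * x.re * e.re := by
  have hr : HasFDerivAt (fun y : ℂ => y.re) reCLM x := reCLM.hasFDerivAt
  have hi : HasFDerivAt (fun y : ℂ => y.im) imCLM x := imCLM.hasFDerivAt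
  have h := (((hi.pow 2).const_mul α).add (hr.const_mul β)).sub ((hr.pow 2).const_mul γ)
  have h' := congrArg (fun A : ℂ →L[ℝ] ℝ => A e) h.fderiv
  refine Eq.trans h' ?_
  simp
  ring

theorem contDiff_quadratic (α β γ : ℝ) {n : WithTop ℕ∞} :
    ContDiff ℝ n fun y : ℂ => α * y.im ^ 2 + β * y.re - γ * y.re ^ 2 := by
  have hr : ContDiff ℝ n fun y : ℂ => y.re := reCLM.contDiff
  have hi : ContDiff ℝ n fun y : ℂ => y.im := imCLM.contDiff
  exact ((contDiff_const.mul (hi.pow 2)).add (contDiff_const.mul hr)).sub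
    (contDiff_const.mul (hr.pow 2))

theorem lap_quadratic (α β γ : ℝ) (x : ℂ) :
    lap (fun y : ℂ => α * y.im ^ 2 + β * y.re - γ * y.re ^ 2) x = 2 * α - 2 * γ := by
  have h1 : dir 1 (fun y : ℂ => α * y.im ^ 2 + β * y.re - γ * y.re ^ 2) =
      fun y : ℂ => 0 * y.im ^ 2 + (-2 * γ) * y.re - 0 * y.re ^ 2 + β := by
    funext y; rw [dir_quadratic]; simp; ring
  have h2 : dir I (fun y : ℂ => α * y.im ^ 2 + β * y.re - γ * y.re ^ 2) =
      fun y : ℂ => 2 * α * y.im := by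
    funext y; rw [dir_quadratic]; simp
  have h3 : dir I (fun y : ℂ => 2 * α * y.im) x = 2 * α := by
    have h := (imCLM.hasFDerivAt (x := x)).const_mul (2 * α)
    refine (congrArg (fun A : ℂ →L[ℝ] ℝ => A I) h.fderiv).trans ?_
    simp
  rw [lap, h1, h2, h3, dir_add ((contDiff_quadratic _ _ _ (n := 1)).differentiable (by simp) _)
    (differentiableAt_const _), dir_quadratic, dir_const]
  simp; ring

/-- Comparison on a half square: an odd function bounded by `M` with Laplacian bounded by `N`
has controlled normal derivative on the axis. -/
theorem dir_one_le_of_ball {w : ℂ → ℝ} {d M N : ℝ} (hd : 0 < d)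
    (hw : ∀ y ∈ ball (0 : ℂ) d, ContDiffAt ℝ 2 w y) (hM : ∀ y ∈ ball (0 : ℂ) d, |w y| ≤ M)
    (hN : ∀ y ∈ ball (0 : ℂ) d, |lap w y| ≤ N) : dir 1 w 0 ≤ 4 * M / d + N * d / 4 := by
  set a : ℝ := d / 2 with ha
  have ha0 : 0 < a := by positivity
  have h0 : (0 : ℂ) ∈ ball (0 : ℂ) d := mem_ball_self hd
  have hM0 : 0 ≤ M := (abs_nonneg _).trans (hM 0 h0)
  set L : ℂ →L[ℝ] ℂ := -(conjCLE : ℂ →L[ℝ] ℂ) with hL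
  have hLnorm : ∀ y, ‖L y‖ = ‖y‖ := fun y => by simp [hL]
  have hLball : ∀ {y}, y ∈ ball (0 : ℂ) d → 0 + L y ∈ ball (0 : ℂ) d := fun {y} hy => by
    simpa [hLnorm] using hy
  have hLd : (L 1 = 1 ∨ L 1 = -1) ∧ (L I = I ∨ L I = -I) ∨
      (L 1 = I ∨ L 1 = -I) ∧ (L I = 1 ∨ L I = -1) := by
    left; simp [hL]
  set Q : Set ℂ := {y | 0 < y.re ∧ y.re < a ∧ -a < y.im ∧ y.im < a} with hQ
  have hQo : IsOpen Q :=
    (isOpen_lt continuous_const continuous_re).inter ((isOpen_lt continuous_re continuous_const).inter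
      ((isOpen_lt continuous_const continuous_im).inter (isOpen_lt continuous_im continuous_const)))
  have hcl : closure Q ⊆ {y | 0 ≤ y.re ∧ y.re ≤ a ∧ -a ≤ y.im ∧ y.im ≤ a} := by
    refine closure_minimal (fun y hy => ⟨hy.1.le, hy.2.1.le, hy.2.2.1.le, hy.2.2.2.le⟩) ?_
    exact (isClosed_le continuous_const continuous_re).inter
      ((isClosed_le continuous_re continuous_const).inter
      ((isClosed_le continuous_const continuous_im).inter
        (isClosed_le continuous_im continuous_const)))
  have hclb : closure Q ⊆ ball (0 : ℂ) d := fun y hy => by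
    obtain ⟨h1, h2, h3, h4⟩ := hcl hy
    rw [mem_ball_zero_iff]
    have : ‖y‖ ^ 2 < d ^ 2 := by
      rw [Complex.sq_norm, normSq_apply]; nlinarith
    exact lt_of_pow_lt_pow_left₀ 2 hd.le this
  have hQb : IsBounded Q := isBounded_ball.subset (subset_closure.trans hclb)
  set α : ℝ := M / a ^ 2
  set β : ℝ := 2 * M / a + N * a / 2
  set γ : ℝ := M / a ^ 2 + N / 2
  set q : ℂ → ℝ := fun y => α * y.im ^ 2 + β * y.re - γ * y.re ^ 2 with hq
  have hq' : ∀ y : ℂ, q y = M / a ^ 2 * (y.im ^ 2 + y.re * (2 * a - y.re)) +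
      N / 2 * (y.re * (a - y.re)) := fun y => by
    simp only [hq, α, β, γ]; field_simp; ring
  have hN0 : 0 ≤ N := (abs_nonneg _).trans (hN 0 h0)
  set v : ℂ → ℝ := fun y => w (0 + L y) with hv
  have hv2 : ∀ y ∈ ball (0 : ℂ) d, ContDiffAt ℝ 2 v y := fun y hy =>
    contDiffAt_comp_affine (hw _ (hLball hy))
  set F : ℂ → ℝ := fun y => (1 / 2 : ℝ) • (w y - v y) - q y with hF
  have hF2 : ∀ y ∈ ball (0 : ℂ) d, ContDiffAt ℝ 2 F y := fun y hy =>
    (((hw y hy).sub (hv2 y hy)).const_smul _).sub (contDiff_quadratic _ _ _).contDiffAt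
  have hle : ∀ y ∈ closure Q, F y ≤ 0 := by
    intro y hy
    refine max_principle hQo hQb (fun z hz => (hF2 z (hclb hz)).continuousAt.continuousWithinAt)
      (fun z hz => ?_) (fun z hz _ => ?_) hy
    · have hzc := frontier_subset_closure hz
      obtain ⟨h1, h2, h3, h4⟩ := hcl hzc
      have hzb := hclb hzc
      have hzQ : z ∉ Q := by rw [hQo.frontier_eq] at hz; exact hz.2
      have e1 := (abs_le.1 (hM z hzb)).2
      have e2 := (abs_le.1 (hM _ (hLball hzb))).1
      simp only [hF, hv, hq', smul_eq_mul]
      have hn : 0 ≤ N / 2 * (z.re * (a - z.re)) := by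
        have := sub_nonneg.2 h2; positivity
      by_cases hz0 : z.re = 0
      · have : 0 + L z = z := by apply Complex.ext <;> simp [hL, hz0]
        rw [this, hz0]
        have : 0 ≤ M / a ^ 2 * z.im ^ 2 := by positivity
        simp; linarith
      · have hsq : a ^ 2 ≤ z.im ^ 2 + z.re * (2 * a - z.re) := by
          have hz0' : 0 < z.re := lt_of_le_of_ne h1 (Ne.symm hz0)
          by_cases hz1 : z.re = a
          · nlinarith [sq_nonneg z.im]
          · have hz1' : z.re < a := lt_of_le_of_ne h2 hz1
            have : z.im = a ∨ z.im = -a := by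
              by_contra! hne
              exact hzQ ⟨hz0', hz1', lt_of_le_of_ne h3 (Ne.symm hne.2), lt_of_le_of_ne h4 hne.1⟩
            have h5 : 0 ≤ z.re * (2 * a - z.re) := mul_nonneg h1 (by linarith)
            rcases this with h | h <;> rw [h] <;> nlinarith
        have := mul_le_mul_of_nonneg_left hsq (by positivity : 0 ≤ M / a ^ 2)
        rw [div_mul_cancel₀ _ (by positivity)] at this
        linarith
    · have hzb := hclb (subset_closure hz)
      refine ⟨hF2 z hzb, ?_⟩
      have hs : ContDiffAt ℝ 2 (fun y => w y - v y) z := (hw z hzb).sub (hv2 z hzb)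
      rw [hF, lap_sub (f := fun y => (1 / 2 : ℝ) • (w y - v y)) (hs.const_smul _)
        (contDiff_quadratic _ _ _).contDiffAt, lap_quadratic,
        lap_const_smul (g := fun y => w y - v y) _ hs, lap_sub (hw z hzb) (hv2 z hzb), hv,
        lap_comp_affine (hw _ (hLball hzb)) hLd]
      have e1 := (abs_le.1 (hN z hzb)).1
      have e2 := (abs_le.1 (hN _ (hLball hzb))).2
      simp only [smul_eq_mul, α, γ]
      linarith
  have hd0 : dir 1 F 0 = dir 1 w 0 - β := by
    have e1 := differentiableAt_of_two (hw 0 h0)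
    have e2 := differentiableAt_of_two (hv2 0 h0)
    have e3 : DifferentiableAt ℝ q 0 := (contDiff_quadratic _ _ _ (n := 1)).differentiable (by simp) _
    have e4 : dir 1 v 0 = - dir 1 w 0 := by
      rw [hv, dir_comp_affine L (differentiableAt_of_two (hw _ (hLball h0)))]
      have : L 1 = -1 := by simp [hL]
      rw [this, dir_neg_vec]; simp
    have e5 : dir 1 q 0 = β := by rw [hq, dir_quadratic]; simp
    have h := (((e1.hasFDerivAt.sub e2.hasFDerivAt).const_smul (1 / 2 : ℝ)).sub e3.hasFDerivAt).fderiv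
    have h' := congrArg (fun A : ℂ →L[ℝ] ℝ => A 1) h
    refine Eq.trans h' ?_
    change (1 / 2 : ℝ) • (dir 1 w 0 - dir 1 v 0) - dir 1 q 0 = _
    rw [e4, e5, smul_eq_mul]; ring
  have hF0 : F 0 = 0 := by simp [hF, hv, hq]
  have hder : HasDerivAt (fun r : ℝ => F (0 + r • (1 : ℂ))) (dir 1 F 0) 0 := by
    have := hasDerivAt_line (f := F) (x := 0) (e := 1) (s := 0)
      (by simpa using differentiableAt_of_two (hF2 0 h0))
    simpa using this
  have hneg : dir 1 F 0 ≤ 0 := by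
    have ht := hder.tendsto_slope_zero_right
    refine le_of_tendsto ht ?_
    filter_upwards [Ioo_mem_nhdsGT ha0] with r hr
    have hmem : (r : ℂ) ∈ Q := by
      refine ⟨by simpa using hr.1, by simpa using hr.2, ?_, ?_⟩ <;> simp [ha0]
    have := hle _ (subset_closure hmem)
    simp only [zero_add, zero_smul, hF0, sub_zero, smul_eq_mul, Complex.real_smul, mul_one]
    exact mul_nonpos_of_nonneg_of_nonpos (inv_nonneg.2 hr.1.le) this
  have : β = 4 * M / d + N * d / 4 := by simp only [β, ha]; field_simp; ring
  linarith

/-- Interior gradient estimate for the Poisson equation. -/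
theorem interior_gradient {v : ℂ → ℝ} {x : ℂ} {d M N : ℝ} (hd : 0 < d)
    (hv : ∀ y ∈ ball x d, ContDiffAt ℝ 2 v y) (hM : ∀ y ∈ ball x d, |v y| ≤ M)
    (hN : ∀ y ∈ ball x d, |lap v y| ≤ N) :
    |dir 1 v x| ≤ 4 * M / d + N * d / 4 ∧ |dir I v x| ≤ 4 * M / d + N * d / 4 := by
  have key : ∀ c : ℂ, (c = 1 ∨ c = -1 ∨ c = I ∨ c = -I) →
      dir c v x ≤ 4 * M / d + N * d / 4 := by
    intro c hc
    set L : ℂ →L[ℝ] ℂ := ContinuousLinearMap.mul ℝ ℂ c with hL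
    have hnc : ‖c‖ = 1 := by rcases hc with h | h | h | h <;> simp [h]
    have hball : ∀ {y}, y ∈ ball (0 : ℂ) d → x + L y ∈ ball x d := fun {y} hy => by
      simpa [hL, hnc] using hy
    have hLd : (L 1 = 1 ∨ L 1 = -1) ∧ (L I = I ∨ L I = -I) ∨
        (L 1 = I ∨ L 1 = -I) ∧ (L I = 1 ∨ L I = -1) := by
      rcases hc with h | h | h | h <;> simp [hL, h]
    have := dir_one_le_of_ball (w := fun y => v (x + L y)) (N := N) (M := M) hd
      (fun y hy => contDiffAt_comp_affine (hv _ (hball hy))) (fun y hy => hM _ (hball hy))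
      (fun y hy => by rw [lap_comp_affine (hv _ (hball hy)) hLd]; exact hN _ (hball hy))
    rw [dir_comp_affine L (differentiableAt_of_two (hv _ (hball (mem_ball_self hd))))] at this
    simpa [hL] using this
  have h1 := key 1 (by simp)
  have h2 := key (-1) (by simp)
  have h3 := key I (by simp)
  have h4 := key (-I) (by simp)
  rw [dir_neg_vec] at h2 h4
  exact ⟨abs_le.2 ⟨by linarith, h1⟩, abs_le.2 ⟨by linarith, h3⟩⟩

end InteriorGradient

section ThreeCircles

theorem lap_log_norm_sq {a x : ℂ} (hx : x ≠ a) :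
    lap (fun y => Real.log (‖y - a‖ ^ 2)) x = 0 := by
  have hpos : 0 < ‖x - a‖ ^ 2 := by have := sub_ne_zero.2 hx; positivity
  rw [lap_comp (f := fun y => ‖y - a‖ ^ 2) (Real.contDiffAt_log.2 hpos.ne')
    (contDiff_norm_sq_sub a).contDiffAt, dir_norm_sq, dir_norm_sq, lap_norm_sq]
  have h1 : (2 * inner ℝ (x - a) 1) ^ 2 + (2 * inner ℝ (x - a) I) ^ 2 = 4 * ‖x - a‖ ^ 2 := by
    rw [Complex.sq_norm, normSq_apply]; simp [Complex.inner]; ring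
  rw [h1, Real.deriv_log', deriv_inv]
  simp only [smul_eq_mul]
  field_simp
  ring

/-- Hadamard's three circles theorem for subharmonic functions. -/
theorem three_circles {v : ℂ → ℝ} {x : ℂ} {ρ₀ R M₀ M₁ : ℝ} (h0 : 0 < ρ₀) (hR : ρ₀ < R)
    (hc : ∀ y ∈ closedBall x R, ContDiffAt ℝ 2 v y) (hs : ∀ y ∈ ball x R, 0 ≤ lap v y)
    (hM₀ : ∀ y ∈ closedBall x ρ₀, v y ≤ M₀) (hM₁ : ∀ y ∈ closedBall x R, v y ≤ M₁)
    {z : ℂ} (hz1 : ρ₀ ≤ ‖z - x‖) (hz2 : ‖z - x‖ ≤ R) :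
    v z ≤ M₀ + (M₁ - M₀) * (Real.log (‖z - x‖ / ρ₀) / Real.log (R / ρ₀)) := by
  have hlog : 0 < Real.log (R / ρ₀) := Real.log_pos ((one_lt_div h0).2 hR)
  have hR0 : 0 < R := h0.trans hR
  set A : Set ℂ := {y | ρ₀ < ‖y - x‖ ∧ ‖y - x‖ < R} with hA
  have hnc : Continuous fun y : ℂ => ‖y - x‖ := by fun_prop
  have hAo : IsOpen A := (isOpen_lt continuous_const hnc).inter (isOpen_lt hnc continuous_const)
  have hcl : closure A ⊆ {y | ρ₀ ≤ ‖y - x‖ ∧ ‖y - x‖ ≤ R} :=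
    closure_minimal (fun y hy => ⟨hy.1.le, hy.2.le⟩)
      ((isClosed_le continuous_const hnc).inter (isClosed_le hnc continuous_const))
  have hclb : closure A ⊆ closedBall x R := fun y hy => by
    rw [mem_closedBall, dist_eq_norm]; exact (hcl hy).2
  set κ : ℝ := (M₁ - M₀) / Real.log (R / ρ₀) / 2 with hκ
  set F : ℂ → ℝ := fun y => v y - (κ • Real.log (‖y - x‖ ^ 2) + (M₀ - κ * (2 * Real.log ρ₀)))
    with hF
  have hFe : ∀ y, ρ₀ ≤ ‖y - x‖ →
      F y = v y - (M₀ + (M₁ - M₀) * (Real.log (‖y - x‖ / ρ₀) / Real.log (R / ρ₀))) := by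
    intro y hy
    have : 0 < ‖y - x‖ := h0.trans_le hy
    simp only [hF, hκ, smul_eq_mul]
    rw [Real.log_div this.ne' h0.ne', Real.log_pow]
    push_cast; field_simp; ring
  have hlogc : ∀ y, ρ₀ ≤ ‖y - x‖ → ContDiffAt ℝ 2 (fun y => Real.log (‖y - x‖ ^ 2)) y := by
    intro y hy
    have : 0 < ‖y - x‖ := h0.trans_le hy
    exact ContDiffAt.comp (g := Real.log) y (Real.contDiffAt_log.2 (by positivity))
      (contDiff_norm_sq_sub x).contDiffAt
  have hF2 : ∀ y ∈ closure A, ContDiffAt ℝ 2 F y := fun y hy =>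
    (hc y (hclb hy)).sub (((hlogc y (hcl hy).1).const_smul κ).add contDiffAt_const)
  have hmain : ∀ y ∈ closure A, F y ≤ 0 := by
    intro y hy
    refine max_principle hAo (isBounded_closedBall.subset (subset_closure.trans hclb))
      (fun z hz => (hF2 z hz).continuousAt.continuousWithinAt) (fun z hz => ?_) (fun z hz _ => ?_) hy
    · have hzc := frontier_subset_closure hz
      obtain ⟨h1, h2⟩ := hcl hzc
      have hzA : z ∉ A := by rw [hAo.frontier_eq] at hz; exact hz.2
      rw [hFe z h1]
      by_cases h3 : ‖z - x‖ = ρ₀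
      · have := hM₀ z (by rw [mem_closedBall, dist_eq_norm, h3])
        rw [h3, div_self h0.ne']; simpa using this
      · have h4 : ‖z - x‖ = R := by
          by_contra h5
          exact hzA ⟨lt_of_le_of_ne h1 (Ne.symm h3), lt_of_le_of_ne h2 h5⟩
        have := hM₁ z (hclb hzc)
        rw [h4, div_self hlog.ne']; linarith
    · refine ⟨hF2 z (subset_closure hz), ?_⟩
      have hz' := hlogc z hz.1.le
      have hne : z ≠ x := by
        rintro rfl
        have := hz.1; simp at this; linarith
      rw [hF, lap_sub (hc z (hclb (subset_closure hz))) ((hz'.const_smul κ).add contDiffAt_const),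
        lap_add (f := fun y => κ • Real.log (‖y - x‖ ^ 2)) (hz'.const_smul κ) contDiffAt_const,
        lap_const_smul (g := fun y => Real.log (‖y - x‖ ^ 2)) κ hz', lap_log_norm_sq hne, lap_const]
      have := hs z (by rw [mem_ball, dist_eq_norm]; exact hz.2)
      simpa using this
  by_cases h3 : ‖z - x‖ = ρ₀
  · have := hM₀ z (by rw [mem_closedBall, dist_eq_norm, h3])
    rw [h3, div_self h0.ne']; simpa using this
  by_cases h4 : ‖z - x‖ = R
  · have := hM₁ z (by rw [mem_closedBall, dist_eq_norm, h4])
    rw [h4, div_self hlog.ne']; linarith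
  have := hmain z (subset_closure ⟨lt_of_le_of_ne hz1 (Ne.symm h3), lt_of_le_of_ne hz2 h4⟩)
  rw [hFe z hz1] at this
  linarith

end ThreeCircles

section ExteriorBall

theorem inner_I_mul_self (z : ℂ) : inner ℝ z (I * z) = 0 := by
  simp [Complex.inner]; ring

theorem abs_inner_le_norm_unit {w e : ℂ} (he : ‖e‖ = 1) : |inner ℝ w e| ≤ ‖w‖ := by
  simpa [he] using abs_real_inner_le_norm w e

theorem periodic_deriv {E : Type*} [NormedAddCommGroup E] [NormedSpace ℝ E] {f : ℝ → E} {L : ℝ}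
    (hf : Function.Periodic f L) : Function.Periodic (deriv f) L := fun s => by
  have : (fun x => f (x + L)) = f := funext hf
  rw [← deriv_comp_add_const, this]

theorem exists_norm_le_of_periodic {E : Type*} [NormedAddCommGroup E] {f : ℝ → E} {L : ℝ}
    (hL : 0 < L) (hf : Function.Periodic f L) (hc : Continuous f) : ∃ K > 0, ∀ s, ‖f s‖ ≤ K := by
  obtain ⟨K, hK⟩ := (isCompact_Icc (a := 0) (b := L)).exists_bound_of_continuousOn hc.continuousOn
  refine ⟨max K 1, by positivity, fun s => ?_⟩
  obtain ⟨y, hy, hys⟩ := hf.exists_mem_Ico₀ hL s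
  rw [hys]
  exact (hK y (Ico_subset_Icc_self hy)).trans (le_max_left _ _)

variable {Ω : Set ℂ} {γ : ℝ → ℂ} {L : ℝ}

theorem boundary_hasDerivAt (h : BoundaryParam Ω γ L) (s : ℝ) :
    HasDerivAt γ (deriv γ s) s :=
  (h.smooth.differentiable (by simp) s).hasDerivAt

theorem boundary_taylor (h : BoundaryParam Ω γ L) :
    ∃ K > 0, ∀ s s', ‖γ s' - γ s - (s' - s) • deriv γ s‖ ≤ K * (s' - s) ^ 2 := by
  have h1 : ContDiff ℝ 1 (deriv γ) :=
    ((contDiff_infty_iff_deriv.1 h.smooth).2).of_le (by exact_mod_cast le_top)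
  have hd1 : Differentiable ℝ (deriv γ) := h1.differentiable (by simp)
  obtain ⟨K, hK, hKb⟩ := exists_norm_le_of_periodic h.Lpos (periodic_deriv (periodic_deriv h.periodic))
    (h1.continuous_deriv (by simp))
  have hlip : ∀ s s', ‖deriv γ s' - deriv γ s‖ ≤ K * ‖s' - s‖ := fun s s' =>
    Convex.norm_image_sub_le_of_norm_deriv_le (s := univ) (fun x _ => hd1 x)
      (fun x _ => hKb x) convex_univ (mem_univ _) (mem_univ _)
  refine ⟨K, hK, fun s s' => ?_⟩
  have hd : ∀ x, HasDerivAt (fun x => γ x - (x - s) • deriv γ s) (deriv γ x - deriv γ s) x :=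
    fun x => by
      have := (boundary_hasDerivAt h x).sub (((hasDerivAt_id x).sub_const s).smul_const (deriv γ s))
      rw [one_smul] at this
      exact this
  have := Convex.norm_image_sub_le_of_norm_hasDerivWithin_le (s := uIcc s s')
    (f := fun x => γ x - (x - s) • deriv γ s) (C := K * |s' - s|)
    (fun x _ => (hd x).hasDerivWithinAt)
    (fun x hx => (hlip s x).trans (by
      gcongr
      exact abs_sub_left_of_mem_uIcc hx)) (convex_uIcc s s') left_mem_uIcc right_mem_uIcc
  simp only [sub_self, zero_smul, sub_zero] at this
  calc _ = ‖γ s' - (s' - s) • deriv γ s - γ s‖ := by congr 1; abel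
    _ ≤ _ := this
    _ = _ := by rw [Real.norm_eq_abs, mul_assoc, ← sq, sq_abs]

/-- Two-sided touching balls: a smooth closed curve has positive reach. -/
theorem boundary_chord (h : BoundaryParam Ω γ L) :
    ∃ r > 0, ∀ s s', 2 * r * |inner ℝ (γ s' - γ s) (I * deriv γ s)| ≤ ‖γ s' - γ s‖ ^ 2 := by
  obtain ⟨K, hK, hT⟩ := boundary_taylor h
  have hL := h.Lpos
  set η : ℝ := 1 / (2 * K) with hη
  have hη0 : 0 < η := by positivity
  have hn : ∀ s, ‖I * deriv γ s‖ = 1 := fun s => by simp [h.arclength s]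
  have hnear : ∀ s s', |s' - s| ≤ η →
      |inner ℝ (γ s' - γ s) (I * deriv γ s)| ≤ 4 * K * ‖γ s' - γ s‖ ^ 2 := by
    intro s s' hs
    have h1 := hT s s'
    have h2 : |inner ℝ (γ s' - γ s) (I * deriv γ s)| ≤ K * (s' - s) ^ 2 := by
      have : inner ℝ (γ s' - γ s) (I * deriv γ s) =
          inner ℝ (γ s' - γ s - (s' - s) • deriv γ s) (I * deriv γ s) := by
        rw [inner_sub_left (γ s' - γ s), real_inner_smul_left, inner_I_mul_self, mul_zero, sub_zero]
      rw [this]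
      exact (abs_inner_le_norm_unit (hn s)).trans h1
    have h3 : |s' - s| / 2 ≤ ‖γ s' - γ s‖ := by
      have h4 : ‖(s' - s) • deriv γ s‖ = |s' - s| := by
        rw [norm_smul, h.arclength, mul_one, Real.norm_eq_abs]
      have h5 := norm_sub_norm_le ((s' - s) • deriv γ s) (γ s' - γ s)
      rw [norm_sub_rev ((s' - s) • deriv γ s)] at h5
      have h6 : K * (s' - s) ^ 2 ≤ |s' - s| / 2 := by
        rw [← sq_abs, sq, ← mul_assoc]
        have : K * |s' - s| ≤ 1 / 2 := by
          calc K * |s' - s| ≤ K * η := by gcongr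
            _ = 1 / 2 := by rw [hη]; field_simp
        nlinarith [abs_nonneg (s' - s)]
      linarith
    have h7 : (|s' - s| / 2) ^ 2 ≤ ‖γ s' - γ s‖ ^ 2 := pow_le_pow_left₀ (by positivity) h3 2
    rw [div_pow, sq_abs] at h7
    nlinarith
  -- away from the diagonal
  set S : Set (ℝ × ℝ) := {p | p.1 ∈ Icc 0 L ∧ p.2 ∈ Icc (p.1 - L / 2) (p.1 + L / 2) ∧
    η ≤ |p.2 - p.1|} with hS
  have hcont : Continuous fun p : ℝ × ℝ => ‖γ p.2 - γ p.1‖ := by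
    have := h.smooth.continuous
    fun_prop
  have hSc : IsCompact S := by
    refine (isCompact_Icc.prod (isCompact_Icc (a := -L / 2) (b := L + L / 2))).of_isClosed_subset
      ?_ (fun p hp => ⟨hp.1, ?_, ?_⟩)
    · refine (isClosed_Icc.preimage continuous_fst).inter (IsClosed.inter ?_ ?_)
      · exact (isClosed_le (by fun_prop) continuous_snd).inter (isClosed_le continuous_snd (by fun_prop))
      · exact isClosed_le (f := fun _ : ℝ × ℝ => η) (by fun_prop)
          (g := fun p : ℝ × ℝ => |p.2 - p.1|) (by fun_prop)
    · linarith [hp.1.1, hp.2.1.1]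
    · linarith [hp.1.2, hp.2.1.2]
  obtain ⟨c, hc, hcS⟩ : ∃ c > 0, ∀ p ∈ S, c ≤ ‖γ p.2 - γ p.1‖ := by
    rcases S.eq_empty_or_nonempty with hE | hE
    · exact ⟨1, one_pos, fun p hp => by rw [hE] at hp; exact hp.elim⟩
    obtain ⟨p, hp, hpm⟩ := hSc.exists_isMinOn hE hcont.continuousOn
    refine ⟨_, ?_, fun q hq => hpm hq⟩
    rw [gt_iff_lt, norm_pos_iff, sub_ne_zero]
    intro heq
    obtain ⟨k, hk⟩ := h.inj _ _ heq
    have h1 := hp.2.1.1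
    have h2 := hp.2.1.2
    have hk0 : k = 0 := by
      have h3 : L * k < L * 1 := by linarith
      have h4 : L * (-1) < L * k := by linarith
      have h5 := lt_of_mul_lt_mul_left h3 hL.le
      have h6 := lt_of_mul_lt_mul_left h4 hL.le
      have h5' : k < 1 := by exact_mod_cast h5
      have h6' : -1 < k := by exact_mod_cast h6
      omega
    have := hp.2.2
    rw [hk, hk0] at this
    simp at this; linarith
  have hfar : ∀ s s', s ∈ Ico 0 L → s' ∈ Ico (s - L / 2) (s - L / 2 + L) →
      |inner ℝ (γ s' - γ s) (I * deriv γ s)| ≤ max (4 * K) (1 / c) * ‖γ s' - γ s‖ ^ 2 := by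
    intro s s' hs hs'
    by_cases hd : |s' - s| ≤ η
    · exact (hnear s s' hd).trans (by gcongr; exact le_max_left _ _)
    · have h1 := hcS (s, s') ⟨Ico_subset_Icc_self hs, ⟨hs'.1, by linarith [hs'.2]⟩, (not_le.1 hd).le⟩
      calc _ ≤ ‖γ s' - γ s‖ := abs_inner_le_norm_unit (hn s)
        _ ≤ 1 / c * ‖γ s' - γ s‖ ^ 2 := by
          rw [div_mul_eq_mul_div, one_mul, le_div_iff₀ hc, sq]
          exact mul_le_mul_of_nonneg_left h1 (norm_nonneg _)
        _ ≤ _ := by gcongr; exact le_max_right _ _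
  set M := max (4 * K) (1 / c)
  have hM : 0 < M := lt_of_lt_of_le (by positivity) (le_max_left _ _)
  refine ⟨1 / (2 * M), by positivity, fun s s' => ?_⟩
  have hper : Function.Periodic (fun s => (γ s, deriv γ s)) L := fun s => by
    simp only [h.periodic s, periodic_deriv h.periodic s]
  obtain ⟨a, ha, hsa⟩ := hper.exists_mem_Ico₀ hL s
  obtain ⟨b, hb, hsb⟩ := h.periodic.exists_mem_Ico hL s' (a - L / 2)
  simp only [Prod.mk.injEq] at hsa
  rw [hsa.1, hsa.2, hsb]
  have := hfar a b ha hb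
  calc _ = |inner ℝ (γ b - γ a) (I * deriv γ a)| / M := by field_simp
    _ ≤ _ := by rw [div_le_iff₀ hM]; linarith

/-- A bounded open set with smooth connected boundary satisfies a uniform exterior ball
condition. -/
theorem boundary_exterior_ball (h : BoundaryParam Ω γ L) (ho : IsOpen Ω) (hb : IsBounded Ω) :
    ∃ r > 0, ∀ x ∈ frontier Ω, ∃ y, ‖x - y‖ = r ∧ ∀ z ∈ closure Ω, r ≤ ‖z - y‖ := by
  obtain ⟨r, hr, hch⟩ := boundary_chord h
  have hn : ∀ s, ‖I * deriv γ s‖ = 1 := fun s => by simp [h.arclength s]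
  have hdist : ∀ σ : ℝ, |σ| = 1 → ∀ s s', r ^ 2 ≤ ‖γ s' - (γ s + (σ * r) • (I * deriv γ s))‖ ^ 2 := by
    intro σ hσ s s'
    have h1 := hch s s'
    rw [← sub_sub, norm_sub_sq_real, real_inner_smul_right, norm_smul, hn, Real.norm_eq_abs, abs_mul,
      hσ, one_mul, mul_one, sq_abs]
    have h2 : σ * inner ℝ (γ s' - γ s) (I * deriv γ s) ≤
        |inner ℝ (γ s' - γ s) (I * deriv γ s)| := by
      refine (le_abs_self _).trans ?_
      rw [abs_mul, hσ, one_mul]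
    nlinarith
  have hfc : IsCompact (frontier Ω) := hb.isCompact_closure.of_isClosed_subset isClosed_frontier
    frontier_subset_closure
  have hγf : ∀ s, γ s ∈ frontier Ω := fun s => h.srange ▸ mem_range_self s
  obtain ⟨p, hp, hpm⟩ := hfc.exists_isMaxOn ⟨γ 0, hγf 0⟩ (continuous_norm.continuousOn)
  have hcl : ∀ z ∈ closure Ω, ‖z‖ ^ 2 ≤ ‖p‖ ^ 2 := by
    intro z hz
    have hcd : ContDiff ℝ 2 fun y : ℂ => ‖y - 0‖ ^ 2 := contDiff_norm_sq_sub 0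
    have := max_principle (F := fun y => ‖y - 0‖ ^ 2 - ‖p‖ ^ 2) ho hb
      (hcd.sub contDiff_const).continuous.continuousOn
      (fun y hy => by
        have : ‖y‖ ≤ ‖p‖ := hpm hy
        simp only [sub_zero, sub_nonpos]; gcongr)
      (fun y _ _ => ⟨(hcd.sub contDiff_const).contDiffAt, by
        rw [lap_sub hcd.contDiffAt contDiffAt_const, lap_norm_sq, lap_const]; norm_num⟩) hz
    simpa using this
  rw [← h.srange] at hp
  obtain ⟨s₁, rfl⟩ := hp
  have horth : inner ℝ (γ s₁) (deriv γ s₁) = 0 := by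
    have hd := (boundary_hasDerivAt h s₁).norm_sq
    have hmax : IsLocalMax (fun s => ‖γ s‖ ^ 2) s₁ := Eventually.of_forall fun s => by
      have : ‖γ s‖ ≤ ‖γ s₁‖ := hpm (hγf s)
      show ‖γ s‖ ^ 2 ≤ ‖γ s₁‖ ^ 2
      gcongr
    have := hmax.hasDerivAt_eq_zero hd
    linarith
  obtain ⟨σ, hσ, hσp⟩ : ∃ σ : ℝ, |σ| = 1 ∧ 0 ≤ σ * inner ℝ (γ s₁) (I * deriv γ s₁) := by
    rcases le_total 0 (inner ℝ (γ s₁) (I * deriv γ s₁)) with h1 | h1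
    · exact ⟨1, by simp, by simpa using h1⟩
    · exact ⟨-1, by simp, by simpa using h1⟩
  set c : ℝ → ℂ := fun s => γ s + (σ * r) • (I * deriv γ s) with hc
  have hcc : Continuous c := by
    have h1 := h.smooth.continuous
    have h2 : Continuous (deriv γ) := h.smooth.continuous_deriv (by simp)
    fun_prop
  have hmiss : ∀ s, ball (c s) r ∩ frontier Ω = ∅ := by
    intro s
    by_contra hne
    obtain ⟨y, hy, hyf⟩ := nonempty_iff_ne_empty.2 hne
    rw [← h.srange] at hyf
    obtain ⟨s', rfl⟩ := hyf
    rw [mem_ball, dist_eq_norm] at hy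
    have := hdist σ hσ s s'
    have h2 := pow_lt_pow_left₀ hy (norm_nonneg _) two_ne_zero
    linarith
  have hsub : ∀ s, ball (c s) r ⊆ Ω ∪ (closure Ω)ᶜ := fun s y hy => by
    by_contra hn
    simp only [mem_union, mem_compl_iff, not_or, not_not] at hn
    have : y ∈ ball (c s) r ∩ frontier Ω := ⟨hy, by rw [ho.frontier_eq]; exact ⟨hn.2, hn.1⟩⟩
    rw [hmiss s] at this; exact this
  have hdisj : ∀ z ∈ Ω, z ∉ (closure Ω)ᶜ := fun z hz hn => hn (subset_closure hz)
  have hclopen : IsClopen {s | c s ∈ Ω} := by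
    refine ⟨?_, ho.preimage hcc⟩
    have : {s | c s ∈ Ω} = (c ⁻¹' (closure Ω)ᶜ)ᶜ := by
      ext s
      have := hsub s (mem_ball_self hr)
      simp only [mem_ofPred_eq, mem_compl_iff, mem_preimage, not_not]
      exact ⟨fun hs => subset_closure hs, fun hs => this.resolve_right fun hn => hn hs⟩
    rw [this]
    exact (isClosed_closure.isOpen_compl.preimage hcc).isClosed_compl
  have hne1 : c s₁ ∉ Ω := fun hmem => by
    have h1 := hcl _ (subset_closure hmem)
    rw [hc] at h1
    simp only at h1
    rw [norm_add_sq_real, real_inner_smul_right, norm_smul, hn, Real.norm_eq_abs, abs_mul, hσ,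
      one_mul, mul_one, sq_abs] at h1
    have : 0 < r ^ 2 := by positivity
    nlinarith [mul_nonneg hr.le hσp]
  have hempty : {s | c s ∈ Ω} = ∅ := by
    rcases isClopen_iff.1 hclopen with h1 | h1
    · exact h1
    · exact absurd (h1 ▸ mem_univ s₁ : s₁ ∈ {s | c s ∈ Ω}) hne1
  refine ⟨r, hr, fun x hx => ?_⟩
  rw [← h.srange] at hx
  obtain ⟨s, rfl⟩ := hx
  refine ⟨c s, ?_, fun z hz => ?_⟩
  · simp only [hc, sub_add_cancel_left, norm_neg, norm_smul, hn, Real.norm_eq_abs, abs_mul, hσ,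
      one_mul, mul_one, abs_of_pos hr]
  · have hballout : ball (c s) r ⊆ (closure Ω)ᶜ := by
      have hpre : IsPreconnected (ball (c s) r) := (convex_ball _ _).isPreconnected
      refine hpre.subset_right_of_subset_union ho isClosed_closure.isOpen_compl
        (disjoint_left.2 hdisj) (hsub s) ⟨c s, mem_ball_self hr, ?_⟩
      refine (hsub s (mem_ball_self hr)).resolve_left fun hm => ?_
      have : s ∈ {s | c s ∈ Ω} := hm
      rw [hempty] at this; exact this
    by_contra! hlt
    exact hballout (by rwa [mem_ball, dist_eq_norm]) hz

end ExteriorBall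

section Barriers

variable {Ω : Set ℂ}

theorem lap_exp_barrier (y x : ℂ) (r β : ℝ) :
    lap (fun z => 1 - Real.exp (-β * (‖z - y‖ ^ 2 - r ^ 2))) x =
      -(4 * β ^ 2 * ‖x - y‖ ^ 2 - 4 * β) * Real.exp (-β * (‖x - y‖ ^ 2 - r ^ 2)) := by
  have hΦ : ContDiff ℝ 2 fun q : ℝ => 1 - Real.exp (-β * (q - r ^ 2)) := by fun_prop
  have hd : ∀ q : ℝ, HasDerivAt (fun q : ℝ => Real.exp (-β * (q - r ^ 2)))
      (Real.exp (-β * (q - r ^ 2)) * -β) q := fun q => by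
    have := (((hasDerivAt_id q).sub_const (r ^ 2)).const_mul (-β)).exp
    simpa using this
  have h1 : deriv (fun q : ℝ => 1 - Real.exp (-β * (q - r ^ 2))) =
      fun q => β * Real.exp (-β * (q - r ^ 2)) := funext fun q => by
    rw [((hd q).const_sub 1).deriv]; ring
  rw [lap_comp (Φ := fun q : ℝ => 1 - Real.exp (-β * (q - r ^ 2))) (f := fun z => ‖z - y‖ ^ 2)
    hΦ.contDiffAt (contDiff_norm_sq_sub y).contDiffAt, h1, ((hd _).const_mul β).deriv, dir_norm_sq,
    dir_norm_sq, lap_norm_sq]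
  have h2 : (2 * inner ℝ (x - y) 1) ^ 2 + (2 * inner ℝ (x - y) I) ^ 2 = 4 * ‖x - y‖ ^ 2 := by
    rw [Complex.sq_norm, normSq_apply]; simp [Complex.inner]; ring
  rw [h2]
  simp only [smul_eq_mul]; ring

theorem contDiff_exp_barrier (y : ℂ) (r β : ℝ) {n : WithTop ℕ∞} :
    ContDiff ℝ n fun z : ℂ => 1 - Real.exp (-β * (‖z - y‖ ^ 2 - r ^ 2)) :=
  contDiff_const.sub (contDiff_const.mul ((contDiff_norm_sq_sub y).sub contDiff_const)).exp

theorem exists_nearest_frontier (hb : IsBounded Ω) (hne : (frontier Ω).Nonempty)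
    (x : ℂ) : ∃ p ∈ frontier Ω, infDist x (frontier Ω) = ‖x - p‖ := by
  obtain ⟨p, hp, h⟩ := (hb.isCompact_closure.of_isClosed_subset isClosed_frontier
    frontier_subset_closure).exists_infDist_eq_dist hne x
  exact ⟨p, hp, by rw [h, dist_eq_norm]⟩

/-- The elementary estimates on the barrier attached to the exterior ball at the boundary point
nearest to `x`. -/
theorem exp_barrier_bounds (hb : IsBounded Ω) (hne : (frontier Ω).Nonempty)
    {r : ℝ} (hr : 0 < r)
    (hext : ∀ x ∈ frontier Ω, ∃ y, ‖x - y‖ = r ∧ ∀ z ∈ closure Ω, r ≤ ‖z - y‖) :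
    ∃ D > 0, ∀ x ∈ Ω, ∃ y, (∀ z ∈ closure Ω, r ≤ ‖z - y‖ ∧ ‖z - y‖ ≤ D) ∧
      ∀ β > 0, 1 - Real.exp (-β * (‖x - y‖ ^ 2 - r ^ 2)) ≤
        β * (2 * D) * infDist x (frontier Ω) := by
  obtain ⟨R, hR⟩ := hb.closure.exists_norm_le
  obtain ⟨p₀, hp₀⟩ := hne
  have hR0 : 0 ≤ R := (norm_nonneg _).trans (hR p₀ (frontier_subset_closure hp₀))
  refine ⟨2 * R + r, by positivity, fun x hx => ?_⟩
  obtain ⟨p, hp, hpd⟩ := exists_nearest_frontier hb ⟨p₀, hp₀⟩ x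
  obtain ⟨y, hy, hyz⟩ := hext p hp
  have hle : ∀ z ∈ closure Ω, ‖z - y‖ ≤ 2 * R + r := fun z hz => by
    have h1 : ‖z - y‖ ≤ ‖z - p‖ + ‖p - y‖ := norm_sub_le_norm_sub_add_norm_sub _ _ _
    have h2 : ‖z - p‖ ≤ ‖z‖ + ‖p‖ := norm_sub_le _ _
    linarith [hR z hz, hR p (frontier_subset_closure hp)]
  refine ⟨y, fun z hz => ⟨hyz z hz, hle z hz⟩, fun β hβ => ?_⟩
  have h1 := Real.add_one_le_exp (-β * (‖x - y‖ ^ 2 - r ^ 2))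
  have h2 : ‖x - y‖ - r ≤ infDist x (frontier Ω) := by
    rw [hpd]
    have : ‖x - y‖ ≤ ‖x - p‖ + ‖p - y‖ := norm_sub_le_norm_sub_add_norm_sub _ _ _
    linarith
  have hx' := subset_closure hx
  have h3 := hyz x hx'
  have h4 := hle x hx'
  have h5 : ‖x - y‖ ^ 2 - r ^ 2 ≤ 2 * (2 * R + r) * infDist x (frontier Ω) := by
    have : ‖x - y‖ ^ 2 - r ^ 2 = (‖x - y‖ + r) * (‖x - y‖ - r) := by ring
    rw [this]
    apply mul_le_mul _ h2 (by linarith) (by positivity)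
    linarith
  nlinarith

theorem exists_barrier (hb : IsBounded Ω) (hne : (frontier Ω).Nonempty) {r : ℝ}
    (hr : 0 < r)
    (hext : ∀ x ∈ frontier Ω, ∃ y, ‖x - y‖ = r ∧ ∀ z ∈ closure Ω, r ≤ ‖z - y‖) :
    ∃ C > 0, ∀ x ∈ Ω, ∃ w : ℂ → ℝ, ContDiff ℝ 2 w ∧ (∀ z ∈ closure Ω, 0 ≤ w z) ∧
      (∀ z ∈ Ω, lap w z ≤ -1) ∧ w x ≤ C * infDist x (frontier Ω) ∧ ∀ z, w z ≤ C := by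
  obtain ⟨D, hD, h⟩ := exp_barrier_bounds hb hne hr hext
  set β : ℝ := 2 / r ^ 2 with hβ
  have hβ0 : 0 < β := by positivity
  set K : ℝ := r ^ 2 * Real.exp (β * D ^ 2) / 8 with hK
  have hK0 : 0 < K := by positivity
  refine ⟨max (K * (β * (2 * D))) K, lt_of_lt_of_le hK0 (le_max_right _ _), fun x hx => ?_⟩
  obtain ⟨y, hy, hyx⟩ := h x hx
  have hcd : ContDiff ℝ 2 fun z : ℂ => 1 - Real.exp (-β * (‖z - y‖ ^ 2 - r ^ 2)) :=
    contDiff_exp_barrier y r β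
  refine ⟨fun z => K • (1 - Real.exp (-β * (‖z - y‖ ^ 2 - r ^ 2))), hcd.const_smul K,
    fun z hz => ?_, fun z hz => ?_, ?_, fun z => ?_⟩
  · have h1 := pow_le_pow_left₀ hr.le (hy z hz).1 2
    have : Real.exp (-β * (‖z - y‖ ^ 2 - r ^ 2)) ≤ 1 := Real.exp_le_one_iff.2 (by nlinarith)
    simp only [smul_eq_mul]
    exact mul_nonneg hK0.le (by linarith)
  · obtain ⟨h1, h2⟩ := hy z (subset_closure hz)
    rw [lap_const_smul (g := fun z : ℂ => 1 - Real.exp (-β * (‖z - y‖ ^ 2 - r ^ 2))) K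
      hcd.contDiffAt, lap_exp_barrier, smul_eq_mul]
    have h3 := pow_le_pow_left₀ hr.le h1 2
    have h4 := pow_le_pow_left₀ (norm_nonneg _) h2 2
    have h5 : 8 / r ^ 2 ≤ 4 * β ^ 2 * ‖z - y‖ ^ 2 - 4 * β := by
      have : 4 * β ^ 2 * r ^ 2 - 4 * β = 8 / r ^ 2 := by rw [hβ]; field_simp; ring
      nlinarith [sq_nonneg β]
    have h6 : Real.exp (-(β * D ^ 2)) ≤ Real.exp (-β * (‖z - y‖ ^ 2 - r ^ 2)) :=
      Real.exp_le_exp.2 (by nlinarith)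
    have h7 := mul_le_mul h5 h6 (Real.exp_pos _).le (le_trans (by positivity) h5)
    have h8 : K * (8 / r ^ 2 * Real.exp (-(β * D ^ 2))) = 1 := by
      rw [hK, Real.exp_neg]; field_simp
    have h9 := mul_le_mul_of_nonneg_left h7 hK0.le
    linarith
  · have h1 := mul_le_mul_of_nonneg_left (hyx β hβ0) hK0.le
    have h2 : K * (β * (2 * D)) * infDist x (frontier Ω) ≤
        max (K * (β * (2 * D))) K * infDist x (frontier Ω) :=
      mul_le_mul_of_nonneg_right (le_max_left _ _) infDist_nonneg
    simp only [smul_eq_mul]; linarith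
  · have := Real.exp_pos (-β * (‖z - y‖ ^ 2 - r ^ 2))
    simp only [smul_eq_mul]
    exact le_trans (by nlinarith) (le_max_right _ _)

/-- Barriers with a boundary layer of width `ε`. -/
theorem exists_layer_barrier (hb : IsBounded Ω) (hne : (frontier Ω).Nonempty)
    {r : ℝ} (hr : 0 < r)
    (hext : ∀ x ∈ frontier Ω, ∃ y, ‖x - y‖ = r ∧ ∀ z ∈ closure Ω, r ≤ ‖z - y‖) :
    ∃ C > 0, ∀ ε > 0, 2 * ε ≤ r ^ 2 → ∀ x ∈ Ω, ∃ w : ℂ → ℝ, ContDiff ℝ 2 w ∧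
      (∀ z ∈ closure Ω, 0 ≤ w z ∧ w z ≤ 1) ∧
      (∀ z ∈ Ω, lap w z ≤ -(2 * r ^ 2 / ε ^ 2) * (1 - w z)) ∧
        w x ≤ C * infDist x (frontier Ω) / ε := by
  obtain ⟨D, hD, h⟩ := exp_barrier_bounds hb hne hr hext
  refine ⟨2 * D, by positivity, fun ε hε hεr x hx => ?_⟩
  obtain ⟨y, hy, hyx⟩ := h x hx
  refine ⟨fun z => 1 - Real.exp (-(1 / ε) * (‖z - y‖ ^ 2 - r ^ 2)), contDiff_exp_barrier _ _ _,
    fun z hz => ⟨?_, ?_⟩, fun z hz => ?_, ?_⟩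
  · have h1 := pow_le_pow_left₀ hr.le (hy z hz).1 2
    have h2 : 0 ≤ 1 / ε * (‖z - y‖ ^ 2 - r ^ 2) := mul_nonneg (by positivity) (by linarith)
    have : Real.exp (-(1 / ε) * (‖z - y‖ ^ 2 - r ^ 2)) ≤ 1 := Real.exp_le_one_iff.2 (by linarith)
    linarith
  · linarith [Real.exp_pos (-(1 / ε) * (‖z - y‖ ^ 2 - r ^ 2))]
  · have h3 := pow_le_pow_left₀ hr.le (hy z (subset_closure hz)).1 2
    rw [lap_exp_barrier, sub_sub_cancel]
    refine mul_le_mul_of_nonneg_right ?_ (Real.exp_pos _).le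
    rw [neg_le_neg_iff, div_pow]
    have : 4 * (1 ^ 2 / ε ^ 2) * ‖z - y‖ ^ 2 - 4 * (1 / ε) =
        (4 * ‖z - y‖ ^ 2 - 4 * ε) / ε ^ 2 := by field_simp
    rw [this]
    gcongr
    linarith
  · refine (hyx (1 / ε) (by positivity)).trans (le_of_eq ?_)
    ring

end Barriers

section KernelLimits

open scoped Convolution ContDiff

variable {E : Type*} [NormedAddCommGroup E]

theorem integrable_of_dominated_limit {k : ℕ → ℂ → E} {k' : ℂ → E} {D : ℂ → ℝ}
    (hk : ∀ n, AEStronglyMeasurable (k n) volume) (hD : Integrable D)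
    (hb : ∀ n, ∀ᵐ z, ‖k n z‖ ≤ D z) (hl : ∀ᵐ z, Tendsto (fun n => k n z) atTop (𝓝 (k' z))) :
    Integrable k' ∧ Tendsto (fun n => ∫ z, ‖k n z - k' z‖) atTop (𝓝 0) := by
  have hm := aestronglyMeasurable_of_tendsto_ae atTop hk hl
  have hb' : ∀ᵐ z, ‖k' z‖ ≤ D z := by
    filter_upwards [hl, ae_all_iff.2 hb] with z h1 h2
    exact le_of_tendsto h1.norm (Eventually.of_forall h2)
  refine ⟨hD.mono' hm hb', ?_⟩
  have := tendsto_integral_of_dominated_convergence (F := fun n z => ‖k n z - k' z‖)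
    (f := fun _ => (0 : ℝ)) (fun z => D z + D z) (fun n => ((hk n).sub hm).norm) (hD.add hD)
    (fun n => by
      filter_upwards [hb n, hb'] with z h1 h2
      rw [norm_norm]
      exact (norm_sub_le _ _).trans (add_le_add h1 h2))
    (by
      filter_upwards [hl] with z h1
      have := (h1.sub_const (k' z)).norm
      simpa using this)
  simpa using this

theorem tendstoUniformly_convolution [NormedSpace ℝ E] {F : Type*} [NormedAddCommGroup F]
    [NormedSpace ℝ F] {k : ℕ → ℂ → E} {k' : ℂ → E}
    (hk : ∀ n, Integrable (k n)) (hk' : Integrable k')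
    (hl : Tendsto (fun n => ∫ z, ‖k n z - k' z‖) atTop (𝓝 0)) (L : E →L[ℝ] ℂ →L[ℝ] F)
    {g : ℂ → ℂ} (hg : Continuous g) (hgc : HasCompactSupport g) :
    TendstoUniformly (fun n => (k n ⋆[L] g)) (k' ⋆[L] g) atTop := by
  obtain ⟨M, hM⟩ := hgc.exists_bound_of_continuous hg
  have hM0 : 0 ≤ M := (norm_nonneg _).trans (hM 0)
  rw [Metric.tendstoUniformly_iff]
  intro e he
  have h1 : Tendsto (fun n => ‖L‖ * M * ∫ z, ‖k n z - k' z‖) atTop (𝓝 0) := by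
    simpa using hl.const_mul (‖L‖ * M)
  filter_upwards [h1.eventually_lt_const he] with n hn x
  have hi : ∀ {q : ℂ → E}, Integrable q → Integrable fun z => L (q z) (g (x - z)) := fun {q} hq =>
    hgc.convolutionExists_right L hq.locallyIntegrable hg x
  rw [dist_comm, dist_eq_norm, convolution_def, convolution_def, ← integral_sub (hi (hk n)) (hi hk')]
  refine lt_of_le_of_lt ?_ hn
  rw [← integral_const_mul]
  refine norm_integral_le_of_norm_le (((hk n).sub hk').norm.const_mul _) (Eventually.of_forall
    fun z => ?_)
  have : L (k n z) (g (x - z)) - L (k' z) (g (x - z)) = L (k n z - k' z) (g (x - z)) := by simp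
  rw [this]
  calc _ ≤ ‖L‖ * ‖k n z - k' z‖ * ‖g (x - z)‖ := L.le_opNorm₂ _ _
    _ ≤ ‖L‖ * ‖k n z - k' z‖ * M := by gcongr; exact hM _
    _ = _ := by ring

end KernelLimits

section LogKernel

open scoped ContDiff

/-- The regularised logarithm `½ log(|z|² + δ²)`. -/
def regLog (δ : ℝ) (z : ℂ) : ℝ := 1 / 2 * Real.log (‖z - 0‖ ^ 2 + δ ^ 2)

theorem contDiffAt_regLog {δ : ℝ} {z : ℂ} (h : 0 < ‖z‖ ^ 2 + δ ^ 2) {n : WithTop ℕ∞} :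
    ContDiffAt ℝ n (regLog δ) z := by
  refine contDiffAt_const.mul (ContDiffAt.log ?_ ?_)
  · exact ((contDiff_norm_sq_sub 0).add contDiff_const).contDiffAt
  · simpa using h.ne'

theorem contDiff_regLog {δ : ℝ} (h : 0 < δ) {n : WithTop ℕ∞} : ContDiff ℝ n (regLog δ) :=
  contDiff_iff_contDiffAt.2 fun _ => contDiffAt_regLog (by positivity)

theorem hasFDerivAt_regLog {δ : ℝ} (h : 0 < δ) (z : ℂ) :
    HasFDerivAt (regLog δ) ((‖z‖ ^ 2 + δ ^ 2)⁻¹ • innerSL ℝ z) z := by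
  have h1 := ((hasStrictFDerivAt_norm_sq z).hasFDerivAt.add_const (δ ^ 2)).log
    (by positivity : ‖z‖ ^ 2 + δ ^ 2 ≠ 0)
  have h2 := h1.const_mul (1 / 2)
  have h3 : regLog δ = fun y => 1 / 2 * Real.log (‖y‖ ^ 2 + δ ^ 2) := by
    funext y; simp [regLog]
  rw [h3]
  refine h2.congr_fderiv ?_
  ext v
  simp
  ring

theorem lap_regLog {δ : ℝ} (h : 0 < δ) (z : ℂ) :
    lap (regLog δ) z = 2 * δ ^ 2 / (‖z‖ ^ 2 + δ ^ 2) ^ 2 := by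
  have hd : ∀ q : ℝ, 0 < q + δ ^ 2 → HasDerivAt (fun q : ℝ => 1 / 2 * Real.log (q + δ ^ 2))
      (1 / 2 * (q + δ ^ 2)⁻¹) q := fun q hq => by
    have := (((hasDerivAt_id q).add_const (δ ^ 2)).log hq.ne').const_mul (1 / 2)
    simpa using this
  have hd2 : ∀ q : ℝ, 0 < q + δ ^ 2 → HasDerivAt (fun q : ℝ => 1 / 2 * (q + δ ^ 2)⁻¹)
      (-(1 / 2 * ((q + δ ^ 2) ^ 2)⁻¹)) q := fun q hq => by
    have := (((hasDerivAt_id q).add_const (δ ^ 2)).inv hq.ne').const_mul (1 / 2)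
    exact this.congr_deriv (by simp only [id]; ring)
  have hp : ∀ y : ℂ, 0 < ‖y - 0‖ ^ 2 + δ ^ 2 := fun y => by positivity
  have hc : ContDiffAt ℝ 2 (fun q : ℝ => 1 / 2 * Real.log (q + δ ^ 2)) (‖z - 0‖ ^ 2) :=
    contDiffAt_const.mul (ContDiffAt.log (by fun_prop) (hp z).ne')
  have := lap_comp (f := fun z => ‖z - 0‖ ^ 2) hc (contDiff_norm_sq_sub 0).contDiffAt
  have h1 : deriv (fun q : ℝ => 1 / 2 * Real.log (q + δ ^ 2)) =ᶠ[𝓝 (‖z - 0‖ ^ 2)]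
      fun q => 1 / 2 * (q + δ ^ 2)⁻¹ := by
    have : ∀ᶠ q : ℝ in 𝓝 (‖z - 0‖ ^ 2), 0 < q + δ ^ 2 :=
      (continuous_id.add continuous_const).continuousAt.eventually (lt_mem_nhds (hp z))
    filter_upwards [this] with q hq using (hd q hq).deriv
  rw [h1.deriv_eq, h1.eq_of_nhds, (hd2 _ (hp z)).deriv, dir_norm_sq, dir_norm_sq, lap_norm_sq] at this
  have h2 : (2 * inner ℝ (z - 0) 1) ^ 2 + (2 * inner ℝ (z - 0) I) ^ 2 = 4 * ‖z - 0‖ ^ 2 := by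
    rw [Complex.sq_norm, normSq_apply]; simp [Complex.inner]; ring
  rw [h2] at this
  refine this.trans ?_
  have := (hp z).ne'
  simp only [sub_zero, smul_eq_mul] at *
  field_simp; ring

theorem abs_regLog_le {δ : ℝ} (h0 : 0 ≤ δ) (h1 : δ ≤ 1) {z : ℂ} (hz : z ≠ 0) (hz6 : ‖z‖ ≤ 6) :
    |regLog δ z| ≤ 200 * ‖z‖⁻¹ := by
  have hz0 : 0 < ‖z‖ := norm_pos_iff.2 hz
  have hpos : 0 < ‖z‖ ^ 2 + δ ^ 2 := by positivity
  have hi : 1 / 6 ≤ ‖z‖⁻¹ := by rw [one_div]; exact inv_anti₀ hz0 hz6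
  simp only [regLog, sub_zero]
  rw [abs_le]
  constructor
  · have h2 : Real.log (‖z‖ ^ 2) ≤ Real.log (‖z‖ ^ 2 + δ ^ 2) :=
      Real.log_le_log (by positivity) (by nlinarith [sq_nonneg δ])
    rw [Real.log_pow] at h2
    have h3 := Real.one_sub_inv_le_log_of_pos hz0
    push_cast at h2
    linarith
  · have h2 := Real.log_le_sub_one_of_pos hpos
    nlinarith

end LogKernel

section NewtonKernel

open scoped Convolution ContDiff

/-- A smooth cutoff equal to `1` on the ball of radius `4`. -/
def cutBump : ContDiffBump (0 : ℂ) := ⟨4, 5, by norm_num, by norm_num⟩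

/-- The truncated logarithmic kernel and its regularisations (`δ = 0` is the kernel). -/
def newton (δ : ℝ) (z : ℂ) : ℝ := cutBump z * regLog δ z

/-- The gradient of `newton`. -/
def newtonGrad (δ : ℝ) (z : ℂ) : ℂ →L[ℝ] ℝ :=
  (cutBump z * (‖z‖ ^ 2 + δ ^ 2)⁻¹) • innerSL ℝ z + regLog δ z • fderiv ℝ cutBump z

theorem cutBump_contDiff {n : ℕ∞} : ContDiff ℝ n cutBump := cutBump.contDiff

theorem cutBump_eq_zero {z : ℂ} (h : 5 ≤ ‖z‖) : cutBump z = 0 :=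
  cutBump.zero_of_le_dist (by simpa [cutBump] using h)

theorem cutBump_eq_one {z : ℂ} (h : ‖z‖ ≤ 4) : cutBump z = 1 :=
  cutBump.one_of_mem_closedBall (by simpa [cutBump] using h)

theorem hasFDerivAt_newton {δ : ℝ} (h : 0 < δ) (z : ℂ) :
    HasFDerivAt (newton δ) (newtonGrad δ z) z := by
  have h1 : HasFDerivAt cutBump (fderiv ℝ cutBump z) z :=
    ((cutBump_contDiff (n := 1)).differentiable (by simp) z).hasFDerivAt
  have := h1.mul (hasFDerivAt_regLog h z)
  rwa [smul_smul] at this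

theorem contDiff_newton {δ : ℝ} (h : 0 < δ) {n : ℕ∞} : ContDiff ℝ n (newton δ) :=
  cutBump_contDiff.mul (contDiff_regLog h)

theorem fderiv_newton {δ : ℝ} (h : 0 < δ) : fderiv ℝ (newton δ) = newtonGrad δ :=
  funext fun z => (hasFDerivAt_newton h z).fderiv

theorem hasCompactSupport_newton (δ : ℝ) : HasCompactSupport (newton δ) :=
  cutBump.hasCompactSupport.mul_right

/-- The dominating function for the kernels. -/
def newtonDom (C : ℝ) : ℂ → ℝ := (ball 0 6).indicator fun z => C * ‖z‖⁻¹

theorem integrable_newtonDom (C : ℝ) : Integrable (newtonDom C) := by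
  refine (integrable_indicator_iff measurableSet_ball).2
    (integrableOn_ball_of_norm_le_rpow (C := |C|) (α := 1) ?_ ?_ ?_ ?_)
  · simp [Complex.finrank_real_complex]
  · simp [Complex.finrank_real_complex]
  · refine Eventually.of_forall fun z => ?_
    rw [norm_mul, Real.norm_eq_abs, norm_inv, norm_norm, Real.rpow_neg_one]
  · exact (Measurable.aestronglyMeasurable (by fun_prop))

theorem exists_newton_bounds : ∃ C, ∀ δ, 0 ≤ δ → δ ≤ 1 → ∀ z : ℂ, z ≠ 0 →
    ‖newton δ z‖ ≤ newtonDom C z ∧ ‖newtonGrad δ z‖ ≤ newtonDom C z := by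
  obtain ⟨B, hB⟩ := (cutBump.hasCompactSupport.fderiv (𝕜 := ℝ)).exists_bound_of_continuous
    ((cutBump_contDiff (n := 1)).continuous_fderiv (by simp))
  have hB0 : 0 ≤ B := (norm_nonneg _).trans (hB 0)
  refine ⟨200 + (1 + 200 * B), fun δ h0 h1 z hz => ?_⟩
  have hz0 : 0 < ‖z‖ := norm_pos_iff.2 hz
  by_cases h6 : z ∈ ball (0 : ℂ) 6
  · rw [newtonDom, indicator_of_mem h6]
    have hle : ‖z‖ ≤ 6 := by simpa using (mem_ball_zero_iff.1 h6).le
    have h2 := abs_regLog_le h0 h1 hz hle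
    have h3 : ‖cutBump z‖ ≤ 1 := by
      rw [Real.norm_eq_abs, abs_of_nonneg cutBump.nonneg]; exact cutBump.le_one
    have hi : 0 < ‖z‖⁻¹ := by positivity
    constructor
    · rw [newton, norm_mul, Real.norm_eq_abs (regLog δ z)]
      nlinarith [abs_nonneg (regLog δ z), norm_nonneg (cutBump z), mul_nonneg hB0 hi.le]
    · have h4 : ‖(cutBump z * (‖z‖ ^ 2 + δ ^ 2)⁻¹) • innerSL ℝ z‖ ≤ ‖z‖⁻¹ := by
        rw [norm_smul, norm_mul, innerSL_apply_norm, norm_inv, Real.norm_eq_abs (‖z‖ ^ 2 + δ ^ 2),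
          abs_of_pos (by positivity)]
        have : (‖z‖ ^ 2 + δ ^ 2)⁻¹ ≤ (‖z‖ ^ 2)⁻¹ :=
          inv_anti₀ (by positivity) (by nlinarith [sq_nonneg δ])
        calc _ ≤ 1 * (‖z‖ ^ 2)⁻¹ * ‖z‖ := by gcongr
          _ = _ := by field_simp
      have h5 : ‖regLog δ z • fderiv ℝ cutBump z‖ ≤ 200 * ‖z‖⁻¹ * B := by
        rw [norm_smul, Real.norm_eq_abs]
        exact mul_le_mul h2 (hB z) (norm_nonneg _) (by positivity)
      refine (norm_add_le _ _).trans ?_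
      nlinarith [mul_nonneg hB0 hi.le]
  · have h5 : 6 ≤ ‖z‖ := by simpa using h6
    have h7 : cutBump z = 0 := cutBump_eq_zero (by linarith)
    have h8 : fderiv ℝ cutBump z = 0 := by
      have : cutBump =ᶠ[𝓝 z] fun _ => (0 : ℝ) := by
        filter_upwards [continuous_norm.continuousAt.eventually (lt_mem_nhds
          (show (5 : ℝ) < ‖z‖ by linarith))] with y hy using cutBump_eq_zero hy.le
      rw [this.fderiv_eq]; simp
    rw [newtonDom, indicator_of_notMem h6]
    simp [newton, newtonGrad, h7, h8]

/-- A sequence of regularisation parameters. -/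
def regSeq (n : ℕ) : ℝ := 1 / ((n : ℝ) + 1)

theorem regSeq_pos (n : ℕ) : 0 < regSeq n := Nat.one_div_pos_of_nat

theorem regSeq_le (n : ℕ) : regSeq n ≤ 1 := by
  rw [regSeq, div_le_one (by positivity)]; simp

theorem tendsto_regSeq : Tendsto regSeq atTop (𝓝 0) := tendsto_one_div_add_atTop_nhds_zero_nat

theorem continuousAt_regLog_param {z : ℂ} (hz : z ≠ 0) : ContinuousAt (fun δ => regLog δ z) 0 := by
  have : ‖z - 0‖ ^ 2 + (0 : ℝ) ^ 2 ≠ 0 := by simpa using hz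
  exact continuousAt_const.mul (ContinuousAt.log (by fun_prop) this)

theorem newton_limits :
    (Integrable (newton 0) ∧ Tendsto (fun n => ∫ z, ‖newton (regSeq n) z - newton 0 z‖) atTop (𝓝 0)) ∧
    Integrable (newtonGrad 0) ∧
      Tendsto (fun n => ∫ z, ‖newtonGrad (regSeq n) z - newtonGrad 0 z‖) atTop (𝓝 0) := by
  obtain ⟨C, hC⟩ := exists_newton_bounds
  have hne : ∀ᵐ z : ℂ, z ≠ 0 := by simp [ae_iff]
  constructor
  · refine integrable_of_dominated_limit (fun n => (contDiff_newton (n := 1)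
      (regSeq_pos n)).continuous.aestronglyMeasurable) (integrable_newtonDom C) (fun n => ?_) ?_
    · filter_upwards [hne] with z hz using (hC _ (regSeq_pos n).le (regSeq_le n) z hz).1
    · filter_upwards [hne] with z hz
      exact (((continuousAt_regLog_param hz).tendsto.comp tendsto_regSeq).const_mul (cutBump z))
  · refine integrable_of_dominated_limit (fun n => ?_) (integrable_newtonDom C) (fun n => ?_) ?_
    · rw [← fderiv_newton (regSeq_pos n)]
      exact ((contDiff_newton (n := 1) (regSeq_pos n)).continuous_fderiv
        (by simp)).aestronglyMeasurable
    · filter_upwards [hne] with z hz using (hC _ (regSeq_pos n).le (regSeq_le n) z hz).2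
    · filter_upwards [hne] with z hz
      have h1 : ContinuousAt (fun δ : ℝ => newtonGrad δ z) 0 := by
        have h2 : ‖z‖ ^ 2 + (0 : ℝ) ^ 2 ≠ 0 := by simpa using hz
        have h3 : ContinuousAt (fun δ : ℝ => (‖z‖ ^ 2 + δ ^ 2)⁻¹) 0 :=
          ContinuousAt.inv₀ (by fun_prop) h2
        exact ((continuousAt_const.mul h3).smul continuousAt_const).add
          ((continuousAt_regLog_param hz).smul continuousAt_const)
      exact h1.tendsto.comp tendsto_regSeq

end NewtonKernel
end GLPhase

namespace GLPhase

section NewtonPotential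

open scoped Convolution ContDiff

/-- The truncated logarithmic potential of `g`. -/
def pot (k : ℂ → ℝ) (g : ℂ → ℂ) : ℂ → ℂ := k ⋆[ContinuousLinearMap.lsmul ℝ ℝ] g

theorem hasFDerivAt_pot {g : ℂ → ℂ} (hg : Continuous g) (hgc : HasCompactSupport g) (x : ℂ) :
    HasFDerivAt (pot (newton 0) g)
      ((newtonGrad 0 ⋆[(ContinuousLinearMap.lsmul ℝ ℝ).precompL ℂ] g) x) x := by
  obtain ⟨⟨hi, hl⟩, hi', hl'⟩ := newton_limits
  have hin : ∀ n, Integrable (newton (regSeq n)) := fun n =>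
    (contDiff_newton (n := 1) (regSeq_pos n)).continuous.integrable_of_hasCompactSupport
      (hasCompactSupport_newton _)
  have hin' : ∀ n, Integrable (newtonGrad (regSeq n)) := fun n => by
    rw [← fderiv_newton (regSeq_pos n)]
    exact ((contDiff_newton (n := 1) (regSeq_pos n)).continuous_fderiv
      (by simp)).integrable_of_hasCompactSupport ((hasCompactSupport_newton _).fderiv (𝕜 := ℝ))
  refine hasFDerivAt_of_tendstoUniformly (l := atTop)
    (f := fun n => newton (regSeq n) ⋆[ContinuousLinearMap.lsmul ℝ ℝ] g)
    (tendstoUniformly_convolution hin' hi' hl' ((ContinuousLinearMap.lsmul ℝ ℝ).precompL ℂ) hg hgc)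
    (fun n x => ?_) (fun x => ?_) x
  · rw [← fderiv_newton (regSeq_pos n)]
    exact (hasCompactSupport_newton _).hasFDerivAt_convolution_left _
      (contDiff_newton (n := 1) (regSeq_pos n)) hg.locallyIntegrable x
  · exact (tendstoUniformly_convolution hin hi hl _ hg hgc).tendsto_at x

theorem contDiff_pot_succ {g : ℂ → ℂ} {n : ℕ} (hg : ContDiff ℝ n g) (hgc : HasCompactSupport g) :
    ContDiff ℝ (n + 1) (pot (newton 0) g) := by
  have h1 := hasFDerivAt_pot hg.continuous hgc
  rw [contDiff_succ_iff_fderiv]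
  refine ⟨fun x => (h1 x).differentiableAt, by simp, ?_⟩
  have : fderiv ℝ (pot (newton 0) g) =
      newtonGrad 0 ⋆[(ContinuousLinearMap.lsmul ℝ ℝ).precompL ℂ] g := funext fun x => (h1 x).fderiv
  rw [this]
  exact hgc.contDiff_convolution_right (n := (n : ℕ∞)) _ newton_limits.2.1.locallyIntegrable hg

theorem dir_pot_right {k : ℂ → ℝ} (hk : LocallyIntegrable k) {g : ℂ → ℂ} (hg : ContDiff ℝ 1 g)
    (hgc : HasCompactSupport g) (e : ℂ) : dir e (pot k g) = pot k (dir e g) := by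
  funext x
  have h1 := hgc.hasFDerivAt_convolution_right (ContinuousLinearMap.lsmul ℝ ℝ) hk hg x
  rw [dir, pot, h1.fderiv, convolution_precompR_apply _ hk (hgc.fderiv (𝕜 := ℝ))
    (hg.continuous_fderiv (by simp))]
  rfl

theorem dir_pot_left {k : ℂ → ℝ} (hk : ContDiff ℝ 1 k) (hkc : HasCompactSupport k) {g : ℂ → ℂ}
    (hg : Continuous g) (e : ℂ) :
    dir e (pot k g) = pot (dir e k) g := by
  have hflip : ∀ k : ℂ → ℝ, pot k g = g ⋆[(ContinuousLinearMap.lsmul ℝ ℝ).flip] k := fun k =>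
    (convolution_flip (L := ContinuousLinearMap.lsmul ℝ ℝ) (f := k) (g := g) (μ := volume)).symm
  funext x
  have h1 := hkc.hasFDerivAt_convolution_right (ContinuousLinearMap.lsmul ℝ ℝ).flip
    (hg.locallyIntegrable (μ := volume)) hk x
  rw [dir, hflip, h1.fderiv, convolution_precompR_apply _ hg.locallyIntegrable
    (hkc.fderiv (𝕜 := ℝ)) (hk.continuous_fderiv (by simp)), hflip]
  rfl

theorem hasCompactSupport_dir {E : Type*} [NormedAddCommGroup E] [NormedSpace ℝ E] {f : ℂ → E}
    (hf : HasCompactSupport f) (e : ℂ) : HasCompactSupport (dir e f) :=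
  hf.fderiv_apply (𝕜 := ℝ) e

theorem contDiff_dir {E : Type*} [NormedAddCommGroup E] [NormedSpace ℝ E] {f : ℂ → E}
    {n : WithTop ℕ∞} (hf : ContDiff ℝ (n + 1) f) (e : ℂ) : ContDiff ℝ n (dir e f) :=
  contDiff_iff_contDiffAt.2 fun _ => ContDiffAt.dir hf.contDiffAt e

theorem contDiff_one_dir {E : Type*} [NormedAddCommGroup E] [NormedSpace ℝ E] {f : ℂ → E}
    (hf : ContDiff ℝ 2 f) (e : ℂ) : ContDiff ℝ 1 (dir e f) :=
  contDiff_dir (by simpa [one_add_one_eq_two] using hf) e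

theorem pot_add_left {k k' : ℂ → ℝ} (hk : Continuous k) (hk' : Continuous k') {g : ℂ → ℂ}
    (hg : Continuous g) (hgc : HasCompactSupport g) (x : ℂ) :
    pot k g x + pot k' g x = pot (fun z => k z + k' z) g x := by
  have := ConvolutionExistsAt.add_distrib
    (hgc.convolutionExists_right (ContinuousLinearMap.lsmul ℝ ℝ) hk.locallyIntegrable hg x)
    (hgc.convolutionExists_right (ContinuousLinearMap.lsmul ℝ ℝ) hk'.locallyIntegrable hg x)
    (μ := volume)
  exact this.symm

theorem lap_pot_right {k : ℂ → ℝ} (hk : LocallyIntegrable k) {g : ℂ → ℂ} (hg : ContDiff ℝ 2 g)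
    (hgc : HasCompactSupport g) (x : ℂ) :
    lap (pot k g) x = pot k (dir 1 (dir 1 g)) x + pot k (dir I (dir I g)) x := by
  have h1 : ContDiff ℝ 1 g := hg.of_le (by norm_num)
  simp only [lap, dir_pot_right hk h1 hgc, dir_pot_right hk (contDiff_one_dir hg _)
    (hasCompactSupport_dir hgc _)]

theorem lap_pot_left {k : ℂ → ℝ} (hk : ContDiff ℝ 2 k) (hkc : HasCompactSupport k) {g : ℂ → ℂ}
    (hg : Continuous g) (hgc : HasCompactSupport g) (x : ℂ) :
    lap (pot k g) x = pot (lap k) g x := by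
  have h1 : ContDiff ℝ 1 k := hk.of_le (by norm_num)
  have h2 : ∀ e, Continuous (dir e (dir e k)) := fun e =>
    (contDiff_dir (n := 0) (by simpa using contDiff_one_dir hk e) e).continuous
  simp only [lap, dir_pot_left h1 hkc hg, dir_pot_left (contDiff_one_dir hk _)
    (hasCompactSupport_dir hkc _) hg]
  exact pot_add_left (h2 _) (h2 _) hg hgc x

/-- The mass of the Laplacian of the regularised logarithm. -/
def newtonMass : ℝ := ∫ w : ℂ, 2 / (‖w‖ ^ 2 + 1) ^ 2

theorem integrable_mass : Integrable fun w : ℂ => 2 / (‖w‖ ^ 2 + 1) ^ 2 := by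
  have := (integrable_rpow_neg_one_add_norm_sq (E := ℂ) (μ := volume) (r := 4)
    (by simp [Complex.finrank_real_complex]; norm_num)).const_mul 2
  refine this.congr (Eventually.of_forall fun w => ?_)
  have h : (0 : ℝ) < 1 + ‖w‖ ^ 2 := by positivity
  simp only
  rw [show (-(4 : ℝ) / 2) = -((2 : ℕ) : ℝ) by norm_num, Real.rpow_neg h.le, Real.rpow_natCast,
    add_comm (1 : ℝ)]
  rfl

theorem newtonMass_pos : 0 < newtonMass := by
  refine (integral_pos_iff_support_of_nonneg (fun w => by positivity) integrable_mass).2 ?_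
  have : Function.support (fun w : ℂ => 2 / (‖w‖ ^ 2 + 1) ^ 2) = univ := by
    ext w
    simp only [Function.mem_support, mem_univ, iff_true]
    positivity
  rw [this]; simp

theorem tendsto_pot_lap_newton {g : ℂ → ℂ} (hg : Continuous g) (hgc : HasCompactSupport g)
    (hg2 : ∀ z, 2 ≤ ‖z‖ → g z = 0) {x : ℂ} (hx : x ∈ ball (0 : ℂ) 1) :
    Tendsto (fun n => pot (lap (newton (regSeq n))) g x) atTop (𝓝 (newtonMass • g x)) := by
  have hx1 : ‖x‖ < 1 := by simpa using hx
  have h1 : ∀ n, pot (lap (newton (regSeq n))) g x =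
      ∫ w : ℂ, (2 / (‖w‖ ^ 2 + 1) ^ 2) • g (x - (regSeq n) • w) := by
    intro n
    have hδ := regSeq_pos n
    have h2 : pot (lap (newton (regSeq n))) g x =
        ∫ z : ℂ, (2 * regSeq n ^ 2 / (‖z‖ ^ 2 + regSeq n ^ 2) ^ 2) • g (x - z) := by
      rw [pot, convolution_def]
      refine integral_congr_ae (Eventually.of_forall fun z => ?_)
      simp only [ContinuousLinearMap.lsmul_apply]
      by_cases hz : ‖z‖ < 4
      · congr 1
        rw [← lap_regLog hδ]
        refine lap_congr ?_
        filter_upwards [continuous_norm.continuousAt.eventually (gt_mem_nhds hz)] with y hy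
        rw [newton, cutBump_eq_one hy.le, one_mul]
      · have : g (x - z) = 0 := hg2 _ (by
          have := norm_sub_norm_le z x
          rw [norm_sub_rev] at this
          linarith [not_lt.1 hz])
        rw [this, smul_zero, smul_zero]
    have h3 := Measure.integral_comp_smul (volume : Measure ℂ)
      (fun z => (2 * regSeq n ^ 2 / (‖z‖ ^ 2 + regSeq n ^ 2) ^ 2) • g (x - z)) (regSeq n)
    rw [Complex.finrank_real_complex] at h3
    rw [h2, ← inv_smul_smul₀ (a := |(regSeq n ^ 2)⁻¹|) (by positivity) (∫ z : ℂ, _), ← h3,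
      ← integral_smul]
    refine integral_congr_ae (Eventually.of_forall fun w => ?_)
    simp only [smul_smul]
    congr 1
    rw [norm_smul, Real.norm_eq_abs, abs_of_pos hδ, abs_of_pos (by positivity)]
    field_simp
  simp only [h1]
  obtain ⟨M, hM⟩ := hgc.exists_bound_of_continuous hg
  have := tendsto_integral_of_dominated_convergence
    (F := fun (n : ℕ) (w : ℂ) => (2 / (‖w‖ ^ 2 + 1) ^ 2) • g (x - (regSeq n) • w))
    (f := fun w => (2 / (‖w‖ ^ 2 + 1) ^ 2) • g x) (fun w => (2 / (‖w‖ ^ 2 + 1) ^ 2) * M)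
    (fun n => ?_) (integrable_mass.mul_const M) (fun n => ?_) ?_
  · rwa [integral_smul_const] at this
  · refine Continuous.aestronglyMeasurable ?_
    have : ∀ w : ℂ, (‖w‖ ^ 2 + 1) ^ 2 ≠ 0 := fun w => by positivity
    fun_prop (disch := assumption)
  · refine Eventually.of_forall fun w => ?_
    rw [norm_smul, Real.norm_eq_abs, abs_of_pos (by positivity)]
    gcongr
    exact hM _
  · refine Eventually.of_forall fun w => ?_
    have h2 : Continuous fun δ : ℝ => (2 / (‖w‖ ^ 2 + 1) ^ 2) • g (x - δ • w) := by fun_prop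
    have := (h2.tendsto 0).comp tendsto_regSeq
    simpa [Function.comp_def] using this

theorem lap_pot {g : ℂ → ℂ} (hg : ContDiff ℝ 2 g) (hgc : HasCompactSupport g)
    (hg2 : ∀ z, 2 ≤ ‖z‖ → g z = 0) {x : ℂ} (hx : x ∈ ball (0 : ℂ) 1) :
    lap (pot (newton 0) g) x = newtonMass • g x := by
  obtain ⟨⟨hi, hl⟩, -⟩ := newton_limits
  have hin : ∀ n, Integrable (newton (regSeq n)) := fun n =>
    (contDiff_newton (n := 1) (regSeq_pos n)).continuous.integrable_of_hasCompactSupport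
      (hasCompactSupport_newton _)
  have h1 : ∀ e, Continuous (dir e (dir e g)) ∧ HasCompactSupport (dir e (dir e g)) := fun e =>
    ⟨(contDiff_dir (n := 0) (by simpa using contDiff_one_dir hg e) e).continuous,
      hasCompactSupport_dir (hasCompactSupport_dir hgc e) e⟩
  have h2 : Tendsto (fun n => lap (pot (newton (regSeq n)) g) x) atTop
      (𝓝 (lap (pot (newton 0) g) x)) := by
    simp only [lap_pot_right hi.locallyIntegrable hg hgc,
      fun n => lap_pot_right (hin n).locallyIntegrable hg hgc x]
    have := fun e => (tendstoUniformly_convolution hin hi hl (ContinuousLinearMap.lsmul ℝ ℝ)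
      (h1 e).1 (h1 e).2).tendsto_at x
    exact (this 1).add (this I)
  simp only [fun n => lap_pot_left (contDiff_newton (n := 2) (regSeq_pos n))
    (hasCompactSupport_newton _) hg.continuous hgc x] at h2
  exact tendsto_nhds_unique h2 (tendsto_pot_lap_newton hg.continuous hgc hg2 hx)

theorem norm_pot_le {g : ℂ → ℂ} {M : ℝ} (hM : ∀ z, ‖g z‖ ≤ M) (x : ℂ) :
    ‖pot (newton 0) g x‖ ≤ (∫ z, ‖newton 0 z‖) * M := by
  rw [pot, convolution_def, ← integral_mul_const]
  refine norm_integral_le_of_norm_le (newton_limits.1.1.norm.mul_const M)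
    (Eventually.of_forall fun z => ?_)
  simp only [ContinuousLinearMap.lsmul_apply, norm_smul]
  exact mul_le_mul_of_nonneg_left (hM _) (norm_nonneg _)

theorem pot_sub {g g' : ℂ → ℂ} (hg : Continuous g) (hgc : HasCompactSupport g)
    (hg' : Continuous g') (hgc' : HasCompactSupport g') (x : ℂ) :
    pot (newton 0) g x - pot (newton 0) g' x = pot (newton 0) (fun z => g z - g' z) x := by
  have hl := newton_limits.1.1.locallyIntegrable
  have h1 := fun {q : ℂ → ℂ} (hq : Continuous q) (hqc : HasCompactSupport q) =>
    hqc.convolutionExists_right (ContinuousLinearMap.lsmul ℝ ℝ) hl hq x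
  rw [pot, pot, pot, convolution_def, convolution_def, convolution_def,
    ← integral_sub (h1 hg hgc) (h1 hg' hgc')]
  simp only [map_sub]

end NewtonPotential

section LocalExistence

open scoped Convolution ContDiff BoundedContinuousFunction

/-- The cutoff used to localise the nonlinearity. -/
def rhsBump : ContDiffBump (0 : ℂ) := ⟨1, 2, by norm_num, by norm_num⟩

theorem rhsBump_eq_zero {z : ℂ} (h : 2 ≤ ‖z‖) : rhsBump z = 0 :=
  rhsBump.zero_of_le_dist (by simpa [rhsBump] using h)

theorem norm_rhsBump_smul_le (z v : ℂ) : ‖rhsBump z • v‖ ≤ ‖v‖ := by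
  rw [norm_smul, Real.norm_eq_abs, abs_of_nonneg rhsBump.nonneg]
  exact mul_le_of_le_one_left (norm_nonneg _) rhsBump.le_one

/-- Local solvability of `Δr = H(y, r)` for small Lipschitz nonlinearities. -/
theorem exists_local_solution : ∃ P > 0, ∀ (H : ℂ × ℂ → ℂ) (l N : ℝ), ContDiff ℝ ∞ H →
    (∀ y v v', ‖H (y, v) - H (y, v')‖ ≤ l * ‖v - v'‖) → 0 ≤ l → P * l ≤ 1 / 2 →
    (∀ y, ‖y‖ < 2 → ‖H (y, 0)‖ ≤ N) →
    ∃ r : ℂ → ℂ, ContDiff ℝ ∞ r ∧ (∀ x ∈ ball (0 : ℂ) 1, lap r x = H (x, r x)) ∧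
      ∀ x, ‖r x‖ ≤ 2 * P * N := by
  set c := newtonMass⁻¹ with hc
  have hc0 : 0 < c := inv_pos.2 newtonMass_pos
  set A := ∫ z, ‖newton 0 z‖ with hA
  have hA0 : 0 ≤ A := integral_nonneg fun _ => norm_nonneg _
  refine ⟨c * (A + 1), by positivity, fun H l N hH hlip hl hPl hN => ?_⟩
  have hN0 : 0 ≤ N := (norm_nonneg _).trans (hN 0 (by simp))
  have hrhs : ∀ r : ℂ → ℂ, HasCompactSupport fun y => rhsBump y • H (y, r y) := fun r =>
    rhsBump.hasCompactSupport.smul_right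
  have hrhsc : ∀ r : ℂ → ℂ, Continuous r → Continuous fun y => rhsBump y • H (y, r y) :=
    fun r hr => rhsBump.continuous.smul (hH.continuous.comp (continuous_id.prodMk hr))
  have hb : ∀ (r : ℂ → ℂ) (M : ℝ), (∀ x, ‖r x‖ ≤ M) → ∀ y, ‖rhsBump y • H (y, r y)‖ ≤ l * M + N := by
    intro r M hM y
    have hM0 : 0 ≤ M := (norm_nonneg _).trans (hM 0)
    by_cases hy : 2 ≤ ‖y‖
    · rw [rhsBump_eq_zero hy, zero_smul, norm_zero]; positivity
    · refine (norm_rhsBump_smul_le _ _).trans ?_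
      have h1 := hlip y (r y) 0
      rw [sub_zero] at h1
      have h2 := norm_le_norm_add_norm_sub' (H (y, r y)) (H (y, 0))
      have h3 := mul_le_mul_of_nonneg_left (hM y) hl
      linarith [hN y (not_le.1 hy)]
  have hcont : ∀ r : ℂ → ℂ, Continuous r →
      Continuous fun x => c • pot (newton 0) (fun y => rhsBump y • H (y, r y)) x := fun r hr =>
    ((hrhs r).continuous_convolution_right (ContinuousLinearMap.lsmul ℝ ℝ)
      newton_limits.1.1.locallyIntegrable (hrhsc r hr)).const_smul c
  let T : (ℂ →ᵇ ℂ) → (ℂ →ᵇ ℂ) := fun r => BoundedContinuousFunction.ofNormedAddCommGroup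
    (fun x => c • pot (newton 0) (fun y => rhsBump y • H (y, r y)) x) (hcont r r.continuous)
    (c * (A * (l * ‖r‖ + N))) fun x => by
      rw [norm_smul, Real.norm_eq_abs, abs_of_pos hc0]
      exact mul_le_mul_of_nonneg_left (norm_pot_le (hb r ‖r‖ r.norm_coe_le_norm) x) hc0.le
  have hT : ContractingWith (1 / 2) T := by
    refine ⟨by rw [div_lt_one (by norm_num)]; norm_num, LipschitzWith.of_dist_le_mul fun r r' => ?_⟩
    rw [BoundedContinuousFunction.dist_le (by positivity)]
    intro x
    rw [dist_eq_norm]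
    change ‖c • pot (newton 0) _ x - c • pot (newton 0) _ x‖ ≤ _
    rw [← smul_sub, pot_sub (hrhsc r r.continuous) (hrhs r) (hrhsc r' r'.continuous) (hrhs r'),
      norm_smul, Real.norm_eq_abs, abs_of_pos hc0]
    have h1 : ∀ y, ‖rhsBump y • H (y, r y) - rhsBump y • H (y, r' y)‖ ≤ l * dist r r' := fun y => by
      rw [← smul_sub]
      refine (norm_rhsBump_smul_le _ _).trans ((hlip _ _ _).trans ?_)
      rw [← dist_eq_norm]
      exact mul_le_mul_of_nonneg_left (BoundedContinuousFunction.dist_coe_le_dist y) hl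
    have h2 := mul_le_mul_of_nonneg_left (norm_pot_le h1 x) hc0.le
    refine h2.trans ?_
    have h3 : c * (A * (l * dist r r')) ≤ (c * (A + 1) * l) * dist r r' := by
      have : 0 ≤ c * l * dist r r' := by positivity
      nlinarith
    refine h3.trans ?_
    have := mul_le_mul_of_nonneg_right hPl (dist_nonneg (x := r) (y := r'))
    simpa using this
  obtain ⟨r, hr⟩ : ∃ r, T r = r := ⟨_, hT.fixedPoint_isFixedPt⟩
  have hfix : ∀ x, r x = c • pot (newton 0) (fun y => rhsBump y • H (y, r y)) x := fun x =>
    (DFunLike.congr_fun hr x).symm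
  have hfix' : (r : ℂ → ℂ) = fun x => c • pot (newton 0) (fun y => rhsBump y • H (y, r y)) x :=
    funext hfix
  have hsm : ∀ n : ℕ, ContDiff ℝ n r := by
    intro n
    induction n with
    | zero => exact contDiff_zero.2 r.continuous
    | succ n ih =>
      rw [hfix']
      have : ContDiff ℝ n fun y => rhsBump y • H (y, r y) :=
        (rhsBump.contDiff (n := (n : ℕ∞))).smul
          ((hH.of_le (by exact_mod_cast le_top)).comp (contDiff_id.prodMk ih))
      exact_mod_cast (contDiff_pot_succ this (hrhs r)).const_smul c
  have hsmi : ContDiff ℝ ∞ r := contDiff_infty.2 hsm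
  have hsr : ContDiff ℝ 2 fun y => rhsBump y • H (y, r y) :=
    (rhsBump.contDiff (n := 2)).smul
      ((hH.of_le (by exact_mod_cast le_top)).comp (contDiff_id.prodMk (hsm 2)))
  have hnorm : ‖r‖ ≤ 2 * (c * (A + 1)) * N := by
    have h1 : ‖r‖ ≤ c * (A * (l * ‖r‖ + N)) := by
      refine (BoundedContinuousFunction.norm_le (by positivity)).2 fun x => ?_
      rw [hfix x, norm_smul, Real.norm_eq_abs, abs_of_pos hc0]
      exact mul_le_mul_of_nonneg_left (norm_pot_le (hb r ‖r‖ r.norm_coe_le_norm) x) hc0.le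
    have h2 : c * (A * (l * ‖r‖ + N)) ≤ c * (A + 1) * l * ‖r‖ + c * (A + 1) * N := by
      have h3 : 0 ≤ c * l * ‖r‖ := by positivity
      have h4 : 0 ≤ c * N := by positivity
      nlinarith
    have h3 := mul_le_mul_of_nonneg_right hPl (norm_nonneg r)
    linarith
  refine ⟨r, hsmi, fun x hx => ?_, fun x => (r.norm_coe_le_norm x).trans hnorm⟩
  have h1 : lap r x = c • (newtonMass • (rhsBump x • H (x, r x))) := by
    have h0 : lap r x =
        lap (fun x => c • pot (newton 0) (fun y => rhsBump y • H (y, r y)) x) x := by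
      rw [← hfix']
    rw [h0, lap_const_smul c, lap_pot hsr (hrhs r)
      (fun z hz => by rw [rhsBump_eq_zero hz, zero_smul]) hx]
    exact ((contDiff_pot_succ (n := 1) (hsr.of_le (by norm_num)) (hrhs r)).of_le
      (by norm_num)).contDiffAt
  have h2 : rhsBump x = 1 := rhsBump.one_of_mem_closedBall (by
    simpa [rhsBump] using (mem_ball_zero_iff.1 hx).le)
  rw [h1, h2, one_smul, smul_smul, hc, inv_mul_cancel₀ newtonMass_pos.ne', one_smul]

end LocalExistence

section Curve

open scoped ContDiff ComplexConjugate

/-- The unit normal along `τ`. -/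
def nrm (τ : ℝ → ℂ) (s : ℝ) : ℂ := I * deriv τ s

/-- The signed curvature of `τ`. -/
def curv (τ : ℝ → ℂ) (s : ℝ) : ℝ := (deriv (deriv τ) s * conj (nrm τ s)).re

/-- Normal coordinates around the curve `τ`. -/
def tube (τ : ℝ → ℂ) (s t : ℝ) : ℂ := τ s + (t : ℂ) * nrm τ s

/-- The pointwise inner product of two gradients. -/
def gdot (f g : ℂ → ℝ) (x : ℂ) : ℝ := dir 1 f x * dir 1 g x + dir I f x * dir I g x

/-- The tangential derivative of `W` at the point with normal coordinates `(s, t)`. -/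
def wTan (W : ℂ → ℝ) (τ : ℝ → ℂ) (s t : ℝ) : ℝ := fderiv ℝ W (tube τ s t) (deriv τ s)

/-- The normal derivative of `W` at the point with normal coordinates `(s, t)`. -/
def wNor (W : ℂ → ℝ) (τ : ℝ → ℂ) (s t : ℝ) : ℝ := fderiv ℝ W (tube τ s t) (nrm τ s)

variable {Γ : Set ℂ} {τ : ℝ → ℂ} {W : ℂ → ℝ} {R₀ : ℝ}

theorem gdot_self_nonneg (f : ℂ → ℝ) (x : ℂ) : 0 ≤ gdot f f x :=
  add_nonneg (mul_self_nonneg _) (mul_self_nonneg _)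

theorem contDiff_deriv_top {E : Type*} [NormedAddCommGroup E] [NormedSpace ℝ E] {f : ℝ → E}
    (hf : ContDiff ℝ ∞ f) : ContDiff ℝ ∞ (deriv f) :=
  (contDiff_infty_iff_deriv.1 hf).2

theorem contDiff_nrm (h : ArcParam Γ τ) : ContDiff ℝ ∞ (nrm τ) :=
  contDiff_const.mul (contDiff_deriv_top h.smooth)

theorem contDiff_curv (h : ArcParam Γ τ) : ContDiff ℝ ∞ (curv τ) :=
  reCLM.contDiff.comp ((contDiff_deriv_top (contDiff_deriv_top h.smooth)).mul
    (conjCLE.contDiff.comp (contDiff_nrm h)))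

theorem contDiff_tube (h : ArcParam Γ τ) : ContDiff ℝ ∞ fun p : ℝ × ℝ => tube τ p.1 p.2 :=
  (h.smooth.comp contDiff_fst).add ((ofRealCLM.contDiff.comp contDiff_snd).mul
    ((contDiff_nrm h).comp contDiff_fst))

theorem mul_conj_tangent (h : ArcParam Γ τ) (s : ℝ) : deriv τ s * conj (deriv τ s) = 1 := by
  rw [Complex.mul_conj, Complex.normSq_eq_norm_sq, h.arclength]; simp

theorem norm_nrm (h : ArcParam Γ τ) (s : ℝ) : ‖nrm τ s‖ = 1 := by
  simp [nrm, h.arclength]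

theorem deriv_tangent (h : ArcParam Γ τ) (s : ℝ) :
    deriv (deriv τ) s = (curv τ s : ℂ) * nrm τ s := by
  have h1 : HasDerivAt (deriv τ) (deriv (deriv τ) s) s :=
    ((contDiff_deriv_top h.smooth).differentiable (by simp) s).hasDerivAt
  have h2 := h1.mul ((conjCLE : ℂ ≃L[ℝ] ℂ).hasFDerivAt.comp_hasDerivAt s h1)
  have h3 : HasDerivAt (fun s => deriv τ s * conj (deriv τ s)) 0 s := by
    rw [funext (mul_conj_tangent h)]; exact hasDerivAt_const _ _
  have h4 : deriv (deriv τ) s * conj (deriv τ s) + deriv τ s * conj (deriv (deriv τ) s) = 0 :=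
    h2.unique h3
  have h5 : (deriv (deriv τ) s * conj (deriv τ s)).re = 0 := by
    have := congrArg re h4
    simp at this
    simp
    linarith
  have h6 := mul_conj_tangent h s
  have h7 : deriv (deriv τ) s = (deriv (deriv τ) s * conj (deriv τ s)) * deriv τ s := by
    rw [mul_assoc, mul_comm (conj _), h6, mul_one]
  have h8 : deriv (deriv τ) s * conj (deriv τ s) = (curv τ s : ℂ) * I := by
    apply Complex.ext
    · rw [h5]; simp
    · simp [curv, nrm]; ring
  rw [h7, h8, nrm]; ring

theorem deriv_nrm (h : ArcParam Γ τ) (s : ℝ) :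
    deriv (nrm τ) s = -(curv τ s : ℂ) * deriv τ s := by
  have h1 : HasDerivAt (deriv τ) (deriv (deriv τ) s) s :=
    ((contDiff_deriv_top h.smooth).differentiable (by simp) s).hasDerivAt
  refine (h1.const_mul I).deriv.trans ?_
  rw [deriv_tangent h, nrm]
  linear_combination ((curv τ s : ℂ) * deriv τ s) * I_mul_I

theorem deriv_deriv_nrm (h : ArcParam Γ τ) (s : ℝ) :
    deriv (deriv (nrm τ)) s =
      -((deriv (curv τ) s : ℝ) : ℂ) * deriv τ s - (curv τ s : ℂ) ^ 2 * nrm τ s := by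
  have h1 : HasDerivAt (deriv τ) (deriv (deriv τ) s) s :=
    ((contDiff_deriv_top h.smooth).differentiable (by simp) s).hasDerivAt
  have h2 : HasDerivAt (curv τ) (deriv (curv τ) s) s :=
    ((contDiff_curv h).differentiable (by simp) s).hasDerivAt
  rw [funext (deriv_nrm h)]
  refine (h2.ofReal_comp.neg.mul h1).deriv.trans ?_
  rw [deriv_tangent h]
  simp only [Pi.neg_apply]
  ring

theorem tube_zero (s : ℝ) : tube τ s 0 = τ s := by simp [tube]

theorem periodic_nrm (h : ArcParam Γ τ) : Function.Periodic (nrm τ) (2 * Real.pi) := fun s => by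
  simp only [nrm, periodic_deriv h.periodic s]

theorem periodic_curv (h : ArcParam Γ τ) : Function.Periodic (curv τ) (2 * Real.pi) := fun s => by
  simp only [curv, periodic_deriv (periodic_deriv h.periodic) s, periodic_nrm h s]

theorem tube_periodic (h : ArcParam Γ τ) (s t : ℝ) : tube τ (s + 2 * Real.pi) t = tube τ s t := by
  simp only [tube, h.periodic s, periodic_nrm h s]

theorem wTan_periodic (h : ArcParam Γ τ) (s t : ℝ) :
    wTan W τ (s + 2 * Real.pi) t = wTan W τ s t := by
  simp only [wTan, tube_periodic h, periodic_deriv h.periodic s]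

theorem wNor_periodic (h : ArcParam Γ τ) (s t : ℝ) :
    wNor W τ (s + 2 * Real.pi) t = wNor W τ s t := by
  simp only [wNor, tube_periodic h, periodic_nrm h s]

theorem contDiff_wTan (h : ArcParam Γ τ) (hW : PotentialHyp Γ W R₀) :
    ContDiff ℝ ∞ fun p : ℝ × ℝ => wTan W τ p.1 p.2 :=
  ((hW.smooth.fderiv_right (m := ∞) (by simp)).comp (contDiff_tube h)).clm_apply
    ((contDiff_deriv_top h.smooth).comp contDiff_fst)

theorem contDiff_wNor (h : ArcParam Γ τ) (hW : PotentialHyp Γ W R₀) :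
    ContDiff ℝ ∞ fun p : ℝ × ℝ => wNor W τ p.1 p.2 :=
  ((hW.smooth.fderiv_right (m := ∞) (by simp)).comp (contDiff_tube h)).clm_apply
    ((contDiff_nrm h).comp contDiff_fst)

theorem gradW_tube (h : ArcParam Γ τ) (s t : ℝ) :
    gradW W (tube τ s t) = (wTan W τ s t : ℂ) * deriv τ s + (wNor W τ s t : ℂ) * nrm τ s := by
  set L := fderiv ℝ W (tube τ s t) with hL
  have hv : ∀ v : ℂ, L v = v.re * L 1 + v.im * L I := fun v => by
    conv_lhs => rw [show v = v.re • (1 : ℂ) + v.im • I by apply Complex.ext <;> simp]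
    rw [map_add, map_smul, map_smul]; rfl
  have h1 : (deriv τ s).re ^ 2 + (deriv τ s).im ^ 2 = 1 := by
    have := congrArg re (mul_conj_tangent h s)
    simp at this
    nlinarith
  have ha : wTan W τ s t = (deriv τ s).re * L 1 + (deriv τ s).im * L I := hv _
  have hb : wNor W τ s t = -(deriv τ s).im * L 1 + (deriv τ s).re * L I := by
    rw [wNor, ← hL, hv]; simp [nrm]
  rw [ha, hb, gradW, ← hL]
  apply Complex.ext
  · simp [nrm]
    linear_combination (-L 1) * h1
  · simp [nrm]
    linear_combination (-L I) * h1

theorem frame_ext (h : ArcParam Γ τ) {s p q p' q' : ℝ}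
    (he : (p : ℂ) * deriv τ s + (q : ℂ) * nrm τ s = (p' : ℂ) * deriv τ s + (q' : ℂ) * nrm τ s) :
    p = p' ∧ q = q' := by
  have h1 := mul_conj_tangent h s
  have h2 : (p : ℂ) + q * I = p' + q' * I := by
    have := congrArg (· * conj (deriv τ s)) he
    simp only [nrm, add_mul] at this
    linear_combination this + (-(p : ℂ) - q * I + p' + q' * I) * h1
  constructor
  · simpa using congrArg re h2
  · simpa using congrArg im h2

variable {φ t : ℂ → ℝ} {x : ℂ}

theorem dir_tube (h : ArcParam Γ τ) (hφ : ContDiffAt ℝ 2 φ x) (ht : ContDiffAt ℝ 2 t x) (e : ℂ) :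
    dir e (fun y => tube τ (φ y) (t y)) x =
      (((1 - t x * curv τ (φ x)) * dir e φ x : ℝ) : ℂ) * deriv τ (φ x) +
        ((dir e t x : ℝ) : ℂ) * nrm τ (φ x) := by
  have hφ1 := differentiableAt_of_two hφ
  have ht1 := differentiableAt_of_two ht
  have h1 : DifferentiableAt ℝ τ (φ x) := h.smooth.differentiable (by simp) _
  have h2 : DifferentiableAt ℝ (nrm τ) (φ x) := (contDiff_nrm h).differentiable (by simp) _
  have h3 : (fun y => tube τ (φ y) (t y)) = fun y => τ (φ y) + t y • nrm τ (φ y) := by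
    funext y; simp [tube]
  rw [h3, dir_add (f := fun y => τ (φ y)) (g := fun y => t y • nrm τ (φ y)) (h1.comp x hφ1)
    (ht1.fun_smul (h2.comp x hφ1)), dir_smul (g := fun y => nrm τ (φ y)) ht1 (h2.comp x hφ1),
    dir_comp h1 hφ1, dir_comp h2 hφ1, deriv_nrm h]
  simp only [real_smul]
  push_cast
  ring

theorem lap_tube (h : ArcParam Γ τ) (hφ : ContDiffAt ℝ 2 φ x) (ht : ContDiffAt ℝ 2 t x) :
    lap (fun y => tube τ (φ y) (t y)) x =
      (((1 - t x * curv τ (φ x)) * lap φ x - 2 * curv τ (φ x) * gdot t φ x -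
        t x * deriv (curv τ) (φ x) * gdot φ φ x : ℝ) : ℂ) * deriv τ (φ x) +
      ((lap t x + (1 - t x * curv τ (φ x)) * curv τ (φ x) * gdot φ φ x : ℝ) : ℂ) *
        nrm τ (φ x) := by
  have h1 : ContDiffAt ℝ 2 τ (φ x) := (contDiff_infty.1 h.smooth 2).contDiffAt
  have h2 : ContDiffAt ℝ 2 (nrm τ) (φ x) :=
    (contDiff_infty.1 (contDiff_nrm h) 2).contDiffAt
  have h3 : (fun y => tube τ (φ y) (t y)) = fun y => τ (φ y) + t y • nrm τ (φ y) := by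
    funext y; simp [tube]
  have h4 : ContDiffAt ℝ 2 (fun y => nrm τ (φ y)) x := h2.comp x hφ
  have hφ1 := differentiableAt_of_two hφ
  rw [h3, lap_add (f := fun y => τ (φ y)) (g := fun y => t y • nrm τ (φ y)) (h1.comp x hφ)
    (ht.smul h4), lap_smul ht h4, lap_comp h1 hφ, lap_comp h2 hφ,
    dir_comp (h2.differentiableAt (by simp)) hφ1, dir_comp (h2.differentiableAt (by simp)) hφ1,
    deriv_nrm h, deriv_deriv_nrm h, deriv_tangent h]
  simp only [real_smul, gdot]
  push_cast
  ring

/-- The system for `(φ, t)` in normal coordinates. -/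
theorem tube_system (h : ArcParam Γ τ) (hφ : ContDiffAt ℝ 2 φ x) (ht : ContDiffAt ℝ 2 t x) {c : ℝ}
    (hu : lap (fun y => tube τ (φ y) (t y)) x = c • gradW W (tube τ (φ x) (t x))) :
    (1 - t x * curv τ (φ x)) * lap φ x - 2 * curv τ (φ x) * gdot t φ x -
        t x * deriv (curv τ) (φ x) * gdot φ φ x = c * wTan W τ (φ x) (t x) ∧
      lap t x + (1 - t x * curv τ (φ x)) * curv τ (φ x) * gdot φ φ x =
        c * wNor W τ (φ x) (t x) := by
  refine frame_ext h ((lap_tube h hφ ht).symm.trans (hu.trans ?_))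
  rw [gradW_tube h, real_smul]
  push_cast
  ring

end Curve

section Tube

open scoped ContDiff ComplexConjugate

variable {Γ : Set ℂ} {τ : ℝ → ℂ} {s₀ t₀ ϑ : ℝ}

theorem nonneg_of_second_deriv {f f' f'' : ℝ → ℝ} {s σ : ℝ} (h : ∀ x, HasDerivAt f (f' x) x)
    (h' : ∀ x, HasDerivAt f' (f'' x) x) (hpos : ∀ x ∈ uIcc s σ, 0 ≤ f'' x) (h0 : f s = 0)
    (h0' : f' s = 0) : 0 ≤ f σ := by
  have hc : Continuous f := continuous_iff_continuousAt.2 fun x => (h x).continuousAt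
  have hc' : Continuous f' := continuous_iff_continuousAt.2 fun x => (h' x).continuousAt
  have hm : MonotoneOn f' (uIcc s σ) :=
    monotoneOn_of_hasDerivWithinAt_nonneg (convex_uIcc s σ) hc'.continuousOn
      (fun x _ => (h' x).hasDerivWithinAt) fun x hx => hpos x (interior_subset hx)
  rcases le_total s σ with hs | hs
  · rw [uIcc_of_le hs] at hm
    have : MonotoneOn f (Icc s σ) :=
      monotoneOn_of_hasDerivWithinAt_nonneg (convex_Icc s σ) hc.continuousOn
        (fun x _ => (h x).hasDerivWithinAt) fun x hx => by
          have hx' := interior_subset hx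
          rw [← h0']; exact hm (left_mem_Icc.2 hs) hx' hx'.1
    rw [← h0]; exact this (left_mem_Icc.2 hs) (right_mem_Icc.2 hs) hs
  · rw [uIcc_of_ge hs] at hm
    have : AntitoneOn f (Icc σ s) :=
      antitoneOn_of_hasDerivWithinAt_nonpos (convex_Icc σ s) hc.continuousOn
        (fun x _ => (h x).hasDerivWithinAt) fun x hx => by
          have hx' := interior_subset hx
          rw [← h0']; exact hm hx' (right_mem_Icc.2 hs) hx'.2
    rw [← h0]; exact this (left_mem_Icc.2 hs) (right_mem_Icc.2 hs) hs

theorem second_deriv_nonneg_of_min {f f' f'' : ℝ → ℝ} {s : ℝ} (h : ∀ x, HasDerivAt f (f' x) x)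
    (h' : ∀ x, HasDerivAt f' (f'' x) x) (hmin : ∀ x, f s ≤ f x) : 0 ≤ f'' s := by
  by_contra! hneg
  have hd : deriv f = f' := funext fun x => (h x).deriv
  have hd' : deriv f' = f'' := funext fun x => (h' x).deriv
  have hlm : IsLocalMin f s := Eventually.of_forall hmin
  have hlM : IsLocalMax f s := isLocalMax_of_deriv_deriv_neg (by rwa [hd, hd'])
    hlm.deriv_eq_zero (h s).continuousAt
  have heq : f =ᶠ[𝓝 s] fun _ => f s := by
    filter_upwards [hlM] with x hx using le_antisymm hx (hmin x)
  have h1 : f' =ᶠ[𝓝 s] fun _ => 0 := by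
    have := heq.deriv
    rw [hd] at this
    simpa using this
  have h2 := h1.deriv_eq
  rw [hd'] at h2
  simp at h2
  linarith

/-- The signed-distance coordinate condition: `t` is, up to sign, the distance to the curve. -/
def IsFoot (Γ : Set ℂ) (τ : ℝ → ℂ) (s t : ℝ) : Prop := infDist (tube τ s t) Γ = |t|

theorem norm_sub_tube (h : ArcParam Γ τ) (s t : ℝ) : ‖τ s - tube τ s t‖ = |t| := by
  simp [tube, norm_nrm h]

theorem mem_curve (h : ArcParam Γ τ) (s : ℝ) : τ s ∈ Γ := h.srange ▸ mem_range_self s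

theorem isFoot_iff (h : ArcParam Γ τ) (s t : ℝ) :
    IsFoot Γ τ s t ↔ ∀ σ, t ^ 2 ≤ ‖τ σ - tube τ s t‖ ^ 2 := by
  have hne : Γ.Nonempty := ⟨_, mem_curve h 0⟩
  constructor
  · intro hf σ
    have := infDist_le_dist_of_mem (x := tube τ s t) (mem_curve h σ)
    rw [hf, dist_eq_norm, norm_sub_rev] at this
    rw [← sq_abs]
    exact pow_le_pow_left₀ (abs_nonneg _) this 2
  · intro hσ
    refine le_antisymm ?_ ((le_infDist hne).2 fun y hy => ?_)
    · have := infDist_le_dist_of_mem (x := tube τ s t) (mem_curve h s)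
      rwa [dist_eq_norm, norm_sub_rev, norm_sub_tube h] at this
    · rw [← h.srange] at hy
      obtain ⟨σ, rfl⟩ := hy
      rw [dist_eq_norm, norm_sub_rev]
      exact abs_le_of_sq_le_sq (hσ σ) (norm_nonneg _)

theorem isFoot_zero (h : ArcParam Γ τ) (s : ℝ) : IsFoot Γ τ s 0 := by
  rw [isFoot_iff h]; intro σ; simp

/-- Half the derivative of the squared distance from a point to the curve. -/
theorem hasDerivAt_dist_sq (h : ArcParam Γ τ) (z : ℂ) (σ : ℝ) :
    HasDerivAt (fun σ => ‖τ σ - z‖ ^ 2) (2 * inner ℝ (τ σ - z) (deriv τ σ)) σ := by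
  have h1 : HasDerivAt τ (deriv τ σ) σ := (h.smooth.differentiable (by simp) σ).hasDerivAt
  exact (h1.sub_const z).norm_sq

theorem hasDerivAt_dist_sq' (h : ArcParam Γ τ) (z : ℂ) (σ : ℝ) :
    HasDerivAt (fun σ => 2 * inner ℝ (τ σ - z) (deriv τ σ))
      (2 * (1 + inner ℝ (τ σ - z) (deriv (deriv τ) σ))) σ := by
  have h1 : HasDerivAt τ (deriv τ σ) σ := (h.smooth.differentiable (by simp) σ).hasDerivAt
  have h2 : HasDerivAt (deriv τ) (deriv (deriv τ) σ) σ :=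
    ((contDiff_deriv_top h.smooth).differentiable (by simp) σ).hasDerivAt
  refine (((h1.sub_const z).inner ℝ h2).const_mul 2).congr_deriv ?_
  rw [real_inner_self_eq_norm_sq, h.arclength]
  ring

theorem inner_tube_tangent (s t : ℝ) : inner ℝ (τ s - tube τ s t) (deriv τ s) = 0 := by
  have : τ s - tube τ s t = (-t) • (I * deriv τ s) := by simp [tube, nrm]
  rw [this, real_inner_smul_left, real_inner_comm, inner_I_mul_self, mul_zero]

theorem inner_tube_curv (h : ArcParam Γ τ) (s t : ℝ) :
    inner ℝ (τ s - tube τ s t) (deriv (deriv τ) s) = -(t * curv τ s) := by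
  have h1 : τ s - tube τ s t = (-t) • nrm τ s := by simp [tube]
  have h2 : deriv (deriv τ) s = curv τ s • nrm τ s := by rw [deriv_tangent h, real_smul]
  rw [h1, h2, real_inner_smul_left, real_inner_smul_right, real_inner_self_eq_norm_sq, norm_nrm h]
  ring

theorem IsFoot.mul_curv_le (h : ArcParam Γ τ) {s t : ℝ} (hf : IsFoot Γ τ s t) :
    t * curv τ s ≤ 1 := by
  rw [isFoot_iff h] at hf
  have := second_deriv_nonneg_of_min (s := s) (hasDerivAt_dist_sq h (tube τ s t))
    (hasDerivAt_dist_sq' h (tube τ s t)) fun σ => by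
      rw [norm_sub_tube h, sq_abs]; exact hf σ
  rw [inner_tube_curv h] at this
  linarith

theorem IsFoot.shrink (h : ArcParam Γ τ) (hf : IsFoot Γ τ s₀ t₀) (h0 : 0 ≤ ϑ) (σ : ℝ) :
    (ϑ * t₀) ^ 2 + (1 - ϑ) * ‖τ σ - τ s₀‖ ^ 2 ≤ ‖τ σ - tube τ s₀ (ϑ * t₀)‖ ^ 2 := by
  have h1 := (isFoot_iff h _ _).1 hf σ
  have h2 : ∀ t : ℝ, ‖τ σ - tube τ s₀ t‖ ^ 2 =
      ‖τ σ - τ s₀‖ ^ 2 - 2 * (t * inner ℝ (τ σ - τ s₀) (nrm τ s₀)) + t ^ 2 := fun t => by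
    have : τ σ - tube τ s₀ t = (τ σ - τ s₀) - t • nrm τ s₀ := by simp [tube]; ring
    rw [this, norm_sub_sq_real, real_inner_smul_right, norm_smul, norm_nrm h, mul_one,
      Real.norm_eq_abs, sq_abs]
  rw [h2] at h1 ⊢
  nlinarith

theorem IsFoot.jacobian_pos (h : ArcParam Γ τ) (hf : IsFoot Γ τ s₀ t₀) (h0 : 0 ≤ ϑ) (h1 : ϑ < 1) :
    0 < 1 - ϑ * t₀ * curv τ s₀ := by
  have := hf.mul_curv_le h
  nlinarith

theorem IsFoot.eventually (h : ArcParam Γ τ) (hf : IsFoot Γ τ s₀ t₀) (h0 : 0 ≤ ϑ) (h1 : ϑ < 1) :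
    ∀ᶠ p : ℝ × ℝ in 𝓝 (s₀, ϑ * t₀), IsFoot Γ τ p.1 p.2 := by
  set t₁ := ϑ * t₀ with ht₁
  have hτ := h.smooth.continuous
  have hτ2 := (contDiff_deriv_top (contDiff_deriv_top h.smooth)).continuous
  have hT := (contDiff_tube h).continuous
  -- near the diagonal the squared distance is convex
  have hg : Continuous fun q : ℝ × (ℝ × ℝ) =>
      2 * (1 + inner ℝ (τ q.1 - tube τ q.2.1 q.2.2) (deriv (deriv τ) q.1)) :=
    continuous_const.mul (continuous_const.add (Continuous.inner
      ((hτ.comp continuous_fst).sub (hT.comp continuous_snd)) (hτ2.comp continuous_fst)))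
  have hg0 : 0 < 2 * (1 + inner ℝ (τ s₀ - tube τ s₀ t₁) (deriv (deriv τ) s₀)) := by
    rw [inner_tube_curv h]
    have := hf.jacobian_pos h h0 h1
    linarith
  have hg1 := hg.continuousAt (x := (s₀, (s₀, t₁))) |>.eventually (lt_mem_nhds hg0)
  obtain ⟨η, hη, hηb⟩ := Metric.eventually_nhds_iff.1 hg1
  have hnear : ∀ᶠ p : ℝ × ℝ in 𝓝 (s₀, t₁), ∀ σ, |σ - s₀| < η →
      p.2 ^ 2 ≤ ‖τ σ - tube τ p.1 p.2‖ ^ 2 := by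
    refine Metric.eventually_nhds_iff.2 ⟨η, hη, fun p hp σ hσ => ?_⟩
    have hps : |p.1 - s₀| < η := lt_of_le_of_lt (le_max_left _ _) hp
    have := nonneg_of_second_deriv (s := p.1) (σ := σ)
      (f := fun σ => ‖τ σ - tube τ p.1 p.2‖ ^ 2 - p.2 ^ 2)
      (fun x => (hasDerivAt_dist_sq h (tube τ p.1 p.2) x).sub_const _)
      (hasDerivAt_dist_sq' h (tube τ p.1 p.2)) (fun x hx => ?_)
      (by rw [norm_sub_tube h, sq_abs, sub_self]) (by rw [inner_tube_tangent, mul_zero])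
    · linarith
    · refine (hηb (y := (x, p)) ?_).le
      rw [Prod.dist_eq]
      refine max_lt ?_ hp
      rw [Real.dist_eq]
      have hx1 : x ∈ ball s₀ η := (convex_ball s₀ η).ordConnected.uIcc_subset
        (by rwa [mem_ball, Real.dist_eq]) (by rwa [mem_ball, Real.dist_eq]) hx
      rwa [mem_ball, Real.dist_eq] at hx1
  -- away from the foot point the distance is strictly larger
  have hπ := Real.pi_pos
  have hK : IsCompact (Icc (s₀ - Real.pi) (s₀ + Real.pi) ∩ {σ | η ≤ |σ - s₀|}) :=
    isCompact_Icc.inter_right (isClosed_le continuous_const (by fun_prop))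
  have hfar : ∀ᶠ p : ℝ × ℝ in 𝓝 (s₀, t₁),
      ∀ σ ∈ Icc (s₀ - Real.pi) (s₀ + Real.pi) ∩ {σ | η ≤ |σ - s₀|},
        0 < ‖τ σ - tube τ p.1 p.2‖ ^ 2 - p.2 ^ 2 := by
    refine hK.eventually_forall_of_forall_eventually fun σ hσ => ?_
    have hc : Continuous fun q : (ℝ × ℝ) × ℝ => ‖τ q.2 - tube τ q.1.1 q.1.2‖ ^ 2 - q.1.2 ^ 2 :=
      ((((hτ.comp continuous_snd).sub (hT.comp continuous_fst)).norm).pow 2).sub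
        ((continuous_snd.comp continuous_fst).pow 2)
    refine hc.continuousAt.eventually (lt_mem_nhds ?_)
    have h2 := hf.shrink h h0 σ
    have h3 : 0 < ‖τ σ - τ s₀‖ := by
      rw [norm_pos_iff, sub_ne_zero]
      intro heq
      obtain ⟨k, hk⟩ := h.inj _ _ heq
      have hη2 : η ≤ |σ - s₀| := hσ.2
      have h5 : |(k : ℝ)| < 1 := by
        have : |2 * Real.pi * (k : ℝ)| ≤ Real.pi := by
          rw [← hk]; exact abs_le.2 ⟨by linarith [hσ.1.1], by linarith [hσ.1.2]⟩
        rw [abs_mul, abs_of_pos (by positivity)] at this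
        nlinarith
      have h6 : k = 0 := by
        have : |k| < 1 := by exact_mod_cast h5
        exact Int.abs_lt_one_iff.1 this
      rw [hk, h6] at hη2
      simp at hη2
      linarith
    have h4 : 0 < (1 - ϑ) * ‖τ σ - τ s₀‖ ^ 2 := mul_pos (by linarith) (by positivity)
    simp only
    linarith
  filter_upwards [hnear, hfar] with p hp1 hp2
  rw [isFoot_iff h]
  intro σ
  obtain ⟨σ', hσ', heq⟩ := h.periodic.exists_mem_Ico (by positivity) σ (s₀ - Real.pi)
  rw [heq]
  by_cases hd : |σ' - s₀| < η
  · exact hp1 σ' hd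
  · have := hp2 σ' ⟨⟨hσ'.1, by linarith [hσ'.2]⟩, not_lt.1 hd⟩
    linarith

/-- Normal coordinates, as a map of the complex plane. -/
def tubeMap (τ : ℝ → ℂ) (p : ℂ) : ℂ := tube τ p.re p.im

theorem contDiff_tubeMap (h : ArcParam Γ τ) : ContDiff ℝ ∞ (tubeMap τ) :=
  (contDiff_tube h).comp (reCLM.contDiff.prodMk imCLM.contDiff)

/-- Smooth local inverse of normal coordinates at non-cut points. -/
theorem IsFoot.exists_chart (h : ArcParam Γ τ) (hf : IsFoot Γ τ s₀ t₀) (h0 : 0 ≤ ϑ) (h1 : ϑ < 1) :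
    ∃ G : ℂ → ℂ, ContDiffAt ℝ ∞ G (tube τ s₀ (ϑ * t₀)) ∧
      (∀ᶠ z in 𝓝 (tube τ s₀ (ϑ * t₀)), tubeMap τ (G z) = z ∧ infDist z Γ = |(G z).im|) ∧
      (∀ᶠ p in 𝓝 (s₀ + (ϑ * t₀ : ℝ) * I : ℂ), G (tubeMap τ p) = p) := by
  set t₁ := ϑ * t₀ with ht₁
  set p₁ : ℂ := s₀ + (t₁ : ℝ) * I with hp₁
  have hre : p₁.re = s₀ := by simp [hp₁]
  have him : p₁.im = t₁ := by simp [hp₁]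
  have hz : tubeMap τ p₁ = tube τ s₀ t₁ := by rw [tubeMap, hre, him]
  have hsm : ContDiffAt ℝ ∞ (tubeMap τ) p₁ := (contDiff_tubeMap h).contDiffAt
  have hdir : ∀ e : ℂ, fderiv ℝ (tubeMap τ) p₁ e =
      (((1 - t₁ * curv τ s₀) * e.re : ℝ) : ℂ) * deriv τ s₀ + ((e.im : ℝ) : ℂ) * nrm τ s₀ := by
    intro e
    have h2 := dir_tube h (φ := re) (t := im) (x := p₁) reCLM.contDiff.contDiffAt
      imCLM.contDiff.contDiffAt e
    have h3 : dir e re p₁ = e.re := by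
      exact congrArg (fun L : ℂ →L[ℝ] ℝ => L e) reCLM.hasFDerivAt.fderiv
    have h4 : dir e im p₁ = e.im := by
      exact congrArg (fun L : ℂ →L[ℝ] ℝ => L e) imCLM.hasFDerivAt.fderiv
    rw [h3, h4, hre, him] at h2
    exact h2
  have hj := hf.jacobian_pos h h0 h1
  have hinj : Function.Injective (fderiv ℝ (tubeMap τ) p₁ : ℂ →ₗ[ℝ] ℂ) := by
    rw [← LinearMap.ker_eq_bot, LinearMap.ker_eq_bot']
    intro e he
    have h2 : (((1 - t₁ * curv τ s₀) * e.re : ℝ) : ℂ) * deriv τ s₀ + ((e.im : ℝ) : ℂ) * nrm τ s₀ =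
        ((0 : ℝ) : ℂ) * deriv τ s₀ + ((0 : ℝ) : ℂ) * nrm τ s₀ := by
      rw [← hdir]; simpa using he
    obtain ⟨h3, h4⟩ := frame_ext h h2
    refine Complex.ext ?_ h4
    exact (mul_eq_zero.1 h3).resolve_left hj.ne'
  let A : ℂ ≃L[ℝ] ℂ := (LinearEquiv.ofInjectiveEndo _ hinj).toContinuousLinearEquiv
  have hA : HasFDerivAt (tubeMap τ) (A : ℂ →L[ℝ] ℂ) p₁ := by
    have : (A : ℂ →L[ℝ] ℂ) = fderiv ℝ (tubeMap τ) p₁ := by ext e <;> rfl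
    rw [this]
    exact (hsm.differentiableAt (by simp)).hasFDerivAt
  have hst := hsm.hasStrictFDerivAt' hA (by simp)
  set G := hsm.localInverse hA (by simp) with hG
  have hGsm : ContDiffAt ℝ ∞ G (tubeMap τ p₁) := hsm.to_localInverse hA (by simp)
  have hGp : G (tubeMap τ p₁) = p₁ := hsm.localInverse_apply_image hA (by simp)
  refine ⟨G, hz ▸ hGsm, ?_, hst.eventually_left_inverse⟩
  rw [← hz]
  have h2 : Tendsto (fun z => ((G z).re, (G z).im)) (𝓝 (tubeMap τ p₁)) (𝓝 (s₀, t₁)) := by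
    have h3 : Tendsto G (𝓝 (tubeMap τ p₁)) (𝓝 p₁) := by
      have := hGsm.continuousAt.tendsto
      rwa [hGp] at this
    have h4 := ((continuous_re.tendsto p₁).comp h3).prodMk_nhds ((continuous_im.tendsto p₁).comp h3)
    rwa [hre, him] at h4
  filter_upwards [hst.eventually_right_inverse, h2.eventually (hf.eventually h h0 h1)] with z hz1 hz2
  have hz1' : tubeMap τ (G z) = z := hz1
  refine ⟨hz1', ?_⟩
  have : infDist (tubeMap τ (G z)) Γ = |(G z).im| := hz2
  rwa [hz1'] at this

end Tube

section LocalSolution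

open scoped ContDiff

variable {E : Type*} [NormedAddCommGroup E] [NormedSpace ℝ E]

theorem dir_smul_vec (f : ℂ → E) (c : ℝ) (e x : ℂ) : dir (c • e) f x = c • dir e f x := by
  exact (fderiv ℝ f x).map_smul c e

theorem lap_comp_smul {v : ℂ → E} (hv : ContDiff ℝ 2 v) (ρ : ℝ) (y : ℂ) :
    lap (fun z => v (ρ • z)) y = ρ ^ 2 • lap v (ρ • y) := by
  have h : ∀ e : ℂ, dir e (dir e fun z => v (ρ • z)) y = ρ ^ 2 • dir e (dir e v) (ρ • y) := by
    intro e
    have := dir_dir_comp_affine (ρ • ContinuousLinearMap.id ℝ ℂ) (x := 0) (y := y)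
      (v := v) hv.contDiffAt e
    simp only [zero_add, smul_apply, ContinuousLinearMap.id_apply] at this
    rw [this, dir_smul_vec, funext fun x => dir_smul_vec v ρ e x]
    change ρ • fderiv ℝ (fun x => ρ • dir e v x) _ e = _
    have hd : DifferentiableAt ℝ (dir e v) (ρ • y) := differentiableAt_dir hv.contDiffAt e
    rw [fderiv_fun_const_smul hd, smul_apply, smul_smul, ← sq]
    rfl
  simp only [lap, h, smul_add]

theorem contDiff_lap {f : ℂ → E} (hf : ContDiff ℝ ∞ f) : ContDiff ℝ ∞ (lap f) :=
  (contDiff_dir (n := ∞) (contDiff_dir (n := ∞) hf 1) 1).add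
    (contDiff_dir (n := ∞) (contDiff_dir (n := ∞) hf I) I)

theorem contDiff_gradW {W : ℂ → ℝ} (hW : ContDiff ℝ ∞ W) : ContDiff ℝ ∞ (gradW W) := by
  have h1 : ∀ e : ℂ, ContDiff ℝ ∞ fun x => ((fderiv ℝ W x e : ℝ) : ℂ) := fun e =>
    ofRealCLM.contDiff.comp (contDiff_dir (n := ∞) hW e)
  exact (h1 1).add ((h1 I).mul contDiff_const)

/-- A smooth map solving the equation at one point can be perturbed, on small balls, to an exact
solution, with an error of third order in the radius. -/
theorem exists_local_GL {W : ℂ → ℝ} (hW : ContDiff ℝ ∞ W) {base : ℂ → ℂ} (hb : ContDiff ℝ ∞ base)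
    {c : ℝ} (hc : 0 ≤ c) (h0 : lap base 0 = c • gradW W (base 0)) :
    ∃ C ≥ 0, ∃ ρ₀ > 0, ∀ ρ, 0 < ρ → ρ < ρ₀ → ∃ u : ℂ → ℂ, ContDiff ℝ ∞ u ∧
      (∀ y ∈ ball (0 : ℂ) 1, lap u y = (ρ ^ 2 * c) • gradW W (u y)) ∧
      ∀ y, ‖u y - base (ρ • y)‖ ≤ C * ρ ^ 3 := by
  obtain ⟨P, hP, hex⟩ := exists_local_solution
  let χ : ContDiffBump (base 0) := ⟨1, 2, by norm_num, by norm_num⟩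
  set Φ : ℂ → ℂ := fun z => χ z • gradW W z with hΦ
  have hΦs : ContDiff ℝ ∞ Φ := χ.contDiff.smul (contDiff_gradW hW)
  obtain ⟨K, hK⟩ := ContDiff.lipschitzWith_of_hasCompactSupport (𝕂 := ℝ) (f := Φ)
    χ.hasCompactSupport.smul_right hΦs (by simp)
  have hΦ1 : ∀ z, ‖z - base 0‖ ≤ 1 → Φ z = gradW W z := fun z hz => by
    have : χ z = 1 := χ.one_of_mem_closedBall (by simpa [χ, dist_eq_norm] using hz)
    simp only [hΦ, this, one_smul]
  set J : ℂ → ℂ := fun z => c • Φ (base z) - lap base z with hJ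
  have hJs : ContDiff ℝ ∞ J := ((hΦs.comp hb).const_smul c).sub (contDiff_lap hb)
  have hJ0 : J 0 = 0 := by simp only [hJ, hΦ1 (base 0) (by simp), h0, sub_self]
  obtain ⟨KJ, hKJ⟩ := (hJs.contDiffOn (s := closedBall 0 2)).exists_lipschitzOnWith (by simp)
    (convex_closedBall _ _) (isCompact_closedBall _ _)
  obtain ⟨Kb, hKb⟩ := (hb.contDiffOn (s := closedBall 0 2)).exists_lipschitzOnWith (by simp)
    (convex_closedBall _ _) (isCompact_closedBall _ _)
  have h02 : (0 : ℂ) ∈ closedBall (0 : ℂ) 2 := mem_closedBall_self (by norm_num)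
  have hJb : ∀ z, ‖z‖ ≤ 2 → ‖J z‖ ≤ KJ * ‖z‖ := fun z hz => by
    simpa [hJ0] using hKJ.norm_sub_le (by simpa using hz) h02
  have hbb : ∀ z, ‖z‖ ≤ 2 → ‖base z - base 0‖ ≤ Kb * ‖z‖ := fun z hz => by
    simpa using hKb.norm_sub_le (by simpa using hz) h02
  set C : ℝ := 4 * P * KJ with hC
  have hC0 : 0 ≤ C := by positivity
  set D : ℝ := 1 + 2 * (P * c * K) + Kb + C with hD
  have hD1 : 1 ≤ D := by
    have : 0 ≤ 2 * (P * c * K) + Kb + C := by positivity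
    linarith
  refine ⟨C, hC0, 1 / D, by positivity, fun ρ hρ hρD => ?_⟩
  have hρD' : ρ * D < 1 := by rwa [lt_div_iff₀ (by positivity)] at hρD
  have hρ1 : ρ < 1 := by nlinarith
  set H : ℂ × ℂ → ℂ := fun q => ρ ^ 2 • (c • Φ (base (ρ • q.1) + q.2) - lap base (ρ • q.1)) with hH
  have hsc : ContDiff ℝ ∞ fun q : ℂ × ℂ => ρ • q.1 := contDiff_fst.const_smul ρ
  have hs1 : ∀ y v v', ‖H (y, v) - H (y, v')‖ ≤ ρ ^ 2 * c * K * ‖v - v'‖ := by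
    intro y v v'
    simp only [hH]
    rw [← smul_sub, sub_sub_sub_cancel_right, ← smul_sub, norm_smul, norm_smul,
      Real.norm_of_nonneg hc, Real.norm_of_nonneg (by positivity)]
    have h1 := hK.norm_sub_le (base (ρ • y) + v) (base (ρ • y) + v')
    rw [add_sub_add_left_eq_sub] at h1
    calc ρ ^ 2 * (c * ‖Φ (base (ρ • y) + v) - Φ (base (ρ • y) + v')‖)
        ≤ ρ ^ 2 * (c * (K * ‖v - v'‖)) := by gcongr
      _ = _ := by ring
  have hs2 : P * (ρ ^ 2 * c * K) ≤ 1 / 2 := by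
    have h1 : ρ * (2 * (P * c * K)) ≤ ρ * D := by
      refine mul_le_mul_of_nonneg_left ?_ hρ.le
      have : 0 ≤ (Kb : ℝ) := Kb.2
      linarith
    have h2 : 0 ≤ P * c * K := by positivity
    have h3 : ρ ^ 2 * (P * c * K) ≤ ρ * (P * c * K) :=
      mul_le_mul_of_nonneg_right (by nlinarith) h2
    linarith
  have hs3 : ∀ y, ‖y‖ < 2 → ‖H (y, 0)‖ ≤ ρ ^ 3 * (2 * KJ) := by
    intro y hy
    have hny : ‖ρ • y‖ = ρ * ‖y‖ := by rw [norm_smul, Real.norm_eq_abs, abs_of_pos hρ]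
    have h1 := hJb (ρ • y) (by rw [hny]; nlinarith [norm_nonneg y])
    have h2 : H (y, 0) = ρ ^ 2 • J (ρ • y) := by simp only [hH, hJ, add_zero]
    rw [h2, norm_smul, Real.norm_of_nonneg (by positivity)]
    calc ρ ^ 2 * ‖J (ρ • y)‖ ≤ ρ ^ 2 * (KJ * (ρ * 2)) := by
          rw [hny] at h1
          refine mul_le_mul_of_nonneg_left (h1.trans ?_) (by positivity)
          gcongr
      _ = _ := by ring
  obtain ⟨r, hr, hreq, hrb⟩ := hex H (ρ ^ 2 * c * K) (ρ ^ 3 * (2 * KJ))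
    ((((hΦs.comp ((hb.comp hsc).add contDiff_snd)).const_smul c).sub
      ((contDiff_lap hb).comp hsc)).const_smul _) hs1 (by positivity) hs2 hs3
  have hrb' : ∀ y, ‖r y‖ ≤ C * ρ ^ 3 := fun y => (hrb y).trans (by rw [hC]; linarith)
  refine ⟨fun y => base (ρ • y) + r y, (hb.comp (contDiff_id.const_smul ρ)).add hr, fun y hy => ?_,
    fun y => by simpa using hrb' y⟩
  have hb2 : ContDiff ℝ 2 base := contDiff_infty.1 hb 2
  have hy1 : ‖y‖ < 1 := by simpa using hy
  have hny : ‖ρ • y‖ = ρ * ‖y‖ := by rw [norm_smul, Real.norm_eq_abs, abs_of_pos hρ]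
  have hnear : ‖base (ρ • y) + r y - base 0‖ ≤ 1 := by
    have h1 := hbb (ρ • y) (by rw [hny]; nlinarith)
    rw [hny] at h1
    have h2 : (Kb : ℝ) * (ρ * ‖y‖) ≤ Kb * ρ :=
      mul_le_mul_of_nonneg_left (by nlinarith) Kb.2
    have h3 : C * ρ ^ 3 ≤ C * ρ := by
      refine mul_le_mul_of_nonneg_left ?_ hC0
      calc ρ ^ 3 = ρ * ρ ^ 2 := by ring
        _ ≤ ρ * 1 := by gcongr; exact pow_le_one₀ hρ.le hρ1.le
        _ = ρ := mul_one _
    have h4 := norm_add_le (base (ρ • y) - base 0) (r y)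
    rw [show base (ρ • y) + r y - base 0 = base (ρ • y) - base 0 + r y by ring]
    have h5 : ρ * (Kb + C) ≤ ρ * D := by
      refine mul_le_mul_of_nonneg_left ?_ hρ.le
      have : 0 ≤ 2 * (P * c * K) := by positivity
      linarith
    linarith [hrb' y]
  rw [lap_add (f := fun y => base (ρ • y)) (hb2.comp (contDiff_id.const_smul ρ)).contDiffAt
    (contDiff_infty.1 hr 2).contDiffAt, lap_comp_smul hb2, hreq y hy, hH]
  simp only [hΦ1 _ hnear]
  module

end LocalSolution

section Necessary

open scoped ContDiff

variable {Γ : Set ℂ} {τ : ℝ → ℂ} {W : ℂ → ℝ} {R₀ δ₁ m : ℝ}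

theorem simplyConnected_ball : SimplyConnectedSpace ↥(ball (0 : ℂ) 1) := by
  have := contractibleSpace_ball (x := (0 : ℂ)) one_pos
  infer_instance

/-- The maximum principle on the unit disc, as a one-sided bound. -/
theorem bound_of_maxPrinciple (hmax : MaxPrinciple Γ τ W δ₁ m) {σ c M : ℝ} (hσ : σ = 1 ∨ σ = -1)
    (hc : 0 < c) {u : ℂ → ℂ} {t φ : ℂ → ℝ} (hu : ContDiff ℝ ∞ u)
    (heq : ∀ x ∈ ball (0 : ℂ) 1, lap u x = c • gradW W (u x))
    (hd : ∀ x ∈ closedBall (0 : ℂ) 1, infDist (u x) Γ ≤ δ₁)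
    (hp : PhaseDecomp Γ τ (closedBall 0 1) u t φ)
    (hM : ∀ x ∈ sphere (0 : ℂ) 1, σ * φ x + m / 2 * t x ^ 2 ≤ M) :
    σ * φ 0 + m / 2 * t 0 ^ 2 ≤ M := by
  have hcl : closure (ball (0 : ℂ) 1) = closedBall 0 1 := closure_ball _ one_ne_zero
  have hfr : frontier (ball (0 : ℂ) 1) = sphere 0 1 := frontier_ball _ one_ne_zero
  have hε : ((√c)⁻¹ ^ 2)⁻¹ = c := by rw [inv_pow, inv_inv, Real.sq_sqrt hc.le]
  obtain ⟨hinf, hsup⟩ := hmax (ball 0 1) (√c)⁻¹ u t φ isOpen_ball isBounded_ball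
    ⟨0, mem_ball_self one_pos⟩ simplyConnected_ball (by positivity) hu.contDiffOn
    hu.continuous.continuousOn (fun x hx => by rw [hε, lapC_eq_lap]; exact heq x hx)
    (by rwa [hcl]) (by rwa [hcl])
  rw [hcl, hfr] at hinf hsup
  have hne : (sphere (0 : ℂ) 1).Nonempty := NormedSpace.sphere_nonempty.2 zero_le_one
  have h0 : (0 : ℂ) ∈ closedBall (0 : ℂ) 1 := mem_closedBall_self zero_le_one
  have hcomp : IsCompact (closedBall (0 : ℂ) 1) := isCompact_closedBall _ _
  rcases hσ with rfl | rfl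
  · have hcont : ContinuousOn (fun x => φ x + m * t x ^ 2 / 2) (closedBall 0 1) :=
      hp.2.1.add ((continuousOn_const.mul (hp.1.pow 2)).div_const 2)
    have h1 := le_csSup (hcomp.bddAbove_image hcont) (mem_image_of_mem _ h0)
    have h2 : sSup ((fun x => φ x + m * t x ^ 2 / 2) '' sphere (0 : ℂ) 1) ≤ M := by
      refine csSup_le (hne.image _) ?_
      rintro _ ⟨x, hx, rfl⟩
      have := hM x hx
      simp only
      linarith
    rw [hsup] at h1
    linarith
  · have hcont : ContinuousOn (fun x => φ x - m * t x ^ 2 / 2) (closedBall 0 1) :=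
      hp.2.1.sub ((continuousOn_const.mul (hp.1.pow 2)).div_const 2)
    have h1 := csInf_le (hcomp.bddBelow_image hcont) (mem_image_of_mem _ h0)
    have h2 : -M ≤ sInf ((fun x => φ x - m * t x ^ 2 / 2) '' sphere (0 : ℂ) 1) := by
      refine le_csInf (hne.image _) ?_
      rintro _ ⟨x, hx, rfl⟩
      have := hM x hx
      simp only
      linarith
    rw [hinf] at h1
    linarith

/-- The maximum principle prevents second-order solutions from having a strict interior maximum
of the phase function. -/
theorem no_bump (h : ArcParam Γ τ) (hW : PotentialHyp Γ W R₀) (hmax : MaxPrinciple Γ τ W δ₁ m)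
    {s₀ t₀ ϑ : ℝ} (hf : IsFoot Γ τ s₀ t₀) (h0 : 0 ≤ ϑ) (h1 : ϑ < 1) (hδ : |ϑ * t₀| < δ₁)
    {c : ℝ} (hc : 0 < c) {s t : ℂ → ℝ} (hs : ContDiff ℝ ∞ s) (ht : ContDiff ℝ ∞ t)
    (hs0 : s 0 = s₀) (ht0 : t 0 = ϑ * t₀)
    (heq : lap (fun y => tube τ (s y) (t y)) 0 = c • gradW W (tube τ (s 0) (t 0)))
    {σ q F₁ : ℝ} (hσ : σ = 1 ∨ σ = -1)
    (hF : ∀ y, σ * s y + m / 2 * t y ^ 2 = F₁ - q * ‖y‖ ^ 2) : q ≤ 0 := by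
  by_contra! hq
  obtain ⟨G, hGs, hGz, hGp⟩ := hf.exists_chart h h0 h1
  set z₁ := tube τ s₀ (ϑ * t₀) with hz₁
  set base : ℂ → ℂ := fun y => tube τ (s y) (t y) with hbase
  have hbs : ContDiff ℝ ∞ base := (contDiff_tube h).comp (hs.prodMk ht)
  have hb0 : base 0 = z₁ := by change tube τ (s 0) (t 0) = z₁; rw [hs0, ht0]
  set F : ℂ → ℝ := fun z => σ * (G z).re + m / 2 * (G z).im ^ 2 with hFdef
  have hFs : ContDiffAt ℝ 1 F z₁ := by
    have hG1 : ContDiffAt ℝ 1 G z₁ := hGs.of_le (by simp)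
    have hre : ContDiffAt ℝ 1 (fun z => (G z).re) z₁ :=
      (reCLM.contDiff (n := 1)).contDiffAt.comp z₁ hG1
    have him : ContDiffAt ℝ 1 (fun z => (G z).im) z₁ := imCLM.contDiff.contDiffAt.comp z₁ hG1
    exact (contDiffAt_const.mul hre).add (contDiffAt_const.mul (him.pow 2))
  obtain ⟨K, N, hN, hK⟩ := hFs.exists_lipschitzOnWith
  have hGcont : ∀ᶠ z in 𝓝 z₁, ContinuousAt G z :=
    (eventually_contDiffAt (contDiffAt_infty.1 hGs 2)).mono fun z hz => hz.continuousAt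
  have hG1 : G z₁ = s₀ + (ϑ * t₀ : ℝ) * I := by
    have := hGp.self_of_nhds
    have h2 : tubeMap τ (s₀ + (ϑ * t₀ : ℝ) * I : ℂ) = z₁ := by simp [tubeMap, hz₁]
    rwa [h2] at this
  have hGδ : ∀ᶠ z in 𝓝 z₁, |(G z).im| ≤ δ₁ := by
    have hct : ContinuousAt (fun z => |(G z).im|) z₁ :=
      (continuous_im.continuousAt.comp hGs.continuousAt).abs
    have : |(G z₁).im| < δ₁ := by rw [hG1]; simpa using hδ
    exact (hct.eventually (gt_mem_nhds this)).mono fun _ h => le_of_lt h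
  obtain ⟨r, hr, hball⟩ := Metric.mem_nhds_iff.1 (inter_mem hN (hGz.and (hGcont.and hGδ)))
  have hFbase : ∀ᶠ y in 𝓝 (0 : ℂ), F (base y) = F₁ - q * ‖y‖ ^ 2 := by
    have hct : Tendsto (fun y => (s y : ℂ) + (t y : ℂ) * I) (𝓝 0) (𝓝 (s₀ + (ϑ * t₀ : ℝ) * I)) := by
      have : Continuous fun y => (s y : ℂ) + (t y : ℂ) * I := by
        have := hs.continuous
        have := ht.continuous
        fun_prop
      have h3 := this.tendsto 0
      rwa [hs0, ht0] at h3
    filter_upwards [hct.eventually hGp] with y hy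
    have h2 : tubeMap τ ((s y : ℂ) + (t y : ℂ) * I) = base y := by simp [tubeMap, hbase]
    rw [h2] at hy
    rw [← hF y, hFdef]
    simp only
    rw [hy]
    simp
  have hbball : ∀ᶠ y in 𝓝 (0 : ℂ), base y ∈ ball z₁ (r / 2) :=
    hbs.continuous.continuousAt.eventually (by rw [hb0]; exact ball_mem_nhds _ (by positivity))
  obtain ⟨η, hη, hηb⟩ := Metric.eventually_nhds_iff_ball.1 (hFbase.and hbball)
  obtain ⟨C, hC, ρ₀, hρ₀, hex⟩ := exists_local_GL hW.smooth hbs hc.le heq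
  obtain ⟨ρ, hρ, hρlt⟩ : ∃ ρ > 0, ρ < min (min ρ₀ (η / 2)) (min 1 (min (r / (2 * (C + 1)))
      (q / (2 * K * C + 1)))) := by
    refine exists_between ?_
    positivity
  simp only [lt_min_iff] at hρlt
  obtain ⟨⟨hρ1, hρ2⟩, hρ3, hρ4, hρ5⟩ := hρlt
  obtain ⟨u, hus, hueq, huC⟩ := hex ρ hρ hρ1
  rw [lt_div_iff₀ (by positivity)] at hρ4 hρ5
  have hny : ∀ y ∈ closedBall (0 : ℂ) 1, ρ • y ∈ ball (0 : ℂ) η := fun y hy => by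
    rw [mem_closedBall_zero_iff] at hy
    rw [mem_ball_zero_iff, norm_smul, Real.norm_of_nonneg hρ.le]
    nlinarith
  have hCr : C * ρ ^ 3 < r / 2 := by
    have : ρ ^ 3 ≤ ρ := by nlinarith [sq_nonneg ρ, mul_pos hρ hρ]
    nlinarith
  have hur : ∀ y ∈ closedBall (0 : ℂ) 1, u y ∈ ball z₁ r := fun y hy => by
    have h2 := (hηb _ (hny y hy)).2
    rw [mem_ball, dist_eq_norm] at h2 ⊢
    have h3 := norm_add_le (u y - base (ρ • y)) (base (ρ • y) - z₁)
    rw [sub_add_sub_cancel] at h3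
    linarith [huC y]
  have hFu : ∀ y ∈ closedBall (0 : ℂ) 1,
      |F (u y) - (F₁ - q * ρ ^ 2 * ‖y‖ ^ 2)| ≤ K * C * ρ ^ 3 := fun y hy => by
    have h2 := hηb _ (hny y hy)
    have h3 := hK.norm_sub_le (hball (hur y hy)).1
      (hball (ball_subset_ball (by linarith) h2.2)).1
    rw [h2.1, norm_smul, Real.norm_of_nonneg hρ.le, mul_pow, Real.norm_eq_abs] at h3
    calc |F (u y) - (F₁ - q * ρ ^ 2 * ‖y‖ ^ 2)| = |F (u y) - (F₁ - q * (ρ ^ 2 * ‖y‖ ^ 2))| := by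
          rw [mul_assoc]
      _ ≤ K * ‖u y - base (ρ • y)‖ := h3
      _ ≤ K * (C * ρ ^ 3) := by gcongr; exact huC y
      _ = _ := by ring
  have hGu : ContinuousOn (fun y => G (u y)) (closedBall 0 1) := fun y hy =>
    ((hball (hur y hy)).2.2.1.comp hus.continuous.continuousAt).continuousWithinAt
  have key := bound_of_maxPrinciple hmax (c := ρ ^ 2 * c) (M := F₁ - q * ρ ^ 2 + K * C * ρ ^ 3)
    (t := fun y => (G (u y)).im) (φ := fun y => (G (u y)).re) hσ (by positivity) hus hueq
    (fun y hy => by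
      obtain ⟨-, ⟨-, h3⟩, -, h4⟩ := hball (hur y hy)
      rw [h3]; exact h4)
    ⟨continuous_im.comp_continuousOn hGu, continuous_re.comp_continuousOn hGu, fun y hy =>
      ⟨(hball (hur y hy)).2.1.1.symm, (hball (hur y hy)).2.1.2.symm⟩⟩
    fun y hy => by
      have h2 := (abs_le.1 (hFu y (sphere_subset_closedBall hy))).2
      rw [mem_sphere_zero_iff_norm.1 hy] at h2
      simp only [hFdef] at h2
      linarith
  have h2 := (abs_le.1 (hFu 0 (mem_closedBall_self zero_le_one))).1
  simp only [hFdef, norm_zero] at h2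
  have h3 : q * ρ ^ 2 ≤ 2 * K * C * ρ ^ 3 := by linarith
  have h4 : ρ ^ 2 * (ρ * (2 * K * C + 1)) < ρ ^ 2 * q := mul_lt_mul_of_pos_left hρ5 (by positivity)
  nlinarith [pow_pos hρ 3]

end Necessary

section Jet

variable {f g : ℂ → ℝ} {x : ℂ} {p q l p' q' l' : ℝ}

/-- `f` is twice continuously differentiable at `x`, with gradient `(p, q)` and Laplacian `l`. -/
structure HasJet (f : ℂ → ℝ) (x : ℂ) (p q l : ℝ) : Prop where
  smooth : ContDiffAt ℝ 2 f x
  d1 : dir 1 f x = p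
  dI : dir I f x = q
  lap : lap f x = l

theorem hasJet (hf : ContDiffAt ℝ 2 f x) : HasJet f x (dir 1 f x) (dir I f x) (lap f x) :=
  ⟨hf, rfl, rfl, rfl⟩

theorem HasJet.congr (hf : HasJet f x p q l) (h : p = p') (h' : q = q') (h'' : l = l') :
    HasJet f x p' q' l' := by subst h h' h''; exact hf

theorem hasJet_const (c : ℝ) (x : ℂ) : HasJet (fun _ => c) x 0 0 0 :=
  ⟨contDiffAt_const, dir_const _ _ _, dir_const _ _ _, lap_const _ _⟩

theorem HasJet.add (hf : HasJet f x p q l) (hg : HasJet g x p' q' l') :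
    HasJet (fun y => f y + g y) x (p + p') (q + q') (l + l') := by
  obtain ⟨h1, rfl, rfl, rfl⟩ := hf
  obtain ⟨h1', rfl, rfl, rfl⟩ := hg
  have h2 := differentiableAt_of_two h1
  have h2' := differentiableAt_of_two h1'
  exact ⟨h1.add h1', dir_add h2 h2' _, dir_add h2 h2' _, lap_add h1 h1'⟩

theorem HasJet.mul (hf : HasJet f x p q l) (hg : HasJet g x p' q' l') :
    HasJet (fun y => f y * g y) x (f x * p' + p * g x) (f x * q' + q * g x)
      (f x * l' + 2 * (p * p' + q * q') + l * g x) := by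
  obtain ⟨h1, rfl, rfl, rfl⟩ := hf
  obtain ⟨h1', rfl, rfl, rfl⟩ := hg
  have h2 := differentiableAt_of_two h1
  have h2' := differentiableAt_of_two h1'
  exact ⟨h1.mul h1', by simpa using dir_smul h2 h2' 1, by simpa using dir_smul h2 h2' I,
    lap_mul h1 h1'⟩

theorem HasJet.const_mul (c : ℝ) (hf : HasJet f x p q l) :
    HasJet (fun y => c * f y) x (c * p) (c * q) (c * l) := by
  simpa using (hasJet_const c x).mul hf

theorem HasJet.neg (hf : HasJet f x p q l) : HasJet (fun y => -f y) x (-p) (-q) (-l) := by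
  simpa using hf.const_mul (-1)

theorem HasJet.sub (hf : HasJet f x p q l) (hg : HasJet g x p' q' l') :
    HasJet (fun y => f y - g y) x (p - p') (q - q') (l - l') := by
  simpa only [sub_eq_add_neg] using hf.add hg.neg

theorem HasJet.sq (hf : HasJet f x p q l) :
    HasJet (fun y => f y ^ 2) x (2 * f x * p) (2 * f x * q)
      (2 * f x * l + 2 * (p ^ 2 + q ^ 2)) := by
  have h := hf.mul hf
  refine ⟨hf.smooth.pow 2, ?_, ?_, ?_⟩ <;> simp only [_root_.pow_two]
  · rw [h.d1]; ring
  · rw [h.dI]; ring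
  · rw [h.lap]; ring

theorem HasJet.comp {Φ : ℝ → ℝ} {a b : ℝ} (hf : HasJet f x p q l) (hΦ : ContDiffAt ℝ 2 Φ (f x))
    (h1 : deriv Φ (f x) = a) (h2 : deriv (deriv Φ) (f x) = b) :
    HasJet (fun y => Φ (f y)) x (p * a) (q * a) ((p ^ 2 + q ^ 2) * b + l * a) := by
  obtain ⟨h, rfl, rfl, rfl⟩ := hf
  subst h1 h2
  have hd := differentiableAt_of_two h
  have hd' : DifferentiableAt ℝ Φ (f x) := hΦ.differentiableAt (by simp)
  exact ⟨ContDiffAt.comp (f := f) x hΦ h, dir_comp hd' hd 1, dir_comp hd' hd I, lap_comp hΦ h⟩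

theorem HasJet.exp (hf : HasJet f x p q l) :
    HasJet (fun y => Real.exp (f y)) x (p * Real.exp (f x)) (q * Real.exp (f x))
      ((p ^ 2 + q ^ 2 + l) * Real.exp (f x)) := by
  have h := hf.comp (Φ := Real.exp) Real.contDiff_exp.contDiffAt
    (congrFun Real.deriv_exp _) (b := Real.exp (f x)) (by simp)
  exact h.congr rfl rfl (by ring)

theorem hasJet_norm_sq (x : ℂ) : HasJet (fun y : ℂ => ‖y‖ ^ 2) x (2 * x.re) (2 * x.im) 4 := by
  have h := fun e => dir_norm_sq 0 e x
  have h' := lap_norm_sq 0 x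
  have h'' := contDiff_norm_sq_sub 0 (n := 2)
  simp only [sub_zero] at h h' h''
  exact ⟨h''.contDiffAt, by simp [h, Complex.inner], by simp [h, Complex.inner], h'⟩

theorem hasJet_re (x : ℂ) : HasJet (fun y : ℂ => y.re) x 1 0 0 := by
  have h : ∀ e x, dir e (fun y : ℂ => y.re) x = e.re := fun e x =>
    congrArg (fun L : ℂ →L[ℝ] ℝ => L e) reCLM.hasFDerivAt.fderiv
  refine ⟨reCLM.contDiff.contDiffAt, by simp [h], by simp [h], ?_⟩
  simp only [GLPhase.lap]
  rw [funext (h 1), funext (h I), dir_const, dir_const, add_zero]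

end Jet

section Bracket

open scoped ContDiff

variable {Γ : Set ℂ} {τ : ℝ → ℂ} {W : ℂ → ℝ} {R₀ δ₁ m : ℝ}

/-- The pointwise inequality forced by the maximum principle strictly inside the cut locus. -/
theorem bracket_nonneg_of_lt (h : ArcParam Γ τ) (hW : PotentialHyp Γ W R₀)
    (hmax : MaxPrinciple Γ τ W δ₁ m) {s₀ t₀ ϑ : ℝ} (hf : IsFoot Γ τ s₀ t₀) (h0 : 0 ≤ ϑ) (h1 : ϑ < 1)
    (hδ : |ϑ * t₀| < δ₁) {c : ℝ} (hc : 0 < c) {σ : ℝ} (hσ : σ = 1 ∨ σ = -1) (b t κ : ℝ)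
    (ht₁ : t = ϑ * t₀) (hκ : κ = curv τ s₀) :
    0 ≤ (1 - t * κ) * m * b ^ 2 - 2 * κ * m * t * b ^ 2
      + σ * deriv (curv τ) s₀ * m ^ 2 * t ^ 3 * b ^ 2
      + (1 - t * κ) * m * t * (c * wNor W τ s₀ t - (1 - t * κ) * κ * m ^ 2 * t ^ 2 * b ^ 2)
      + σ * c * wTan W τ s₀ t := by
  set Q := (1 - t * κ) * m * b ^ 2 - 2 * κ * m * t * b ^ 2
      + σ * deriv (curv τ) s₀ * m ^ 2 * t ^ 3 * b ^ 2
      + (1 - t * κ) * m * t * (c * wNor W τ s₀ t - (1 - t * κ) * κ * m ^ 2 * t ^ 2 * b ^ 2)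
      + σ * c * wTan W τ s₀ t with hQ
  have hj : 0 < 1 - t * κ := by rw [ht₁, hκ]; exact hf.jacobian_pos h h0 h1
  set q := -Q / (4 * (1 - t * κ)) with hq
  set β := (c * wNor W τ s₀ t - (1 - t * κ) * κ * m ^ 2 * t ^ 2 * b ^ 2) / 4 with hβ
  set T : ℂ → ℝ := fun y => t + b * y.re + β * ‖y‖ ^ 2 with hT
  set S : ℂ → ℝ := fun y => s₀ + σ * (m * t ^ 2 / 2 - m / 2 * T y ^ 2 - q * ‖y‖ ^ 2) with hS
  have hN : ContDiff ℝ ∞ fun y : ℂ => ‖y‖ ^ 2 := contDiff_norm_sq ℝ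
  have hTs : ContDiff ℝ ∞ T :=
    (contDiff_const.add (contDiff_const.mul reCLM.contDiff)).add (contDiff_const.mul hN)
  have hSs : ContDiff ℝ ∞ S := contDiff_const.add (contDiff_const.mul
    ((contDiff_const.sub (contDiff_const.mul (hTs.pow 2))).sub (contDiff_const.mul hN)))
  have hT0 : T 0 = t := by simp [hT]
  have hS0 : S 0 = s₀ := by simp [hS, hT0]; ring_nf; simp
  have jT : HasJet T 0 b 0 (4 * β) :=
    (((hasJet_const t 0).add ((hasJet_re 0).const_mul b)).add
      ((hasJet_norm_sq 0).const_mul β)).congr (by simp) (by simp) (by ring)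
  have jS : HasJet S 0 (-(σ * m * t * b)) 0 (-σ * (m * (t * (4 * β) + b ^ 2) + 4 * q)) :=
    ((hasJet_const s₀ 0).add ((((hasJet_const (m * t ^ 2 / 2) 0).sub
      (jT.sq.const_mul (m / 2))).sub ((hasJet_norm_sq 0).const_mul q)).const_mul σ)).congr
      (by simp [hT0]; ring) (by simp) (by rw [hT0]; ring)
  have hσ2 : σ * σ = 1 := by rcases hσ with rfl | rfl <;> norm_num
  have hqle : q ≤ 0 := by
    refine no_bump h hW hmax hf h0 h1 hδ hc hSs hTs hS0 (hT0.trans ht₁) ?_ hσ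
      (F₁ := σ * s₀ + m * t ^ 2 / 2) fun y => ?_
    · rw [lap_tube h jS.smooth jT.smooth, gradW_tube h, jS.lap, jT.lap, hS0, hT0]
      simp only [gdot, jS.d1, jS.dI, jT.d1, jT.dI, ← hκ]
      rw [real_smul, mul_add (c : ℂ), ← mul_assoc (c : ℂ), ← mul_assoc (c : ℂ), ← ofReal_mul, ← ofReal_mul]
      have e4q : 4 * (1 - t * κ) * q = -Q := by rw [hq]; field_simp
      congr 3
      · have h4 : σ * (4 * (1 - t * κ) * q) = σ * -Q := by rw [e4q]
        have h5 : σ * Q = σ * ((1 - t * κ) * m * b ^ 2 - 2 * κ * m * t * b ^ 2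
            + (1 - t * κ) * m * t * (4 * β)) + (σ * σ) * (deriv (curv τ) s₀ * m ^ 2 * t ^ 3 * b ^ 2)
            + (σ * σ) * (c * wTan W τ s₀ t) := by rw [hQ, hβ]; ring
        rw [hσ2] at h5
        have h6 : t * deriv (curv τ) s₀ * (-(σ * m * t * b) * -(σ * m * t * b) + 0 * 0) =
            (σ * σ) * (t ^ 3 * deriv (curv τ) s₀ * m ^ 2 * b ^ 2) := by ring
        rw [h6, hσ2]
        linear_combination -h4 + h5
      · have h6 : (1 - t * κ) * κ * (-(σ * m * t * b) * -(σ * m * t * b) + 0 * 0) =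
            (σ * σ) * ((1 - t * κ) * κ * m ^ 2 * t ^ 2 * b ^ 2) := by ring
        rw [h6, hσ2, hβ]
        ring
    · have h6 : σ * S y = σ * s₀ + (σ * σ) * (m * t ^ 2 / 2 - m / 2 * T y ^ 2 - q * ‖y‖ ^ 2) := by
        rw [hS]; ring
      rw [h6, hσ2]; ring
  rw [hq, div_le_iff₀ (by positivity)] at hqle
  linarith

end Bracket

section FootIneq

open scoped ContDiff

variable {Γ : Set ℂ} {τ : ℝ → ℂ} {W : ℂ → ℝ} {R₀ δ₁ m s₀ t₀ : ℝ}

theorem nonneg_of_shrink {E : ℝ → ℝ} (hE : Continuous E)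
    (h : ∀ ϑ, 0 ≤ ϑ → ϑ < 1 → 0 ≤ E (ϑ * t₀)) : 0 ≤ E t₀ := by
  have ht : Tendsto (fun ϑ : ℝ => E (ϑ * t₀)) (𝓝[<] 1) (𝓝 (E (1 * t₀))) :=
    (hE.comp (continuous_id.mul continuous_const)).continuousAt.tendsto.mono_left
      nhdsWithin_le_nhds
  rw [one_mul] at ht
  refine ge_of_tendsto ht ?_
  filter_upwards [Ioo_mem_nhdsLT (zero_lt_one : (0 : ℝ) < 1)] with ϑ hϑ
  exact h ϑ hϑ.1.le hϑ.2

theorem nonneg_of_forall_add_mul {A B : ℝ} (h : ∀ c > 0, 0 ≤ A + c * B) : 0 ≤ A := by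
  have ht : Tendsto (fun c : ℝ => A + c * B) (𝓝[>] 0) (𝓝 (A + 0 * B)) :=
    (Continuous.continuousAt (by fun_prop)).tendsto.mono_left nhdsWithin_le_nhds
  rw [zero_mul, add_zero] at ht
  refine ge_of_tendsto ht ?_
  filter_upwards [self_mem_nhdsWithin] with c hc using h c hc

theorem abs_shrink_lt (hδ₁ : 0 < δ₁) (hδ : |t₀| ≤ δ₁) {ϑ : ℝ} (h0 : 0 ≤ ϑ) (h1 : ϑ < 1) :
    |ϑ * t₀| < δ₁ := by
  rw [abs_mul, abs_of_nonneg h0]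
  nlinarith [abs_nonneg t₀]

theorem contDiff_wTan_right (h : ArcParam Γ τ) (hW : PotentialHyp Γ W R₀) (s : ℝ) :
    ContDiff ℝ ∞ fun t => wTan W τ s t :=
  (contDiff_wTan h hW).comp (contDiff_const.prodMk contDiff_id)

theorem contDiff_wNor_right (h : ArcParam Γ τ) (hW : PotentialHyp Γ W R₀) (s : ℝ) :
    ContDiff ℝ ∞ fun t => wNor W τ s t :=
  (contDiff_wNor h hW).comp (contDiff_const.prodMk contDiff_id)

theorem IsFoot.abs_wTan_le (h : ArcParam Γ τ) (hW : PotentialHyp Γ W R₀)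
    (hmax : MaxPrinciple Γ τ W δ₁ m) (hδ₁ : 0 < δ₁) (hf : IsFoot Γ τ s₀ t₀) (hδ : |t₀| ≤ δ₁) :
    |wTan W τ s₀ t₀| ≤ m * (1 - t₀ * curv τ s₀) * (t₀ * wNor W τ s₀ t₀) := by
  have ha := (contDiff_wTan_right h hW s₀).continuous
  have hb := (contDiff_wNor_right h hW s₀).continuous
  have key : ∀ σ : ℝ, σ = 1 ∨ σ = -1 →
      0 ≤ (1 - t₀ * curv τ s₀) * m * t₀ * wNor W τ s₀ t₀ + σ * wTan W τ s₀ t₀ := by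
    intro σ hσ
    refine nonneg_of_shrink (E := fun t => (1 - t * curv τ s₀) * m * t * wNor W τ s₀ t +
      σ * wTan W τ s₀ t) (by fun_prop) fun ϑ h0 h1 => ?_
    have := bracket_nonneg_of_lt h hW hmax hf h0 h1 (abs_shrink_lt hδ₁ hδ h0 h1) one_pos hσ 0
      _ _ rfl rfl
    linarith
  rw [abs_le]
  constructor
  · linarith [key 1 (.inl rfl)]
  · linarith [key (-1) (.inr rfl)]

theorem IsFoot.convexity (h : ArcParam Γ τ) (hW : PotentialHyp Γ W R₀)
    (hmax : MaxPrinciple Γ τ W δ₁ m) (hm : 0 < m) (hδ₁ : 0 < δ₁) (hf : IsFoot Γ τ s₀ t₀)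
    (hδ : |t₀| ≤ δ₁) {σ : ℝ} (hσ : σ = 1 ∨ σ = -1) :
    0 ≤ (1 - t₀ * curv τ s₀) - 2 * curv τ s₀ * t₀ + σ * deriv (curv τ) s₀ * m * t₀ ^ 3
      - (1 - t₀ * curv τ s₀) ^ 2 * curv τ s₀ * m ^ 2 * t₀ ^ 3 := by
  refine nonneg_of_shrink (E := fun t₀ => (1 - t₀ * curv τ s₀) - 2 * curv τ s₀ * t₀ +
      σ * deriv (curv τ) s₀ * m * t₀ ^ 3 - (1 - t₀ * curv τ s₀) ^ 2 * curv τ s₀ * m ^ 2 * t₀ ^ 3)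
      (by fun_prop) fun ϑ h0 h1 => ?_
  set t := ϑ * t₀ with ht
  refine nonneg_of_mul_nonneg_right (a := m) ?_ hm
  refine nonneg_of_forall_add_mul
    (B := (1 - t * curv τ s₀) * m * t * wNor W τ s₀ t + σ * wTan W τ s₀ t) fun c hc => ?_
  have := bracket_nonneg_of_lt h hW hmax hf h0 h1 (abs_shrink_lt hδ₁ hδ h0 h1) hc hσ 1
      _ _ rfl rfl
  rw [← ht] at this
  linarith

theorem IsFoot.jacobian_ge (h : ArcParam Γ τ) (hW : PotentialHyp Γ W R₀)
    (hmax : MaxPrinciple Γ τ W δ₁ m) (hm : 0 < m) (hδ₁ : 0 < δ₁) (hf : IsFoot Γ τ s₀ t₀)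
    (hδ : |t₀| ≤ δ₁) : 2 / 3 ≤ 1 - t₀ * curv τ s₀ := by
  have h1 := hf.convexity h hW hmax hm hδ₁ hδ (.inl rfl)
  have h2 := hf.convexity h hW hmax hm hδ₁ hδ (.inr rfl)
  set x := t₀ * curv τ s₀ with hx
  have h3 : 0 ≤ 1 - 3 * x - x * ((1 - x) ^ 2 * m ^ 2 * t₀ ^ 2) := by
    have : curv τ s₀ * t₀ = x := by rw [hx]; ring
    have h4 : (1 - x) ^ 2 * curv τ s₀ * m ^ 2 * t₀ ^ 3 = x * ((1 - x) ^ 2 * m ^ 2 * t₀ ^ 2) := by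
      rw [← this]; ring
    linarith
  by_contra! h5
  have : 0 ≤ x * ((1 - x) ^ 2 * m ^ 2 * t₀ ^ 2) := by
    have : 0 ≤ x := by linarith
    positivity
  linarith

theorem IsFoot.mul_wNor_nonneg (h : ArcParam Γ τ) (hW : PotentialHyp Γ W R₀)
    (hmax : MaxPrinciple Γ τ W δ₁ m) (hm : 0 < m) (hδ₁ : 0 < δ₁) (hf : IsFoot Γ τ s₀ t₀)
    (hδ : |t₀| ≤ δ₁) : 0 ≤ t₀ * wNor W τ s₀ t₀ := by
  have h1 := hf.abs_wTan_le h hW hmax hδ₁ hδ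
  have h2 := hf.jacobian_ge h hW hmax hm hδ₁ hδ
  refine nonneg_of_mul_nonneg_right ((abs_nonneg _).trans h1) (by positivity)

end FootIneq

section Const

open scoped ContDiff

variable {Γ : Set ℂ} {τ : ℝ → ℂ} {W : ℂ → ℝ} {R₀ δ₁ m : ℝ}

theorem hasDerivAt_snd_slice {f : ℝ → ℝ → ℝ} (hf : ContDiff ℝ ∞ fun p : ℝ × ℝ => f p.1 p.2)
    (s t : ℝ) : HasDerivAt (f s) (fderiv ℝ (fun p : ℝ × ℝ => f p.1 p.2) (s, t) (0, 1)) t := by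
  have h1 : HasFDerivAt (fun p : ℝ × ℝ => f p.1 p.2) _ (s, t) :=
    (hf.differentiable (by simp) (s, t)).hasFDerivAt
  have h2 : HasDerivAt (fun t : ℝ => (s, t)) ((0 : ℝ), (1 : ℝ)) t :=
    (hasDerivAt_const t s).prodMk (hasDerivAt_id t)
  exact h1.comp_hasDerivAt t h2

theorem contDiff_deriv_slice {f : ℝ → ℝ → ℝ} (hf : ContDiff ℝ ∞ fun p : ℝ × ℝ => f p.1 p.2) :
    ContDiff ℝ ∞ fun p : ℝ × ℝ => deriv (f p.1) p.2 := by
  have : (fun p : ℝ × ℝ => deriv (f p.1) p.2) =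
      fun p => fderiv ℝ (fun p : ℝ × ℝ => f p.1 p.2) p (0, 1) :=
    funext fun p => (hasDerivAt_snd_slice hf p.1 p.2).deriv
  rw [this]
  exact (hf.fderiv_right (m := ∞) (by simp)).clm_apply contDiff_const

theorem hasDerivAt_slice {f : ℝ → ℝ → ℝ} (hf : ContDiff ℝ ∞ fun p : ℝ × ℝ => f p.1 p.2)
    (s t : ℝ) : HasDerivAt (f s) (deriv (f s) t) t :=
  (hasDerivAt_snd_slice hf s t).differentiableAt.hasDerivAt

theorem exists_bound_of_periodic {f : ℝ → ℝ → ℝ} (hf : Continuous fun p : ℝ × ℝ => f p.1 p.2)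
    (hp : ∀ s t, f (s + 2 * Real.pi) t = f s t) (δ : ℝ) :
    ∃ K > 0, ∀ s t, |t| ≤ δ → |f s t| ≤ K := by
  have hcomp : IsCompact (Icc 0 (2 * Real.pi) ×ˢ Icc (-δ) δ) := isCompact_Icc.prod isCompact_Icc
  obtain ⟨K, hK⟩ := hcomp.exists_bound_of_continuousOn hf.continuousOn
  refine ⟨|K| + 1, by positivity, fun s t ht => ?_⟩
  have hper : Function.Periodic (fun s => f s t) (2 * Real.pi) := fun s => hp s t
  obtain ⟨s', hs', hss⟩ := hper.exists_mem_Ico₀ (by positivity) s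
  rw [hss]
  have := hK (s', t) ⟨⟨hs'.1, hs'.2.le⟩, abs_le.1 ht⟩
  rw [Real.norm_eq_abs] at this
  linarith [le_abs_self K]

theorem lipschitz_of_deriv_bound {f : ℝ → ℝ} (hf : Differentiable ℝ f) {K : ℝ}
    (hK : ∀ s, |deriv f s| ≤ K) (s s' : ℝ) : |f s - f s'| ≤ K * |s - s'| :=
  Convex.norm_image_sub_le_of_norm_deriv_le (s := univ) (fun x _ => hf x)
    (fun x _ => hK x) convex_univ (mem_univ s') (mem_univ s)

theorem exists_lipschitz_of_periodic {f : ℝ → ℝ} (hf : ContDiff ℝ ∞ f)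
    (hp : Function.Periodic f (2 * Real.pi)) :
    ∃ K > 0, (∀ s, |f s| ≤ K) ∧ (∀ s, |deriv f s| ≤ K) ∧ ∀ s s', |f s - f s'| ≤ K * |s - s'| := by
  obtain ⟨K₁, h1, hK₁⟩ := exists_norm_le_of_periodic Real.two_pi_pos hp hf.continuous
  obtain ⟨K₂, h2, hK₂⟩ := exists_norm_le_of_periodic Real.two_pi_pos (periodic_deriv hp)
    (contDiff_deriv_top hf).continuous
  refine ⟨K₁ + K₂, by positivity, fun s => ?_, fun s => ?_, fun s s' => ?_⟩
  · have := hK₁ s; rw [Real.norm_eq_abs] at this; linarith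
  · have := hK₂ s; rw [Real.norm_eq_abs] at this; linarith
  · refine (lipschitz_of_deriv_bound (hf.differentiable (by simp)) hK₂ s s').trans ?_
    gcongr; linarith

theorem fderiv_curve_eq_zero (h : ArcParam Γ τ) (hW : PotentialHyp Γ W R₀) (s : ℝ) :
    fderiv ℝ W (τ s) = 0 := by
  have h0 : W (τ s) = 0 := by
    have : τ s ∈ W ⁻¹' {0} := hW.zeros ▸ mem_curve h s
    simpa using this
  exact IsLocalMin.fderiv_eq_zero (Eventually.of_forall fun z => h0 ▸ hW.nonneg z)

theorem wNor_zero (h : ArcParam Γ τ) (hW : PotentialHyp Γ W R₀) (s : ℝ) : wNor W τ s 0 = 0 := by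
  rw [wNor, tube_zero, fderiv_curve_eq_zero h hW]; rfl

/-- The second normal derivative of `W` along the curve. -/
def wHess (W : ℂ → ℝ) (τ : ℝ → ℂ) (s : ℝ) : ℝ := deriv (wNor W τ s) 0

theorem contDiff_wHess (h : ArcParam Γ τ) (hW : PotentialHyp Γ W R₀) :
    ContDiff ℝ ∞ (wHess W τ) :=
  (contDiff_deriv_slice (contDiff_wNor h hW)).comp (contDiff_id.prodMk contDiff_const)

theorem wHess_periodic (h : ArcParam Γ τ) : Function.Periodic (wHess W τ) (2 * Real.pi) := fun s => by
  rw [wHess, wHess, funext (wNor_periodic h s)]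

theorem wHess_ge (h : ArcParam Γ τ) (hW : PotentialHyp Γ W R₀) {μ δ : ℝ} (hδ : 0 < δ)
    (hμ : ∀ z : ℂ, infDist z Γ < δ → μ * infDist z Γ ^ 2 ≤ W z) (s : ℝ) :
    2 * μ ≤ wHess W τ s := by
  by_contra! hlt
  set f : ℝ → ℝ := fun t => W (tube τ s t) - μ * t ^ 2 with hf
  have hb := contDiff_wNor h hW
  have hd : ∀ t, HasDerivAt f (wNor W τ s t - 2 * μ * t) t := fun t => by
    have h1 : HasDerivAt (fun t : ℝ => tube τ s t) (nrm τ s) t := by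
      have := ((hasDerivAt_id t).ofReal_comp.mul_const (nrm τ s)).const_add (τ s)
      exact this.congr_deriv (by simp)
    have h2 := (hW.smooth.differentiable (by simp) (tube τ s t)).hasFDerivAt.comp_hasDerivAt t h1
    exact (h2.sub (((hasDerivAt_id t).pow 2).const_mul μ)).congr_deriv (by simp [wNor]; ring)
  have hd' : deriv f = fun t => wNor W τ s t - 2 * μ * t := funext fun t => (hd t).deriv
  have hdd : deriv (deriv f) 0 = wHess W τ s - 2 * μ := by
    rw [hd']
    exact (((hasDerivAt_slice hb s 0).sub ((hasDerivAt_id (0 : ℝ)).const_mul (2 * μ))).congr_deriv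
      (by simp [wHess])).deriv
  have hmax : IsLocalMax f 0 := by
    have := isLocalMin_of_deriv_deriv_pos (f := fun t => -f t) (x₀ := 0)
      (by
        have e : deriv (fun t => -f t) = fun t => -deriv f t := funext fun t => deriv.fun_neg
        rw [e, deriv.fun_neg, hdd]; linarith)
      (by rw [deriv.fun_neg, hd']; simp [wNor_zero h hW])
      (hd 0).continuousAt.neg
    simpa [IsLocalMax, IsLocalMin, IsMaxFilter, IsMinFilter] using this
  have h0 : f 0 = 0 := by
    have : τ s ∈ W ⁻¹' {0} := hW.zeros ▸ mem_curve h s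
    simpa [hf, tube_zero] using this
  have hfoot : ∀ᶠ t in 𝓝 (0 : ℝ), IsFoot Γ τ s t := by
    have h1 := (isFoot_zero (Γ := Γ) h s).eventually h (ϑ := 0) le_rfl zero_lt_one
    rw [mul_zero] at h1
    exact ((continuous_const (y := s)).prodMk continuous_id).continuousAt.eventually h1
  have hge : ∀ᶠ t in 𝓝 (0 : ℝ), 0 ≤ f t := by
    have h1 : ∀ᶠ t in 𝓝 (0 : ℝ), |t| < δ := by
      exact (continuous_abs.tendsto (0 : ℝ)).eventually (gt_mem_nhds (by simpa using hδ))
    filter_upwards [hfoot, h1] with t h2 h3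
    have h4 := hμ (tube τ s t) (by rw [h2]; exact h3)
    rw [h2, sq_abs] at h4
    simp only [hf]; linarith
  have heq : f =ᶠ[𝓝 0] fun _ => 0 := by
    filter_upwards [hmax, hge] with t h2 h3
    rw [h0] at h2
    exact le_antisymm h2 h3
  have h2 := heq.deriv.deriv_eq
  rw [hdd] at h2
  simp at h2
  linarith

/-- Uniform bounds, with a single constant, for the geometry of the curve and the potential. -/
structure Bounds (W : ℂ → ℝ) (τ : ℝ → ℂ) (δ₁ K ω₀ : ℝ) : Prop where
  K_pos : 0 < K
  ω_pos : 0 < ω₀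
  curv : ∀ s, |curv τ s| ≤ K
  deriv_curv : ∀ s, |deriv (GLPhase.curv τ) s| ≤ K
  curv_lip : ∀ s s', |GLPhase.curv τ s - GLPhase.curv τ s'| ≤ K * |s - s'|
  hess_ge : ∀ s, ω₀ ≤ wHess W τ s
  hess_le : ∀ s, wHess W τ s ≤ K
  hess_lip : ∀ s s', |wHess W τ s - wHess W τ s'| ≤ K * |s - s'|
  wTan : ∀ s t, |t| ≤ δ₁ → |wTan W τ s t| ≤ K
  wNor : ∀ s t, |t| ≤ δ₁ → |wNor W τ s t| ≤ K * |t|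
  wNor_taylor : ∀ s t, |t| ≤ δ₁ → |GLPhase.wNor W τ s t - wHess W τ s * t| ≤ K * t ^ 2

theorem abs_le_of_deriv_abs_le {f f' : ℝ → ℝ} {K t : ℝ} (hf : ∀ t, HasDerivAt f (f' t) t)
    (h0 : f 0 = 0) (hK : ∀ r, |r| ≤ |t| → |f' r| ≤ K) : |f t| ≤ K * |t| := by
  have h := Convex.norm_image_sub_le_of_norm_hasDerivWithin_le (s := Icc (-|t|) |t|) (C := K)
    (fun x _ => (hf x).hasDerivWithinAt) (fun x hx => hK x (abs_le.2 hx)) (convex_Icc _ _)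
    (x := 0) (y := t) (by simp) (abs_le.1 le_rfl)
  simpa [h0] using h

theorem exists_bounds (h : ArcParam Γ τ) (hW : PotentialHyp Γ W R₀) (δ₁ : ℝ) :
    ∃ K ω₀, Bounds W τ δ₁ K ω₀ := by
  obtain ⟨μ, hμ, δ, hδ, hnd⟩ := hW.nondeg
  have hb := contDiff_wNor h hW
  have hb1 := contDiff_deriv_slice hb
  have hb2 := contDiff_deriv_slice (f := fun s => deriv (wNor W τ s)) hb1
  have hp0 : ∀ s, wNor W τ (s + 2 * Real.pi) = wNor W τ s := fun s => funext (wNor_periodic h s)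
  obtain ⟨K₁, h1, hκ, hκ', hκl⟩ := exists_lipschitz_of_periodic (contDiff_curv h) (periodic_curv h)
  obtain ⟨K₂, h2, hω, -, hωl⟩ := exists_lipschitz_of_periodic (contDiff_wHess h hW)
    (wHess_periodic (W := W) h)
  obtain ⟨K₃, h3, ha⟩ := exists_bound_of_periodic (contDiff_wTan h hW).continuous
    (wTan_periodic h) δ₁
  obtain ⟨K₄, h4, hb1K⟩ := exists_bound_of_periodic
    (f := fun s t => deriv (wNor W τ s) t) hb1.continuous
    (fun s t => by simp only [hp0]) δ₁
  obtain ⟨K₅, h5, hb2K⟩ := exists_bound_of_periodic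
    (f := fun s t => deriv (deriv (wNor W τ s)) t) hb2.continuous
    (fun s t => by simp only [hp0]) δ₁
  set K := K₁ + K₂ + K₃ + K₄ + K₅ with hK
  refine ⟨K, 2 * μ, by positivity, by positivity, fun s => (hκ s).trans (by linarith),
    fun s => (hκ' s).trans (by linarith), fun s s' => (hκl s s').trans ?_, wHess_ge h hW hδ hnd,
    fun s => (le_abs_self _).trans ((hω s).trans (by linarith)), fun s s' => (hωl s s').trans ?_,
    fun s t ht => (ha s t ht).trans (by linarith), fun s t ht => ?_, fun s t ht => ?_⟩
  · gcongr; linarith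
  · gcongr; linarith
  · refine (abs_le_of_deriv_abs_le (hasDerivAt_slice hb s) (wNor_zero h hW s)
      fun r hr => hb1K s r (hr.trans ht)).trans ?_
    gcongr; linarith
  · have key : ∀ r, |r| ≤ |t| → |deriv (wNor W τ s) r - wHess W τ s| ≤ K₅ * |t| := fun r hr => by
      refine (abs_le_of_deriv_abs_le (f := fun r => deriv (wNor W τ s) r - wHess W τ s)
        (fun r => (hasDerivAt_slice (f := fun s => deriv (wNor W τ s)) hb1 s r).sub_const _)
        (by simp [wHess]) fun r' hr' => hb2K s r' (hr'.trans (hr.trans ht))).trans ?_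
      gcongr
    refine (abs_le_of_deriv_abs_le (f := fun t => wNor W τ s t - wHess W τ s * t)
      (fun r => ((hasDerivAt_slice hb s r).sub ((hasDerivAt_id r).const_mul _)).congr_deriv
        (by simp)) (by simp [wNor_zero h hW]) key).trans ?_
    rw [mul_assoc, ← sq, sq_abs]
    gcongr; linarith

end Const

section Profile

open scoped ContDiff

variable {Γ : Set ℂ} {τ : ℝ → ℂ} {W : ℂ → ℝ} {R₀ δ₁ m K ω₀ : ℝ}

/-- A convex profile `k` for which `σ φ + k(t)` is, up to a multiple of `|∇(σ φ + k(t))|²`,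
strictly subharmonic along solutions. -/
structure Profile (Γ : Set ℂ) (τ : ℝ → ℂ) (W : ℂ → ℝ) (δ₁ : ℝ) (k k₁ k₂ : ℝ → ℝ)
    (c₀ C₀ : ℝ) : Prop where
  c_pos : 0 < c₀
  C_pos : 0 < C₀
  deriv1 : ∀ t, HasDerivAt k (k₁ t) t
  deriv2 : ∀ t, HasDerivAt k₁ (k₂ t) t
  smooth : ContDiff ℝ ∞ k
  zero : k 0 = 0
  ge : ∀ t, c₀ * t ^ 2 ≤ k t
  deriv_le : ∀ t, |t| ≤ δ₁ → |k₁ t| ≤ C₀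
  quad : ∀ s t σ, IsFoot Γ τ s t → |t| ≤ δ₁ → σ = 1 ∨ σ = -1 →
    c₀ ≤ k₂ t - 2 * curv τ s * k₁ t / (1 - t * curv τ s) +
      σ * t * deriv (curv τ) s * k₁ t ^ 2 / (1 - t * curv τ s) -
      (1 - t * curv τ s) * curv τ s * k₁ t ^ 3
  force : ∀ s t σ, IsFoot Γ τ s t → |t| ≤ δ₁ → σ = 1 ∨ σ = -1 →
    c₀ * (t * wNor W τ s t) ≤ σ * wTan W τ s t / (1 - t * curv τ s) + k₁ t * wNor W τ s t

theorem abs_sinh_le_cosh (x : ℝ) : |Real.sinh x| ≤ Real.cosh x := by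
  rw [← Real.cosh_abs, Real.abs_sinh]
  exact (Real.sinh_lt_cosh _).le

theorem quad_perturb {m t κ κ' σ p h C δ K : ℝ} (hm : 0 < m) (hδ : 0 < δ) (hK : 0 < K)
    (hσ : σ = 1 ∨ σ = -1)
    (hh : 2 / 3 ≤ h) (hhu : h ≤ 1 + δ * K) (ht : |t| ≤ δ) (hκ : |κ| ≤ K) (hκ' : |κ'| ≤ K)
    (hp : |p| ≤ 1)
    (hC : C = 3 * K + 3 / 2 * δ * K * (2 * m * δ + 1) +
      (1 + δ * K) * K * (3 * m ^ 2 * δ ^ 2 + 3 * m * δ + 1))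
    (conv : 0 ≤ h - 2 * κ * t + σ * κ' * m * t ^ 3 - h ^ 2 * κ * m ^ 2 * t ^ 3) :
    -(C * |p|) ≤ m - 2 * κ * (m * t + p) / h + σ * t * κ' * (m * t + p) ^ 2 / h -
      h * κ * (m * t + p) ^ 3 := by
  have h0 : 0 < h := by linarith
  have e : m - 2 * κ * (m * t + p) / h + σ * t * κ' * (m * t + p) ^ 2 / h -
      h * κ * (m * t + p) ^ 3 =
      m / h * (h - 2 * κ * t + σ * κ' * m * t ^ 3 - h ^ 2 * κ * m ^ 2 * t ^ 3) +
      (-(2 * κ / h) + σ * t * κ' / h * (2 * m * t + p) -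
        h * κ * (3 * m ^ 2 * t ^ 2 + 3 * m * t * p + p ^ 2)) * p := by
    field_simp; ring
  rw [e]
  have hinv : h⁻¹ ≤ 3 / 2 := by
    rw [inv_le_comm₀ h0 (by norm_num)]; linarith
  have hσ' : |σ| = 1 := by rcases hσ with rfl | rfl <;> simp
  have b1 : |2 * κ / h| ≤ 3 * K := by
    rw [abs_div, abs_mul, abs_two, abs_of_pos h0, div_eq_mul_inv]
    calc 2 * |κ| * h⁻¹ ≤ 2 * K * (3 / 2) := by gcongr
      _ = _ := by ring
  have b2 : |σ * t * κ' / h * (2 * m * t + p)| ≤ 3 / 2 * δ * K * (2 * m * δ + 1) := by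
    have b : |2 * m * t + p| ≤ 2 * m * δ + 1 := by
      refine (abs_add_le _ _).trans ?_
      rw [abs_mul, abs_of_pos (by positivity : 0 < 2 * m)]
      gcongr
    rw [abs_mul, abs_div, abs_mul, abs_mul, hσ', abs_of_pos h0, div_eq_mul_inv]
    calc 1 * |t| * |κ'| * h⁻¹ * |2 * m * t + p|
        ≤ 1 * δ * K * (3 / 2) * (2 * m * δ + 1) := by gcongr
      _ = _ := by ring
  have b3 : |h * κ * (3 * m ^ 2 * t ^ 2 + 3 * m * t * p + p ^ 2)| ≤
      (1 + δ * K) * K * (3 * m ^ 2 * δ ^ 2 + 3 * m * δ + 1) := by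
    have b : |3 * m ^ 2 * t ^ 2 + 3 * m * t * p + p ^ 2| ≤
        3 * m ^ 2 * δ ^ 2 + 3 * m * δ + 1 := by
      refine (abs_add_three _ _ _).trans ?_
      rw [abs_mul, abs_mul (3 * m * t), abs_mul (3 * m), abs_of_pos (by positivity : 0 < 3 * m),
        abs_of_pos (by positivity : 0 < 3 * m ^ 2), abs_pow, abs_pow]
      calc 3 * m ^ 2 * |t| ^ 2 + 3 * m * |t| * |p| + |p| ^ 2
          ≤ 3 * m ^ 2 * δ ^ 2 + 3 * m * δ * 1 + 1 ^ 2 := by gcongr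
        _ = _ := by ring
    rw [abs_mul, abs_mul, abs_of_pos h0]
    gcongr
  have b4 : |(-(2 * κ / h) + σ * t * κ' / h * (2 * m * t + p) -
        h * κ * (3 * m ^ 2 * t ^ 2 + 3 * m * t * p + p ^ 2)) * p| ≤ C * |p| := by
    rw [abs_mul, hC]
    gcongr
    refine (abs_sub _ _).trans (add_le_add ((abs_add_le _ _).trans (add_le_add ?_ b2)) b3)
    rwa [abs_neg]
  have := abs_le.1 b4
  have : 0 ≤ m / h * (h - 2 * κ * t + σ * κ' * m * t ^ 3 - h ^ 2 * κ * m ^ 2 * t ^ 3) := by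
    positivity
  linarith

theorem exists_profile (h : ArcParam Γ τ) (hW : PotentialHyp Γ W R₀)
    (hmax : MaxPrinciple Γ τ W δ₁ m) (hm : 0 < m) (hδ₁ : 0 < δ₁) (hB : Bounds W τ δ₁ K ω₀) :
    ∃ k k₁ k₂ c₀ C₀, Profile Γ τ W δ₁ k k₁ k₂ c₀ C₀ := by
  have hK := hB.K_pos
  obtain ⟨C, hC⟩ : ∃ C, C = 3 * K + 3 / 2 * δ₁ * K * (2 * m * δ₁ + 1) +
      (1 + δ₁ * K) * K * (3 * m ^ 2 * δ₁ ^ 2 + 3 * m * δ₁ + 1) := ⟨_, rfl⟩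
  have hCpos : 0 < C := by rw [hC]; positivity
  set A := C + 1 with hA
  have hA0 : 0 < A := by positivity
  have hsinh : 0 < Real.sinh (A * δ₁) := Real.sinh_pos_iff.2 (by positivity)
  set η := (Real.sinh (A * δ₁))⁻¹ with hη
  have hη0 : 0 < η := inv_pos.2 hsinh
  have dlin : ∀ t : ℝ, HasDerivAt (fun t => A * t) A t := fun t => by
    simpa using (hasDerivAt_id t).const_mul A
  have hp : ∀ t, |t| ≤ δ₁ → |η * Real.sinh (A * t)| ≤ 1 := fun t ht => by
    rw [abs_mul, abs_of_pos hη0, Real.abs_sinh, abs_mul, abs_of_pos hA0, hη, inv_mul_le_iff₀ hsinh,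
      mul_one, Real.sinh_le_sinh]
    gcongr
  refine ⟨fun t => m / 2 * t ^ 2 + η / A * (Real.cosh (A * t) - 1),
    fun t => m * t + η * Real.sinh (A * t), fun t => m + η * (Real.cosh (A * t) * A),
    min η (m / 2), m * δ₁ + 1, by positivity, by positivity, fun t => ?_, fun t => ?_, ?_, by simp,
    fun t => ?_, fun t ht => ?_, fun s t σ hf ht hσ => ?_, fun s t σ hf ht hσ => ?_⟩
  · refine ((((hasDerivAt_id t).pow 2).const_mul (m / 2)).add
      (((dlin t).cosh.sub_const 1).const_mul (η / A))).congr_deriv ?_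
    field_simp
    simp
    ring
  · refine (((hasDerivAt_id t).const_mul m).add ((dlin t).sinh.const_mul η)).congr_deriv ?_
    simp
  · fun_prop
  · have h1 : 0 ≤ η / A * (Real.cosh (A * t) - 1) :=
      mul_nonneg (by positivity) (by linarith [Real.one_le_cosh (A * t)])
    have h2 : min η (m / 2) * t ^ 2 ≤ m / 2 * t ^ 2 := by gcongr; exact min_le_right _ _
    linarith
  · refine (abs_add_le _ _).trans ?_
    rw [abs_mul, abs_of_pos hm]
    gcongr
    exact hp t ht
  · have hj := hf.jacobian_ge h hW hmax hm hδ₁ ht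
    have hhu : 1 - t * curv τ s ≤ 1 + δ₁ * K := by
      have : |t * curv τ s| ≤ δ₁ * K := by
        rw [abs_mul]; exact mul_le_mul ht (hB.curv s) (abs_nonneg _) hδ₁.le
      linarith [(abs_le.1 this).1]
    have hq := quad_perturb hm hδ₁ hK hσ hj hhu ht (hB.curv s) (hB.deriv_curv s) (hp t ht) hC
      (hf.convexity h hW hmax hm hδ₁ ht hσ)
    have h1 : C * |η * Real.sinh (A * t)| ≤ η * Real.cosh (A * t) * C := by
      rw [abs_mul, abs_of_pos hη0, mul_comm]
      gcongr
      exact abs_sinh_le_cosh _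
    have h2 : η * 1 ≤ η * Real.cosh (A * t) := by gcongr; exact Real.one_le_cosh _
    have h3 : min η (m / 2) ≤ η := min_le_left _ _
    have h4 : η * (Real.cosh (A * t) * A) =
      η * Real.cosh (A * t) * C + η * Real.cosh (A * t) := by rw [hA]; ring
    linarith
  · have hj := hf.jacobian_ge h hW hmax hm hδ₁ ht
    have hb := hf.mul_wNor_nonneg h hW hmax hm hδ₁ ht
    have ha := hf.abs_wTan_le h hW hmax hδ₁ ht
    set b := wNor W τ s t
    have h0 : 0 < 1 - t * curv τ s := by linarith
    have h1 : -(m * (t * b)) ≤ σ * wTan W τ s t / (1 - t * curv τ s) := by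
      rw [le_div_iff₀ h0]
      have := abs_le.1 ha
      rcases hσ with rfl | rfl <;> linarith
    have h2 : t * b ≤ Real.sinh (A * t) * b := by
      rcases le_total 0 t with h3 | h3
      · have h5 : t ≤ Real.sinh (A * t) := by
          refine le_trans ?_ (Real.self_le_sinh_iff.2 (by positivity))
          nlinarith
        rcases h3.eq_or_lt with rfl | h3
        · simp
        · exact mul_le_mul_of_nonneg_right h5 (nonneg_of_mul_nonneg_right hb h3)
      · have h5 : Real.sinh (A * t) ≤ t := by
          refine le_trans (Real.sinh_le_self_iff.2 (mul_nonpos_of_nonneg_of_nonpos hA0.le h3)) ?_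
          nlinarith
        rcases h3.eq_or_lt with rfl | h3
        · simp
        · exact mul_le_mul_of_nonpos_right h5 (by nlinarith)
    have h3 : min η (m / 2) * (t * b) ≤ η * (t * b) := by gcongr; exact min_le_left _ _
    have h4 : η * (t * b) ≤ η * (Real.sinh (A * t) * b) := by gcongr
    linarith

end Profile

section Compare

/-- Bounded connected domains satisfying a uniform exterior ball condition. -/
structure Dom (Ω : Set ℂ) : Prop where
  isOpen : IsOpen Ω
  bdd : IsBounded Ω
  conn : IsPreconnected Ω
  ne : (frontier Ω).Nonempty
  ext : ∃ r > 0, ∀ x ∈ frontier Ω, ∃ y, ‖x - y‖ = r ∧ ∀ z ∈ closure Ω, r ≤ ‖z - y‖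

/-- The distance to the boundary. -/
def bdist (Ω : Set ℂ) (x : ℂ) : ℝ := infDist x (frontier Ω)

variable {Ω : Set ℂ}

theorem bdist_nonneg (x : ℂ) : 0 ≤ bdist Ω x := infDist_nonneg

theorem bdist_le_add (x y : ℂ) : bdist Ω x ≤ bdist Ω y + ‖x - y‖ := by
  rw [← dist_eq_norm]; exact infDist_le_infDist_add_dist

theorem continuous_bdist : Continuous (bdist Ω) := continuous_infDist_pt _

theorem Dom.subset_closure (_ : Dom Ω) {x : ℂ} (hx : x ∈ Ω) : x ∈ closure Ω :=
  _root_.subset_closure hx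

theorem Dom.frontier_closure (_ : Dom Ω) {x : ℂ} (hx : x ∈ frontier Ω) : x ∈ closure Ω :=
  frontier_subset_closure hx

theorem Dom.bdist_pos (hD : Dom Ω) {x : ℂ} (hx : x ∈ Ω) : 0 < bdist Ω x := by
  refine (isClosed_frontier.notMem_iff_infDist_pos hD.ne).1 fun h => ?_
  rw [hD.isOpen.frontier_eq] at h
  exact h.2 hx

theorem Dom.ball_subset (hD : Dom Ω) {x : ℂ} (hx : x ∈ Ω) : ball x (bdist Ω x) ⊆ Ω := by
  intro y hy
  by_contra hyn
  have hcov : ∀ z ∈ ball x (bdist Ω x), z ∉ Ω → z ∉ closure Ω := fun z hz hzn hzc => by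
    have h1 : bdist Ω x ≤ dist x z :=
      infDist_le_dist_of_mem (by rw [hD.isOpen.frontier_eq]; exact ⟨hzc, hzn⟩)
    rw [mem_ball, dist_comm] at hz
    linarith
  obtain ⟨z, -, hz, hz'⟩ := (convex_ball x (bdist Ω x)).isPreconnected Ω (closure Ω)ᶜ hD.isOpen
    isClosed_closure.isOpen_compl
    (fun z hz => (em (z ∈ Ω)).imp id fun h => hcov z hz h)
    ⟨x, mem_ball_self (pos_of_mem_ball hy), hx⟩ ⟨y, hy, hcov y hy hyn⟩
  exact hz' (hD.subset_closure hz)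

theorem Dom.ball_subset_of_le (hD : Dom Ω) {x : ℂ} (hx : x ∈ Ω) {r : ℝ} (hr : r ≤ bdist Ω x) :
    ball x r ⊆ Ω :=
  (ball_subset_ball hr).trans (hD.ball_subset hx)

theorem Dom.exists_bdist_le (hD : Dom Ω) : ∃ D > 0, ∀ x ∈ closure Ω, bdist Ω x ≤ D := by
  obtain ⟨D, hD'⟩ := hD.bdd.isCompact_closure.exists_bound_of_continuousOn
    (continuous_bdist (Ω := Ω)).continuousOn
  refine ⟨|D| + 1, by positivity, fun x hx => ?_⟩
  have := hD' x hx
  rw [Real.norm_eq_abs] at this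
  linarith [le_abs_self (bdist Ω x), le_abs_self D]

theorem Dom.comparison_pair (hD : Dom Ω) : ∃ C > 0, ∀ (F G : ℂ → ℝ) (N : ℝ), 0 ≤ N →
    ContinuousOn F (closure Ω) → ContinuousOn G (closure Ω) →
    (∀ x ∈ frontier Ω, F x ≤ 0) → (∀ x ∈ frontier Ω, G x ≤ 0) →
    (∀ x ∈ Ω, ContDiffAt ℝ 2 G x ∧ -N ≤ lap G x) →
    (∀ x ∈ Ω, 0 < F x → ContDiffAt ℝ 2 F x ∧ -N ≤ lap F x + lap G x) →
    ∀ x ∈ Ω, F x + G x ≤ C * N * bdist Ω x ∧ F x + G x ≤ C * N := by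
  obtain ⟨r, hr, hext⟩ := hD.ext
  obtain ⟨C, hC, hw⟩ := exists_barrier hD.bdd hD.ne hr hext
  refine ⟨C, hC, fun F G N hN hFc hGc hFf hGf hG hF x hx => ?_⟩
  obtain ⟨w, hws, hw0, hwl, hwx, hwC⟩ := hw x hx
  have hwN : ContinuousOn (fun x => N * w x) (closure Ω) :=
    continuousOn_const.mul hws.continuous.continuousOn
  have hle : ∀ z ∈ closure Ω, G z - N * w z ≤ 0 := fun z hz => by
    refine max_principle hD.isOpen hD.bdd (F := fun x => G x - N * w x)
      (hGc.sub hwN) (fun z hz => ?_) (fun z hz hpos => ?_) hz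
    · have := mul_nonneg hN (hw0 z (hD.frontier_closure hz))
      linarith [hGf z hz]
    · obtain ⟨hF, hlap⟩ := hG z hz
      have j := (hasJet hF).sub ((hasJet (hws.contDiffAt (x := z))).const_mul N)
      refine ⟨j.smooth, ?_⟩
      rw [j.lap]
      nlinarith [hwl z hz]
  have key : F x + G x - N * w x ≤ 0 := by
    refine max_principle hD.isOpen hD.bdd (F := fun x => F x + G x - N * w x)
      ((hFc.add hGc).sub hwN) (fun z hz => ?_) (fun z hz hpos => ?_) (hD.subset_closure hx)
    · have := mul_nonneg hN (hw0 z (hD.frontier_closure hz))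
      linarith [hFf z hz, hGf z hz]
    · obtain ⟨hF, hlap⟩ := hF z hz (by linarith [hle z (hD.subset_closure hz)])
      have j := ((hasJet hF).add (hasJet (hG z hz).1)).sub
        ((hasJet (hws.contDiffAt (x := z))).const_mul N)
      refine ⟨j.smooth, ?_⟩
      rw [j.lap]
      nlinarith [hwl z hz]
  have h1 : N * w x ≤ N * (C * bdist Ω x) := by gcongr; exact hwx
  have h2 : N * w x ≤ N * C := by gcongr; exact hwC x
  constructor <;> linarith

theorem Dom.comparison (hD : Dom Ω) : ∃ C > 0, ∀ (F : ℂ → ℝ) (N : ℝ), 0 ≤ N →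
    ContinuousOn F (closure Ω) → (∀ x ∈ frontier Ω, F x ≤ 0) →
    (∀ x ∈ Ω, 0 < F x → ContDiffAt ℝ 2 F x ∧ -N ≤ lap F x) →
    ∀ x ∈ Ω, F x ≤ C * N * bdist Ω x ∧ F x ≤ C * N := by
  obtain ⟨C, hC, h⟩ := hD.comparison_pair
  refine ⟨C, hC, fun F N hN hFc hFf hF x hx => ?_⟩
  simpa using h F (fun _ => 0) N hN hFc continuousOn_const hFf (fun _ _ => le_rfl)
    (fun x _ => ⟨contDiffAt_const, by simpa [lap_const] using hN⟩)
    (fun x hx h0 => by simpa [lap_const] using hF x hx h0) x hx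

theorem Dom.layer_comparison (hD : Dom Ω) {ω₀ : ℝ} (hω : 0 < ω₀) : ∃ C > 0, ∃ e₀ > 0,
    ∀ (F : ℂ → ℝ) (N ε : ℝ), 0 ≤ N → 0 < ε → ε ≤ e₀ →
    ContinuousOn F (closure Ω) → (∀ x ∈ frontier Ω, F x ≤ 0) →
    (∀ x ∈ Ω, 0 < F x → ContDiffAt ℝ 2 F x ∧ ω₀ / ε ^ 2 * F x - N ≤ lap F x) →
    ∀ x ∈ Ω, F x ≤ C * N * ε * bdist Ω x ∧ F x ≤ C * N * ε ^ 2 := by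
  obtain ⟨r, hr, hext⟩ := hD.ext
  obtain ⟨C, hC, hw⟩ := exists_layer_barrier hD.bdd hD.ne hr hext
  set ν := min ω₀ (2 * r ^ 2) with hν
  have hν0 : 0 < ν := by positivity
  refine ⟨(C + 1) / ν, by positivity, r ^ 2 / 2, by positivity,
    fun F N ε hN hε hεr hc hfr h x hx => ?_⟩
  obtain ⟨w, hws, hw0, hwl, hwx⟩ := hw ε hε (by linarith) x hx
  set M := N * ε ^ 2 / ν with hM
  have hM0 : 0 ≤ M := by positivity
  have key : F x - M * w x ≤ 0 := by
    refine max_principle hD.isOpen hD.bdd (F := fun x => F x - M * w x)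
      (hc.sub (continuousOn_const.mul hws.continuous.continuousOn)) (fun z hz => ?_)
      (fun z hz hpos => ?_) (hD.subset_closure hx)
    · have := mul_nonneg hM0 (hw0 z (hD.frontier_closure hz)).1
      linarith [hfr z hz]
    · obtain ⟨hz0, hz1⟩ := hw0 z (hD.subset_closure hz)
      have := mul_nonneg hM0 hz0
      obtain ⟨hF, hlap⟩ := h z hz (by linarith)
      have j := (hasJet hF).sub ((hasJet (hws.contDiffAt (x := z))).const_mul M)
      refine ⟨j.smooth, ?_⟩
      rw [j.lap]
      have h1 : ω₀ / ε ^ 2 * (M * w z) ≤ ω₀ / ε ^ 2 * F z := by gcongr; linarith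
      have h2 : M * lap w z ≤ M * (-(2 * r ^ 2 / ε ^ 2) * (1 - w z)) :=
        mul_le_mul_of_nonneg_left (hwl z hz) hM0
      have h3 : N = ν / ε ^ 2 * M * w z + ν / ε ^ 2 * M * (1 - w z) := by
        rw [hM]; field_simp; ring
      have h4 : ν / ε ^ 2 * M * w z ≤ ω₀ / ε ^ 2 * M * w z := by
        gcongr; exact min_le_left _ _
      have h5 : ν / ε ^ 2 * M * (1 - w z) ≤ 2 * r ^ 2 / ε ^ 2 * M * (1 - w z) := by
        have : 0 ≤ 1 - w z := by linarith
        gcongr; exact min_le_right _ _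
      linarith
  have h1 : M * w x ≤ M * (C * bdist Ω x / ε) := by gcongr; exact hwx
  have h2 : M * w x ≤ M * 1 := by gcongr; exact (hw0 x (hD.subset_closure hx)).2
  have hb := bdist_nonneg (Ω := Ω) x
  constructor
  · have : M * (C * bdist Ω x / ε) = C / ν * N * ε * bdist Ω x := by
      rw [hM]; field_simp
    have h3 : C / ν * N * ε * bdist Ω x ≤ (C + 1) / ν * N * ε * bdist Ω x := by
      gcongr; linarith
    linarith
  · have : M * 1 = 1 / ν * N * ε ^ 2 := by rw [hM]; field_simp
    have h3 : 1 / ν * N * ε ^ 2 ≤ (C + 1) / ν * N * ε ^ 2 := by gcongr; linarith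
    linarith

end Compare

section Sol

open scoped ContDiff

/-- Quantitative facts, with a single constant `K`, on the geometry of the tube of radius `δ₁`
around the curve and on the potential there. -/
structure Geom (Γ : Set ℂ) (τ : ℝ → ℂ) (W : ℂ → ℝ) (δ₁ K : ℝ) : Prop where
  arc : ArcParam Γ τ
  one_le : 1 ≤ K
  δ_pos : 0 < δ₁
  δ_le : δ₁ ≤ K
  curv_le : ∀ s, |curv τ s| ≤ K
  deriv_curv_le : ∀ s, |deriv (curv τ) s| ≤ K
  curv_lip : ∀ s s', |curv τ s - curv τ s'| ≤ K * |s - s'|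
  hess_ge : ∀ s, K⁻¹ ≤ wHess W τ s
  hess_le : ∀ s, wHess W τ s ≤ K
  hess_lip : ∀ s s', |wHess W τ s - wHess W τ s'| ≤ K * |s - s'|
  jac_ge : ∀ s t, IsFoot Γ τ s t → |t| ≤ δ₁ → 2 / 3 ≤ 1 - t * curv τ s
  jac_le : ∀ s t, |t| ≤ δ₁ → 1 - t * curv τ s ≤ K
  force_nonneg : ∀ s t, IsFoot Γ τ s t → |t| ≤ δ₁ → 0 ≤ t * wNor W τ s t
  tan_le : ∀ s t, IsFoot Γ τ s t → |t| ≤ δ₁ → |wTan W τ s t| ≤ K * (t * wNor W τ s t)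
  nor_le : ∀ s t, |t| ≤ δ₁ → |wNor W τ s t| ≤ K * |t|
  nor_taylor : ∀ s t, |t| ≤ δ₁ → |wNor W τ s t - wHess W τ s * t| ≤ K * t ^ 2

theorem exists_geom {Γ : Set ℂ} {τ : ℝ → ℂ} {W : ℂ → ℝ} {R₀ δ₁ m K₀ ω₀ : ℝ}
    (h : ArcParam Γ τ) (hW : PotentialHyp Γ W R₀)
    (hmax : MaxPrinciple Γ τ W δ₁ m) (hm : 0 < m) (hδ₁ : 0 < δ₁) (hB : Bounds W τ δ₁ K₀ ω₀) :
    ∃ K, Geom Γ τ W δ₁ K := by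
  have hK₀ := hB.K_pos
  have hω := hB.ω_pos
  set H := 1 + δ₁ * K₀ with hH
  set K := K₀ + ω₀⁻¹ + δ₁ + H + m * H with hK
  have hH0 : 0 < H := by positivity
  have hωi : 0 < ω₀⁻¹ := by positivity
  have hmH : 0 < m * H := by positivity
  have hKK : K₀ ≤ K := by linarith
  have hjac : ∀ s t, |t| ≤ δ₁ → 1 - t * curv τ s ≤ H := fun s t ht => by
    have : |t * curv τ s| ≤ δ₁ * K₀ := by
      rw [abs_mul]; exact mul_le_mul ht (hB.curv s) (abs_nonneg _) hδ₁.le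
    linarith [(abs_le.1 this).1]
  have hH1 : 1 ≤ H := by rw [hH]; have := mul_pos hδ₁ hK₀; linarith
  refine ⟨K, h, by linarith, hδ₁, by linarith, fun s => (hB.curv s).trans hKK,
    fun s => (hB.deriv_curv s).trans hKK,
    fun s s' => (hB.curv_lip s s').trans (by gcongr), fun s => le_trans ?_ (hB.hess_ge s),
    fun s => (hB.hess_le s).trans hKK, fun s s' => (hB.hess_lip s s').trans (by gcongr),
    fun s t hf ht => hf.jacobian_ge h hW hmax hm hδ₁ ht,
    fun s t ht => (hjac s t ht).trans (by linarith),
    fun s t hf ht => hf.mul_wNor_nonneg h hW hmax hm hδ₁ ht,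
    fun s t hf ht => (hf.abs_wTan_le h hW hmax hδ₁ ht).trans ?_,
    fun s t ht => (hB.wNor s t ht).trans (by gcongr),
    fun s t ht => (hB.wNor_taylor s t ht).trans (by gcongr)⟩
  · rw [inv_le_comm₀ (by linarith) hω]; linarith
  · have h1 := hf.mul_wNor_nonneg h hW hmax hm hδ₁ ht
    gcongr
    have h2 : m * (1 - t * curv τ s) ≤ m * H := by gcongr; exact hjac s t ht
    linarith

/-- The squared norm of the gradient of the pair `(t, φ)`. -/
def gsq (t φ : ℂ → ℝ) (x : ℂ) : ℝ := gdot t t x + gdot φ φ x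

/-- Solutions in normal coordinates `(φ, t)`. -/
structure Sol (Γ : Set ℂ) (τ : ℝ → ℂ) (W : ℂ → ℝ) (δ₁ : ℝ) (Ω : Set ℂ) (ζ : ℂ → ℝ) (ε : ℝ)
    (t φ : ℂ → ℝ) : Prop where
  ε_pos : 0 < ε
  contDiff_t : ∀ x ∈ Ω, ContDiffAt ℝ 2 t x
  contDiff_φ : ∀ x ∈ Ω, ContDiffAt ℝ 2 φ x
  cont_t : ContinuousOn t (closure Ω)
  cont_φ : ContinuousOn φ (closure Ω)
  foot : ∀ x ∈ closure Ω, IsFoot Γ τ (φ x) (t x)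
  le : ∀ x ∈ closure Ω, |t x| ≤ δ₁
  bd_t : ∀ x ∈ frontier Ω, t x = 0
  bd_φ : ∀ x ∈ frontier Ω, φ x = ζ x
  eq_φ : ∀ x ∈ Ω, (1 - t x * curv τ (φ x)) * lap φ x - 2 * curv τ (φ x) * gdot t φ x -
    t x * deriv (curv τ) (φ x) * gdot φ φ x = (ε ^ 2)⁻¹ * wTan W τ (φ x) (t x)
  eq_t : ∀ x ∈ Ω, lap t x + (1 - t x * curv τ (φ x)) * curv τ (φ x) * gdot φ φ x =
    (ε ^ 2)⁻¹ * wNor W τ (φ x) (t x)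

variable {Γ : Set ℂ} {τ : ℝ → ℂ} {W : ℂ → ℝ} {δ₁ K : ℝ} {Ω : Set ℂ} {ζ : ℂ → ℝ} {ε : ℝ}
  {t φ : ℂ → ℝ} {x : ℂ}

theorem gsq_nonneg (t φ : ℂ → ℝ) (x : ℂ) : 0 ≤ gsq t φ x :=
  add_nonneg (gdot_self_nonneg t x) (gdot_self_nonneg φ x)

theorem abs_gdot_le (t φ : ℂ → ℝ) (x : ℂ) : 2 * |gdot t φ x| ≤ gsq t φ x := by
  simp only [gsq, gdot]
  rw [← abs_two, ← abs_mul, abs_le]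
  constructor
  · nlinarith [sq_nonneg (dir 1 t x + dir 1 φ x), sq_nonneg (dir I t x + dir I φ x)]
  · nlinarith [sq_nonneg (dir 1 t x - dir 1 φ x), sq_nonneg (dir I t x - dir I φ x)]

theorem Sol.abs_lap_φ_le (hG : Geom Γ τ W δ₁ K) (hS : Sol Γ τ W δ₁ Ω ζ ε t φ) (hD : Dom Ω)
    (hx : x ∈ Ω) : |lap φ x| ≤
      3 * K ^ 2 * (gsq t φ x + (ε ^ 2)⁻¹ * (t x * wNor W τ (φ x) (t x))) := by
  have hxc := hD.subset_closure hx
  have hf := hS.foot x hxc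
  have ht := hS.le x hxc
  have hK := hG.one_le
  have h1 := hG.jac_ge _ _ hf ht
  have h2 := hG.tan_le _ _ hf ht
  have h3 := hG.force_nonneg _ _ hf ht
  have h4 := abs_gdot_le t φ x
  have h5 := gsq_nonneg t φ x
  have h6 : gdot φ φ x ≤ gsq t φ x := by
    have := gdot_self_nonneg t x; simp only [gsq]; linarith
  have h7 := gdot_self_nonneg φ x
  have hε : 0 ≤ (ε ^ 2)⁻¹ := by positivity
  have e : (1 - t x * curv τ (φ x)) * lap φ x = curv τ (φ x) * (2 * gdot t φ x) +
    t x * deriv (curv τ) (φ x) * gdot φ φ x + (ε ^ 2)⁻¹ * wTan W τ (φ x) (t x) := by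
    linarith [hS.eq_φ x hx]
  have b : |(1 - t x * curv τ (φ x)) * lap φ x| ≤ K * gsq t φ x + K * K * gsq t φ x +
      (ε ^ 2)⁻¹ * (K * (t x * wNor W τ (φ x) (t x))) := by
    rw [e]
    refine (abs_add_three _ _ _).trans ?_
    rw [abs_mul, abs_mul (t x * _), abs_mul (t x), abs_mul (ε ^ 2)⁻¹, abs_of_nonneg hε, abs_mul 2,
      abs_two, abs_of_nonneg h7]
    gcongr
    · exact hG.curv_le _
    · exact ht.trans hG.δ_le
    · exact hG.deriv_curv_le _
  rw [abs_mul, abs_of_nonneg (by linarith)] at b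
  have h8 : 2 / 3 * |lap φ x| ≤ (1 - t x * curv τ (φ x)) * |lap φ x| := by gcongr
  have h9 : 0 ≤ (ε ^ 2)⁻¹ * (t x * wNor W τ (φ x) (t x)) := mul_nonneg hε h3
  have h10 : K ≤ K ^ 2 := by nlinarith
  have h11 : K * gsq t φ x ≤ K ^ 2 * gsq t φ x := by gcongr
  have h12 : K * ((ε ^ 2)⁻¹ * (t x * wNor W τ (φ x) (t x))) ≤
    K ^ 2 * ((ε ^ 2)⁻¹ * (t x * wNor W τ (φ x) (t x))) := by gcongr
  nlinarith

theorem Sol.abs_curv_term_le (hG : Geom Γ τ W δ₁ K) (hS : Sol Γ τ W δ₁ Ω ζ ε t φ) (hD : Dom Ω)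
    (hx : x ∈ Ω) :
    |(1 - t x * curv τ (φ x)) * curv τ (φ x) * gdot φ φ x| ≤ K ^ 2 * gsq t φ x := by
  have hxc := hD.subset_closure hx
  have hf := hS.foot x hxc
  have ht := hS.le x hxc
  have hK := hG.one_le
  have h1 := hG.jac_ge _ _ hf ht
  have h6 : gdot φ φ x ≤ gsq t φ x := by
    have := gdot_self_nonneg t x; simp only [gsq]; linarith
  have h7 := gdot_self_nonneg φ x
  rw [abs_mul, abs_mul, abs_of_nonneg h7, abs_of_nonneg (by linarith), _root_.sq]
  gcongr
  · exact hG.jac_le _ _ ht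
  · exact hG.curv_le _

theorem Sol.abs_lap_t_le (hG : Geom Γ τ W δ₁ K) (hS : Sol Γ τ W δ₁ Ω ζ ε t φ) (hD : Dom Ω)
    (hx : x ∈ Ω) : |lap t x| ≤ K ^ 2 * (gsq t φ x + (ε ^ 2)⁻¹ * |t x|) := by
  have hε : 0 ≤ (ε ^ 2)⁻¹ := by positivity
  have hK := hG.one_le
  have b := hS.abs_curv_term_le hG hD hx
  have hn := hG.nor_le (φ x) _ (hS.le x (hD.subset_closure hx))
  have e : lap t x = (ε ^ 2)⁻¹ * wNor W τ (φ x) (t x) -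
    (1 - t x * curv τ (φ x)) * curv τ (φ x) * gdot φ φ x := by linarith [hS.eq_t x hx]
  have h1 : |(ε ^ 2)⁻¹ * wNor W τ (φ x) (t x)| ≤ K ^ 2 * ((ε ^ 2)⁻¹ * |t x|) := by
    rw [abs_mul, abs_of_nonneg hε]
    calc (ε ^ 2)⁻¹ * |wNor W τ (φ x) (t x)| ≤ (ε ^ 2)⁻¹ * (K * |t x|) := by gcongr
      _ = K * ((ε ^ 2)⁻¹ * |t x|) := by ring
      _ ≤ K ^ 2 * ((ε ^ 2)⁻¹ * |t x|) := by gcongr; nlinarith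
  rw [e, mul_add, add_comm (K ^ 2 * _)]
  exact (abs_sub _ _).trans (add_le_add h1 b)

set_option maxHeartbeats 1000000 in
theorem quadratic_bound {h κ κ' σ t k₁ k₂ p q p' q' c a b lφ lt c₀ C₀ K lam c₁ M : ℝ}
    (hσ : σ = 1 ∨ σ = -1) (hc₀ : 0 < c₀) (hK : 1 ≤ K) (hC₀ : 0 < C₀)
    (hh : 2 / 3 ≤ h) (hhK : h ≤ K) (hκ : |κ| ≤ K) (hκ' : |κ'| ≤ K) (ht : |t| ≤ K)
    (hk₁ : |k₁| ≤ C₀) (hc : 0 ≤ c) (htb : 0 ≤ t * b)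
    (hφ : h * lφ - 2 * κ * (p' * p + q' * q) - t * κ' * (p * p + q * q) = c * a)
    (hlt : lt + h * κ * (p * p + q * q) = c * b)
    (hQ : c₀ ≤ k₂ - 2 * κ * k₁ / h + σ * t * κ' * k₁ ^ 2 / h - h * κ * k₁ ^ 3)
    (hF : c₀ * (t * b) ≤ σ * a / h + k₁ * b)
    (hM : M = 3 * K + (2 * K ^ 2 + C₀ * K ^ 2) * (1 + 2 * C₀))
    (hlam : lam = M + M ^ 2 / (2 * c₀) + 1)
    (hc₁ : c₁ = min (1 / 2) (min (c₀ / (2 * (2 * C₀ ^ 2 + 1))) c₀)) :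
    c₁ * ((p' * p' + q' * q' + (p * p + q * q)) + c * (t * b)) ≤
      lam * ((σ * p + p' * k₁) ^ 2 + (σ * q + q' * k₁) ^ 2) +
        (σ * lφ + ((p' ^ 2 + q' ^ 2) * k₂ + lt * k₁)) := by
  have h0 : 0 < h := by linarith
  have hσ2 : σ * σ = 1 := by rcases hσ with rfl | rfl <;> norm_num
  have hσ' : |σ| = 1 := by rcases hσ with rfl | rfl <;> simp
  obtain ⟨P, hP⟩ : ∃ P, P = σ * p + p' * k₁ := ⟨_, rfl⟩
  obtain ⟨Q, hQ'⟩ : ∃ Q, Q = σ * q + q' * k₁ := ⟨_, rfl⟩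
  have hp : p = σ * (P - p' * k₁) := by rw [hP]; linear_combination (-p) * hσ2
  have hq : q = σ * (Q - q' * k₁) := by rw [hQ']; linear_combination (-q) * hσ2
  have elφ : lφ = (c * a + 2 * κ * (p' * p + q' * q) + t * κ' * (p * p + q * q)) / h := by
    rw [eq_div_iff h0.ne']; linarith
  have elt : lt = c * b - h * κ * (p * p + q * q) := by linarith
  have hpp : p * p + q * q = P ^ 2 + Q ^ 2 - 2 * k₁ * (P * p' + Q * q') +
      k₁ ^ 2 * (p' ^ 2 + q' ^ 2) := by
    rw [hp, hq]; linear_combination ((P - p' * k₁) ^ 2 + (Q - q' * k₁) ^ 2) * hσ2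
  have hpq : σ * (p' * p + q' * q) = (P * p' + Q * q') - k₁ * (p' ^ 2 + q' ^ 2) := by
    rw [hp, hq]; linear_combination (p' * (P - p' * k₁) + q' * (Q - q' * k₁)) * hσ2
  obtain ⟨S, hS⟩ : ∃ S, S = P ^ 2 + Q ^ 2 := ⟨_, rfl⟩
  obtain ⟨T, hT⟩ : ∃ T, T = p' ^ 2 + q' ^ 2 := ⟨_, rfl⟩
  obtain ⟨X, hX⟩ : ∃ X, X = P * p' + Q * q' := ⟨_, rfl⟩
  have hS0 : 0 ≤ S := by rw [hS]; positivity
  have hT0 : 0 ≤ T := by rw [hT]; positivity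
  have hXST : X ^ 2 ≤ S * T := by
    rw [hX, hS, hT]; nlinarith [sq_nonneg (P * q' - Q * p')]
  have e : σ * lφ + (T * k₂ + lt * k₁) =
      T * (k₂ - 2 * κ * k₁ / h + σ * t * κ' * k₁ ^ 2 / h - h * κ * k₁ ^ 3) +
      (2 * κ / h * X + (σ * t * κ' / h - k₁ * h * κ) * (S - 2 * k₁ * X)) +
      c * (σ * a / h + k₁ * b) := by
    have : σ * lφ = (c * (σ * a) + 2 * κ * (σ * (p' * p + q' * q)) +
      σ * t * κ' * (p * p + q * q)) / h := by rw [elφ]; ring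
    rw [this, elt, hpq, hpp, ← hS, ← hT, ← hX]
    field_simp
    ring
  have hinv : h⁻¹ ≤ 3 / 2 := by
    rw [inv_le_comm₀ h0 (by norm_num)]; linarith
  have b1 : |2 * κ / h| ≤ 3 * K := by
    rw [abs_div, abs_mul, abs_two, abs_of_pos h0, div_eq_mul_inv]
    calc 2 * |κ| * h⁻¹ ≤ 2 * K * (3 / 2) := by gcongr
      _ = _ := by ring
  have b2 : |σ * t * κ' / h - k₁ * h * κ| ≤ 2 * K ^ 2 + C₀ * K ^ 2 := by
    refine (abs_sub _ _).trans (add_le_add ?_ ?_)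
    · rw [abs_div, abs_mul, abs_mul, hσ', abs_of_pos h0, div_eq_mul_inv]
      calc 1 * |t| * |κ'| * h⁻¹ ≤ 1 * K * K * (3 / 2) := by gcongr
        _ = 3 / 2 * K ^ 2 := by ring
        _ ≤ _ := by linarith [_root_.sq_nonneg K]
    · rw [abs_mul, abs_mul, abs_of_pos h0]
      calc |k₁| * h * |κ| ≤ C₀ * K * K := by gcongr
        _ = _ := by ring
  set y := Real.sqrt S * Real.sqrt T with hy
  have hXy : |X| ≤ y := by
    rw [hy, ← Real.sqrt_mul hS0]; exact Real.abs_le_sqrt hXST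
  have hy0 : 0 ≤ y := by positivity
  have hN : 0 ≤ 2 * K ^ 2 + C₀ * K ^ 2 := by positivity
  have b3 : |2 * κ / h * X + (σ * t * κ' / h - k₁ * h * κ) * (S - 2 * k₁ * X)| ≤
      M * (S + y) := by
    refine (abs_add_le _ _).trans ?_
    rw [abs_mul, abs_mul (σ * t * κ' / h - _)]
    have b4 : |S - 2 * k₁ * X| ≤ S + 2 * C₀ * y := by
      refine (abs_sub _ _).trans ?_
      rw [abs_of_nonneg hS0, abs_mul, abs_mul, abs_two]
      gcongr
    calc |2 * κ / h| * |X| + |σ * t * κ' / h - k₁ * h * κ| * |S - 2 * k₁ * X|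
        ≤ 3 * K * y + (2 * K ^ 2 + C₀ * K ^ 2) * (S + 2 * C₀ * y) := by gcongr
      _ ≤ M * (S + y) := by
        rw [hM]
        have : 0 ≤ 3 * K * S := by positivity
        have := mul_nonneg (mul_nonneg hN hC₀.le) hS0
        have := mul_nonneg hN hy0
        linarith
  have hM0 : 0 ≤ M := by rw [hM]; positivity
  have b5 : M * y ≤ c₀ / 2 * T + M ^ 2 / (2 * c₀) * S := by
    have h1 := Real.sq_sqrt hS0
    have h2 := Real.sq_sqrt hT0
    have h3 : 0 ≤ (c₀ * Real.sqrt T - M * Real.sqrt S) ^ 2 / (2 * c₀) := by positivity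
    have h4 : (c₀ * Real.sqrt T - M * Real.sqrt S) ^ 2 / (2 * c₀) =
        c₀ / 2 * T + M ^ 2 / (2 * c₀) * S - M * y := by
      rw [hy, div_eq_iff (by positivity)]
      field_simp
      linear_combination c₀ ^ 2 * h2 + M ^ 2 * h1
    linarith
  have b6 := (abs_le.1 b3).1
  have b7 : T * c₀ ≤
      T * (k₂ - 2 * κ * k₁ / h + σ * t * κ' * k₁ ^ 2 / h - h * κ * k₁ ^ 3) := by gcongr
  have b8 : c * (c₀ * (t * b)) ≤ c * (σ * a / h + k₁ * b) := by gcongr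
  have c1 : c₁ ≤ 1 / 2 := hc₁ ▸ min_le_left _ _
  have c2 : c₁ * (2 * (2 * C₀ ^ 2 + 1)) ≤ c₀ := by
    rw [← le_div_iff₀ (by positivity), hc₁]
    exact (min_le_right _ _).trans (min_le_left _ _)
  have c3 : c₁ ≤ c₀ := hc₁ ▸ (min_le_right _ _).trans (min_le_right _ _)
  have c0 : 0 < c₁ := by rw [hc₁]; positivity
  have b9 : p * p + q * q ≤ 2 * S + 2 * C₀ ^ 2 * T := by
    have : -(2 * k₁ * X) ≤ S + k₁ ^ 2 * T := by
      have : 0 ≤ (P + k₁ * p') ^ 2 + (Q + k₁ * q') ^ 2 := by positivity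
      rw [hS, hT, hX]; linear_combination this
    have h1 : k₁ ^ 2 * T ≤ C₀ ^ 2 * T := by
      exact mul_le_mul_of_nonneg_right (sq_le_sq' (abs_le.1 hk₁).1 (abs_le.1 hk₁).2) hT0
    rw [hpp, ← hS, ← hT, ← hX]; linarith
  have b10 : c₁ * (p' * p' + q' * q' + (p * p + q * q)) ≤ S + c₀ / 2 * T := by
    have : p' * p' + q' * q' = T := by rw [hT]; ring
    rw [this]
    have h1 : c₁ * (T + (p * p + q * q)) ≤ c₁ * (T + (2 * S + 2 * C₀ ^ 2 * T)) := by gcongr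
    have h2 : c₁ * S ≤ 1 / 2 * S := by gcongr
    have h3 : c₁ * (2 * (2 * C₀ ^ 2 + 1)) * T ≤ c₀ * T := by gcongr
    linarith
  have b11 : c₁ * (c * (t * b)) ≤ c * (c₀ * (t * b)) := by
    have h1 : c₁ * (c * (t * b)) ≤ c₀ * (c * (t * b)) := by gcongr
    linear_combination h1
  rw [← hP, ← hQ', ← hS, ← hT, e, hlam]
  linear_combination b5 + b6 + b7 + b8 + b10 + b11

end Sol

section Sub

open scoped ContDiff

variable {Γ : Set ℂ} {τ : ℝ → ℂ} {W : ℂ → ℝ} {δ₁ K c₀ C₀ : ℝ} {Ω : Set ℂ} {ζ : ℂ → ℝ}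
  {k k₁ k₂ : ℝ → ℝ}

/-- The subharmonic function attached to a profile. -/
def subsol (k : ℝ → ℝ) (lam σ : ℝ) (t φ : ℂ → ℝ) (x : ℂ) : ℝ :=
  Real.exp (lam * (σ * φ x + k (t x)))

/-- The normal force, `ε⁻² t ∂W/∂n`. -/
def force (W : ℂ → ℝ) (τ : ℝ → ℂ) (ε : ℝ) (t φ : ℂ → ℝ) (x : ℂ) : ℝ :=
  (ε ^ 2)⁻¹ * (t x * wNor W τ (φ x) (t x))

theorem Sol.force_nonneg {ε : ℝ} {t φ : ℂ → ℝ} {x : ℂ} (hG : Geom Γ τ W δ₁ K)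
    (hS : Sol Γ τ W δ₁ Ω ζ ε t φ) (hx : x ∈ closure Ω) : 0 ≤ force W τ ε t φ x :=
  mul_nonneg (by positivity) (hG.force_nonneg _ _ (hS.foot x hx) (hS.le x hx))

theorem exists_subsol (hG : Geom Γ τ W δ₁ K) (hP : Profile Γ τ W δ₁ k k₁ k₂ c₀ C₀) :
    ∃ lam > 0, ∃ c₁ > 0, ∀ (Ω : Set ℂ) (ζ : ℂ → ℝ) (ε : ℝ) (t φ : ℂ → ℝ), Dom Ω →
      Sol Γ τ W δ₁ Ω ζ ε t φ → ∀ σ : ℝ, σ = 1 ∨ σ = -1 → ∀ x ∈ Ω,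
      ContDiffAt ℝ 2 (subsol k lam σ t φ) x ∧
      c₁ * (gsq t φ x + force W τ ε t φ x) * subsol k lam σ t φ x ≤
        lap (subsol k lam σ t φ) x := by
  have hK := hG.one_le
  have hc₀ := hP.c_pos
  have hC₀ := hP.C_pos
  obtain ⟨M, hM⟩ : ∃ M, M = 3 * K + (2 * K ^ 2 + C₀ * K ^ 2) * (1 + 2 * C₀) := ⟨_, rfl⟩
  have hM0 : 0 < M := by rw [hM]; positivity
  obtain ⟨lam, hlam⟩ : ∃ lam, lam = M + M ^ 2 / (2 * c₀) + 1 := ⟨_, rfl⟩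
  have hlam0 : 0 < lam := by rw [hlam]; positivity
  obtain ⟨c₁, hc₁⟩ : ∃ c₁, c₁ = min (1 / 2) (min (c₀ / (2 * (2 * C₀ ^ 2 + 1))) c₀) := ⟨_, rfl⟩
  have hc₁0 : 0 < c₁ := by rw [hc₁]; positivity
  refine ⟨lam, hlam0, lam * c₁, by positivity, fun Ω ζ ε t φ hD hS σ hσ x hx => ?_⟩
  have hxc := hD.subset_closure hx
  have hf := hS.foot x hxc
  have ht := hS.le x hxc
  have hk' : deriv k = k₁ := funext fun t => (hP.deriv1 t).deriv
  have hk'' : deriv (deriv k) (t x) = k₂ (t x) := by rw [hk']; exact (hP.deriv2 _).deriv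
  have j := ((((hasJet (hS.contDiff_φ x hx)).const_mul σ).add
    ((hasJet (hS.contDiff_t x hx)).comp (contDiff_infty.1 hP.smooth 2).contDiffAt
      (congrFun hk' _) hk'')).const_mul lam).exp
  refine ⟨j.smooth, ?_⟩
  have hq := quadratic_bound hσ hc₀ hK hC₀ (hG.jac_ge _ _ hf ht) (hG.jac_le _ _ ht)
    (hG.curv_le _) (hG.deriv_curv_le _) (ht.trans hG.δ_le) (hP.deriv_le _ ht)
    (by positivity : 0 ≤ (ε ^ 2)⁻¹) (hG.force_nonneg _ _ hf ht) (hS.eq_φ x hx) (hS.eq_t x hx)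
    (hP.quad _ _ _ hf ht hσ) (hP.force _ _ _ hf ht hσ) hM hlam hc₁
  have e : lap (subsol k lam σ t φ) x = _ := j.lap
  rw [e, subsol]
  refine mul_le_mul_of_nonneg_right ?_ (Real.exp_pos _).le
  have hq' := mul_le_mul_of_nonneg_left hq hlam0.le
  simp only [gsq, gdot, force]
  linear_combination hq'

/-- Bounds on the limiting phase `ζ`. -/
structure Phase (Ω : Set ℂ) (ζ : ℂ → ℝ) (Z : ℝ) : Prop where
  smooth : ContDiff ℝ ∞ ζ
  harm : ∀ x ∈ Ω, lap ζ x = 0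
  Z_pos : 0 < Z
  le : ∀ x ∈ closure Ω, |ζ x| ≤ Z
  grad_le : ∀ x ∈ closure Ω, gdot ζ ζ x ≤ Z

variable {Z : ℝ}

theorem Phase.contDiffAt (hζ : Phase Ω ζ Z) (x : ℂ) : ContDiffAt ℝ 2 ζ x :=
  (contDiff_infty.1 hζ.smooth 2).contDiffAt

theorem continuous_dir {f : ℂ → ℝ} (hf : ContDiff ℝ ∞ f) (e : ℂ) : Continuous (dir e f) :=
  ((hf.continuous_fderiv (by simp)).clm_apply continuous_const)

theorem exists_phase (hD : Dom Ω) (hs : ContDiff ℝ ∞ ζ) (hh : ∀ x ∈ Ω, lap ζ x = 0) :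
    ∃ Z, Phase Ω ζ Z := by
  obtain ⟨Z₁, h1⟩ := hD.bdd.isCompact_closure.exists_bound_of_continuousOn
    hs.continuous.continuousOn
  have hg : Continuous (gdot ζ ζ) := by
    have := continuous_dir hs 1
    have := continuous_dir hs I
    unfold gdot; fun_prop
  obtain ⟨Z₂, h2⟩ := hD.bdd.isCompact_closure.exists_bound_of_continuousOn hg.continuousOn
  refine ⟨|Z₁| + |Z₂| + 1, hs, hh, by positivity, fun x hx => ?_, fun x hx => ?_⟩
  · have := h1 x hx
    rw [Real.norm_eq_abs] at this
    linarith [le_abs_self Z₁, abs_nonneg Z₂]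
  · have := h2 x hx
    rw [Real.norm_eq_abs] at this
    linarith [le_abs_self Z₂, abs_nonneg Z₁, le_abs_self (gdot ζ ζ x)]

/-- Uniform bounds for the solutions. -/
structure Apriori (W : ℂ → ℝ) (τ : ℝ → ℂ) (Ω : Set ℂ) (ζ : ℂ → ℝ) (k : ℝ → ℝ) (lam c₁ A : ℝ)
    (ε : ℝ) (t φ : ℂ → ℝ) : Prop where
  phase : ∀ x ∈ closure Ω, |φ x| ≤ A
  sub : ∀ σ : ℝ, σ = 1 ∨ σ = -1 → ∀ x ∈ Ω, ContDiffAt ℝ 2 (subsol k lam σ t φ) x ∧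
    c₁ * (gsq t φ x + force W τ ε t φ x) ≤ lap (subsol k lam σ t φ) x
  dev : ∀ x ∈ Ω, |φ x - ζ x| ≤ A * bdist Ω x
  dist : ∀ x ∈ Ω, |t x| ≤ A * bdist Ω x

theorem Profile.nonneg (hP : Profile Γ τ W δ₁ k k₁ k₂ c₀ C₀) (t : ℝ) : 0 ≤ k t :=
  (mul_nonneg hP.c_pos.le (sq_nonneg t)).trans (hP.ge t)

theorem Profile.le_mul (hP : Profile Γ τ W δ₁ k k₁ k₂ c₀ C₀) {t : ℝ} (ht : |t| ≤ δ₁) :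
    k t ≤ C₀ * |t| :=
  (le_abs_self _).trans (abs_le_of_deriv_abs_le hP.deriv1 hP.zero
    fun r hr => hP.deriv_le r (hr.trans ht))

theorem Sol.continuousOn_subsol {ε : ℝ} {t φ : ℂ → ℝ} (hP : Profile Γ τ W δ₁ k k₁ k₂ c₀ C₀)
    (hS : Sol Γ τ W δ₁ Ω ζ ε t φ) (lam σ : ℝ) : ContinuousOn (subsol k lam σ t φ) (closure Ω) :=
  Real.continuous_exp.comp_continuousOn (continuousOn_const.mul
    ((continuousOn_const.mul hS.cont_φ).add (hP.smooth.continuous.comp_continuousOn hS.cont_t)))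

theorem exists_apriori (hG : Geom Γ τ W δ₁ K) (hP : Profile Γ τ W δ₁ k k₁ k₂ c₀ C₀) (hD : Dom Ω)
    (hζ : Phase Ω ζ Z) : ∃ lam > 0, ∃ c₁ > 0, ∃ A > 0, ∀ (ε : ℝ) (t φ : ℂ → ℝ),
      Sol Γ τ W δ₁ Ω ζ ε t φ → Apriori W τ Ω ζ k lam c₁ A ε t φ := by
  obtain ⟨lam, hlam, c₁', hc₁', hsub⟩ := exists_subsol hG hP
  obtain ⟨C, hC, hcomp⟩ := hD.comparison_pair
  have hZ := hζ.Z_pos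
  set E := Real.exp (lam * Z) with hE
  have hE0 : 0 < E := Real.exp_pos _
  set c₁ := c₁' * Real.exp (-(lam * Z)) with hc₁
  have hc₁0 : 0 < c₁ := by positivity
  set N := lam ^ 2 * Z * E with hN
  have hN0 : 0 < N := by positivity
  set B := C * N * E / lam with hB
  have hB0 : 0 < B := by positivity
  set Λ := K ^ 2 / c₁ + 1 with hΛ
  have hΛ0 : 0 < Λ := by positivity
  set A := Z + B + (C * (Λ * N) + Λ * (E * lam * B)) with hA
  refine ⟨lam, hlam, c₁, hc₁0, A, by positivity, fun ε t φ hS => ?_⟩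
  have hσabs : ∀ σ : ℝ, σ = 1 ∨ σ = -1 → ∀ y : ℝ, σ * y ≤ |y| := fun σ hσ y => by
    rcases hσ with rfl | rfl
    · simpa using le_abs_self y
    · simpa using neg_le_abs y
  have hs0 : ∀ σ : ℝ, σ = 1 ∨ σ = -1 → ∀ x ∈ Ω, 0 ≤ lap (subsol k lam σ t φ) x :=
    fun σ hσ x hx => by
      refine le_trans ?_ (hsub Ω ζ ε t φ hD hS σ hσ x hx).2
      have := hS.force_nonneg hG (hD.subset_closure hx)
      have := gsq_nonneg t φ x
      have := (Real.exp_pos (lam * (σ * φ x + k (t x)))).le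
      unfold subsol; positivity
  have hup : ∀ σ : ℝ, σ = 1 ∨ σ = -1 → ∀ x ∈ closure Ω, σ * φ x + k (t x) ≤ Z :=
    fun σ hσ x hx => by
      have h1 : subsol k lam σ t φ x - E ≤ 0 := by
        refine max_principle hD.isOpen hD.bdd (F := fun x => subsol k lam σ t φ x - E)
          ((hS.continuousOn_subsol hP lam σ).sub continuousOn_const) (fun z hz => ?_)
          (fun z hz _ => ?_) hx
        · rw [sub_nonpos, subsol, hE, Real.exp_le_exp, hS.bd_t z hz, hP.zero, hS.bd_φ z hz,
            add_zero]
          gcongr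
          exact (hσabs σ hσ _).trans (hζ.le z (hD.frontier_closure hz))
        · have j := (hasJet (hsub Ω ζ ε t φ hD hS σ hσ z hz).1).sub (hasJet_const E z)
          refine ⟨j.smooth, ?_⟩
          rw [j.lap, sub_zero]
          exact hs0 σ hσ z hz
      rw [sub_nonpos, subsol, hE, Real.exp_le_exp] at h1
      exact le_of_mul_le_mul_left h1 hlam
  have hφZ : ∀ x ∈ closure Ω, |φ x| ≤ Z := fun x hx => by
    have h1 := hup 1 (.inl rfl) x hx
    have h2 := hup (-1) (.inr rfl) x hx
    have h3 := hP.nonneg (t x)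
    rw [abs_le]; constructor <;> linarith
  have hlow : ∀ σ : ℝ, σ = 1 ∨ σ = -1 → ∀ x ∈ Ω,
      c₁ * (gsq t φ x + force W τ ε t φ x) ≤ lap (subsol k lam σ t φ) x := fun σ hσ x hx => by
    refine le_trans ?_ (hsub Ω ζ ε t φ hD hS σ hσ x hx).2
    have h1 := hS.force_nonneg hG (hD.subset_closure hx)
    have h2 := gsq_nonneg t φ x
    have h3 : Real.exp (-(lam * Z)) ≤ subsol k lam σ t φ x := by
      rw [subsol, Real.exp_le_exp, ← mul_neg]
      gcongr
      have h4 := hσabs (-σ) (by rcases hσ with rfl | rfl <;> simp) (φ x)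
      have h5 := hP.nonneg (t x)
      linarith [hφZ x (hD.subset_closure hx)]
    rw [hc₁, mul_right_comm]
    gcongr
  have jζ : ∀ σ : ℝ, ∀ x, HasJet (fun y => Real.exp (lam * (σ * ζ y))) x _ _ _ := fun σ x =>
    (((hasJet (hζ.contDiffAt x)).const_mul σ).const_mul lam).exp
  have hζE : ∀ σ : ℝ, σ = 1 ∨ σ = -1 → ∀ x ∈ closure Ω, Real.exp (lam * (σ * ζ x)) ≤ E :=
    fun σ hσ x hx => by
      rw [hE, Real.exp_le_exp]
      gcongr
      exact (hσabs σ hσ _).trans (hζ.le x hx)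
  have hζl : ∀ σ : ℝ, σ = 1 ∨ σ = -1 → ∀ x ∈ Ω,
      lap (fun y => Real.exp (lam * (σ * ζ y))) x ≤ N := fun σ hσ x hx => by
    rw [(jζ σ x).lap, hζ.harm x hx]
    have h1 := hζ.grad_le x (hD.subset_closure hx)
    have h2 := gdot_self_nonneg ζ x
    have hσ2 : σ ^ 2 = 1 := by rcases hσ with rfl | rfl <;> norm_num
    have h3 : ((lam * (σ * dir 1 ζ x)) ^ 2 + (lam * (σ * dir I ζ x)) ^ 2 + lam * (σ * 0)) =
        lam ^ 2 * gdot ζ ζ x := by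
      simp only [gdot]
      linear_combination (lam ^ 2 * (dir 1 ζ x ^ 2 + dir I ζ x ^ 2)) * hσ2
    rw [h3, hN]
    gcongr
    exact hζE σ hσ x (hD.subset_closure hx)
  set G : ℝ → ℂ → ℝ := fun σ x => subsol k lam σ t φ x - Real.exp (lam * (σ * ζ x)) with hGdef
  have hGc : ∀ σ, ContinuousOn (G σ) (closure Ω) := fun σ =>
    (hS.continuousOn_subsol hP lam σ).sub (Continuous.continuousOn
      (by have := hζ.smooth.continuous; fun_prop))
  have hGf : ∀ σ, ∀ x ∈ frontier Ω, G σ x ≤ 0 := fun σ x hx => by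
    simp [hGdef, subsol, hS.bd_t x hx, hP.zero, hS.bd_φ x hx]
  have jG : ∀ σ : ℝ, σ = 1 ∨ σ = -1 → ∀ x ∈ Ω, HasJet (G σ) x _ _ _ := fun σ hσ x hx =>
    (hasJet (hsub Ω ζ ε t φ hD hS σ hσ x hx).1).sub (hasJet (jζ σ x).smooth)
  have hdev : ∀ σ : ℝ, σ = 1 ∨ σ = -1 → ∀ x ∈ Ω, σ * (φ x - ζ x) ≤ B * bdist Ω x :=
    fun σ hσ x hx => by
      have h1 := (hcomp (fun _ => 0) (G σ) N hN0.le continuousOn_const (hGc σ) (fun _ _ => le_rfl)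
        (hGf σ) (fun x hx => ⟨(jG σ hσ x hx).smooth, by
          rw [(jG σ hσ x hx).lap]
          linarith [hs0 σ hσ x hx, hζl σ hσ x hx]⟩)
        (fun x hx h => absurd h (lt_irrefl 0)) x hx).1
      have h2 : Real.exp (lam * (σ * ζ x)) * (lam * (σ * (φ x - ζ x) + k (t x))) ≤ G σ x := by
        have h3 := Real.add_one_le_exp (lam * (σ * (φ x - ζ x) + k (t x)))
        have h4 : subsol k lam σ t φ x = Real.exp (lam * (σ * ζ x)) *
            Real.exp (lam * (σ * (φ x - ζ x) + k (t x))) := by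
          rw [subsol, ← Real.exp_add]; congr 1; ring
        simp only [hGdef]
        rw [h4]
        nlinarith [Real.exp_pos (lam * (σ * ζ x))]
      rw [zero_add] at h1
      have h5 : lam * (σ * (φ x - ζ x) + k (t x)) ≤ E * (C * N * bdist Ω x) := by
        have hb := bdist_nonneg (Ω := Ω) x
        have h6 := hζE (-σ) (by rcases hσ with rfl | rfl <;> simp) x (hD.subset_closure hx)
        have h7 : Real.exp (lam * (-σ * ζ x)) * Real.exp (lam * (σ * ζ x)) = 1 := by
          rw [← Real.exp_add]; simp
        calc _ = Real.exp (lam * (-σ * ζ x)) *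
              (Real.exp (lam * (σ * ζ x)) * (lam * (σ * (φ x - ζ x) + k (t x)))) := by
              rw [← mul_assoc, h7, one_mul]
          _ ≤ Real.exp (lam * (-σ * ζ x)) * (C * N * bdist Ω x) := by
              exact mul_le_mul_of_nonneg_left (h2.trans h1) (Real.exp_pos _).le
          _ ≤ _ := by gcongr
      have h8 := hP.nonneg (t x)
      have h9 : lam * (σ * (φ x - ζ x)) ≤ lam * (B * bdist Ω x) := by
        have : lam * (B * bdist Ω x) = E * (C * N * bdist Ω x) := by
          rw [hB]; field_simp
        have := mul_nonneg hlam.le h8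
        linarith
      exact le_of_mul_le_mul_left h9 hlam
  have hdev' : ∀ x ∈ Ω, |φ x - ζ x| ≤ B * bdist Ω x := fun x hx => by
    have h1 := hdev 1 (.inl rfl) x hx
    have h2 := hdev (-1) (.inr rfl) x hx
    rw [abs_le]; constructor <;> linarith
  refine ⟨fun x hx => (hφZ x hx).trans (by rw [hA]; linarith [show 0 < C * (Λ * N) + Λ * (E * lam * B) by positivity]),
    fun σ hσ x hx => ⟨(hsub Ω ζ ε t φ hD hS σ hσ x hx).1, hlow σ hσ x hx⟩,
    fun x hx => (hdev' x hx).trans ?_, fun x hx => ?_⟩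
  · have hb := bdist_nonneg (Ω := Ω) x
    gcongr
    rw [hA]; linarith [show 0 < C * (Λ * N) + Λ * (E * lam * B) by positivity]
  · have hb := bdist_nonneg (Ω := Ω) x
    have key : ∀ σ : ℝ, σ = 1 ∨ σ = -1 →
        σ * t x ≤ (C * (Λ * N) + Λ * (E * lam * B)) * bdist Ω x := fun σ hσ => by
      have h1 := (hcomp (fun x => σ * t x) (fun x => Λ * G 1 x) (Λ * N) (by positivity)
        (continuousOn_const.mul hS.cont_t) (continuousOn_const.mul (hGc 1))
        (fun x hx => by simp [hS.bd_t x hx])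
        (fun x hx => mul_nonpos_of_nonneg_of_nonpos hΛ0.le (hGf 1 x hx))
        (fun x hx => by
          have j := (jG 1 (.inl rfl) x hx).const_mul Λ
          refine ⟨j.smooth, ?_⟩
          rw [j.lap, ← mul_neg]
          gcongr
          linarith [hs0 1 (.inl rfl) x hx, hζl 1 (.inl rfl) x hx])
        (fun x hx hpos => by
          have j := (jG 1 (.inl rfl) x hx).const_mul Λ
          have jt := (hasJet (hS.contDiff_t x hx)).const_mul σ
          refine ⟨jt.smooth, ?_⟩
          rw [j.lap, jt.lap]
          have hxc := hD.subset_closure hx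
          have e1 := hS.eq_t x hx
          have e2 := hS.abs_curv_term_le hG hD hx
          have e3 := hG.force_nonneg _ _ (hS.foot x hxc) (hS.le x hxc)
          have e4 : 0 ≤ σ * wNor W τ (φ x) (t x) := by
            have hσ2 : σ * σ = 1 := by rcases hσ with rfl | rfl <;> norm_num
            refine nonneg_of_mul_nonneg_right (a := σ * t x) ?_ hpos
            calc 0 ≤ t x * wNor W τ (φ x) (t x) := e3
              _ = _ := by linear_combination (-(t x * wNor W τ (φ x) (t x))) * hσ2
          have e5 : 0 ≤ (ε ^ 2)⁻¹ * (σ * wNor W τ (φ x) (t x)) := mul_nonneg (by positivity) e4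
          have e6 := hσabs σ hσ
            ((1 - t x * curv τ (φ x)) * curv τ (φ x) * gdot φ φ x)
          have e7 : σ * lap t x = (ε ^ 2)⁻¹ * (σ * wNor W τ (φ x) (t x)) -
              σ * ((1 - t x * curv τ (φ x)) * curv τ (φ x) * gdot φ φ x) := by
            linear_combination σ * e1
          have e8 := hlow 1 (.inl rfl) x hx
          have e9 := hS.force_nonneg hG hxc
          have e10 := gsq_nonneg t φ x
          have e11 : K ^ 2 * gsq t φ x ≤ Λ * lap (subsol k lam 1 t φ) x := by
            calc K ^ 2 * gsq t φ x ≤ (K ^ 2 + c₁) * (gsq t φ x + force W τ ε t φ x) := by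
                  gcongr <;> linarith
              _ = Λ * (c₁ * (gsq t φ x + force W τ ε t φ x)) := by rw [hΛ]; field_simp
              _ ≤ _ := by gcongr
          have e12 := mul_le_mul_of_nonneg_left (hζl 1 (.inl rfl) x hx) hΛ0.le
          rw [mul_sub]
          linarith) x hx).1
      have h2 : -(E * lam * (B * bdist Ω x)) ≤ G 1 x := by
        have h3 := Real.add_one_le_exp (lam * (1 * (φ x - ζ x) + k (t x)))
        have h4 : subsol k lam 1 t φ x = Real.exp (lam * (1 * ζ x)) *
            Real.exp (lam * (1 * (φ x - ζ x) + k (t x))) := by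
          rw [subsol, ← Real.exp_add]; congr 1; ring
        have h5 := hζE 1 (.inl rfl) x (hD.subset_closure hx)
        have h6 := (abs_le.1 (hdev' x hx)).1
        have h7 := hP.nonneg (t x)
        have h8 := Real.exp_pos (lam * (1 * ζ x))
        have h9 : Real.exp (lam * (1 * ζ x)) * (lam * -(B * bdist Ω x)) ≤ G 1 x := by
          simp only [hGdef]
          rw [h4]
          have : Real.exp (lam * (1 * ζ x)) * (lam * -(B * bdist Ω x) + 1) ≤
            Real.exp (lam * (1 * ζ x)) * Real.exp (lam * (1 * (φ x - ζ x) + k (t x))) := by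
            gcongr
            refine le_trans ?_ h3
            gcongr
            linarith
          linarith
        have h10 : Real.exp (lam * (1 * ζ x)) * (lam * (B * bdist Ω x)) ≤
          E * (lam * (B * bdist Ω x)) := by gcongr
        linarith
      have h3 : Λ * -(E * lam * (B * bdist Ω x)) ≤ Λ * G 1 x := by gcongr
      linarith
    have h1 := key 1 (.inl rfl)
    have h2 := key (-1) (.inr rfl)
    have h3 : (C * (Λ * N) + Λ * (E * lam * B)) * bdist Ω x ≤ A * bdist Ω x := by
      gcongr; rw [hA]; linarith
    rw [abs_le]; constructor <;> linarith

end Sub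

section Grad

open scoped ContDiff

variable {Γ : Set ℂ} {τ : ℝ → ℂ} {W : ℂ → ℝ} {δ₁ K c₀ C₀ R₀ Z : ℝ} {Ω : Set ℂ} {ζ : ℂ → ℝ}
  {k k₁ k₂ : ℝ → ℝ} {x : ℂ}

theorem dir_clm {F : Type*} [NormedAddCommGroup F] [NormedSpace ℝ F] (L : ℂ →L[ℝ] F) {v : ℂ → ℂ}
    (hv : DifferentiableAt ℝ v x) (e : ℂ) : dir e (fun y => L (v y)) x = L (dir e v x) := by
  have := (L.hasFDerivAt.comp x hv.hasFDerivAt).fderiv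
  exact congrArg (fun T : ℂ →L[ℝ] F => T e) this

theorem lap_clm {F : Type*} [NormedAddCommGroup F] [NormedSpace ℝ F] (L : ℂ →L[ℝ] F) {v : ℂ → ℂ}
    (hv : ContDiffAt ℝ 2 v x) : lap (fun y => L (v y)) x = L (lap v x) := by
  have h : ∀ e : ℂ, dir e (dir e fun y => L (v y)) x = L (dir e (dir e v) x) := fun e => by
    have h1 : dir e (fun y => L (v y)) =ᶠ[𝓝 x] fun y => L (dir e v y) :=
      (eventually_differentiableAt hv).mono fun y hy => dir_clm L hy e
    rw [dir_congr h1, dir_clm L]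
    exact ((ContDiffAt.dir (n := 1) (by simpa [one_add_one_eq_two] using hv) e).differentiableAt
      (by simp))
  simp only [lap, h, map_add]

theorem interior_gradient_complex {v : ℂ → ℂ} {d M N : ℝ} (hd : 0 < d)
    (hv : ∀ y ∈ ball x d, ContDiffAt ℝ 2 v y) (hM : ∀ y ∈ ball x d, ‖v y‖ ≤ M)
    (hN : ∀ y ∈ ball x d, ‖lap v y‖ ≤ N) :
    ‖fderiv ℝ v x‖ ≤ 4 * (4 * M / d + N * d / 4) := by
  have hx := differentiableAt_of_two (hv x (mem_ball_self hd))
  have h1 := interior_gradient (v := fun y => reCLM (v y)) hd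
    (fun y hy => reCLM.contDiff.contDiffAt.comp y (hv y hy))
    (fun y hy => (abs_re_le_norm _).trans (hM y hy))
    (fun y hy => by rw [lap_clm _ (hv y hy)]; exact (abs_re_le_norm _).trans (hN y hy))
  have h2 := interior_gradient (v := fun y => imCLM (v y)) hd
    (fun y hy => imCLM.contDiff.contDiffAt.comp y (hv y hy))
    (fun y hy => (abs_im_le_norm _).trans (hM y hy))
    (fun y hy => by rw [lap_clm _ (hv y hy)]; exact (abs_im_le_norm _).trans (hN y hy))
  rw [dir_clm _ hx, dir_clm _ hx] at h1 h2
  have h3 := norm_fderiv_le v x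
  have h4 := norm_le_abs_re_add_abs_im (dir 1 v x)
  have h5 := norm_le_abs_re_add_abs_im (dir I v x)
  simp only [reCLM_apply, imCLM_apply] at h1 h2
  linarith [h1.1, h1.2, h2.1, h2.2]

/-- A map `u` with normal coordinates `(φ, t)`, solving the Ginzburg–Landau equation. -/
structure Lift (Γ : Set ℂ) (τ : ℝ → ℂ) (W : ℂ → ℝ) (Ω : Set ℂ) (ε : ℝ) (u : ℂ → ℂ)
    (t φ : ℂ → ℝ) : Prop where
  smooth : ContDiff ℝ ∞ u
  eq_tube : ∀ x ∈ closure Ω, u x = tube τ (φ x) (t x)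
  dist_eq : ∀ x ∈ closure Ω, |t x| = infDist (u x) Γ
  lap_eq : ∀ x ∈ Ω, lap u x = (ε ^ 2)⁻¹ • gradW W (u x)

variable {ε : ℝ} {u : ℂ → ℂ} {t φ : ℂ → ℝ}

theorem Lift.gsq_le (hL : Lift Γ τ W Ω ε u t φ) (hG : Geom Γ τ W δ₁ K)
    (hS : Sol Γ τ W δ₁ Ω ζ ε t φ) (hD : Dom Ω) (hx : x ∈ Ω) :
    gsq t φ x ≤ 5 * ‖fderiv ℝ u x‖ ^ 2 := by
  have hxc := hD.subset_closure hx
  have hev : u =ᶠ[𝓝 x] fun y => tube τ (φ y) (t y) :=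
    eventually_of_mem (hD.isOpen.mem_nhds hx) fun y hy => hL.eq_tube y (hD.subset_closure hy)
  have hh := hG.jac_ge _ _ (hS.foot x hxc) (hS.le x hxc)
  have key : ∀ e : ℂ, ‖e‖ = 1 →
      dir e t x * dir e t x + dir e φ x * dir e φ x ≤ 9 / 4 * ‖fderiv ℝ u x‖ ^ 2 := by
    intro e he
    have h1 : dir e u x = (((1 - t x * curv τ (φ x)) * dir e φ x : ℝ) + (dir e t x : ℝ) * I) *
        deriv τ (φ x) := by
      rw [dir_congr hev, dir_tube hG.arc (hS.contDiff_φ x hx) (hS.contDiff_t x hx), nrm]; ring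
    have h2 : ‖dir e u x‖ ^ 2 = ((1 - t x * curv τ (φ x)) * dir e φ x) ^ 2 + dir e t x ^ 2 := by
      rw [h1, norm_mul, hG.arc.arclength, mul_one, ← normSq_eq_norm_sq, normSq_add_mul_I]
    have h3 : ‖dir e u x‖ ≤ ‖fderiv ℝ u x‖ := by
      simpa [he, dir] using (fderiv ℝ u x).le_opNorm e
    have h4 : ‖dir e u x‖ ^ 2 ≤ ‖fderiv ℝ u x‖ ^ 2 := by gcongr
    have h5 : (2 / 3 : ℝ) ^ 2 * dir e φ x ^ 2 ≤ (1 - t x * curv τ (φ x)) ^ 2 * dir e φ x ^ 2 := by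
      gcongr
    nlinarith [_root_.sq_nonneg (dir e t x)]
  have h1 := key 1 (by simp)
  have hI := key I (by simp)
  simp only [gsq, gdot]
  nlinarith [_root_.sq_nonneg ‖fderiv ℝ u x‖]

theorem Geom.norm_sub_le (hG : Geom Γ τ W δ₁ K) (s s' : ℝ) : ‖τ s - τ s'‖ ≤ |s - s'| := by
  have h := Convex.norm_image_sub_le_of_norm_deriv_le (s := univ) (f := τ) (C := 1)
    (fun x _ => hG.arc.smooth.differentiable (by simp) x) (fun x _ => (hG.arc.arclength x).le)
    convex_univ (mem_univ s') (mem_univ s)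
  simpa using h

theorem exists_gradient_bound (hW : PotentialHyp Γ W R₀) (hG : Geom Γ τ W δ₁ K) (hD : Dom Ω)
    (hζ : Phase Ω ζ Z) {lam c₁ A : ℝ} (hA : 0 < A) : ∃ C > 0, ∀ (ε : ℝ) (t φ : ℂ → ℝ) (u : ℂ → ℂ),
      Sol Γ τ W δ₁ Ω ζ ε t φ → Apriori W τ Ω ζ k lam c₁ A ε t φ → Lift Γ τ W Ω ε u t φ →
      ∀ x ∈ Ω, ‖fderiv ℝ u x‖ ≤ C * (1 + ε⁻¹) := by
  obtain ⟨D, hD0, hDb⟩ := hD.exists_bdist_le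
  obtain ⟨T, hT0, hT⟩ := exists_norm_le_of_periodic Real.two_pi_pos hG.arc.periodic
    hG.arc.smooth.continuous
  obtain ⟨N₁, hN₁⟩ := (isCompact_closedBall (0 : ℂ) (T + δ₁)).exists_bound_of_continuousOn
    (contDiff_gradW hW.smooth).continuous.continuousOn
  have hb : ContDiff ℝ ∞ fun y => τ (ζ y) := hG.arc.smooth.comp hζ.smooth
  obtain ⟨N₂, hN₂⟩ := hD.bdd.isCompact_closure.exists_bound_of_continuousOn
    (contDiff_lap hb).continuous.continuousOn
  obtain ⟨N₃, hN₃⟩ := hD.bdd.isCompact_closure.exists_bound_of_continuousOn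
    (hb.continuous_fderiv (by simp)).continuousOn
  have hN : ∃ N > 0, N₁ ≤ N ∧ N₂ ≤ N ∧ N₃ ≤ N := ⟨|N₁| + |N₂| + |N₃| + 1, by positivity, by
    linarith [le_abs_self N₁, abs_nonneg N₂, abs_nonneg N₃], by
    linarith [le_abs_self N₂, abs_nonneg N₁, abs_nonneg N₃], by
    linarith [le_abs_self N₃, abs_nonneg N₂, abs_nonneg N₁]⟩
  obtain ⟨N, hN0, h1N, h2N, h3N⟩ := hN
  refine ⟨4 * (16 * A + 8 * A * D + N + N * D) + N, by positivity,
    fun ε t φ u hS hA' hL x hx => ?_⟩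
  have hε := hS.ε_pos
  have hd := hD.bdist_pos hx
  have hdD := hDb x (hD.subset_closure hx)
  set v : ℂ → ℂ := fun y => u y - τ (ζ y) with hv
  have hvs : ContDiff ℝ ∞ v := hL.smooth.sub hb
  have hvle : ∀ y ∈ Ω, ‖v y‖ ≤ 2 * A * bdist Ω y := fun y hy => by
    have h1 : v y = (τ (φ y) - τ (ζ y)) - (τ (φ y) - tube τ (φ y) (t y)) := by
      rw [hv]; simp only [hL.eq_tube y (hD.subset_closure hy)]; ring
    rw [h1]
    refine (norm_sub_le _ _).trans ?_
    rw [norm_sub_tube hG.arc]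
    linarith [hG.norm_sub_le (φ y) (ζ y), hA'.dev y hy, hA'.dist y hy]
  have hvlap : ∀ y ∈ Ω, ‖lap v y‖ ≤ N * (ε ^ 2)⁻¹ + N := fun y hy => by
    have hyc := hD.subset_closure hy
    rw [hv, lap_sub (contDiff_infty.1 hL.smooth 2).contDiffAt (contDiff_infty.1 hb 2).contDiffAt,
      hL.lap_eq y hy]
    refine (norm_sub_le _ _).trans (add_le_add ?_ ((hN₂ y hyc).trans h2N))
    rw [norm_smul, Real.norm_of_nonneg (by positivity), mul_comm]
    gcongr
    refine (hN₁ _ ?_).trans h1N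
    rw [mem_closedBall_zero_iff, hL.eq_tube y hyc]
    have h1 : tube τ (φ y) (t y) = τ (φ y) - (τ (φ y) - tube τ (φ y) (t y)) := by ring
    rw [h1]
    refine (norm_sub_le _ _).trans ?_
    rw [norm_sub_tube hG.arc]
    exact add_le_add (hT _) (hS.le y hyc)
  have huv : ‖fderiv ℝ u x‖ ≤ ‖fderiv ℝ v x‖ + N := by
    have h1 : fderiv ℝ v x = fderiv ℝ u x - fderiv ℝ (fun y => τ (ζ y)) x :=
      fderiv_fun_sub (hL.smooth.differentiable (by simp) x) (hb.differentiable (by simp) x)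
    have h2 : fderiv ℝ u x = fderiv ℝ v x + fderiv ℝ (fun y => τ (ζ y)) x := by rw [h1]; abel
    rw [h2]
    exact (norm_add_le _ _).trans (add_le_add le_rfl ((hN₃ x (hD.subset_closure hx)).trans h3N))
  have hei : 0 < ε⁻¹ := by positivity
  have hmain : ‖fderiv ℝ v x‖ ≤ 4 * (16 * A + 8 * A * D + N + N * D) * (1 + ε⁻¹) := by
    have hp1 : 0 ≤ A * ε⁻¹ := by positivity
    have hp2 : 0 ≤ A * D := by positivity
    have hp3 : 0 ≤ N * D := by positivity
    have hp4 : 0 ≤ A * D * ε⁻¹ := by positivity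
    have hp5 : 0 ≤ N * D * ε⁻¹ := by positivity
    have hp6 : 0 ≤ N * ε⁻¹ := by positivity
    have hsq : (ε ^ 2)⁻¹ * ε = ε⁻¹ := by field_simp
    rcases le_total (bdist Ω x) ε with hle | hle
    · have hsub := hD.ball_subset hx
      have h1 := interior_gradient_complex (v := v) hd
        (fun y _ => (contDiff_infty.1 hvs 2).contDiffAt)
        (M := 2 * A * (2 * bdist Ω x)) (fun y hy => (hvle y (hsub hy)).trans (by
          have := bdist_le_add (Ω := Ω) y x
          rw [mem_ball, dist_eq_norm] at hy
          gcongr; linarith)) (fun y hy => hvlap y (hsub hy))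
      refine h1.trans ?_
      have h2 : 4 * (2 * A * (2 * bdist Ω x)) / bdist Ω x = 16 * A := by field_simp; norm_num
      have h3 : N * (ε ^ 2)⁻¹ * bdist Ω x ≤ N * ε⁻¹ := by
        rw [mul_assoc, ← hsq]; gcongr
      have h4 : N * bdist Ω x ≤ N * D := by gcongr
      rw [h2]
      linarith
    · have hsub := hD.ball_subset_of_le hx hle
      have h1 := interior_gradient_complex (v := v) hε
        (fun y _ => (contDiff_infty.1 hvs 2).contDiffAt)
        (M := 2 * A * D) (fun y hy => (hvle y (hsub hy)).trans (by
          have := hDb y (hD.subset_closure (hsub hy))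
          gcongr)) (fun y hy => hvlap y (hsub hy))
      refine h1.trans ?_
      have h2 : 4 * (2 * A * D) / ε = 8 * (A * D * ε⁻¹) := by field_simp; norm_num
      have h3 : N * (ε ^ 2)⁻¹ * ε = N * ε⁻¹ := by rw [mul_assoc, hsq]
      have h4 : N * ε ≤ N * D := by gcongr; exact hle.trans hdD
      rw [h2, add_mul, h3]
      linarith
  have : 0 ≤ N * ε⁻¹ := by positivity
  linarith

end Grad

section Small

open scoped ContDiff

theorem le_sub_of_le_lap {v : ℂ → ℝ} {x z : ℂ} {σ q M : ℝ} (hσ : 0 < σ)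
    (hc : ∀ y ∈ closedBall x σ, ContDiffAt ℝ 2 v y) (hq : ∀ y ∈ ball x σ, q ≤ lap v y)
    (hM : ∀ y ∈ closedBall x σ, v y ≤ M) (hz : z ∈ closedBall x σ) :
    v z ≤ M - q / 4 * (σ ^ 2 - ‖z - x‖ ^ 2) := by
  have hs : ∀ y, ContDiffAt ℝ 2 (fun y : ℂ => q / 4 * ‖y - x‖ ^ 2) y := fun y =>
    contDiffAt_const.mul (contDiff_norm_sq_sub x).contDiffAt
  have hcl : closure (ball x σ) = closedBall x σ := closure_ball x hσ.ne'
  have h := max_principle (Ω := ball x σ)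
    (F := fun y => (v y - q / 4 * ‖y - x‖ ^ 2) + (q / 4 * σ ^ 2 - M)) isOpen_ball isBounded_ball
    (hcl ▸ fun y hy => (((hc y hy).sub (hs y)).add contDiffAt_const).continuousAt.continuousWithinAt)
    (fun y hy => by
      rw [frontier_ball x hσ.ne', mem_sphere, dist_eq_norm] at hy
      have := hM y (by rw [mem_closedBall, dist_eq_norm, hy])
      simp only [hy]; linarith)
    (fun y hy _ => ⟨((hc y (ball_subset_closedBall hy)).sub (hs y)).add contDiffAt_const, by
      have h1 := hc y (ball_subset_closedBall hy)
      have h2 : lap (fun y : ℂ => q / 4 * ‖y - x‖ ^ 2) y = q := by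
        have := lap_const_smul (q / 4) (g := fun y : ℂ => ‖y - x‖ ^ 2) (x := y)
          (contDiff_norm_sq_sub x).contDiffAt
        rw [lap_norm_sq] at this
        simp only [smul_eq_mul] at this
        rw [this]; ring
      rw [lap_add (h1.sub (hs y)) contDiffAt_const, lap_sub h1 (hs y), h2, lap_const]
      linarith [hq y hy]⟩) (hcl ▸ hz)
  linarith

/-- A bounded subharmonic function cannot have a large Laplacian on a small ball. -/
theorem lap_mul_sq_le {v : ℂ → ℝ} {x : ℂ} {σ R q M : ℝ} (hσ : 0 < σ) (hR : σ < R)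
    (hc : ∀ y ∈ closedBall x R, ContDiffAt ℝ 2 v y) (hs : ∀ y ∈ ball x R, 0 ≤ lap v y)
    (h0 : 0 ≤ v x) (hM : ∀ y ∈ closedBall x R, v y ≤ M)
    (hq0 : 0 ≤ q) (hq : ∀ y ∈ ball x σ, q ≤ lap v y) :
    3 / 16 * (q * σ ^ 2) * Real.log (2 * R / σ) ≤ M * Real.log 2 := by
  have hsub : closedBall x σ ⊆ closedBall x R := closedBall_subset_closedBall hR.le
  obtain ⟨z₁, hz₁, hmax⟩ := (isCompact_closedBall x σ).exists_isMaxOn (nonempty_closedBall.2 hσ.le)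
    (fun y hy => (hc y (hsub hy)).continuousAt.continuousWithinAt)
  have hquad := fun {z} (hz : z ∈ closedBall x σ) => le_sub_of_le_lap hσ
    (fun y hy => hc y (hsub hy)) hq (fun y hy => hmax hy) hz
  have hhalf : ∀ y ∈ closedBall x (σ / 2), v y ≤ v z₁ - 3 / 16 * (q * σ ^ 2) := fun y hy => by
    have h1 := hquad (closedBall_subset_closedBall (half_le_self hσ.le) hy)
    rw [mem_closedBall, dist_eq_norm] at hy
    have h2 : ‖y - x‖ ^ 2 ≤ (σ / 2) ^ 2 := by gcongr
    have h3 : q / 4 * ‖y - x‖ ^ 2 ≤ q / 4 * (σ / 2) ^ 2 := by gcongr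
    linarith
  have hz1' : ‖z₁ - x‖ ≤ σ := by rwa [mem_closedBall, dist_eq_norm] at hz₁
  have hMz := hM z₁ (hsub hz₁)
  have hx0 := hhalf x (mem_closedBall_self (by positivity))
  have hqs : 0 ≤ 3 / 16 * (q * σ ^ 2) := by positivity
  have hl2 : 0 < Real.log 2 := Real.log_pos one_lt_two
  have hR0 := hσ.trans hR
  have hlog : 0 < Real.log (2 * R / σ) := Real.log_pos ((one_lt_div hσ).2 (by linarith))
  rcases le_or_gt (σ / 2) ‖z₁ - x‖ with hle | hlt
  · have h1 := three_circles (half_pos hσ) ((half_le_self hσ.le).trans_lt hR) hc hs hhalf hM hle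
      (hz1'.trans hR.le)
    rw [show R / (σ / 2) = 2 * R / σ by field_simp] at h1
    have h2 : Real.log (‖z₁ - x‖ / (σ / 2)) ≤ Real.log 2 :=
      Real.log_le_log (by have := half_pos hσ; have := this.trans_le hle; positivity)
        ((div_le_iff₀ (by positivity)).2 (by linarith))
    have h3 : (M - (v z₁ - 3 / 16 * (q * σ ^ 2))) * (Real.log (‖z₁ - x‖ / (σ / 2)) /
        Real.log (2 * R / σ)) ≤ M * (Real.log 2 / Real.log (2 * R / σ)) := by
      have h4 : 0 ≤ Real.log (‖z₁ - x‖ / (σ / 2)) := Real.log_nonneg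
        ((one_le_div (by positivity)).2 hle)
      gcongr
      · linarith
      · linarith
    have h5 : 3 / 16 * (q * σ ^ 2) ≤ M * (Real.log 2 / Real.log (2 * R / σ)) := by linarith
    rwa [← mul_div_assoc, le_div_iff₀ hlog] at h5
  · have h1 := hhalf z₁ (by rw [mem_closedBall, dist_eq_norm]; exact hlt.le)
    have h2 : 3 / 16 * (q * σ ^ 2) = 0 := by linarith
    rw [h2, zero_mul]
    have : 0 ≤ M := by linarith
    positivity

variable {Γ : Set ℂ} {τ : ℝ → ℂ} {W : ℂ → ℝ} {δ₁ K c₀ C₀ R₀ Z : ℝ} {Ω : Set ℂ} {ζ : ℂ → ℝ}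
  {k k₁ k₂ : ℝ → ℝ} {x : ℂ}

theorem Geom.mul_wNor_ge (hG : Geom Γ τ W δ₁ K) {s t : ℝ} (ht : |t| ≤ δ₁)
    (ht' : |t| ≤ (2 * K ^ 2)⁻¹) : (2 * K)⁻¹ * t ^ 2 ≤ t * wNor W τ s t := by
  have hK := hG.one_le
  have h1 := hG.nor_taylor s t ht
  have h2 := hG.hess_ge s
  have h3 : t * wNor W τ s t = wHess W τ s * t ^ 2 + t * (wNor W τ s t - wHess W τ s * t) := by
    ring
  have h4 : |t * (wNor W τ s t - wHess W τ s * t)| ≤ (2 * K ^ 2)⁻¹ * (K * t ^ 2) := by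
    rw [abs_mul]; gcongr
  have h5 : (2 * K ^ 2)⁻¹ * (K * t ^ 2) = (2 * K)⁻¹ * t ^ 2 := by field_simp
  have h6 : K⁻¹ * t ^ 2 ≤ wHess W τ s * t ^ 2 := by gcongr
  have h7 : K⁻¹ * t ^ 2 = (2 * K)⁻¹ * t ^ 2 + (2 * K)⁻¹ * t ^ 2 := by field_simp; norm_num
  linarith [(abs_le.1 h4).1]

theorem Apriori.subsol_le {lam c₁ A ε : ℝ} {t φ : ℂ → ℝ} (hlam : 0 < lam)
    (hP : Profile Γ τ W δ₁ k k₁ k₂ c₀ C₀)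
    (hS : Sol Γ τ W δ₁ Ω ζ ε t φ) (hA : Apriori W τ Ω ζ k lam c₁ A ε t φ) {σ : ℝ}
    (hσ : σ = 1 ∨ σ = -1) (hx : x ∈ closure Ω) :
    subsol k lam σ t φ x ≤ Real.exp (lam * (A + C₀ * δ₁)) := by
  have h1 := hA.phase x hx
  have h2 := hP.le_mul (hS.le x hx)
  have h3 := hS.le x hx
  have hC := hP.C_pos
  have h4 : σ * φ x ≤ A := by
    rcases hσ with rfl | rfl <;> linarith [(abs_le.1 h1).1, (abs_le.1 h1).2]
  rw [subsol]
  gcongr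
  exact h2.trans (by gcongr)

theorem Lift.abs_sub_le {ε : ℝ} {u : ℂ → ℂ} {t φ : ℂ → ℝ} (hL : Lift Γ τ W Ω ε u t φ) {y z : ℂ}
    (hy : y ∈ closure Ω) (hz : z ∈ closure Ω) : |t z| ≤ |t y| + ‖u z - u y‖ := by
  rw [hL.dist_eq z hz, hL.dist_eq y hy, ← dist_eq_norm]
  exact infDist_le_infDist_add_dist

set_option maxHeartbeats 400000 in
/-- The solutions converge uniformly to the curve as `ε → 0`. -/
theorem exists_small (hW : PotentialHyp Γ W R₀) (hG : Geom Γ τ W δ₁ K)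
    (hP : Profile Γ τ W δ₁ k k₁ k₂ c₀ C₀) (hD : Dom Ω)
    (hζ : Phase Ω ζ Z) {lam c₁ A : ℝ} (hlam : 0 < lam) (hc₁ : 0 < c₁) (hA : 0 < A) {a : ℝ}
    (ha : 0 < a) : ∃ ε₁ > 0, ∀ (ε : ℝ) (t φ : ℂ → ℝ) (u : ℂ → ℂ), ε ≤ ε₁ →
      Sol Γ τ W δ₁ Ω ζ ε t φ → Apriori W τ Ω ζ k lam c₁ A ε t φ → Lift Γ τ W Ω ε u t φ →
      ∀ x ∈ closure Ω, |t x| ≤ a := by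
  obtain ⟨C, hC, hgrad⟩ := exists_gradient_bound (k := k) (lam := lam) (c₁ := c₁) hW hG hD hζ hA
  have hK := hG.one_le
  obtain ⟨b, hb0, hba, hbK⟩ : ∃ b > 0, b ≤ a ∧ b ≤ (2 * K ^ 2)⁻¹ :=
    ⟨min a (2 * K ^ 2)⁻¹, by positivity, min_le_left _ _, min_le_right _ _⟩
  set d₀ := b / (2 * A) with hd₀
  have hd₀0 : 0 < d₀ := by positivity
  set θ := b / (8 * C) with hθ
  have hθ0 : 0 < θ := by positivity
  set q₀ := c₁ * ((2 * K)⁻¹ * (b / 4) ^ 2) with hq₀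
  have hq0 : 0 < q₀ := by positivity
  set M := Real.exp (lam * (A + C₀ * δ₁)) with hM
  have hM0 : 0 < M := Real.exp_pos _
  set Λ := M * Real.log 2 / (3 / 16 * (q₀ * θ ^ 2)) with hΛ
  obtain ⟨ε₁, hε₁⟩ : ∃ ε₁, ε₁ = min 1 (min (d₀ / (4 * θ)) (d₀ / (2 * θ * Real.exp Λ))) := ⟨_, rfl⟩
  refine ⟨ε₁, by rw [hε₁]; positivity, fun ε t φ u hε hS hAp hL x hx => ?_⟩
  have hε0 := hS.ε_pos
  have e1 : ε ≤ 1 := hε.trans (hε₁ ▸ min_le_left _ _)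
  have e2 : ε * (4 * θ) ≤ d₀ := (le_div_iff₀ (by positivity)).1
    (hε.trans (hε₁ ▸ (min_le_right _ _).trans (min_le_left _ _)))
  have e3 : ε * (2 * θ * Real.exp Λ) ≤ d₀ := (le_div_iff₀ (by positivity)).1
    (hε.trans (hε₁ ▸ (min_le_right _ _).trans (min_le_right _ _)))
  by_contra! hlt
  obtain ⟨p, hp⟩ := hD.ne
  have hconn : IsPreconnected (closure Ω) := hD.conn.closure
  obtain ⟨y, hyc, hy⟩ := hconn.intermediate_value (hD.frontier_closure hp) hx hS.cont_t.abs
    (show b / 2 ∈ Icc |t p| |t x| by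
      rw [hS.bd_t p hp, abs_zero]; exact ⟨by positivity, by linarith⟩)
  have hyΩ : y ∈ Ω := by
    by_contra hn
    have := hS.bd_t y (by rw [hD.isOpen.frontier_eq]; exact ⟨hyc, hn⟩)
    simp only [this, abs_zero] at hy
    linarith
  have hdy : d₀ ≤ bdist Ω y := by
    have := hAp.dist y hyΩ
    rw [hd₀, div_le_iff₀ (by positivity)]
    simp only at hy
    linarith
  have hball := hD.ball_subset_of_le hyΩ hdy
  have hσ0 : 0 < θ * ε := by positivity
  have hσd : θ * ε < d₀ / 2 := by linarith
  have hcb : closedBall y (d₀ / 2) ⊆ Ω :=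
    (closedBall_subset_ball (half_lt_self hd₀0)).trans hball
  have hsmall : ball y (θ * ε) ⊆ Ω :=
    (ball_subset_ball (by linarith)).trans hball
  have hei : 1 + ε⁻¹ ≤ 2 * ε⁻¹ := by
    have := (one_le_inv₀ hε0).2 e1; linarith
  have hlip : ∀ z ∈ ball y (θ * ε), ‖u z - u y‖ ≤ b / 4 := fun z hz => by
    have h1 := (convex_ball y (θ * ε)).norm_image_sub_le_of_norm_fderiv_le (𝕜 := ℝ) (f := u)
      (fun w _ => hL.smooth.differentiable (by simp) w)
      (fun w hw => hgrad ε t φ u hS hAp hL w (hsmall hw)) (mem_ball_self hσ0) hz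
    rw [mem_ball, dist_eq_norm] at hz
    refine h1.trans ?_
    calc C * (1 + ε⁻¹) * ‖z - y‖ ≤ C * (2 * ε⁻¹) * (θ * ε) := by gcongr
      _ = b / 4 := by rw [hθ]; field_simp; norm_num
  have hforce : ∀ z ∈ ball y (θ * ε), q₀ * (ε ^ 2)⁻¹ ≤ lap (subsol k lam 1 t φ) z := fun z hz => by
    have hzc := hD.subset_closure (hsmall hz)
    have h1 := hL.abs_sub_le hyc hzc
    have h2 := hL.abs_sub_le hzc hyc
    rw [norm_sub_rev] at h2
    have h3 := hlip z hz
    simp only at hy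
    have h4 : b / 4 ≤ |t z| := by linarith
    have h5 : |t z| ≤ b := by linarith
    have h6 := hG.mul_wNor_ge (s := φ z) (hS.le z hzc) (h5.trans hbK)
    have h7 : (b / 4) ^ 2 ≤ t z ^ 2 := by rw [← sq_abs (t z)]; gcongr
    refine le_trans ?_ (hAp.sub 1 (Or.inl rfl) z (hsmall hz)).2
    have h8 : (2 * K)⁻¹ * (b / 4) ^ 2 ≤ t z * wNor W τ (φ z) (t z) := le_trans (by gcongr) h6
    have h9 := gsq_nonneg t φ z
    rw [hq₀, mul_assoc]
    refine mul_le_mul_of_nonneg_left ?_ hc₁.le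
    rw [force]
    have : (2 * K)⁻¹ * (b / 4) ^ 2 * (ε ^ 2)⁻¹ ≤ (ε ^ 2)⁻¹ * (t z * wNor W τ (φ z) (t z)) := by
      rw [mul_comm]; gcongr
    linarith
  have hfin := lap_mul_sq_le (v := subsol k lam 1 t φ) hσ0 hσd
    (fun z hz => (hAp.sub 1 (Or.inl rfl) z (hcb hz)).1)
    (fun z hz => by
      have hzΩ := hcb (ball_subset_closedBall hz)
      refine le_trans ?_ (hAp.sub 1 (Or.inl rfl) z hzΩ).2
      have := gsq_nonneg t φ z
      have := hS.force_nonneg hG (hD.subset_closure hzΩ)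
      positivity)
    (Real.exp_pos _).le (fun z hz => hAp.subsol_le hlam hP hS (Or.inl rfl)
      (hD.subset_closure (hcb hz))) (by positivity) hforce
  have h1 : q₀ * (ε ^ 2)⁻¹ * (θ * ε) ^ 2 = q₀ * θ ^ 2 := by field_simp
  rw [h1, ← hM] at hfin
  have h2 : Λ + Real.log 2 ≤ Real.log (2 * (d₀ / 2) / (θ * ε)) := by
    rw [Real.le_log_iff_exp_le (by positivity), Real.exp_add, Real.exp_log two_pos,
      le_div_iff₀ hσ0]
    linarith
  have h3 : 3 / 16 * (q₀ * θ ^ 2) * Λ = M * Real.log 2 := by rw [hΛ]; field_simp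
  have h4 : 0 < 3 / 16 * (q₀ * θ ^ 2) := by positivity
  have h5 := mul_le_mul_of_nonneg_left h2 h4.le
  have h6 := mul_pos h4 (Real.log_pos one_lt_two)
  rw [mul_add] at h5
  linarith

end Small

section GradB

open scoped ContDiff

variable {Γ : Set ℂ} {τ : ℝ → ℂ} {W : ℂ → ℝ} {δ₁ K c₀ C₀ R₀ Z : ℝ} {Ω : Set ℂ} {ζ : ℂ → ℝ}
  {k k₁ k₂ : ℝ → ℝ} {x : ℂ}

theorem norm_fderiv_le_of_gdot_le {f : ℂ → ℝ} {S : ℝ} (hS : 0 ≤ S) (h : gdot f f x ≤ S ^ 2) :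
    ‖fderiv ℝ f x‖ ≤ 2 * S := by
  have h1 : |dir 1 f x| ≤ S := abs_le_of_sq_le_sq (by
    simp only [gdot] at h; linarith [mul_self_nonneg (dir I f x), _root_.sq (dir 1 f x)]) hS
  have h2 : |dir I f x| ≤ S := abs_le_of_sq_le_sq (by
    simp only [gdot] at h; linarith [mul_self_nonneg (dir 1 f x), _root_.sq (dir I f x)]) hS
  have := norm_fderiv_le f x
  rw [Real.norm_eq_abs, Real.norm_eq_abs] at this
  linarith

theorem gdot_φ_le_gsq (t φ : ℂ → ℝ) (x : ℂ) : gdot φ φ x ≤ gsq t φ x := by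
  have := gdot_self_nonneg t x; simp only [gsq]; linarith

/-- The normal coordinate is of order `ε² S` when the gradients are bounded by `S`. -/
theorem exists_layer_bound (hG : Geom Γ τ W δ₁ K) (hD : Dom Ω) :
    ∃ C > 0, ∃ e₀ > 0, ∀ (ζ : ℂ → ℝ) (ε S : ℝ) (t φ : ℂ → ℝ), ε ≤ e₀ → 0 ≤ S →
      Sol Γ τ W δ₁ Ω ζ ε t φ → (∀ x ∈ closure Ω, |t x| ≤ (2 * K ^ 2)⁻¹) →
      (∀ x ∈ Ω, gsq t φ x ≤ S) →
      ∀ x ∈ Ω, |t x| ≤ C * S * ε * bdist Ω x ∧ |t x| ≤ C * S * ε ^ 2 := by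
  have hK := hG.one_le
  obtain ⟨C, hC, e₀, he₀, hcomp⟩ := hD.layer_comparison (show 0 < (2 * K)⁻¹ by positivity)
  refine ⟨C * K ^ 2, by positivity, e₀, he₀, fun ζ ε S t φ hε hS0 hS hsm hSb => ?_⟩
  have key : ∀ σ : ℝ, σ = 1 ∨ σ = -1 → ∀ x ∈ Ω, σ * t x ≤ C * (K ^ 2 * S) * ε * bdist Ω x ∧
      σ * t x ≤ C * (K ^ 2 * S) * ε ^ 2 := by
    intro σ hσ
    refine hcomp (fun y => σ * t y) (K ^ 2 * S) ε (by positivity) hS.ε_pos hε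
      (continuousOn_const.mul hS.cont_t) (fun y hy => by simp [hS.bd_t y hy]) fun y hy hpos => ?_
    have hyc := hD.subset_closure hy
    have j := (hasJet (hS.contDiff_t y hy)).const_mul σ
    refine ⟨j.smooth, ?_⟩
    have e : lap (fun y => σ * t y) y = _ := j.lap
    rw [e]
    have h1 := hS.abs_curv_term_le hG hD hy
    have h2 := hG.mul_wNor_ge (s := φ y) (hS.le y hyc) (hsm y hyc)
    have h3 : (2 * K)⁻¹ * (σ * t y) ≤ σ * wNor W τ (φ y) (t y) := by
      have hσ2 : σ * σ = 1 := by rcases hσ with rfl | rfl <;> norm_num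
      have h4 : (σ * t y) * ((2 * K)⁻¹ * (σ * t y)) ≤ (σ * t y) * (σ * wNor W τ (φ y) (t y)) := by
        linear_combination h2 + ((2 * K)⁻¹ * t y ^ 2 - t y * wNor W τ (φ y) (t y)) * hσ2
      exact le_of_mul_le_mul_left h4 hpos
    have h5 : lap t y = (ε ^ 2)⁻¹ * wNor W τ (φ y) (t y) -
      (1 - t y * curv τ (φ y)) * curv τ (φ y) * gdot φ φ y := by linarith [hS.eq_t y hy]
    have hε : 0 ≤ (ε ^ 2)⁻¹ := by positivity
    have h6 := mul_le_mul_of_nonneg_left h3 hε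
    have h7 : K ^ 2 * gsq t φ y ≤ K ^ 2 * S :=
      mul_le_mul_of_nonneg_left (hSb y hy) (by positivity)
    have h8 : σ * ((1 - t y * curv τ (φ y)) * curv τ (φ y) * gdot φ φ y) ≤ K ^ 2 * S := by
      refine le_trans ?_ (h1.trans h7)
      rcases hσ with rfl | rfl
      · rw [one_mul]; exact le_abs_self _
      · rw [neg_one_mul]; exact neg_le_abs _
    rw [h5, div_eq_mul_inv]
    linear_combination h6 + h8
  intro x hx
  have h1 := key 1 (Or.inl rfl) x hx
  have h2 := key (-1) (Or.inr rfl) x hx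
  rw [← mul_assoc] at h1 h2
  exact ⟨abs_le'.2 ⟨by linarith, by linarith⟩, abs_le'.2 ⟨by linarith, by linarith⟩⟩

/-- The Laplacians are of order `S` when the gradients are bounded by `S`. -/
theorem exists_lap_bound (hG : Geom Γ τ W δ₁ K) (hD : Dom Ω) :
    ∃ C > 0, ∃ e₀ > 0, ∀ (ζ : ℂ → ℝ) (ε S : ℝ) (t φ : ℂ → ℝ), ε ≤ e₀ → 0 ≤ S →
      Sol Γ τ W δ₁ Ω ζ ε t φ → (∀ x ∈ closure Ω, |t x| ≤ (2 * K ^ 2)⁻¹) →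
      (∀ x ∈ Ω, gsq t φ x ≤ S) →
      ∀ x ∈ Ω, |lap t x| ≤ C * S ∧ |lap φ x| ≤ C * S := by
  have hK := hG.one_le
  have hδ := hG.δ_pos
  obtain ⟨C, hC, e₀, he₀, h⟩ := exists_layer_bound hG hD
  refine ⟨3 * K ^ 2 * (1 + K ^ 2 * C + C), by positivity, e₀, he₀,
    fun ζ ε S t φ hε hS0 hS hsm hSb x hx => ?_⟩
  have hε0 := hS.ε_pos
  have h1 := (h ζ ε S t φ hε hS0 hS hsm hSb x hx).2
  have ht := hS.le x (hD.subset_closure hx)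
  have h2 : (ε ^ 2)⁻¹ * |t x| ≤ C * S := by
    rw [inv_mul_le_iff₀ (by positivity)]; linarith
  have h3 : t x * wNor W τ (φ x) (t x) ≤ K ^ 2 * |t x| := by
    refine (le_abs_self _).trans ?_
    rw [abs_mul]
    calc |t x| * |wNor W τ (φ x) (t x)| ≤ |t x| * (K * |t x|) := by
          gcongr; exact hG.nor_le _ _ ht
      _ ≤ |t x| * (K * K) := by gcongr; exact ht.trans hG.δ_le
      _ = _ := by ring
  have h4 : (ε ^ 2)⁻¹ * (t x * wNor W τ (φ x) (t x)) ≤ K ^ 2 * (C * S) := by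
    refine (mul_le_mul_of_nonneg_left h3 (by positivity)).trans ?_
    rw [mul_left_comm]
    gcongr
  have h5 : 0 ≤ K ^ 2 * S := by positivity
  have h6 : 0 ≤ K ^ 2 * (C * S) := by positivity
  have h7 : 0 ≤ K ^ 2 * (K ^ 2 * (C * S)) := by positivity
  constructor
  · refine (hS.abs_lap_t_le hG hD hx).trans ?_
    have : K ^ 2 * (gsq t φ x + (ε ^ 2)⁻¹ * |t x|) ≤ K ^ 2 * (S + C * S) := by
      gcongr; exact hSb x hx
    linarith
  · refine (hS.abs_lap_φ_le hG hD hx).trans ?_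
    have : 3 * K ^ 2 * (gsq t φ x + (ε ^ 2)⁻¹ * (t x * wNor W τ (φ x) (t x))) ≤
        3 * K ^ 2 * (S + K ^ 2 * (C * S)) := by
      gcongr; exact hSb x hx
    linarith

theorem sq_le_exp_add_exp_neg (s : ℝ) : s ^ 2 ≤ Real.exp s + Real.exp (-s) - 2 := by
  have h1 : |s / 2| ≤ Real.sinh |s / 2| := Real.self_le_sinh_iff.2 (abs_nonneg _)
  have h2 : |s / 2| ^ 2 ≤ Real.sinh |s / 2| ^ 2 := by gcongr
  rw [← Real.abs_sinh, sq_abs, sq_abs] at h2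
  have h3 : Real.exp s + Real.exp (-s) = 2 * Real.cosh (2 * (s / 2)) := by
    rw [Real.cosh_eq, mul_div_cancel₀ s two_ne_zero]; ring
  have h4 := Real.cosh_sq (s / 2)
  rw [h3, Real.cosh_two_mul]
  linarith

/-- Oscillation estimate for the phase at the scale `G⁻¹` of its gradient. -/
theorem exists_osc_bound (hP : Profile Γ τ W δ₁ k k₁ k₂ c₀ C₀) (hG : Geom Γ τ W δ₁ K)
    (hD : Dom Ω) {lam c₁ A : ℝ} (hlam : 0 < lam) (hc₁ : 0 < c₁) {o c d₁ : ℝ} (ho : 0 < o)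
    (hc : 0 < c) (hd₁ : 0 < d₁) :
    ∃ s > 0, ∃ G₁ > 0, ∀ (ζ : ℂ → ℝ) (ε G : ℝ) (t φ : ℂ → ℝ) (x : ℂ),
      Sol Γ τ W δ₁ Ω ζ ε t φ → Apriori W τ Ω ζ k lam c₁ A ε t φ → (∀ y ∈ closure Ω, |t y| ≤ s) →
      x ∈ Ω → d₁ ≤ bdist Ω x → G₁ ≤ G → (∀ y ∈ Ω, gsq t φ y ≤ 2 * G ^ 2) →
      ∀ z ∈ ball x (c / G), |φ z - φ x| ≤ o := by
  have hC₀ := hP.C_pos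
  obtain ⟨η, hη⟩ : ∃ η, η = lam ^ 2 * o ^ 2 := ⟨_, rfl⟩
  have hη0 : 0 < η := by rw [hη]; positivity
  obtain ⟨s, hs0, hsη, hsc⟩ : ∃ s > 0, Real.exp (lam * (C₀ * s)) * (2 * Real.cosh (lam * (3 * s)))
      - 2 < η / 2 ∧ s ≤ c := by
    have hcont : Continuous fun s : ℝ =>
        Real.exp (lam * (C₀ * s)) * (2 * Real.cosh (lam * (3 * s))) - 2 := by
      fun_prop
    have h1 : ∀ᶠ s in 𝓝[>] (0 : ℝ),
        Real.exp (lam * (C₀ * s)) * (2 * Real.cosh (lam * (3 * s))) - 2 < η / 2 :=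
      (hcont.tendsto 0).mono_left nhdsWithin_le_nhds |>.eventually (gt_mem_nhds (by
        simpa using hη0))
    have h2 : ∀ᶠ s in 𝓝[>] (0 : ℝ), s ∈ Ioc 0 c := Ioc_mem_nhdsGT hc
    obtain ⟨s, hs1, hs2⟩ := (h1.and h2).exists
    exact ⟨s, hs2.1, hs1, hs2.2⟩
  set B := Real.exp (lam * (A + C₀ * δ₁)) with hB
  have hB0 : 0 < B := Real.exp_pos _
  set M := 2 * (Real.exp (lam * A) * B) with hM
  have hM0 : 0 < M := by positivity
  set Λ := 2 * (M * Real.log (c / s)) / η with hΛ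
  refine ⟨s, hs0, 4 * s / d₁ + 4 * c / d₁ + 2 * s / d₁ * Real.exp Λ, by positivity,
    fun ζ ε G t φ x hS hA hts hx hdx hG1 hgs z hz => ?_⟩
  have hq1 : 0 < 4 * s / d₁ := by positivity
  have hq2 : 0 < 4 * c / d₁ := by positivity
  have hq3 : 0 < 2 * s / d₁ * Real.exp Λ := by positivity
  have hG0 : 0 < G := by linarith
  have hGs : 4 * s < d₁ * G := by
    have : 4 * s / d₁ < G := by linarith
    rw [div_lt_iff₀ hd₁] at this; linarith
  have hGc : 4 * c < d₁ * G := by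
    have : 4 * c / d₁ < G := by linarith
    rw [div_lt_iff₀ hd₁] at this; linarith
  have hGe : 2 * s * Real.exp Λ ≤ d₁ * G := by
    have : 2 * s / d₁ * Real.exp Λ ≤ G := by linarith
    rw [div_mul_eq_mul_div, div_le_iff₀ hd₁] at this; linarith
  have hcb : closedBall x (d₁ / 2) ⊆ Ω :=
    (closedBall_subset_ball (half_lt_self hd₁)).trans (hD.ball_subset_of_le hx hdx)
  obtain ⟨V, hV⟩ : ∃ V : ℂ → ℝ, V = fun y => (Real.exp (-(lam * φ x)) * subsol k lam 1 t φ y +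
    Real.exp (lam * φ x) * subsol k lam (-1) t φ y) - 2 := ⟨_, rfl⟩
  have hVeq : ∀ y, V y = Real.exp (lam * k (t y)) * (Real.exp (lam * (φ y - φ x)) +
      Real.exp (-(lam * (φ y - φ x)))) - 2 := fun y => by
    rw [hV]; simp only [subsol]
    rw [mul_add (Real.exp (lam * k _)), ← Real.exp_add, ← Real.exp_add, ← Real.exp_add,
      ← Real.exp_add]
    congr 3 <;> ring_nf
  have hVge : ∀ y, lam ^ 2 * (φ y - φ x) ^ 2 ≤ V y := fun y => by
    have h1 := sq_le_exp_add_exp_neg (lam * (φ y - φ x))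
    have h2 : 1 ≤ Real.exp (lam * k (t y)) :=
      Real.one_le_exp (mul_nonneg hlam.le (hP.nonneg _))
    have h3 : 0 < Real.exp (lam * (φ y - φ x)) + Real.exp (-(lam * (φ y - φ x))) := by positivity
    have h4 := mul_le_mul_of_nonneg_right h2 h3.le
    rw [hVeq, ← mul_pow]; linarith
  have hVle : ∀ y ∈ closure Ω, V y ≤ M := fun y hy => by
    have h1 := hA.subsol_le hlam hP hS (Or.inl rfl) hy
    have h2 := hA.subsol_le hlam hP hS (Or.inr rfl) hy
    have h3 := abs_le.1 (hA.phase x (hD.subset_closure hx))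
    have h4 : Real.exp (-(lam * φ x)) ≤ Real.exp (lam * A) := by
      rw [← mul_neg]; gcongr; linarith
    have h5 : Real.exp (lam * φ x) ≤ Real.exp (lam * A) := by gcongr; exact h3.2
    have h6 := mul_le_mul h4 h1 (Real.exp_pos _).le (Real.exp_pos _).le
    have h7 := mul_le_mul h5 h2 (Real.exp_pos _).le (Real.exp_pos _).le
    rw [hV]; simp only; linarith
  have hlip : ∀ y ∈ closedBall x (s / G), |φ y - φ x| ≤ 3 * s := fun y hy => by
    have hsub : closedBall x (s / G) ⊆ Ω := (closedBall_subset_closedBall (by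
      rw [div_le_iff₀ hG0]; linarith)).trans hcb
    have h1 := (convex_closedBall x (s / G)).norm_image_sub_le_of_norm_fderiv_le (𝕜 := ℝ) (f := φ)
      (C := 2 * (3 / 2 * G))
      (fun w hw => differentiableAt_of_two (hS.contDiff_φ w (hsub hw)))
      (fun w hw => norm_fderiv_le_of_gdot_le (by positivity) (by
        have h2 := gdot_φ_le_gsq t φ w
        have h3 := hgs w (hsub hw)
        nlinarith))
      (mem_closedBall_self (by positivity)) hy
    rw [mem_closedBall, dist_eq_norm, le_div_iff₀ hG0] at hy
    rw [Real.norm_eq_abs] at h1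
    linarith
  have hVs : ∀ y ∈ closedBall x (s / G), y ∈ closure Ω → V y ≤ η / 2 := fun y hy hyc => by
    refine le_trans ?_ hsη.le
    have h1 : Real.exp (lam * (φ y - φ x)) + Real.exp (-(lam * (φ y - φ x))) =
        2 * Real.cosh (lam * (φ y - φ x)) := by rw [Real.cosh_eq]; ring
    have h2 : Real.cosh (lam * (φ y - φ x)) ≤ Real.cosh (lam * (3 * s)) := by
      rw [Real.cosh_le_cosh, abs_mul, abs_mul, abs_of_pos (by positivity : 0 < 3 * s)]
      gcongr; exact hlip y hy
    have h3 : k (t y) ≤ C₀ * s := (hP.le_mul (hS.le y hyc)).trans (by gcongr; exact hts y hyc)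
    rw [hVeq, h1]
    have h4 := Real.cosh_pos (lam * (φ y - φ x))
    gcongr
  have hzc : ‖z - x‖ < c / G := by rwa [mem_ball, dist_eq_norm] at hz
  have hcG : c / G ≤ d₁ / 2 := by rw [div_le_iff₀ hG0]; linarith
  have hzΩ : z ∈ Ω := hcb (by rw [mem_closedBall, dist_eq_norm]; linarith)
  have hVz : V z ≤ η := by
    rcases le_or_gt (s / G) ‖z - x‖ with hle | hlt
    · have hsd : s / G < d₁ / 2 := by rw [div_lt_iff₀ hG0]; linarith
      have hsG : 0 < s / G := by positivity
      have hj : ∀ y ∈ Ω, HasJet V y _ _ _ := fun y hy => by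
        have h1 := (hA.sub 1 (Or.inl rfl) y hy).1
        have h2 := (hA.sub (-1) (Or.inr rfl) y hy).1
        rw [hV]
        exact (((hasJet h1).const_mul (Real.exp (-(lam * φ x)))).add
          ((hasJet h2).const_mul (Real.exp (lam * φ x)))).sub (hasJet_const 2 y)
      have h1 := three_circles hsG hsd (fun y hy => (hj y (hcb hy)).smooth)
        (fun y hy => by
          have hyΩ := hcb (ball_subset_closedBall hy)
          rw [(hj y hyΩ).lap, sub_zero]
          have h3 : 0 ≤ c₁ * (gsq t φ y + force W τ ε t φ y) :=
            mul_nonneg hc₁.le (add_nonneg (gsq_nonneg t φ y)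
              (hS.force_nonneg hG (hD.subset_closure hyΩ)))
          exact add_nonneg
            (mul_nonneg (Real.exp_pos _).le (h3.trans (hA.sub 1 (Or.inl rfl) y hyΩ).2))
            (mul_nonneg (Real.exp_pos _).le (h3.trans (hA.sub (-1) (Or.inr rfl) y hyΩ).2)))
        (fun y hy => hVs y hy (hD.subset_closure
          (hcb (closedBall_subset_closedBall hsd.le hy))))
        (fun y hy => hVle y (hD.subset_closure (hcb hy))) hle (hzc.le.trans hcG)
      refine h1.trans ?_
      have h2 : Λ ≤ Real.log (d₁ / 2 / (s / G)) := by
        rw [Real.le_log_iff_exp_le (by positivity), le_div_iff₀ hsG, mul_div_assoc',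
          div_le_iff₀ hG0]
        linarith
      have hl0 : 0 < Real.log (d₁ / 2 / (s / G)) := Real.log_pos ((one_lt_div hsG).2 hsd)
      have h3 : Real.log (‖z - x‖ / (s / G)) ≤ Real.log (c / s) := by
        refine Real.log_le_log (div_pos (hsG.trans_le hle) hsG) ?_
        rw [div_le_iff₀ hsG]
        refine hzc.le.trans (le_of_eq ?_)
        field_simp
      have h4 : 0 ≤ Real.log (‖z - x‖ / (s / G)) := Real.log_nonneg ((one_le_div hsG).2 hle)
      have h5 : (M - η / 2) * (Real.log (‖z - x‖ / (s / G)) / Real.log (d₁ / 2 / (s / G))) ≤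
          M * (Real.log (c / s) / Real.log (d₁ / 2 / (s / G))) := by
        have : 0 ≤ Real.log (‖z - x‖ / (s / G)) / Real.log (d₁ / 2 / (s / G)) := by positivity
        refine (mul_le_mul_of_nonneg_right (sub_le_self M (by positivity)) this).trans ?_
        gcongr
      have h6 : M * (Real.log (c / s) / Real.log (d₁ / 2 / (s / G))) ≤ η / 2 := by
        rw [mul_div_assoc', div_le_iff₀ hl0]
        have h7 : η / 2 * Λ = M * Real.log (c / s) := by rw [hΛ]; field_simp
        rw [← h7]; gcongr
      linarith
    · exact (hVs z (by rw [mem_closedBall, dist_eq_norm]; exact hlt.le)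
        (hD.subset_closure hzΩ)).trans (by linarith)
  have h1 := (hVge z).trans hVz
  rw [hη] at h1
  exact abs_le_of_sq_le_sq (le_of_mul_le_mul_left h1 (by positivity)) ho.le

end GradB

section Lip

open scoped ContDiff

variable {Γ : Set ℂ} {τ : ℝ → ℂ} {W : ℂ → ℝ} {δ₁ K c₀ C₀ R₀ Z : ℝ} {Ω : Set ℂ} {ζ : ℂ → ℝ}
  {k k₁ k₂ : ℝ → ℝ} {x : ℂ}

theorem gdot_self_le_of_interior {v : ℂ → ℝ} {d M N : ℝ} (hd : 0 < d)
    (hv : ∀ y ∈ ball x d, ContDiffAt ℝ 2 v y) (hM : ∀ y ∈ ball x d, |v y| ≤ M)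
    (hN : ∀ y ∈ ball x d, |lap v y| ≤ N) :
    gdot v v x ≤ 2 * (4 * M / d + N * d / 4) ^ 2 := by
  obtain ⟨h1, h2⟩ := interior_gradient hd hv hM hN
  have h3 : dir 1 v x ^ 2 ≤ (4 * M / d + N * d / 4) ^ 2 := sq_le_sq' (abs_le.1 h1).1 (abs_le.1 h1).2
  have h4 : dir I v x ^ 2 ≤ (4 * M / d + N * d / 4) ^ 2 := sq_le_sq' (abs_le.1 h2).1 (abs_le.1 h2).2
  simp only [gdot]
  linarith [_root_.sq (dir 1 v x), _root_.sq (dir I v x)]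

theorem exists_near_max {s : Set ℂ} {f : ℂ → ℝ} {B : ℝ} (hb : ∀ x ∈ s, f x ≤ B) {y : ℂ}
    (hy : y ∈ s) (hpos : 0 < f y) : ∃ x ∈ s, 0 < f x ∧ f y ≤ 2 * f x ∧ ∀ z ∈ s, f z ≤ 2 * f x := by
  have hbdd : BddAbove (f '' s) := ⟨B, by rintro _ ⟨x, hx, rfl⟩; exact hb x hx⟩
  have h1 : ∀ z ∈ s, f z ≤ sSup (f '' s) := fun z hz => le_csSup hbdd (mem_image_of_mem f hz)
  have h2 : 0 < sSup (f '' s) := hpos.trans_le (h1 y hy)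
  obtain ⟨_, ⟨x, hx, rfl⟩, hlt⟩ :=
    exists_lt_of_lt_csSup (⟨f y, mem_image_of_mem f hy⟩ : (f '' s).Nonempty) (half_lt_self h2)
  exact ⟨x, hx, by linarith, by linarith [h1 y hy], fun z hz => by linarith [h1 z hz]⟩

/-- Uniform gradient bound for small `ε`. -/
theorem exists_gsq_bound (hW : PotentialHyp Γ W R₀) (hG : Geom Γ τ W δ₁ K)
    (hP : Profile Γ τ W δ₁ k k₁ k₂ c₀ C₀) (hD : Dom Ω) (hζ : Phase Ω ζ Z) {lam c₁ A : ℝ}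
    (hlam : 0 < lam) (hc₁ : 0 < c₁) (hA0 : 0 < A) :
    ∃ ε₂ > 0, ∃ S > 0, ∀ (ε : ℝ) (t φ : ℂ → ℝ) (u : ℂ → ℂ), ε ≤ ε₂ →
      Sol Γ τ W δ₁ Ω ζ ε t φ → Apriori W τ Ω ζ k lam c₁ A ε t φ → Lift Γ τ W Ω ε u t φ →
      (∀ x ∈ closure Ω, |t x| ≤ (2 * K ^ 2)⁻¹) ∧ ∀ x ∈ Ω, gsq t φ x ≤ S := by
  have hK := hG.one_le
  have hZ := hζ.Z_pos
  obtain ⟨C₁, hC₁, e₀, he₀, hlapb⟩ := exists_lap_bound hG hD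
  obtain ⟨C₂, hC₂, hgrad⟩ := exists_gradient_bound (k := k) (lam := lam) (c₁ := c₁) hW hG hD hζ hA0
  obtain ⟨L, hL⟩ : ∃ L, L = 3 * A + 2 * (Z + 1) := ⟨_, rfl⟩
  have hL0 : 0 < L := by rw [hL]; positivity
  obtain ⟨c, hc⟩ : ∃ c, c = (2 * C₁)⁻¹ := ⟨_, rfl⟩
  have hc0 : 0 < c := by rw [hc]; positivity
  have hcC : C₁ * c = 1 / 2 := by rw [hc]; field_simp
  obtain ⟨s, hs, G₁, hG₁, hosc⟩ := exists_osc_bound hP hG hD (A := A) hlam hc₁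
    (show 0 < c / 20 by positivity) hc0 (show 0 < c / 20 / L by positivity)
  obtain ⟨ε₁, hε₁, hsmall⟩ := exists_small hW hG hP hD hζ hlam hc₁ hA0
    (a := min (c / 20) (min s (2 * K ^ 2)⁻¹)) (by positivity)
  refine ⟨min e₀ ε₁, by positivity, 2 * (16 * L + G₁) ^ 2, by positivity,
    fun ε t φ u hε hS hA hU => ?_⟩
  have hts := hsmall ε t φ u (hε.trans (min_le_right _ _)) hS hA hU
  have htc : ∀ y ∈ closure Ω, |t y| ≤ c / 20 := fun y hy => (hts y hy).trans (min_le_left _ _)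
  have hts' : ∀ y ∈ closure Ω, |t y| ≤ s := fun y hy =>
    (hts y hy).trans ((min_le_right _ _).trans (min_le_left _ _))
  have htK : ∀ y ∈ closure Ω, |t y| ≤ (2 * K ^ 2)⁻¹ := fun y hy =>
    (hts y hy).trans ((min_le_right _ _).trans (min_le_right _ _))
  refine ⟨htK, fun y hy => ?_⟩
  have hε0 := hS.ε_pos
  rcases le_or_gt (gsq t φ y) 0 with hy0 | hy0
  · exact hy0.trans (by positivity)
  obtain ⟨x, hx, hgx, hyx, hmx⟩ := exists_near_max (f := gsq t φ)
    (B := 5 * (C₂ * (1 + ε⁻¹)) ^ 2) (fun z hz => (hU.gsq_le hG hS hD hz).trans (by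
      gcongr; exact hgrad ε t φ u hS hA hU z hz)) hy hy0
  obtain ⟨G, hGdef⟩ : ∃ G, G = √(gsq t φ x) := ⟨_, rfl⟩
  have hG0 : 0 < G := by rw [hGdef]; exact Real.sqrt_pos.2 hgx
  have hGsq : gsq t φ x = G ^ 2 := by rw [hGdef, Real.sq_sqrt hgx.le]
  rw [hGsq] at hyx hmx
  suffices hfin : G ≤ 16 * L + G₁ by
    refine hyx.trans ?_
    gcongr
  by_contra! hcon
  have hlb := hlapb ζ ε (2 * G ^ 2) t φ (hε.trans (min_le_left _ _)) (by positivity) hS htK hmx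
  have hd := hD.bdist_pos hx
  have hdball := hD.ball_subset hx
  have key : ∀ ρ M, 0 < ρ → ρ ≤ bdist Ω x → ρ ≤ c / G → (∀ z ∈ ball x ρ, |t z| ≤ M) →
      (∀ z ∈ ball x ρ, |φ z - φ x| ≤ M) → G ≤ 16 * M / ρ := by
    intro ρ M hρ hρd hρc hMt hMφ
    have hM0 : 0 ≤ M := (abs_nonneg _).trans (hMt x (mem_ball_self hρ))
    have hsub : ball x ρ ⊆ Ω := hD.ball_subset_of_le hx hρd
    have h1 := gdot_self_le_of_interior hρ (fun z hz => hS.contDiff_t z (hsub hz)) hMt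
      fun z hz => (hlb z (hsub hz)).1
    have jφ : ∀ z ∈ Ω, HasJet (fun w => φ w - φ x) z _ _ _ := fun z hz =>
      (hasJet (hS.contDiff_φ z hz)).sub (hasJet_const (φ x) z)
    have h2 := gdot_self_le_of_interior hρ (fun z hz => (jφ z (hsub hz)).smooth) hMφ
      (N := C₁ * (2 * G ^ 2)) fun z hz => by
        have e : lap (fun w => φ w - φ x) z = _ := (jφ z (hsub hz)).lap
        rw [e, sub_zero]; exact (hlb z (hsub hz)).2
    have h3 : gdot (fun w => φ w - φ x) (fun w => φ w - φ x) x = gdot φ φ x := by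
      have e1 : dir 1 (fun w => φ w - φ x) x = _ := (jφ x hx).d1
      have e2 : dir I (fun w => φ w - φ x) x = _ := (jφ x hx).dI
      simp only [gdot]; rw [e1, e2]; simp
    rw [h3] at h2
    have h4 : G ^ 2 ≤ (2 * (4 * M / ρ + C₁ * (2 * G ^ 2) * ρ / 4)) ^ 2 := by
      have : gdot t t x + gdot φ φ x = G ^ 2 := hGsq
      rw [mul_pow]; linarith
    have h5 : G ≤ 2 * (4 * M / ρ + C₁ * (2 * G ^ 2) * ρ / 4) :=
      le_of_sq_le_sq h4 (by positivity)
    have h6 : C₁ * G ^ 2 * ρ ≤ G / 2 := by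
      rw [le_div_iff₀ hG0] at hρc
      have := mul_le_mul_of_nonneg_left hρc (show 0 ≤ C₁ * G by positivity)
      linear_combination this + G * hcC
    have h7 : 16 * M / ρ = 2 * (2 * (4 * M / ρ)) := by ring
    rw [h7]
    linear_combination 2 * h5 + 2 * h6
  have hnear : ∀ z ∈ ball x (bdist Ω x), |t z| ≤ L * bdist Ω x ∧
      |φ z - φ x| ≤ L * bdist Ω x := by
    intro z hz
    have hzΩ := hdball hz
    have hzx : ‖z - x‖ ≤ bdist Ω x := by rw [mem_ball, dist_eq_norm] at hz; exact hz.le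
    have hbz : bdist Ω z ≤ 2 * bdist Ω x := by linarith [bdist_le_add (Ω := Ω) z x]
    have h1 : A * bdist Ω z ≤ 2 * A * bdist Ω x := by
      linarith [mul_le_mul_of_nonneg_left hbz hA0.le]
    have h2 := hA.dist z hzΩ
    have h3 := hA.dev z hzΩ
    have h4 := hA.dev x hx
    have h5 := (convex_ball x (bdist Ω x)).norm_image_sub_le_of_norm_fderiv_le (𝕜 := ℝ) (f := ζ)
      (C := 2 * (Z + 1)) (fun w _ => differentiableAt_of_two (hζ.contDiffAt w))
      (fun w hw => norm_fderiv_le_of_gdot_le (by positivity) (by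
        have := hζ.grad_le w (hD.subset_closure (hdball hw))
        nlinarith)) (mem_ball_self hd) hz
    rw [Real.norm_eq_abs] at h5
    have h6 : 2 * (Z + 1) * ‖z - x‖ ≤ 2 * (Z + 1) * bdist Ω x := by gcongr
    have h7 : 0 ≤ A * bdist Ω x := by positivity
    have h8 : 0 ≤ 2 * (Z + 1) * bdist Ω x := by positivity
    have h9 : L * bdist Ω x = 3 * (A * bdist Ω x) + 2 * (Z + 1) * bdist Ω x := by rw [hL]; ring
    refine ⟨by linarith, ?_⟩
    have h10 : φ z - φ x = (φ z - ζ z) - (φ x - ζ x) + (ζ z - ζ x) := by ring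
    have h11 := abs_add_le (φ z - ζ z - (φ x - ζ x)) (ζ z - ζ x)
    have h12 := abs_sub (φ z - ζ z) (φ x - ζ x)
    rw [h10]
    linarith
  rcases le_or_gt (bdist Ω x) (c / G) with hcase | hcase
  · have h1 := key (bdist Ω x) (L * bdist Ω x) hd le_rfl hcase (fun z hz => (hnear z hz).1)
      fun z hz => (hnear z hz).2
    have h2 : 16 * (L * bdist Ω x) / bdist Ω x = 16 * L := by field_simp
    linarith
  · have hρ : 0 < c / G := by positivity
    have h1 := key (c / G) (c / 20) hρ hcase.le le_rfl
      (fun z hz => htc z (hD.subset_closure (hdball (ball_subset_ball hcase.le hz)))) (by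
        rcases le_or_gt (c / 20 / L) (bdist Ω x) with hdd | hdd
        · exact hosc ζ ε G t φ x hS hA hts' hx hdd (by linarith) hmx
        · intro z hz
          refine (hnear z (ball_subset_ball hcase.le hz)).2.trans ?_
          rw [lt_div_iff₀ hL0] at hdd
          linarith)
    have h2 : 16 * (c / 20) / (c / G) = 4 / 5 * G := by field_simp; norm_num
    linarith

end Lip

section Est

open scoped ContDiff

variable {Γ : Set ℂ} {τ : ℝ → ℂ} {W : ℂ → ℝ} {δ₁ K Z : ℝ} {Ω : Set ℂ} {ζ : ℂ → ℝ}
  {x : ℂ}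

theorem abs_gdot_le_mul {f g : ℂ → ℝ} {a b : ℝ} (ha : 0 ≤ a) (hb : 0 ≤ b)
    (hf : gdot f f x ≤ a ^ 2) (hg : gdot g g x ≤ b ^ 2) : |gdot f g x| ≤ a * b := by
  refine abs_le_of_sq_le_sq ?_ (by positivity)
  have h1 : gdot f g x ^ 2 ≤ gdot f f x * gdot g g x := by
    simp only [gdot]
    linarith [_root_.sq_nonneg (dir 1 f x * dir I g x - dir I f x * dir 1 g x)]
  rw [mul_pow]
  exact h1.trans (mul_le_mul hf hg (gdot_self_nonneg g x) (by positivity))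

theorem mul_abs_gdot_le {f g : ℂ → ℝ} {a η : ℝ} (hη : 0 < η) :
    a * |gdot f g x| ≤ η⁻¹ * gdot f f x + a ^ 2 / 4 * η * gdot g g x := by
  have h : ∀ b : ℝ, b ^ 2 = a ^ 2 →
      b * gdot f g x ≤ η⁻¹ * gdot f f x + a ^ 2 / 4 * η * gdot g g x := fun b hb => by
    have hη1 : η⁻¹ * η = 1 := inv_mul_cancel₀ hη.ne'
    have h1 := mul_nonneg (inv_nonneg.2 hη.le) (_root_.sq_nonneg (dir 1 f x - b / 2 * η * dir 1 g x))
    have h2 := mul_nonneg (inv_nonneg.2 hη.le) (_root_.sq_nonneg (dir I f x - b / 2 * η * dir I g x))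
    simp only [gdot]
    rw [← hb]
    linear_combination h1 + h2 - (b * dir 1 f x * dir 1 g x + b * dir I f x * dir I g x -
      b ^ 2 / 4 * η * (dir 1 g x ^ 2 + dir I g x ^ 2)) * hη1
  rcases abs_choice (gdot f g x) with h1 | h1
  · rw [h1]; exact h a rfl
  · rw [h1]; linarith [h (-a) (by ring)]

theorem exists_t_bound (hG : Geom Γ τ W δ₁ K) (hD : Dom Ω) {S : ℝ} (hS0 : 0 < S) :
    ∃ C > 0, ∃ e₀ > 0, ∀ (ζ : ℂ → ℝ) (ε : ℝ) (t φ : ℂ → ℝ), ε ≤ e₀ →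
      Sol Γ τ W δ₁ Ω ζ ε t φ → (∀ x ∈ closure Ω, |t x| ≤ (2 * K ^ 2)⁻¹) →
      (∀ x ∈ Ω, gsq t φ x ≤ S) →
      ∀ x ∈ Ω, |t x| ≤ C * ε ^ 2 ∧ gdot t t x ≤ (C * ε) ^ 2 := by
  obtain ⟨C₁, hC₁, e₁, he₁, h1⟩ := exists_layer_bound hG hD
  obtain ⟨C₂, hC₂, e₂, he₂, h2⟩ := exists_lap_bound hG hD
  refine ⟨2 * (8 * (C₁ * S) + C₂ * S), by positivity, min e₁ e₂, by positivity,
    fun ζ ε t φ hε hS hsm hSb x hx => ?_⟩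
  have hε0 := hS.ε_pos
  have ht := h1 ζ ε S t φ (hε.trans (min_le_left _ _)) hS0.le hS hsm hSb
  have hl := h2 ζ ε S t φ (hε.trans (min_le_right _ _)) hS0.le hS hsm hSb
  have hp1 : 0 < C₁ * S := by positivity
  have hp2 : 0 < C₂ * S := by positivity
  refine ⟨(ht x hx).2.trans (mul_le_mul_of_nonneg_right (by linarith) (by positivity)), ?_⟩
  have hd := hD.bdist_pos hx
  obtain ⟨r, hr⟩ : ∃ r, r = min (bdist Ω x) ε := ⟨_, rfl⟩
  have hr0 : 0 < r := by rw [hr]; positivity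
  have hrd : r ≤ bdist Ω x := by rw [hr]; exact min_le_left _ _
  have hrε : r ≤ ε := by rw [hr]; exact min_le_right _ _
  have hsub := hD.ball_subset_of_le hx hrd
  have h3 := gdot_self_le_of_interior hr0 (fun z hz => hS.contDiff_t z (hsub hz))
    (M := 2 * (C₁ * S) * ε * r) (fun z hz => by
      rcases le_total (bdist Ω x) ε with h | h
      · have hrx : r = bdist Ω x := by rw [hr, min_eq_left h]
        have hb : bdist Ω z ≤ 2 * r := by
          rw [mem_ball, dist_eq_norm] at hz
          linarith [bdist_le_add (Ω := Ω) z x]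
        have := mul_le_mul_of_nonneg_left hb (show 0 ≤ C₁ * S * ε by positivity)
        linarith [(ht z (hsub hz)).1]
      · have hrx : r = ε := by rw [hr, min_eq_right h]
        rw [hrx]
        have : 0 ≤ C₁ * S * ε ^ 2 := by positivity
        linarith [(ht z (hsub hz)).2]) fun z hz => (hl z (hsub hz)).1
  refine h3.trans ?_
  have h4 : 4 * (2 * (C₁ * S) * ε * r) / r = 8 * (C₁ * S) * ε := by field_simp; norm_num
  have h5 : C₂ * S * r ≤ C₂ * S * ε := by gcongr
  have h6 : 0 ≤ C₂ * S * r := by positivity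
  have h7 : 0 ≤ C₁ * S * ε := by positivity
  rw [h4]
  have h8 : (8 * (C₁ * S) * ε + C₂ * S * r / 4) ^ 2 ≤ ((8 * (C₁ * S) + C₂ * S) * ε) ^ 2 := by
    refine pow_le_pow_left₀ (by positivity) ?_ 2
    linarith
  linarith [mul_pow 2 ((8 * (C₁ * S) + C₂ * S) * ε) 2, mul_assoc 2 (8 * (C₁ * S) + C₂ * S) ε,
    congrArg (· ^ 2) (mul_assoc 2 (8 * (C₁ * S) + C₂ * S) ε),
    _root_.sq_nonneg ((8 * (C₁ * S) + C₂ * S) * ε)]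

variable {ε Q : ℝ} {t φ : ℂ → ℝ}

theorem Sol.abs_lap_φ_le_gdot (hG : Geom Γ τ W δ₁ K) (hS : Sol Γ τ W δ₁ Ω ζ ε t φ) (hD : Dom Ω)
    (hx : x ∈ Ω) (hQ : 1 ≤ Q) (hKQ : K ≤ Q) (ht : |t x| ≤ Q * ε ^ 2) (hφ : gdot φ φ x ≤ Q ^ 2) :
    |lap φ x| ≤ 3 * Q * |gdot t φ x| + 3 * Q ^ 4 * ε ^ 2 := by
  have hxc := hD.subset_closure hx
  have hK := hG.one_le
  have hε := hS.ε_pos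
  have hJ := hG.jac_ge _ _ (hS.foot x hxc) (hS.le x hxc)
  have hκ := hG.curv_le (φ x)
  have hκ' := hG.deriv_curv_le (φ x)
  have hT := hG.tan_le _ _ (hS.foot x hxc) (hS.le x hxc)
  have hN := hG.nor_le (φ x) _ (hS.le x hxc)
  have hφ0 := gdot_self_nonneg φ x
  have h1 : |2 * curv τ (φ x) * gdot t φ x| ≤ 2 * Q * |gdot t φ x| := by
    rw [abs_mul, abs_mul, abs_two]; gcongr; exact hκ.trans hKQ
  have h2 : |t x * deriv (curv τ) (φ x) * gdot φ φ x| ≤ Q ^ 4 * ε ^ 2 := by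
    rw [abs_mul, abs_mul, abs_of_nonneg hφ0]
    calc _ ≤ Q * ε ^ 2 * Q * Q ^ 2 := by gcongr; exact hκ'.trans hKQ
      _ = _ := by ring
  have h3 : t x * wNor W τ (φ x) (t x) ≤ Q * (Q * ε ^ 2) ^ 2 := by
    calc _ ≤ |t x| * |wNor W τ (φ x) (t x)| := by rw [← abs_mul]; exact le_abs_self _
      _ ≤ |t x| * (Q * |t x|) := by gcongr; exact hN.trans (by gcongr)
      _ = Q * |t x| ^ 2 := by ring
      _ ≤ _ := by gcongr
  have h4 : |(ε ^ 2)⁻¹ * wTan W τ (φ x) (t x)| ≤ Q ^ 4 * ε ^ 2 := by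
    rw [abs_mul, abs_of_pos (by positivity), inv_mul_le_iff₀ (by positivity)]
    calc _ ≤ K * (t x * wNor W τ (φ x) (t x)) := hT
      _ ≤ Q * (Q * (Q * ε ^ 2) ^ 2) := mul_le_mul hKQ h3
          (hG.force_nonneg _ _ (hS.foot x hxc) (hS.le x hxc)) (by linarith)
      _ = _ := by ring
  have h5 : (1 - t x * curv τ (φ x)) * lap φ x = 2 * curv τ (φ x) * gdot t φ x +
    t x * deriv (curv τ) (φ x) * gdot φ φ x + (ε ^ 2)⁻¹ * wTan W τ (φ x) (t x) := by
    linarith [hS.eq_φ x hx]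
  have h6 : (1 - t x * curv τ (φ x)) * |lap φ x| ≤ 2 * Q * |gdot t φ x| + 2 * (Q ^ 4 * ε ^ 2) := by
    rw [← abs_of_pos (show 0 < 1 - t x * curv τ (φ x) by linarith), ← abs_mul, h5]
    refine (abs_add_three _ _ _).trans ?_
    linarith
  have h7 := mul_le_mul_of_nonneg_right hJ (abs_nonneg (lap φ x))
  linarith

/-- The phase deviation vanishes linearly at the boundary, with slope of order `ε`. -/
theorem exists_psi_bound (hG : Geom Γ τ W δ₁ K) (hD : Dom Ω) (hζ : Phase Ω ζ Z)
    (hQ : 1 ≤ Q) (hKQ : K ≤ Q) : ∃ C > 0, ∀ (ε : ℝ) (t φ : ℂ → ℝ), ε ≤ 1 →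
      Sol Γ τ W δ₁ Ω ζ ε t φ →
      (∀ x ∈ Ω, |t x| ≤ Q * ε ^ 2 ∧ gdot t t x ≤ (Q * ε) ^ 2 ∧ gdot φ φ x ≤ Q ^ 2) →
      ∀ x ∈ Ω, |φ x - ζ x| ≤ C * ε ∧
        gdot (fun y => φ y - ζ y) (fun y => φ y - ζ y) x ≤ (C * ε) ^ 2 := by
  obtain ⟨C, hC, hcomp⟩ := hD.comparison
  obtain ⟨D, hD0, hDb⟩ := hD.exists_bdist_le
  obtain ⟨N, hN⟩ : ∃ N, N = 6 * Q ^ 4 := ⟨_, rfl⟩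
  have hN0 : 0 < N := by rw [hN]; positivity
  refine ⟨C * N + 2 * (8 * (C * N) + N * D), by positivity, fun ε t φ hε1 hS hb => ?_⟩
  have hε := hS.ε_pos
  have j : ∀ y ∈ Ω, HasJet (fun y => φ y - ζ y) y _ _ _ := fun y hy =>
    (hasJet (hS.contDiff_φ y hy)).sub (hasJet (hζ.contDiffAt y))
  have hlap : ∀ y ∈ Ω, |lap φ y| ≤ N * ε := fun y hy => by
    obtain ⟨h1, h2, h3⟩ := hb y hy
    have h4 := hS.abs_lap_φ_le_gdot hG hD hy hQ hKQ h1 h3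
    have h5 := abs_gdot_le_mul (by positivity) (by positivity) h2 h3
    have h6 : 3 * Q * |gdot t φ y| ≤ 3 * Q * (Q * ε * Q) := by gcongr
    have h7 : ε ^ 2 ≤ ε := by nlinarith
    have h8 : 3 * Q ^ 4 * ε ^ 2 ≤ 3 * Q ^ 4 * ε := by gcongr
    have h9 : Q ^ 3 * ε ≤ Q ^ 4 * ε := by gcongr; norm_num
    rw [hN]; linarith
  have key : ∀ σ : ℝ, σ = 1 ∨ σ = -1 → ∀ y ∈ Ω,
      σ * (φ y - ζ y) ≤ C * (N * ε) * bdist Ω y ∧ σ * (φ y - ζ y) ≤ C * (N * ε) := by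
    intro σ hσ
    refine hcomp (fun y => σ * (φ y - ζ y)) (N * ε) (by positivity)
      (continuousOn_const.mul (hS.cont_φ.sub hζ.smooth.continuous.continuousOn))
      (fun y hy => by simp [hS.bd_φ y hy]) fun y hy _ => ?_
    have j' := (j y hy).const_mul σ
    refine ⟨j'.smooth, ?_⟩
    have e : lap (fun y => σ * (φ y - ζ y)) y = _ := j'.lap
    rw [e, hζ.harm y hy, sub_zero]
    have := abs_le.1 (hlap y hy)
    rcases hσ with rfl | rfl <;> linarith
  have habs : ∀ y ∈ Ω, |φ y - ζ y| ≤ C * (N * ε) * bdist Ω y ∧ |φ y - ζ y| ≤ C * (N * ε) :=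
    fun y hy => by
      have h1 := key 1 (Or.inl rfl) y hy
      have h2 := key (-1) (Or.inr rfl) y hy
      exact ⟨abs_le'.2 ⟨by linarith, by linarith⟩, abs_le'.2 ⟨by linarith, by linarith⟩⟩
  intro x hx
  have hp1 : 0 ≤ C * N * ε := by positivity
  have hp2 : 0 ≤ N * D * ε := by positivity
  refine ⟨(habs x hx).2.trans (by linarith), ?_⟩
  have hd := hD.bdist_pos hx
  have hsub := hD.ball_subset hx
  have h3 := gdot_self_le_of_interior hd (fun z hz => (j z (hsub hz)).smooth)
    (M := 2 * (C * N) * ε * bdist Ω x) (N := N * ε) (fun z hz => by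
      have hb : bdist Ω z ≤ 2 * bdist Ω x := by
        rw [mem_ball, dist_eq_norm] at hz
        linarith [bdist_le_add (Ω := Ω) z x]
      have := mul_le_mul_of_nonneg_left hb hp1
      linarith [(habs z (hsub hz)).1]) fun z hz => by
        have e : lap (fun y => φ y - ζ y) z = _ := (j z (hsub hz)).lap
        rw [e, hζ.harm z (hsub hz), sub_zero]
        exact hlap z (hsub hz)
  refine h3.trans ?_
  have h4 : 4 * (2 * (C * N) * ε * bdist Ω x) / bdist Ω x = 8 * (C * N) * ε := by
    field_simp; norm_num
  have h5 : N * ε * bdist Ω x ≤ N * ε * D := by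
    gcongr; exact hDb x (hD.subset_closure hx)
  have h6 : 0 ≤ N * ε * bdist Ω x := by positivity
  rw [h4]
  obtain ⟨X, hX⟩ : ∃ X, X = (8 * (C * N) + N * D) * ε := ⟨_, rfl⟩
  have hX0 : 0 ≤ X := by rw [hX]; positivity
  have h8 : (8 * (C * N) * ε + N * ε * bdist Ω x / 4) ^ 2 ≤ X ^ 2 := by
    refine pow_le_pow_left₀ (by positivity) ?_ 2
    rw [hX]; linarith
  have h9 : (2 * X) ^ 2 ≤ ((C * N + 2 * (8 * (C * N) + N * D)) * ε) ^ 2 := by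
    refine pow_le_pow_left₀ (by positivity) ?_ 2
    rw [hX]; linarith
  linarith [_root_.sq_nonneg X, mul_pow 2 X 2]

end Est

section Fine

open scoped ContDiff

variable {Γ : Set ℂ} {τ : ℝ → ℂ} {W : ℂ → ℝ} {δ₁ K Z : ℝ} {Ω : Set ℂ} {ζ : ℂ → ℝ}
  {x : ℂ}

/-- The leading coefficient `f` of the expansion `t = ε² f + …`. -/
theorem exists_profile_coeff {R₀ : ℝ} (hW : PotentialHyp Γ W R₀) (hG : Geom Γ τ W δ₁ K) (hD : Dom Ω)
    (hζ : Phase Ω ζ Z) : ∃ f : ℂ → ℝ, ContDiff ℝ ∞ f ∧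
      (∀ x, wHess W τ (ζ x) * f x = curv τ (ζ x) * gdot ζ ζ x) ∧
      ∃ F, ∀ x ∈ closure Ω, |f x| ≤ F ∧ gdot f f x ≤ F ^ 2 ∧ |lap f x| ≤ F := by
  have hK := hG.one_le
  have hpos : ∀ s, wHess W τ s ≠ 0 := fun s =>
    ((inv_pos.2 (by linarith)).trans_le (hG.hess_ge s)).ne'
  have hd : ∀ e, ContDiff ℝ ∞ (dir e ζ) := fun e => contDiff_dir (n := ∞) hζ.smooth e
  have hg : ContDiff ℝ ∞ (gdot ζ ζ) := ((hd 1).mul (hd 1)).add ((hd I).mul (hd I))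
  have hf : ContDiff ℝ ∞ fun x => curv τ (ζ x) * gdot ζ ζ x / wHess W τ (ζ x) :=
    (((contDiff_curv hG.arc).comp hζ.smooth).mul hg).div
      ((contDiff_wHess hG.arc hW).comp hζ.smooth) fun x => hpos _
  refine ⟨_, hf, fun x => by field_simp [hpos (ζ x)], ?_⟩
  set f := fun x => curv τ (ζ x) * gdot ζ ζ x / wHess W τ (ζ x)
  have hc : IsCompact (closure Ω) := hD.bdd.isCompact_closure
  have hb : ∀ h : ℂ → ℝ, Continuous h → ∃ B, ∀ x ∈ closure Ω, |h x| ≤ B := fun h hh =>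
    hc.exists_bound_of_continuousOn hh.continuousOn
  obtain ⟨B₁, h1⟩ := hb f hf.continuous
  obtain ⟨B₂, h2⟩ := hb (gdot f f) (((((contDiff_dir (n := ∞) hf 1).mul (contDiff_dir (n := ∞) hf 1)).add
    ((contDiff_dir (n := ∞) hf I).mul (contDiff_dir (n := ∞) hf I)))).continuous)
  obtain ⟨B₃, h3⟩ := hb (lap f) (contDiff_lap hf).continuous
  refine ⟨1 + |B₁| + |B₂| + |B₃|, fun x hx => ⟨?_, ?_, ?_⟩⟩
  · linarith [h1 x hx, le_abs_self B₁, abs_nonneg B₂, abs_nonneg B₃]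
  · have : gdot f f x ≤ 1 + |B₁| + |B₂| + |B₃| := by
      linarith [h2 x hx, le_abs_self (gdot f f x), le_abs_self B₂, abs_nonneg B₁, abs_nonneg B₃]
    nlinarith [abs_nonneg B₁, abs_nonneg B₂, abs_nonneg B₃]
  · linarith [h3 x hx, le_abs_self B₃, abs_nonneg B₂, abs_nonneg B₁]

variable {ε Q : ℝ} {t φ f : ℂ → ℝ}

theorem gdot_sub_gdot (hφ : ContDiffAt ℝ 2 φ x) (hζ : ContDiffAt ℝ 2 ζ x) :
    gdot φ φ x - gdot ζ ζ x =
      gdot (fun y => φ y - ζ y) φ x + gdot (fun y => φ y - ζ y) ζ x := by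
  have j := (hasJet hφ).sub (hasJet hζ)
  have e1 : dir 1 (fun y => φ y - ζ y) x = _ := j.d1
  have e2 : dir I (fun y => φ y - ζ y) x = _ := j.dI
  simp only [gdot]; rw [e1, e2]; ring

/-- The linearised equation for the normal coordinate. -/
theorem Sol.abs_lap_t_sub_le (hG : Geom Γ τ W δ₁ K) (hS : Sol Γ τ W δ₁ Ω ζ ε t φ) (hD : Dom Ω)
    (hζ : Phase Ω ζ Z) (hx : x ∈ Ω) (hε1 : ε ≤ 1) (hQ : 1 ≤ Q) (hKQ : K ≤ Q)
    (hg : gdot ζ ζ x ≤ Q ^ 2) (ht : |t x| ≤ Q * ε ^ 2) (hφ : gdot φ φ x ≤ Q ^ 2)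
    (hψ : |φ x - ζ x| ≤ Q * ε)
    (hψ' : gdot (fun y => φ y - ζ y) (fun y => φ y - ζ y) x ≤ (Q * ε) ^ 2) :
    |lap t x + curv τ (ζ x) * gdot ζ ζ x - (ε ^ 2)⁻¹ * (wHess W τ (ζ x) * t x)| ≤
      6 * Q ^ 5 * ε := by
  have hxc := hD.subset_closure hx
  have hK := hG.one_le
  have hε := hS.ε_pos
  have hεε : ε ^ 2 ≤ ε := by nlinarith
  have hκ := (hG.curv_le (φ x)).trans hKQ
  have hφ0 := gdot_self_nonneg φ x
  have hp : ∀ n : ℕ, n ≤ 5 → Q ^ n * ε ≤ Q ^ 5 * ε := fun n hn => by gcongr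
  have h1 : |(ε ^ 2)⁻¹ * (wNor W τ (φ x) (t x) - wHess W τ (φ x) * t x)| ≤ Q ^ 5 * ε := by
    rw [abs_mul, abs_of_pos (by positivity), inv_mul_le_iff₀ (by positivity)]
    calc _ ≤ K * t x ^ 2 := hG.nor_taylor _ _ (hS.le x hxc)
      _ ≤ Q * (Q * ε ^ 2) ^ 2 := by rw [← sq_abs (t x)]; gcongr
      _ = ε ^ 2 * (Q ^ 3 * ε ^ 2) := by ring
      _ ≤ ε ^ 2 * (Q ^ 3 * ε) := by gcongr
      _ ≤ _ := by gcongr ε ^ 2 * ?_; exact hp 3 (by norm_num)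
  have h2 : |(ε ^ 2)⁻¹ * ((wHess W τ (φ x) - wHess W τ (ζ x)) * t x)| ≤ Q ^ 5 * ε := by
    rw [abs_mul, abs_of_pos (by positivity), inv_mul_le_iff₀ (by positivity), abs_mul]
    calc _ ≤ (K * |φ x - ζ x|) * (Q * ε ^ 2) := by gcongr; exact hG.hess_lip _ _
      _ ≤ (Q * (Q * ε)) * (Q * ε ^ 2) := by gcongr
      _ = ε ^ 2 * (Q ^ 3 * ε) := by ring
      _ ≤ _ := by gcongr ε ^ 2 * ?_; exact hp 3 (by norm_num)
  have h3 : |(curv τ (φ x) - curv τ (ζ x)) * gdot φ φ x| ≤ Q ^ 5 * ε := by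
    rw [abs_mul, abs_of_nonneg hφ0]
    calc _ ≤ (K * |φ x - ζ x|) * Q ^ 2 := by gcongr; exact hG.curv_lip _ _
      _ ≤ (Q * (Q * ε)) * Q ^ 2 := by gcongr
      _ = Q ^ 4 * ε := by ring
      _ ≤ _ := hp 4 (by norm_num)
  have h4 : |t x * curv τ (φ x) * curv τ (φ x) * gdot φ φ x| ≤ Q ^ 5 * ε := by
    rw [abs_mul, abs_mul, abs_mul, abs_of_nonneg hφ0]
    calc _ ≤ (Q * ε ^ 2) * Q * Q * Q ^ 2 := by gcongr
      _ = Q ^ 5 * ε ^ 2 := by ring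
      _ ≤ _ := by gcongr
  have h5 : |curv τ (ζ x) * (gdot φ φ x - gdot ζ ζ x)| ≤ 2 * (Q ^ 5 * ε) := by
    have hQ0 : 0 ≤ Q := by linarith
    have a1 := abs_gdot_le_mul (by positivity) hQ0 hψ' hφ
    have a2 := abs_gdot_le_mul (by positivity) hQ0 hψ' hg
    rw [gdot_sub_gdot (hS.contDiff_φ x hx) (hζ.contDiffAt x), abs_mul]
    calc _ ≤ Q * (Q * ε * Q + Q * ε * Q) := by
          gcongr
          · exact (hG.curv_le _).trans hKQ
          · exact (abs_add_le _ _).trans (add_le_add a1 a2)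
      _ = 2 * (Q ^ 3 * ε) := by ring
      _ ≤ _ := by gcongr 2 * ?_; exact hp 3 (by norm_num)
  have h6 : lap t x + curv τ (ζ x) * gdot ζ ζ x - (ε ^ 2)⁻¹ * (wHess W τ (ζ x) * t x) =
      (ε ^ 2)⁻¹ * (wNor W τ (φ x) (t x) - wHess W τ (φ x) * t x) +
      (ε ^ 2)⁻¹ * ((wHess W τ (φ x) - wHess W τ (ζ x)) * t x) -
      (curv τ (φ x) - curv τ (ζ x)) * gdot φ φ x +
      t x * curv τ (φ x) * curv τ (φ x) * gdot φ φ x -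
      curv τ (ζ x) * (gdot φ φ x - gdot ζ ζ x) := by
    linear_combination hS.eq_t x hx
  rw [h6]
  rw [abs_le] at h1 h2 h3 h4 h5 ⊢
  constructor <;> linarith

theorem sq_sub_mul_abs_ge {κ E s : ℝ} (hK : 0 < K) (hκ : K⁻¹ ≤ κ) :
    -(K * E ^ 2 / 4) ≤ κ * s ^ 2 - E * |s| := by
  have h1 : K⁻¹ * s ^ 2 ≤ κ * s ^ 2 := by gcongr
  have h2 : K⁻¹ * K = 1 := inv_mul_cancel₀ hK.ne'
  have h3 := mul_nonneg (inv_nonneg.2 hK.le) (_root_.sq_nonneg (|s| - K * E / 2))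
  have h4 := sq_abs s
  linear_combination h1 + h3 + K⁻¹ * h4 - (E * |s| - K * E ^ 2 / 4) * h2

/-- The Laplacian of the corrected phase deviation is bounded below at order `ε²`. -/
theorem Sol.lap_corrected_ge (hG : Geom Γ τ W δ₁ K) (hS : Sol Γ τ W δ₁ Ω ζ ε t φ) (hD : Dom Ω)
    (hζ : Phase Ω ζ Z) (hx : x ∈ Ω) (hε1 : ε ≤ 1) (hQ : 1 ≤ Q) (hKQ : K ≤ Q)
    (hg : gdot ζ ζ x ≤ Q ^ 2) (ht : |t x| ≤ Q * ε ^ 2) (hφ : gdot φ φ x ≤ Q ^ 2)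
    (hψ : |φ x - ζ x| ≤ Q * ε)
    (hψ' : gdot (fun y => φ y - ζ y) (fun y => φ y - ζ y) x ≤ (Q * ε) ^ 2)
    (hf : ContDiff ℝ ∞ f) (hfe : wHess W τ (ζ x) * f x = curv τ (ζ x) * gdot ζ ζ x)
    (hf1 : gdot f f x ≤ Q ^ 2) (hf2 : |lap f x| ≤ Q) {σ : ℝ} (hσ : σ = 1 ∨ σ = -1) :
    ContDiffAt ℝ 2 (fun y => σ * (φ y - ζ y) + (2 * ε ^ 2)⁻¹ * (t y - ε ^ 2 * f y) ^ 2) x ∧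
    -(30 * Q ^ 11 * ε ^ 2) ≤
      lap (fun y => σ * (φ y - ζ y) + (2 * ε ^ 2)⁻¹ * (t y - ε ^ 2 * f y) ^ 2) x := by
  have hK := hG.one_le
  have hε := hS.ε_pos
  have hε2 : 0 < ε ^ 2 := by positivity
  have hεε : ε ^ 2 ≤ ε := by nlinarith
  have hf0 : ContDiffAt ℝ 2 f x := (contDiff_infty.1 hf 2).contDiffAt
  have js := (hasJet (hS.contDiff_t x hx)).sub ((hasJet hf0).const_mul (ε ^ 2))
  have j := (((hasJet (hS.contDiff_φ x hx)).sub (hasJet (hζ.contDiffAt x))).const_mul σ).add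
    (js.sq.const_mul (2 * ε ^ 2)⁻¹)
  refine ⟨j.smooth, ?_⟩
  have e : lap (fun y => σ * (φ y - ζ y) + (2 * ε ^ 2)⁻¹ * (t y - ε ^ 2 * f y) ^ 2) x = _ := j.lap
  rw [e, hζ.harm x hx, sub_zero]
  obtain ⟨s, hs⟩ : ∃ s : ℂ → ℝ, s = fun y => t y - ε ^ 2 * f y := ⟨_, rfl⟩
  have d1 : dir 1 s x = dir 1 t x - ε ^ 2 * dir 1 f x := by rw [hs]; exact js.d1
  have dI : dir I s x = dir I t x - ε ^ 2 * dir I f x := by rw [hs]; exact js.dI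
  have hQ0 : 0 ≤ Q := by linarith
  have hp : ∀ n : ℕ, n ≤ 11 → Q ^ n ≤ Q ^ 11 := fun n hn => by gcongr
  -- the tangential part
  have h1 := hS.abs_lap_φ_le_gdot hG hD hx hQ hKQ ht hφ
  have h2 : |gdot t φ x| ≤ |gdot s φ x| + ε ^ 2 * (Q * Q) := by
    have a := abs_gdot_le_mul hQ0 hQ0 hf1 hφ
    have b : gdot t φ x = gdot s φ x + ε ^ 2 * gdot f φ x := by
      simp only [gdot]; rw [d1, dI]; ring
    rw [b]
    refine (abs_add_le _ _).trans ?_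
    rw [abs_mul, abs_of_pos hε2]
    gcongr
  have h3 := mul_abs_gdot_le (x := x) (f := s) (g := φ) (a := 3 * Q) hε2
  have h4 : (3 * Q) ^ 2 / 4 * ε ^ 2 * gdot φ φ x ≤ (3 * Q) ^ 2 / 4 * ε ^ 2 * Q ^ 2 := by gcongr
  have h5 : 3 * Q * |gdot t φ x| ≤ 3 * Q * (|gdot s φ x| + ε ^ 2 * (Q * Q)) := by gcongr
  -- the normal part
  have h6 := hS.abs_lap_t_sub_le hG hD hζ hx hε1 hQ hKQ hg ht hφ hψ hψ'
  have h7 : |lap t x - ε ^ 2 * lap f x - (ε ^ 2)⁻¹ * (wHess W τ (ζ x) * s x)| ≤ 7 * Q ^ 5 * ε := by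
    have a : lap t x - ε ^ 2 * lap f x - (ε ^ 2)⁻¹ * (wHess W τ (ζ x) * s x) =
        (lap t x + curv τ (ζ x) * gdot ζ ζ x - (ε ^ 2)⁻¹ * (wHess W τ (ζ x) * t x)) -
          ε ^ 2 * lap f x := by
      rw [← hfe, hs]; field_simp; ring
    rw [a]
    refine (abs_sub _ _).trans ?_
    rw [abs_mul, abs_of_pos hε2]
    have b : ε ^ 2 * |lap f x| ≤ ε * Q := by gcongr
    have c : Q * ε ≤ Q ^ 5 * ε := by
      gcongr; exact le_self_pow₀ hQ (by norm_num)
    linarith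
  have h8 : -(|s x| * (7 * Q ^ 5 * ε)) ≤
      s x * (lap t x - ε ^ 2 * lap f x - (ε ^ 2)⁻¹ * (wHess W τ (ζ x) * s x)) := by
    refine neg_le_of_abs_le ?_
    rw [abs_mul]; gcongr
  have h9 := sq_sub_mul_abs_ge (K := K) (E := 7 * Q ^ 5 * ε ^ 3) (s := s x) (by linarith)
    (hG.hess_ge (ζ x))
  have h10 : -(Q * (7 * Q ^ 5) ^ 2 / 4 * ε ^ 2) ≤
      (ε ^ 2)⁻¹ * (s x * (lap t x - ε ^ 2 * lap f x)) := by
    have a : (ε ^ 2)⁻¹ * (s x * (lap t x - ε ^ 2 * lap f x)) =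
        (ε ^ 2)⁻¹ * (s x * (lap t x - ε ^ 2 * lap f x -
          (ε ^ 2)⁻¹ * (wHess W τ (ζ x) * s x))) +
        (ε ^ 2)⁻¹ * (ε ^ 2)⁻¹ * (wHess W τ (ζ x) * s x ^ 2) := by ring
    have b := mul_le_mul_of_nonneg_left h8 (inv_nonneg.2 hε2.le)
    have c := mul_le_mul_of_nonneg_left h9
      (mul_nonneg (inv_nonneg.2 hε2.le) (inv_nonneg.2 hε2.le))
    have d : (ε ^ 2)⁻¹ * (ε ^ 2)⁻¹ * (K * (7 * Q ^ 5 * ε ^ 3) ^ 2 / 4) =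
        K * (7 * Q ^ 5) ^ 2 / 4 * ε ^ 2 := by field_simp
    have d' : (ε ^ 2)⁻¹ * (ε ^ 2)⁻¹ * (7 * Q ^ 5 * ε ^ 3 * |s x|) =
        (ε ^ 2)⁻¹ * (|s x| * (7 * Q ^ 5 * ε)) := by field_simp
    have g : K * (7 * Q ^ 5) ^ 2 / 4 * ε ^ 2 ≤ Q * (7 * Q ^ 5) ^ 2 / 4 * ε ^ 2 := by gcongr
    rw [a]
    linarith
  have h11 : -|lap φ x| ≤ σ * lap φ x := by
    rcases hσ with rfl | rfl
    · linarith [neg_abs_le (lap φ x)]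
    · linarith [le_abs_self (lap φ x)]
  have h12 : Q ^ 4 * ε ^ 2 ≤ Q ^ 11 * ε ^ 2 := by gcongr ?_ * _; exact hp 4 (by norm_num)
  have h13 : Q ^ 3 * ε ^ 2 ≤ Q ^ 11 * ε ^ 2 := by gcongr ?_ * _; exact hp 3 (by norm_num)
  have h14 : (2 * ε ^ 2)⁻¹ * (2 * (s x) * (lap t x - ε ^ 2 * lap f x) + 2 * (dir 1 s x ^ 2 +
      dir I s x ^ 2)) = (ε ^ 2)⁻¹ * (s x * (lap t x - ε ^ 2 * lap f x)) +
        (ε ^ 2)⁻¹ * gdot s s x := by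
    simp only [gdot]; rw [mul_inv]; ring
  have hsx : t x - ε ^ 2 * f x = s x := by rw [hs]
  have h15 : 0 ≤ Q ^ 11 * ε ^ 2 := by positivity
  rw [d1, dI, ← hsx] at h14
  rw [← hsx] at h10
  rw [h14]
  linarith

end Fine

section Comb

open scoped ContDiff

variable {Γ : Set ℂ} {τ : ℝ → ℂ} {W : ℂ → ℝ} {δ₁ K c₀ C₀ R₀ Z : ℝ} {Ω : Set ℂ} {ζ : ℂ → ℝ}
  {k k₁ k₂ : ℝ → ℝ}

/-- The conclusion of the main estimates with constant `C`. -/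
def Estimates (Ω : Set ℂ) (ζ : ℂ → ℝ) (C ε : ℝ) (t φ : ℂ → ℝ) : Prop :=
  ∀ x ∈ Ω, |t x| ≤ C * ε ^ 2 ∧ ‖fderiv ℝ t x‖ ≤ C * ε ∧ |φ x - ζ x| ≤ C * ε ^ 2 ∧
    ‖fderiv ℝ (fun w => φ w - ζ w) x‖ ≤ C * ε

theorem Estimates.mono {C C' ε : ℝ} {t φ : ℂ → ℝ} (h : Estimates Ω ζ C ε t φ) (hC : C ≤ C')
    (hε : 0 < ε) : Estimates Ω ζ C' ε t φ := fun x hx => by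
  obtain ⟨h1, h2, h3, h4⟩ := h x hx
  exact ⟨h1.trans (by gcongr), h2.trans (by gcongr), h3.trans (by gcongr), h4.trans (by gcongr)⟩

theorem exists_estimates_small (hW : PotentialHyp Γ W R₀) (hG : Geom Γ τ W δ₁ K)
    (hD : Dom Ω) (hζ : Phase Ω ζ Z) {S : ℝ} (hS0 : 0 < S) :
    ∃ C, ∃ e₀ > 0, ∀ (ε : ℝ) (t φ : ℂ → ℝ), ε ≤ e₀ → Sol Γ τ W δ₁ Ω ζ ε t φ →
      (∀ x ∈ closure Ω, |t x| ≤ (2 * K ^ 2)⁻¹) → (∀ x ∈ Ω, gsq t φ x ≤ S) →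
      Estimates Ω ζ C ε t φ := by
  have hK := hG.one_le
  have hZ := hζ.Z_pos
  obtain ⟨C₁, hC₁, e₀, he₀, htb⟩ := exists_t_bound hG hD hS0
  obtain ⟨Q₁, hQ₁⟩ : ∃ Q, Q = K + C₁ + S + Z := ⟨_, rfl⟩
  have hQ₁1 : 1 ≤ Q₁ := by linarith
  obtain ⟨C₂, hC₂, hψb⟩ := exists_psi_bound hG hD hζ hQ₁1 (by linarith : K ≤ Q₁)
  obtain ⟨f, hf, hfe, F, hF⟩ := exists_profile_coeff hW hG hD hζ
  obtain ⟨C₃, hC₃, hcomp⟩ := hD.comparison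
  obtain ⟨Q, hQ⟩ : ∃ Q, Q = Q₁ + C₂ + |F| := ⟨_, rfl⟩
  have hQ₁Q : Q₁ ≤ Q := by linarith [abs_nonneg F]
  have hC₂Q : C₂ ≤ Q := by linarith [abs_nonneg F]
  have hFQ : |F| ≤ Q := by linarith
  have hQ1 : 1 ≤ Q := by linarith
  refine ⟨2 * C₁ + 2 * C₂ + (C₃ * (30 * Q ^ 11) + Q ^ 2), min e₀ 1, by positivity,
    fun ε t φ hε hS hsm hSb => ?_⟩
  have hε0 := hS.ε_pos
  have hε1 : ε ≤ 1 := hε.trans (min_le_right _ _)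
  have ht := htb ζ ε t φ (hε.trans (min_le_left _ _)) hS hsm hSb
  have hφS : ∀ x ∈ Ω, gdot φ φ x ≤ S := fun x hx => (gdot_φ_le_gsq t φ x).trans (hSb x hx)
  have hψ := hψb ε t φ hε1 hS fun x hx => by
    obtain ⟨h1, h2⟩ := ht x hx
    refine ⟨h1.trans (by gcongr; linarith), h2.trans (by gcongr; linarith), ?_⟩
    have := hφS x hx
    nlinarith
  have key : ∀ σ : ℝ, σ = 1 ∨ σ = -1 → ∀ x ∈ Ω,
      σ * (φ x - ζ x) ≤ (C₃ * (30 * Q ^ 11) + Q ^ 2) * ε ^ 2 := by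
    intro σ hσ x hx
    have h1 := (hcomp (fun y => σ * (φ y - ζ y) + (2 * ε ^ 2)⁻¹ * (t y - ε ^ 2 * f y) ^ 2 -
      Q ^ 2 * ε ^ 2) (30 * Q ^ 11 * ε ^ 2) (by positivity)
      (((continuousOn_const.mul (hS.cont_φ.sub hζ.smooth.continuous.continuousOn)).add
        (continuousOn_const.mul ((hS.cont_t.sub
          (continuousOn_const.mul hf.continuous.continuousOn)).pow 2))).sub continuousOn_const)
      (fun y hy => by
        have hyc : y ∈ closure Ω := frontier_subset_closure hy
        rw [hS.bd_t y hy, hS.bd_φ y hy]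
        have a : f y ^ 2 ≤ Q ^ 2 := by
          rw [← sq_abs]
          have := (hF y hyc).1.trans ((le_abs_self F).trans hFQ)
          gcongr
        have b : (2 * ε ^ 2)⁻¹ * (0 - ε ^ 2 * f y) ^ 2 = f y ^ 2 / 2 * ε ^ 2 := by field_simp; ring
        have c := mul_le_mul_of_nonneg_right a (_root_.sq_nonneg ε)
        have d : 0 ≤ Q ^ 2 * ε ^ 2 := by positivity
        rw [b]; linarith) (fun y hy _ => by
        have hyc := hD.subset_closure hy
        obtain ⟨t1, -⟩ := ht y hy
        obtain ⟨p1, p2⟩ := hψ y hy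
        obtain ⟨f1, f2, f3⟩ := hF y hyc
        have hF0 : 0 ≤ F := (abs_nonneg _).trans f1
        have hFQ' : F ≤ Q := (le_abs_self F).trans hFQ
        have hl := hS.lap_corrected_ge (f := f) (Q := Q) hG hD hζ hy hε1 hQ1 (by linarith)
          (by have := hζ.grad_le y hyc; nlinarith) (t1.trans (by gcongr; linarith))
          (by have := hφS y hy; nlinarith) (p1.trans (by gcongr)) (p2.trans (by gcongr))
          hf (hfe y) (f2.trans (by gcongr)) (f3.trans hFQ') hσ
        have j := (hasJet hl.1).sub (hasJet_const (Q ^ 2 * ε ^ 2) y)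
        refine ⟨j.smooth, ?_⟩
        rw [j.lap, sub_zero]
        exact hl.2) x hx).2
    have h2 : 0 ≤ (2 * ε ^ 2)⁻¹ * (t x - ε ^ 2 * f x) ^ 2 := by positivity
    linarith
  intro x hx
  have hp1 : 0 ≤ C₁ * ε ^ 2 := by positivity
  have hp2 : 0 ≤ C₂ * ε ^ 2 := by positivity
  have hp3 : 0 ≤ (C₃ * (30 * Q ^ 11) + Q ^ 2) * ε ^ 2 := by positivity
  have hp4 : 0 ≤ C₁ * ε := by positivity
  have hp5 : 0 ≤ C₂ * ε := by positivity
  have hp6 : 0 ≤ (C₃ * (30 * Q ^ 11) + Q ^ 2) * ε := by positivity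
  refine ⟨?_, ?_, abs_le'.2 ⟨?_, ?_⟩, ?_⟩
  · linarith [(ht x hx).1]
  · linarith [norm_fderiv_le_of_gdot_le hp4 (ht x hx).2]
  · linarith [key 1 (Or.inl rfl) x hx]
  · linarith [key (-1) (Or.inr rfl) x hx]
  · linarith [norm_fderiv_le_of_gdot_le hp5 (hψ x hx).2]

theorem exists_estimates_large (hW : PotentialHyp Γ W R₀) (hG : Geom Γ τ W δ₁ K)
    (hD : Dom Ω) (hζ : Phase Ω ζ Z) {lam c₁ A : ℝ} (hA0 : 0 < A) {e₀ : ℝ} (he₀ : 0 < e₀) :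
    ∃ C, ∀ (ε : ℝ) (t φ : ℂ → ℝ) (u : ℂ → ℂ), e₀ ≤ ε → Sol Γ τ W δ₁ Ω ζ ε t φ →
      Apriori W τ Ω ζ k lam c₁ A ε t φ → Lift Γ τ W Ω ε u t φ → Estimates Ω ζ C ε t φ := by
  have hδ := hG.δ_pos
  have hZ := hζ.Z_pos
  obtain ⟨D, hD0, hDb⟩ := hD.exists_bdist_le
  obtain ⟨C, hC, hgrad⟩ := exists_gradient_bound (k := k) (lam := lam) (c₁ := c₁) hW hG hD hζ hA0
  obtain ⟨B, hB⟩ : ∃ B, B = 3 * (C * (1 + e₀⁻¹)) := ⟨_, rfl⟩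
  have hB0 : 0 < B := by rw [hB]; positivity
  obtain ⟨X, hX⟩ : ∃ X, X = δ₁ + A * D + 2 * B + 2 * (Z + 1) := ⟨_, rfl⟩
  have hAD : 0 < A * D := by positivity
  have hX0 : 0 < X := by rw [hX]; positivity
  refine ⟨X * e₀⁻¹ + X * (e₀⁻¹) ^ 2, fun ε t φ u hε hS hA hU => ?_⟩
  have hε0 := hS.ε_pos
  have h1 : 1 ≤ e₀⁻¹ * ε := by rw [← div_eq_inv_mul, one_le_div he₀]; exact hε
  have hX1 : X ≤ (X * e₀⁻¹ + X * (e₀⁻¹) ^ 2) * ε := by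
    have a := mul_le_mul_of_nonneg_left h1 hX0.le
    have b : 0 ≤ X * (e₀⁻¹) ^ 2 * ε := by positivity
    linarith
  have hX2 : X ≤ (X * e₀⁻¹ + X * (e₀⁻¹) ^ 2) * ε ^ 2 := by
    have a : X * 1 ≤ X * (e₀⁻¹ * ε) ^ 2 := by
      gcongr; exact one_le_pow₀ h1
    have b : 0 ≤ X * e₀⁻¹ * ε ^ 2 := by positivity
    rw [mul_pow] at a
    linarith
  intro x hx
  have hxc := hD.subset_closure hx
  have hg : gsq t φ x ≤ B ^ 2 := by
    refine (hU.gsq_le hG hS hD hx).trans ?_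
    have a : ‖fderiv ℝ u x‖ ≤ C * (1 + e₀⁻¹) := (hgrad ε t φ u hS hA hU x hx).trans (by gcongr)
    have b : ‖fderiv ℝ u x‖ ^ 2 ≤ (C * (1 + e₀⁻¹)) ^ 2 := by gcongr
    rw [hB, mul_pow]
    linarith [_root_.sq_nonneg (C * (1 + e₀⁻¹))]
  have hgt : gdot t t x ≤ B ^ 2 := by
    have := gdot_self_nonneg φ x
    simp only [gsq] at hg; linarith
  have h2 := norm_fderiv_le_of_gdot_le hB0.le hgt
  have h3 := norm_fderiv_le_of_gdot_le hB0.le ((gdot_φ_le_gsq t φ x).trans hg)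
  have h4 : ‖fderiv ℝ ζ x‖ ≤ 2 * (Z + 1) := norm_fderiv_le_of_gdot_le (by positivity) (by
    have := hζ.grad_le x hxc; nlinarith)
  have h5 : A * bdist Ω x ≤ A * D := by gcongr; exact hDb x hxc
  refine ⟨?_, ?_, ?_, ?_⟩
  · linarith [hS.le x hxc]
  · linarith
  · linarith [hA.dev x hx]
  · have : fderiv ℝ (fun w => φ w - ζ w) x = fderiv ℝ φ x - fderiv ℝ ζ x :=
      fderiv_sub (differentiableAt_of_two (hS.contDiff_φ x hx))
        (differentiableAt_of_two (hζ.contDiffAt x))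
    rw [this]
    linarith [norm_sub_le (fderiv ℝ φ x) (fderiv ℝ ζ x)]

theorem exists_estimates (hW : PotentialHyp Γ W R₀) (hG : Geom Γ τ W δ₁ K)
    (hP : Profile Γ τ W δ₁ k k₁ k₂ c₀ C₀) (hD : Dom Ω) (hζ : Phase Ω ζ Z) :
    ∃ C, ∀ (ε : ℝ) (t φ : ℂ → ℝ) (u : ℂ → ℂ), Sol Γ τ W δ₁ Ω ζ ε t φ →
      Lift Γ τ W Ω ε u t φ → Estimates Ω ζ C ε t φ := by
  obtain ⟨lam, hlam, c₁, hc₁, A, hA0, hapr⟩ := exists_apriori hG hP hD hζ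
  obtain ⟨e₁, he₁, S, hS0, hgs⟩ := exists_gsq_bound hW hG hP hD hζ hlam hc₁ hA0
  obtain ⟨Cs, e₂, he₂, hsmall⟩ := exists_estimates_small hW hG hD hζ hS0
  obtain ⟨Cl, hlarge⟩ := exists_estimates_large (k := k) (lam := lam) (c₁ := c₁) hW hG hD hζ hA0
    (show 0 < min e₁ e₂ by positivity)
  refine ⟨max Cs Cl, fun ε t φ u hS hU => ?_⟩
  have hA := hapr ε t φ hS
  rcases le_total ε (min e₁ e₂) with h | h
  · obtain ⟨h1, h2⟩ := hgs ε t φ u (h.trans (min_le_left _ _)) hS hA hU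
    exact (hsmall ε t φ (h.trans (min_le_right _ _)) hS h1 h2).mono (le_max_left _ _) hS.ε_pos
  · exact (hlarge ε t φ u h hS hA hU).mono (le_max_right _ _) hS.ε_pos

end Comb

section Main

open scoped ContDiff

variable {Γ : Set ℂ} {τ : ℝ → ℂ} {W : ℂ → ℝ} {δ₁ K ε : ℝ} {Ω : Set ℂ} {ζ : ℂ → ℝ}
  {u : ℂ → ℂ} {t φ : ℂ → ℝ}

theorem Dom.of_boundaryParam {γ : ℝ → ℂ} {L : ℝ} (ho : IsOpen Ω) (hb : IsBounded Ω)
    (hc : IsPreconnected Ω) (h : BoundaryParam Ω γ L) : Dom Ω :=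
  ⟨ho, hb, hc, h.srange ▸ range_nonempty γ, boundary_exterior_ball h ho hb⟩

theorem Lift.of_phaseDecomp (hu : SolvesGL W Ω ε u) (hd : PhaseDecomp Γ τ (closure Ω) u t φ) :
    Lift Γ τ W Ω ε u t φ :=
  ⟨hu.1, fun x hx => (hd.2.2 x hx).1, fun x hx => (hd.2.2 x hx).2, hu.2⟩

theorem Sol.of_phaseDecomp (hΓ : ArcParam Γ τ) (hD : Dom Ω) (hε : 0 < ε) (hδ₁ : 0 < δ₁)
    (hu : SolvesGL W Ω ε u) (hd : PhaseDecomp Γ τ (closure Ω) u t φ)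
    (hbd : ∀ x ∈ frontier Ω, u x ∈ Γ) (hle : ∀ x ∈ Ω, infDist (u x) Γ ≤ δ₁)
    (ht : ContDiffOn ℝ ∞ t Ω) (hφ : ContDiffOn ℝ ∞ φ Ω) (hφζ : ∀ x ∈ frontier Ω, φ x = ζ x) :
    Sol Γ τ W δ₁ Ω ζ ε t φ := by
  have hU := Lift.of_phaseDecomp hu hd
  have hf : ∀ x ∈ frontier Ω, |t x| = 0 := fun x hx => by
    rw [hU.dist_eq x (frontier_subset_closure hx), infDist_zero_of_mem (hbd x hx)]
  have ht2 : ∀ x ∈ Ω, ContDiffAt ℝ 2 t x := fun x hx =>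
    contDiffAt_infty.1 (ht.contDiffAt (hD.isOpen.mem_nhds hx)) 2
  have hφ2 : ∀ x ∈ Ω, ContDiffAt ℝ 2 φ x := fun x hx =>
    contDiffAt_infty.1 (hφ.contDiffAt (hD.isOpen.mem_nhds hx)) 2
  have hsys := fun x hx => tube_system (W := W) (c := (ε ^ 2)⁻¹) hΓ (hφ2 x hx) (ht2 x hx) (by
    rw [← hU.eq_tube x (hD.subset_closure hx), ← hU.lap_eq x hx]
    exact lap_congr (eventually_of_mem (hD.isOpen.mem_nhds hx) fun y hy =>
      (hU.eq_tube y (hD.subset_closure hy)).symm))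
  refine ⟨hε, ht2, hφ2, hd.1, hd.2.1, fun x hx => ?_, fun x hx => ?_,
    fun x hx => abs_eq_zero.1 (hf x hx), hφζ, fun x hx => (hsys x hx).1, fun x hx => (hsys x hx).2⟩
  · rw [IsFoot, ← hU.eq_tube x hx, hU.dist_eq x hx]
  · rcases (closure_eq_self_union_frontier Ω ▸ hx : x ∈ Ω ∪ frontier Ω) with h | h
    · rw [hU.dist_eq x hx]; exact hle x h
    · rw [hf x h]; exact hδ₁.le

end Main

end GLPhase

/-- Proposition 3.9: for vortex-less solutions with degree-zero boundary
datum, with `t_ε` the signed distance to `Γ` and `ψ_ε = φ_ε - ζ` the normalized phase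
deviation, one has `‖t_ε‖_∞ ≤ Cε²`, `‖∇t_ε‖_∞ ≤ Cε`, `‖ψ_ε‖_∞ ≤ Cε²` and
`‖∇ψ_ε‖_∞ ≤ Cε`, with `C` independent of `ε`. -/
theorem t_and_psi_estimates
    (Γ : Set ℂ) (τ : ℝ → ℂ) (W : ℂ → ℝ) (R₀ : ℝ)
    (hΓ : ArcParam Γ τ) (hW : PotentialHyp Γ W R₀)
    (Ω : Set ℂ) (hΩo : IsOpen Ω) (hΩb : Bornology.IsBounded Ω) (hΩne : Ω.Nonempty)
    (hΩsc : SimplyConnectedSpace ↥Ω) (hΩsm : ∃ γ L, BoundaryParam Ω γ L)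
    (δ₁ m : ℝ) (hδ₁ : 0 < δ₁) (hm : 0 < m) (hmax : MaxPrinciple Γ τ W δ₁ m)
    (g : ℂ → ℂ) (φ₀ : ℂ → ℝ) (hφ₀ : ContDiff ℝ (⊤ : ℕ∞) φ₀)
    (hgφ₀ : ∀ x ∈ frontier Ω, g x = τ (φ₀ x))
    (ζ : ℂ → ℝ) (hζsm : ContDiff ℝ (⊤ : ℕ∞) ζ)
    (hζharm : ∀ x ∈ Ω, lapR ζ x = 0)
    (hζbd : ∀ x ∈ frontier Ω, ζ x = φ₀ x)
    (u : ℝ → ℂ → ℂ)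
    (hu : ∀ ε > (0 : ℝ), SolvesGL W Ω ε (u ε) ∧
      (∀ x ∈ frontier Ω, u ε x = g x) ∧
      ∀ x ∈ Ω, Metric.infDist (u ε x) Γ ≤ δ₁)
    (t φ : ℝ → ℂ → ℝ)
    (hdec : ∀ ε > (0 : ℝ), PhaseDecomp Γ τ (closure Ω) (u ε) (t ε) (φ ε) ∧
      ContDiffOn ℝ (⊤ : ℕ∞) (t ε) Ω ∧ ContDiffOn ℝ (⊤ : ℕ∞) (φ ε) Ω ∧
      ∀ x ∈ frontier Ω, φ ε x = ζ x) :
    ∃ C : ℝ, ∀ ε > (0 : ℝ), ∀ x ∈ Ω,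
      |t ε x| ≤ C * ε ^ 2 ∧ ‖fderiv ℝ (t ε) x‖ ≤ C * ε ∧
      |φ ε x - ζ x| ≤ C * ε ^ 2 ∧ ‖fderiv ℝ (fun w => φ ε w - ζ w) x‖ ≤ C * ε := by
  obtain ⟨γ, L, hγ⟩ := hΩsm
  have hD := GLPhase.Dom.of_boundaryParam hΩo hΩb
    (isPreconnected_iff_preconnectedSpace.2 inferInstance) hγ
  obtain ⟨K₀, ω₀, hB⟩ := GLPhase.exists_bounds hΓ hW δ₁
  obtain ⟨K, hG⟩ := GLPhase.exists_geom hΓ hW hmax hm hδ₁ hB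
  obtain ⟨k, k₁, k₂, c₀, C₀, hP⟩ := GLPhase.exists_profile hΓ hW hmax hm hδ₁ hB
  obtain ⟨Z, hζ⟩ := GLPhase.exists_phase hD hζsm hζharm
  obtain ⟨C, hC⟩ := GLPhase.exists_estimates hW hG hP hD hζ
  refine ⟨C, fun ε hε => ?_⟩
  obtain ⟨hu1, hu2, hu3⟩ := hu ε hε
  obtain ⟨hd1, hd2, hd3, hd4⟩ := hdec ε hε
  refine hC ε (t ε) (φ ε) (u ε) (GLPhase.Sol.of_phaseDecomp hΓ hD hε hδ₁ hu1 hd1 (fun x hx => ?_)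
    hu3 hd2 hd3 hd4) (GLPhase.Lift.of_phaseDecomp hu1 hd1)
  rw [hu2 x hx, hgφ₀ x hx, ← hΓ.srange]
  exact mem_range_self _
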